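/- Let r = 1 and 1 < p < ∞. Then there is a constant C = C(p) such that for every Schwartz function f : ℝ → ℂ, the maximal multiplier operator 𝓜_1[f](x) = sup { |(m·f̂)ˇ(x)| : m : ℝ → ℂ, ‖m‖_{V^1} ≤ 1 } satisfies ‖𝓜_1[f]‖_{L^p(ℝ)} ≤ C ‖f‖_{L^p(ℝ)}; that is, the maximal operator over all multipliers of bounded-variation norm at most 1 is bounded on L^p for all 1 < p < ∞. -/

import Mathlib

open MeasureTheory Real Set Filter
open scoped ENNReal NNReal FourierTransform

/-- The `r`-variation norm `‖m‖_{V^r} = ‖m‖_{L^∞} +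
sup_{N, ξ₀ < ⋯ < ξ_N} (∑_{i=1}^N |m(ξ_i) − m(ξ_{i−1})|^r)^{1/r}`,
the supremum being over all strictly increasing finite sequences of reals.
For `r = 1` this is the bounded-variation norm `‖m‖_{V^1}`. -/
noncomputable def variationNorm (r : ℝ) (m : ℝ → ℂ) : ℝ≥0∞ :=
  (⨆ ξ : ℝ, (‖m ξ‖₊ : ℝ≥0∞)) +
    ⨆ (N : ℕ) (ξ : Fin (N + 1) → ℝ) (_ : StrictMono ξ),
      (∑ i : Fin N, (‖m (ξ i.succ) - m (ξ i.castSucc)‖₊ : ℝ≥0∞) ^ r) ^ (1 / r)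

/-- Application of the Fourier multiplier `m` to `f`, i.e. `(m·f̂)ˇ`. -/
noncomputable def applyMultiplier (m f : ℝ → ℂ) : ℝ → ℂ :=
  𝓕⁻ (fun ξ => m ξ * 𝓕 f ξ)

/-- The maximal multiplier operator
`𝓜_r[f](x) = sup { |(m·f̂)ˇ(x)| : m : ℝ → ℂ, ‖m‖_{V^r} ≤ 1 }`. -/
noncomputable def maximalMultiplier (r : ℝ) (f : ℝ → ℂ) (x : ℝ) : ℝ≥0∞ :=
  ⨆ (m : ℝ → ℂ) (_ : variationNorm r m ≤ 1), (‖applyMultiplier m f x‖₊ : ℝ≥0∞)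

namespace CH

/-- dyadic interval -/
def dy (k n : ℤ) : Set ℝ := Set.Ico ((n:ℝ) * 2 ^ k) (((n:ℝ) + 1) * 2 ^ k)

lemma two_zpow_pos (k : ℤ) : (0:ℝ) < (2:ℝ) ^ k := by positivity

lemma mem_dy {k n : ℤ} {x : ℝ} : x ∈ dy k n ↔ (n:ℝ) * 2 ^ k ≤ x ∧ x < ((n:ℝ) + 1) * 2 ^ k := Iff.rfl

lemma left_mem_dy (k n : ℤ) : (n:ℝ) * 2 ^ k ∈ dy k n := by
  have := two_zpow_pos k
  rw [mem_dy]; constructor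
  · exact le_rfl
  · nlinarith

lemma mem_dy_floor {k n : ℤ} {x : ℝ} : x ∈ dy k n ↔ ⌊x * 2 ^ (-k)⌋ = n := by
  have h := two_zpow_pos k
  rw [Int.floor_eq_iff, mem_dy, zpow_neg, ← div_eq_mul_inv, le_div_iff₀ h, div_lt_iff₀ h]

lemma mem_dy_self (k : ℤ) (x : ℝ) : x ∈ dy k ⌊x * 2 ^ (-k)⌋ := mem_dy_floor.2 rfl

lemma dy_eq_of_mem {k n m : ℤ} {x : ℝ} (h : x ∈ dy k n) (h' : x ∈ dy k m) : n = m := by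
  rw [mem_dy_floor] at h h'; exact h.symm.trans h'

lemma measurableSet_dy (k n : ℤ) : MeasurableSet (dy k n) := measurableSet_Ico

lemma volume_dy (k n : ℤ) : volume (dy k n) = ENNReal.ofReal (2 ^ k) := by
  rw [dy, Real.volume_Ico]; congr 1; ring

lemma volume_real_dy (k n : ℤ) : volume.real (dy k n) = 2 ^ k := by
  rw [Measure.real, volume_dy, ENNReal.toReal_ofReal (two_zpow_pos k).le]

/-- nesting -/
lemma dy_subset {k n k' n' : ℤ} (hk : k ≤ k') {x : ℝ} (h : x ∈ dy k n) (h' : x ∈ dy k' n') :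
    dy k n ⊆ dy k' n' := by
  obtain ⟨d, rfl⟩ := Int.le.dest hk
  have h2 : (2:ℝ) ^ (k + (d:ℤ)) = ((2 ^ d : ℤ) : ℝ) * 2 ^ k := by
    rw [zpow_add₀ two_ne_zero, zpow_natCast]; push_cast; ring
  have hp := two_zpow_pos k
  intro y hy
  rw [mem_dy] at *
  rw [h2] at h' ⊢
  have e1 : n' * 2 ^ d < n + 1 := by
    have : ((n' * 2 ^ d : ℤ) : ℝ) < ((n + 1 : ℤ) : ℝ) := by
      push_cast
      have : ((n':ℝ) * 2 ^ d) * 2 ^ k < ((n:ℝ) + 1) * 2 ^ k := by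
        have := h'.1.trans_lt h.2; push_cast at this; linarith
      exact lt_of_mul_lt_mul_right this hp.le
    exact_mod_cast this
  have e2 : n < (n' + 1) * 2 ^ d := by
    have : ((n : ℤ) : ℝ) < (((n' + 1) * 2 ^ d : ℤ) : ℝ) := by
      push_cast
      have : (n:ℝ) * 2 ^ k < ((n':ℝ) + 1) * 2 ^ d * 2 ^ k := by
        have := h.1.trans_lt h'.2; push_cast at this; linarith
      exact lt_of_mul_lt_mul_right this hp.le
    exact_mod_cast this
  have e1' : ((n' : ℝ) * 2 ^ d) ≤ n := by exact_mod_cast (Int.lt_add_one_iff.1 e1)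
  have e2' : (n:ℝ) + 1 ≤ ((n' : ℝ) + 1) * 2 ^ d := by exact_mod_cast e2
  push_cast
  constructor
  · calc (n':ℝ) * (2 ^ d * 2 ^ k) = (n' * 2 ^ d) * 2 ^ k := by ring
      _ ≤ n * 2 ^ k := by gcongr
      _ ≤ y := hy.1
  · calc y < (n + 1) * 2 ^ k := hy.2
      _ ≤ (((n' : ℝ) + 1) * 2 ^ d) * 2 ^ k := by gcongr
      _ = _ := by ring

lemma dy_scale_le_of_subset {k n k' n' : ℤ} (h : dy k n ⊆ dy k' n') : k ≤ k' := by
  have h1 := measure_mono (μ := volume) h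
  rw [volume_dy, volume_dy, ENNReal.ofReal_le_ofReal_iff (two_zpow_pos k').le] at h1
  exact (zpow_le_zpow_iff_right₀ (by norm_num)).1 h1

lemma dy_disjoint_or_subset {k n k' n' : ℤ} (hk : k ≤ k') :
    Disjoint (dy k n) (dy k' n') ∨ dy k n ⊆ dy k' n' := by
  by_cases h : Disjoint (dy k n) (dy k' n')
  · exact Or.inl h
  · obtain ⟨x, hx, hx'⟩ := Set.not_disjoint_iff.1 h
    exact Or.inr (dy_subset hk hx hx')

lemma dy_inj {k n k' n' : ℤ} (h : dy k n = dy k' n') : k = k' ∧ n = n' := by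
  have hk : k = k' := le_antisymm (dy_scale_le_of_subset h.le) (dy_scale_le_of_subset h.ge)
  subst hk
  exact ⟨rfl, dy_eq_of_mem (left_mem_dy k n) (h ▸ left_mem_dy k n)⟩

lemma dy_disjoint {k n n' : ℤ} (h : n ≠ n') : Disjoint (dy k n) (dy k n') := by
  rw [Set.disjoint_left]; intro x hx hx'; exact h (dy_eq_of_mem hx hx')

lemma abs_sub_le_of_mem_dy {k n : ℤ} {x y : ℝ} (hx : x ∈ dy k n) (hy : y ∈ dy k n) :
    |x - y| ≤ 2 ^ k := by
  rw [mem_dy] at *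
  rw [abs_le]; constructor <;> nlinarith

/-- tiles -/
@[ext] structure Tile where
  k : ℤ
  n : ℤ
  l : ℤ

noncomputable instance : DecidableEq Tile := Classical.decEq _

namespace Tile
def I (s : Tile) : Set ℝ := dy s.k s.n
def Om (s : Tile) : Set ℝ := dy (-s.k) s.l
def w1 (s : Tile) : Set ℝ := dy (-s.k - 1) (2 * s.l)
def w2 (s : Tile) : Set ℝ := dy (-s.k - 3) (8 * s.l + 4)
noncomputable def c (s : Tile) : ℝ := (s.n : ℝ) * 2 ^ s.k
/-- order -/
def Le (s s' : Tile) : Prop := s.I ⊆ s'.I ∧ s'.Om ⊆ s.Om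
end Tile

lemma c_mem (s : Tile) : s.c ∈ s.I := left_mem_dy _ _

lemma Tile.Le.refl (s : Tile) : s.Le s := ⟨subset_rfl, subset_rfl⟩
lemma Tile.Le.trans {s t u : Tile} (h : s.Le t) (h' : t.Le u) : s.Le u :=
  ⟨h.1.trans h'.1, h'.2.trans h.2⟩
lemma Tile.Le.k_le {s t : Tile} (h : s.Le t) : s.k ≤ t.k := dy_scale_le_of_subset h.1
lemma Tile.Le.antisymm {s t : Tile} (h : s.Le t) (h' : t.Le s) : s = t := by
  have h1 := dy_inj (h.1.antisymm h'.1)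
  have h2 := dy_inj (h.2.antisymm h'.2)
  exact Tile.ext h1.1 h1.2 h2.2.symm

lemma w1_subset (s : Tile) : s.w1 ⊆ s.Om := by
  intro x hx
  rw [Tile.w1, mem_dy, zpow_sub₀ two_ne_zero] at hx
  rw [Tile.Om, mem_dy]
  have := two_zpow_pos (-s.k)
  push_cast at hx
  constructor <;> nlinarith [hx.1, hx.2]

lemma mem_w2 {s : Tile} {x : ℝ} : x ∈ s.w2 ↔ ((s.l:ℝ) + 1/2) * 2 ^ (-s.k) ≤ x ∧
    x < ((s.l:ℝ) + 5/8) * 2 ^ (-s.k) := by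
  rw [Tile.w2, mem_dy, zpow_sub₀ two_ne_zero]
  push_cast
  norm_num
  constructor <;> rintro ⟨h1, h2⟩ <;> constructor <;> linarith

lemma mem_w1 {s : Tile} {x : ℝ} : x ∈ s.w1 ↔ ((s.l:ℝ)) * 2 ^ (-s.k) ≤ x ∧
    x < ((s.l:ℝ) + 1/2) * 2 ^ (-s.k) := by
  rw [Tile.w1, mem_dy, zpow_sub₀ two_ne_zero]
  push_cast
  norm_num
  constructor <;> rintro ⟨h1, h2⟩ <;> constructor <;> linarith

lemma w2_subset (s : Tile) : s.w2 ⊆ s.Om := by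
  intro x hx
  rw [mem_w2] at hx
  rw [Tile.Om, mem_dy]
  have := two_zpow_pos (-s.k)
  constructor <;> nlinarith [hx.1, hx.2]

lemma w1_lt_w2 {s : Tile} {x y : ℝ} (hx : x ∈ s.w1) (hy : y ∈ s.w2) : x < y :=
  (mem_w1.1 hx).2.trans_le (mem_w2.1 hy).1

lemma disjoint_w1_w2 (s : Tile) : Disjoint s.w1 s.w2 := by
  rw [Set.disjoint_left]; intro x hx hx'; exact lt_irrefl _ (w1_lt_w2 hx hx')

lemma Om_subset_w1 {s s' : Tile} (hk : s'.k < s.k) {x : ℝ} (hx : x ∈ s.Om) (hx' : x ∈ s'.w1) :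
    s.Om ⊆ s'.w1 := dy_subset (by omega) hx hx'

lemma Om_subset_of_lt {s s' : Tile} (hk : s'.k ≤ s.k) {x : ℝ} (hx : x ∈ s.Om) (hx' : x ∈ s'.Om) :
    s.Om ⊆ s'.Om := dy_subset (by omega) hx hx'

lemma I_subset_of_le {s s' : Tile} (hk : s.k ≤ s'.k) {x : ℝ} (hx : x ∈ s.I) (hx' : x ∈ s'.I) :
    s.I ⊆ s'.I := dy_subset (by omega) hx hx'

lemma w1_disjoint_of_mem_w2 {s s' : Tile} {ξ : ℝ} (h : ξ ∈ s.w2) (h' : ξ ∈ s'.w2)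
    (hk : s.k ≠ s'.k) : Disjoint s.w1 s'.w1 := by
  have key : ∀ {s s' : Tile}, ξ ∈ s.w2 → ξ ∈ s'.w2 → s'.k < s.k → Disjoint s.w1 s'.w1 := by
    intro s s' h h' hk
    rw [Set.disjoint_left]; intro x hx hx'
    have := Om_subset_w1 hk (w1_subset _ hx) hx' (w2_subset _ h)
    exact lt_irrefl _ (w1_lt_w2 this h')
  rcases lt_or_gt_of_ne hk with h1 | h1
  · exact (key h' h h1).symm
  · exact key h h' h1

lemma w2_nested {s s' : Tile} {ξ : ℝ} (h : ξ ∈ s.w2) (h' : ξ ∈ s'.w2) (hk : s'.k ≤ s.k) :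
    s.w2 ⊆ s'.w2 := dy_subset (by omega) h h'

lemma measurableSet_I (s : Tile) : MeasurableSet s.I := measurableSet_dy _ _
lemma measurableSet_Om (s : Tile) : MeasurableSet s.Om := measurableSet_dy _ _

/-- convex sets of tiles -/
def TConvex (P : Finset Tile) : Prop :=
  ∀ s ∈ P, ∀ u ∈ P, ∀ t : Tile, s.Le t → t.Le u → t ∈ P

end CH

namespace CH

noncomputable def v (z : ℝ) : ℝ := ((1 + z ^ 2) ^ 2)⁻¹
noncomputable def w (r z : ℝ) : ℝ := r⁻¹ * v (r⁻¹ * z)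
noncomputable def W (r z : ℝ) : ℝ≥0∞ := ENNReal.ofReal (w r z)

lemma v_pos (z : ℝ) : 0 < v z := by unfold v; positivity
lemma v_le_one (z : ℝ) : v z ≤ 1 := by
  unfold v; apply inv_le_one_of_one_le₀; nlinarith [sq_nonneg z, sq_nonneg (z ^ 2)]
lemma v_neg (z : ℝ) : v (-z) = v z := by simp [v]
lemma v_abs (z : ℝ) : v |z| = v z := by simp [v]
lemma w_pos {r : ℝ} (hr : 0 < r) (z : ℝ) : 0 < w r z := by
  have := v_pos (r⁻¹ * z); unfold w; positivity
lemma w_nonneg {r : ℝ} (hr : 0 < r) (z : ℝ) : 0 ≤ w r z := (w_pos hr z).le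
lemma w_neg (r z : ℝ) : w r (-z) = w r z := by simp [w, v]
lemma w_sub_comm (r x y : ℝ) : w r (x - y) = w r (y - x) := by rw [← w_neg, neg_sub]
lemma W_sub_comm (r x y : ℝ) : W r (x - y) = W r (y - x) := by rw [W, w_sub_comm]; rfl
lemma w_le {r : ℝ} (hr : 0 < r) (z : ℝ) : w r z ≤ r⁻¹ := by
  have := v_le_one (r⁻¹ * z); unfold w
  exact mul_le_of_le_one_right (by positivity) this

@[fun_prop] lemma continuous_v : Continuous v := by
  unfold v; refine Continuous.inv₀ (by fun_prop) (fun x => by positivity)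
@[fun_prop] lemma continuous_w (r : ℝ) : Continuous (w r) := by unfold w; fun_prop
@[fun_prop] lemma measurable_w (r : ℝ) : Measurable (w r) := (continuous_w r).measurable
@[fun_prop] lemma measurable_W (r : ℝ) : Measurable (W r) := by unfold W; fun_prop

lemma v_mul_le (x y : ℝ) : v x * v y ≤ 4 * v (x + y) := by
  unfold v
  rw [← mul_inv, show (4:ℝ) * ((1 + (x + y) ^ 2) ^ 2)⁻¹ = (((1 + (x + y) ^ 2) / 2) ^ 2)⁻¹ by
    rw [div_pow, inv_div]; ring_nf]
  apply inv_anti₀ (by positivity)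
  rw [← mul_pow]
  have : (1 + (x + y) ^ 2) / 2 ≤ (1 + x ^ 2) * (1 + y ^ 2) := by
    nlinarith [sq_nonneg (x - y), sq_nonneg (x * y)]
  gcongr

lemma v_le_of_abs_le {x y : ℝ} (h : |x| ≤ |y|) : v y ≤ v x := by
  unfold v
  apply inv_anti₀ (by positivity)
  have := sq_le_sq.2 h
  gcongr

lemma v_half (x : ℝ) : v (x / 2) ≤ 16 * v x := by
  unfold v
  rw [show (16:ℝ) * ((1 + x ^ 2) ^ 2)⁻¹ = (((1 + x ^ 2) / 4) ^ 2)⁻¹ by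
    rw [div_pow, inv_div]; ring_nf]
  apply inv_anti₀ (by positivity)
  have : (1 + x ^ 2) / 4 ≤ 1 + (x / 2) ^ 2 := by nlinarith
  gcongr

lemma v_close {x y : ℝ} (h : |x - y| ≤ 1) : v x ≤ 16 * v y := by
  unfold v
  rw [show (16:ℝ) * ((1 + y ^ 2) ^ 2)⁻¹ = (((1 + y ^ 2) / 4) ^ 2)⁻¹ by
    rw [div_pow, inv_div]; ring_nf]
  apply inv_anti₀ (by positivity)
  have : (1 + y ^ 2) / 4 ≤ 1 + x ^ 2 := by
    have h1 : (x - y) ^ 2 ≤ 1 := by rw [← sq_abs]; nlinarith [abs_nonneg (x - y)]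
    nlinarith [sq_nonneg (2 * x - y), sq_nonneg (x + (x - y))]
  gcongr

lemma w_close {r x y : ℝ} (hr : 0 < r) (h : |x - y| ≤ r) : w r x ≤ 16 * w r y := by
  unfold w
  have : |r⁻¹ * x - r⁻¹ * y| ≤ 1 := by
    rw [← mul_sub, abs_mul, abs_of_pos (by positivity : 0 < r⁻¹), inv_mul_le_iff₀ hr]; simpa using h
  have h2 := v_close this
  have : 0 < r⁻¹ := by positivity
  nlinarith

lemma w_anti {r x y : ℝ} (hr : 0 < r) (h : |x| ≤ |y|) : w r y ≤ w r x := by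
  unfold w
  have : v (r⁻¹ * y) ≤ v (r⁻¹ * x) := by
    apply v_le_of_abs_le; rw [abs_mul, abs_mul]; gcongr
  gcongr

lemma w_half {r x : ℝ} (hr : 0 < r) : w r (x / 2) ≤ 16 * w r x := by
  unfold w
  have := v_half (r⁻¹ * x)
  rw [mul_div_assoc] at this
  have : 0 < r⁻¹ := by positivity
  nlinarith

lemma w_ge_half {r x y : ℝ} (hr : 0 < r) (h : |x| ≤ 2 * |y|) : w r y ≤ 16 * w r x := by
  refine le_trans (w_anti hr ?_) (w_half hr)
  rw [abs_div, abs_two]; linarith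

lemma w_eq {r : ℝ} (hr : 0 < r) (z : ℝ) : w r z = r ^ 3 / (r ^ 2 + z ^ 2) ^ 2 := by
  unfold w v
  have : 0 < r ^ 2 + z ^ 2 := by positivity
  have : 1 + (r⁻¹ * z) ^ 2 = (r ^ 2 + z ^ 2) / r ^ 2 := by field_simp
  rw [this]; field_simp

lemma w_far {r r' t : ℝ} (hr' : 0 < r') (hrr : r' ≤ r) (h : r ≤ |t|) :
    w r' t ≤ 4 * w r t := by
  have hr : 0 < r := hr'.trans_le hrr
  have ht : 0 < |t| := hr.trans_le h
  have h1 : w r' t ≤ r ^ 3 / (|t| ^ 2) ^ 2 := by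
    rw [w_eq hr', ← sq_abs t]; gcongr; nlinarith
  have h2 : r ^ 3 / (|t| ^ 2) ^ 2 ≤ 4 * w r t := by
    rw [w_eq hr, ← sq_abs t, div_le_iff₀ (by positivity), mul_comm, ← mul_assoc, ← mul_div_assoc,
      le_div_iff₀ (by positivity)]
    have : (r ^ 2 + |t| ^ 2) ^ 2 ≤ 4 * (|t| ^ 2) ^ 2 := by
      have : r ^ 2 + |t| ^ 2 ≤ 2 * |t| ^ 2 := by nlinarith
      calc _ ≤ (2 * |t| ^ 2) ^ 2 := by gcongr
        _ = _ := by ring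
    have h3 : 0 < r ^ 3 := by positivity
    nlinarith
  exact h1.trans h2

lemma w_mul_le {r r' x y z : ℝ} (hr' : 0 < r') (hrr : r' ≤ r) :
    w r (x - y) * w r' (y - z) ≤ 64 * w r (x - z) * (w r (x - y) + w r' (y - z)) := by
  have hr : 0 < r := hr'.trans_le hrr
  have p1 := w_pos hr (x - y)
  have p2 := w_pos hr' (y - z)
  have p3 := w_pos hr (x - z)
  by_cases h : |x - z| ≤ 2 * |x - y|
  · have := w_ge_half hr h
    nlinarith [mul_pos p1 p3, mul_pos p2 p3]
  · have h2 : |x - z| ≤ 2 * |y - z| := by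
      have := abs_sub_le x y z
      linarith
    by_cases h3 : |x - z| ≤ r
    · have : w r (x - y) ≤ 16 * w r (x - z) := by
        refine (w_anti hr (by simp) : w r (x - y) ≤ w r 0).trans (w_close hr ?_)
        rw [zero_sub, abs_neg]; exact h3
      nlinarith [mul_pos p1 p3, mul_pos p2 p3]
    · have h4 : w r' (y - z) ≤ 64 * w r (x - z) := by
        refine (w_ge_half hr' h2).trans ?_
        have := w_far hr' hrr (not_le.1 h3).le
        linarith
      nlinarith [mul_pos p1 p3, mul_pos p2 p3]

lemma integrable_v : Integrable v := by
  refine Integrable.mono' integrable_inv_one_add_sq (by fun_prop) (ae_of_all _ fun x => ?_)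
  rw [Real.norm_of_nonneg (v_pos x).le]
  unfold v
  apply inv_anti₀ (by positivity)
  nlinarith [sq_nonneg x, sq_nonneg (x ^ 2)]

lemma integral_v_le : ∫ x, v x ≤ π := by
  rw [← integral_univ_inv_one_add_sq]
  refine integral_mono integrable_v integrable_inv_one_add_sq fun x => ?_
  unfold v
  apply inv_anti₀ (by positivity)
  nlinarith [sq_nonneg x, sq_nonneg (x ^ 2)]

lemma integrable_w {r : ℝ} (hr : 0 < r) : Integrable (w r) := by
  unfold w
  exact (integrable_v.comp_mul_left' (by positivity : r⁻¹ ≠ 0)).const_mul _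

lemma integral_w_le {r : ℝ} (hr : 0 < r) : ∫ x, w r x ≤ π := by
  unfold w
  rw [integral_const_mul, Measure.integral_comp_mul_left, inv_inv, abs_of_pos hr, smul_eq_mul,
    ← mul_assoc, inv_mul_cancel₀ hr.ne', one_mul]
  exact integral_v_le

lemma integrable_w_sub {r : ℝ} (hr : 0 < r) (c : ℝ) : Integrable (fun y => w r (y - c)) :=
  (integrable_w hr).comp_sub_right c

lemma integrable_w_sub' {r : ℝ} (hr : 0 < r) (c : ℝ) : Integrable (fun y => w r (c - y)) :=
  (integrable_w hr).comp_sub_left c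

lemma integral_w_sub_le {r : ℝ} (hr : 0 < r) (c : ℝ) : ∫ y, w r (y - c) ≤ π := by
  rw [integral_sub_right_eq_self (fun y => w r y)]; exact integral_w_le hr

lemma integral_w_sub_le' {r : ℝ} (hr : 0 < r) (c : ℝ) : ∫ y, w r (c - y) ≤ π := by
  rw [integral_sub_left_eq_self (fun y => w r y)]; exact integral_w_le hr

lemma lintegral_W_le {r : ℝ} (hr : 0 < r) : ∫⁻ x, W r x ≤ ENNReal.ofReal π := by
  unfold W
  rw [← ofReal_integral_eq_lintegral_ofReal (integrable_w hr) (ae_of_all _ (w_nonneg hr))]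
  exact ENNReal.ofReal_le_ofReal (integral_w_le hr)

lemma lintegral_W_sub_le {r : ℝ} (hr : 0 < r) (c : ℝ) : ∫⁻ y, W r (c - y) ≤ ENNReal.ofReal π := by
  rw [lintegral_sub_left_eq_self (fun y => W r y)]; exact lintegral_W_le hr

lemma lintegral_W_sub_le' {r : ℝ} (hr : 0 < r) (c : ℝ) : ∫⁻ y, W r (y - c) ≤ ENNReal.ofReal π := by
  rw [lintegral_sub_right_eq_self (fun y => W r y)]; exact lintegral_W_le hr

lemma integrable_w_mul {r r' : ℝ} (hr : 0 < r) (hr' : 0 < r') (x z : ℝ) :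
    Integrable (fun y => w r (x - y) * w r' (y - z)) := by
  refine Integrable.mono' ((integrable_w_sub hr' z).const_mul r⁻¹)
    (by fun_prop) (ae_of_all _ fun y => ?_)
  rw [Real.norm_of_nonneg (mul_nonneg (w_nonneg hr _) (w_nonneg hr' _))]
  exact mul_le_mul_of_nonneg_right (w_le hr _) (w_nonneg hr' _)

lemma integral_w_mul_le {r r' : ℝ} (hr' : 0 < r') (hrr : r' ≤ r) (x z : ℝ) :
    ∫ y, w r (x - y) * w r' (y - z) ≤ 128 * π * w r (x - z) := by
  have hr : 0 < r := hr'.trans_le hrr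
  calc ∫ y, w r (x - y) * w r' (y - z)
      ≤ ∫ y, 64 * w r (x - z) * (w r (x - y) + w r' (y - z)) :=
        integral_mono (integrable_w_mul hr hr' x z)
          (((integrable_w_sub' hr x).add (integrable_w_sub hr' z)).const_mul _)
          fun y => w_mul_le hr' hrr
    _ = 64 * w r (x - z) * ((∫ y, w r (x - y)) + ∫ y, w r' (y - z)) := by
        rw [integral_const_mul, integral_add (integrable_w_sub' hr x) (integrable_w_sub hr' z)]
    _ ≤ 64 * w r (x - z) * (π + π) := by
        have := integral_w_sub_le' hr x
        have := integral_w_sub_le hr' z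
        have := w_nonneg hr (x - z)
        gcongr
    _ = _ := by ring

lemma lintegral_abs_W {r : ℝ} (hr : 0 < r) :
    ∫⁻ z, ENNReal.ofReal |z| * W r z ≤ ENNReal.ofReal (π * r) := by
  have h1 : ∀ z, ENNReal.ofReal |z| * W r z ≤ ENNReal.ofReal ((1 + (r⁻¹ * z) ^ 2)⁻¹) := by
    intro z
    rw [W, ← ENNReal.ofReal_mul (abs_nonneg _)]
    apply ENNReal.ofReal_le_ofReal
    unfold w v
    have e : |z| * (r⁻¹ * ((1 + (r⁻¹ * z) ^ 2) ^ 2)⁻¹) =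
        |r⁻¹ * z| * ((1 + (r⁻¹ * z) ^ 2) ^ 2)⁻¹ := by
      rw [abs_mul, abs_of_pos (by positivity : 0 < r⁻¹)]; ring
    rw [e]
    set u := r⁻¹ * z
    rw [← div_eq_mul_inv, div_le_iff₀ (by positivity), pow_two (1 + u ^ 2), ← mul_assoc,
      inv_mul_cancel₀ (by positivity), one_mul]
    nlinarith [sq_abs u, sq_nonneg (|u| - 1)]
  refine (lintegral_mono h1).trans ?_
  have hi : Integrable (fun z : ℝ => (1 + (r⁻¹ * z) ^ 2)⁻¹) :=
    integrable_inv_one_add_sq.comp_mul_left' (by positivity : r⁻¹ ≠ 0)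
  rw [← ofReal_integral_eq_lintegral_ofReal hi (ae_of_all _ fun z => by positivity)]
  rw [Measure.integral_comp_mul_left (fun u : ℝ => (1 + u ^ 2)⁻¹), inv_inv, abs_of_pos hr,
    integral_univ_inv_one_add_sq, smul_eq_mul, mul_comm]

lemma lint_bdry (a b : ℝ) {r : ℝ} (hr : 0 < r) :
    ∫⁻ x in Ico a b, ∫⁻ y in (Ico a b)ᶜ, W r (x - y) ≤ ENNReal.ofReal (π * r) := by
  classical
  have hm : MeasurableSet (Ico a b) := measurableSet_Ico
  calc ∫⁻ x in Ico a b, ∫⁻ y in (Ico a b)ᶜ, W r (x - y)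
      = ∫⁻ x, ∫⁻ z, (Ico a b).indicator 1 x * ((Ico a b)ᶜ.indicator 1 (x - z) * W r z) := by
        rw [← lintegral_indicator hm]
        congr 1; ext x
        rw [lintegral_const_mul' _ _ (by by_cases h : x ∈ Ico a b <;> simp [h])]
        by_cases h : x ∈ Ico a b
        · rw [indicator_of_mem h, indicator_of_mem h, Pi.one_apply, one_mul,
            ← lintegral_indicator hm.compl, ← lintegral_sub_left_eq_self _ x]
          congr 1; ext y
          by_cases h2 : x - y ∈ (Ico a b)ᶜ
          · rw [indicator_of_mem h2, indicator_of_mem h2]; simp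
          · rw [indicator_of_notMem h2, indicator_of_notMem h2]; simp
        · rw [indicator_of_notMem h, indicator_of_notMem h, zero_mul]
    _ = ∫⁻ z, ∫⁻ x, (Ico a b).indicator 1 x * ((Ico a b)ᶜ.indicator 1 (x - z) * W r z) := by
        apply lintegral_lintegral_swap
        apply Measurable.aemeasurable
        have h1 : Measurable ((Ico a b).indicator (1 : ℝ → ℝ≥0∞)) := measurable_one.indicator hm
        have h2 : Measurable ((Ico a b)ᶜ.indicator (1 : ℝ → ℝ≥0∞)) :=
          measurable_one.indicator hm.compl
        exact (h1.comp measurable_fst).mul ((h2.comp (measurable_fst.sub measurable_snd)).mul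
          ((measurable_W r).comp measurable_snd))
    _ ≤ ∫⁻ z, ENNReal.ofReal |z| * W r z := by
        apply lintegral_mono; intro z
        have : ∀ x, (Ico a b).indicator (1 : ℝ → ℝ≥0∞) x *
            ((Ico a b)ᶜ.indicator 1 (x - z) * W r z) ≤
            (if 0 ≤ z then Ico a (a + z) else Ico (b + z) b).indicator 1 x * W r z := by
          intro x
          rw [← mul_assoc]
          gcongr
          by_cases h : x ∈ Ico a b <;> by_cases h2 : x - z ∈ (Ico a b)ᶜ
          · have : x ∈ (if 0 ≤ z then Ico a (a + z) else Ico (b + z) b) := by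
              rw [mem_compl_iff, mem_Ico] at h2
              rw [mem_Ico] at h
              split_ifs with h0
              · rw [mem_Ico]; refine ⟨h.1, ?_⟩
                by_contra hc; apply h2; constructor <;> linarith
              · rw [mem_Ico]; refine ⟨?_, h.2⟩
                by_contra hc; apply h2; constructor <;> linarith
            simp [h, indicator_of_mem this, indicator_of_mem h2]
          · simp [indicator_of_notMem h2]
          · simp [h]
          · simp [h]
        refine (lintegral_mono this).trans ?_
        rw [lintegral_mul_const _ (measurable_one.indicator
          (by split_ifs <;> exact measurableSet_Ico))]
        refine mul_le_mul' ?_ le_rfl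
        rw [lintegral_indicator_one (by split_ifs <;> exact measurableSet_Ico)]
        split_ifs with h0
        · rw [Real.volume_Ico, abs_of_nonneg h0]; ring_nf; exact le_rfl
        · rw [Real.volume_Ico, abs_of_neg (not_le.1 h0)]; ring_nf; exact le_rfl
    _ ≤ _ := lintegral_abs_W hr

lemma W_close {r x y : ℝ} (hr : 0 < r) (h : |x - y| ≤ r) : W r x ≤ 16 * W r y := by
  unfold W
  rw [show (16:ℝ≥0∞) = ENNReal.ofReal 16 by norm_num, ← ENNReal.ofReal_mul (by norm_num)]
  exact ENNReal.ofReal_le_ofReal (w_close hr h)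

lemma W_avg (k n : ℤ) {c y : ℝ} (hc : c ∈ dy k n) :
    ENNReal.ofReal (2 ^ k) * W (2 ^ k) (c - y) ≤ 16 * ∫⁻ x in dy k n, W (2 ^ k) (x - y) := by
  rw [← volume_dy k n, mul_comm, ← setLIntegral_const, ← lintegral_const_mul _ (by fun_prop)]
  refine setLIntegral_mono (by fun_prop) fun x hx => W_close (two_zpow_pos k) ?_
  rw [sub_sub_sub_cancel_right]; exact abs_sub_le_of_mem_dy hc hx

end CH

namespace CH

noncomputable def e (t : ℝ) : ℂ := Complex.exp (↑(2 * π * t) * Complex.I)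

@[simp] lemma norm_e (t : ℝ) : ‖e t‖ = 1 := Complex.norm_exp_ofReal_mul_I _
lemma e_add (s t : ℝ) : e (s + t) = e s * e t := by
  rw [e, e, e, ← Complex.exp_add]; congr 1; push_cast; ring
lemma e_zero : e 0 = 1 := by simp [e]
lemma e_ne_zero (t : ℝ) : e t ≠ 0 := Complex.exp_ne_zero _
lemma e_neg_mul (t : ℝ) : e (-t) * e t = 1 := by rw [← e_add]; simp [e_zero]
@[fun_prop] lemma continuous_e : Continuous e := by unfold e; fun_prop
lemma conj_e (t : ℝ) : (starRingEnd ℂ) (e t) = e (-t) := by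
  rw [e, e, ← Complex.exp_conj]; congr 1
  rw [map_mul, Complex.conj_ofReal, Complex.conj_I]; push_cast; ring

lemma fourier_eq_e (f : ℝ → ℂ) (η : ℝ) : 𝓕 f η = ∫ y, e (-(y * η)) * f y := by
  rw [Real.fourier_real_eq_integral_exp_smul]
  congr 1; ext y; rw [smul_eq_mul, e]; congr 3; ring

lemma fourierInv_eq_e (f : ℝ → ℂ) (η : ℝ) : 𝓕⁻ f η = ∫ y, e (y * η) * f y := by
  rw [Real.fourierInv_eq_fourier_neg, fourier_eq_e]; simp

lemma fourier_continuous {f : ℝ → ℂ} (hf : Integrable f) : Continuous (𝓕 f) :=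
  VectorFourier.fourierIntegral_continuous Real.continuous_fourierChar
    (by exact continuous_inner) hf

lemma fourier_swap {f g : ℝ → ℂ} (hf : Integrable f) (hg : Integrable g) :
    ∫ x, 𝓕 f x * g x = ∫ x, f x * 𝓕 g x := by
  have := VectorFourier.integral_fourierIntegral_smul_eq_flip (μ := volume) (ν := volume)
    (L := innerₗ ℝ) (f := f) (g := g) Real.continuous_fourierChar (by exact continuous_inner) hf hg
  rw [flip_innerₗ] at this
  exact this

lemma fourier_comp_sub (f : ℝ → ℂ) (x η : ℝ) :
    𝓕 (fun y => f (x - y)) η = e (-(x * η)) * 𝓕 f (-η) := by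
  rw [fourier_eq_e, fourier_eq_e, ← integral_const_mul]
  rw [← integral_sub_left_eq_self _ volume x]
  congr 1; ext y
  rw [sub_sub_cancel, ← mul_assoc, ← e_add]; congr 2; ring

lemma fourier_conj (f : ℝ → ℂ) (η : ℝ) :
    𝓕 (fun y => (starRingEnd ℂ) (f y)) η = (starRingEnd ℂ) (𝓕 f (-η)) := by
  rw [fourier_eq_e, fourier_eq_e, ← integral_conj]
  congr 1; ext y
  rw [map_mul, conj_e]; congr 2; ring

lemma integrable_of_bdd_supp {g : ℝ → ℂ} (hg : Continuous g) {a b : ℝ}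
    (h : ∀ η, g η ≠ 0 → η ∈ Icc a b) : Integrable g := by
  apply hg.integrable_of_hasCompactSupport
  refine HasCompactSupport.intro (isCompact_Icc (a := a) (b := b)) fun x hx => ?_
  by_contra hc; exact hx (h x hc)

/-- master Parseval formula -/
lemma parseval {φ ψ : ℝ → ℂ} (hc : Continuous φ) (hi : Integrable φ) {a b : ℝ}
    (h : ∀ η, 𝓕 φ η ≠ 0 → η ∈ Icc a b) (hψ : Integrable ψ) :
    ∫ y, ψ y * φ y = ∫ η, 𝓕 ψ (-η) * 𝓕 φ η := by
  have hI : Integrable (𝓕 φ) := integrable_of_bdd_supp (fourier_continuous hi) h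
  have inv := hc.fourierInv_fourier_eq hi hI
  have h1 : ∀ y, φ y = 𝓕 (𝓕 φ) (-y) := fun y => by
    conv_lhs => rw [← inv]
    rw [Real.fourierInv_eq_fourier_neg]
  calc ∫ y, ψ y * φ y = ∫ y, ψ (-y) * 𝓕 (𝓕 φ) y := by
        rw [← integral_neg_eq_self]; congr 1; ext y; rw [h1, neg_neg]
    _ = ∫ η, 𝓕 (fun y => ψ (-y)) η * 𝓕 φ η := (fourier_swap hψ.comp_neg hI).symm
    _ = _ := by
      congr 1; ext η
      have := fourier_comp_sub ψ 0 η
      simp only [zero_sub, zero_mul, neg_zero, e_zero, one_mul] at this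
      rw [this]

lemma parseval_zero {φ ψ : ℝ → ℂ} (hc : Continuous φ) (hi : Integrable φ) {a b : ℝ}
    (h : ∀ η, 𝓕 φ η ≠ 0 → η ∈ Icc a b) (hψ : Integrable ψ)
    (h0 : ∀ η, 𝓕 φ η ≠ 0 → 𝓕 ψ η = 0) :
    ∫ y, (starRingEnd ℂ) (ψ y) * φ y = 0 := by
  rw [parseval hc hi h (ψ := fun y => (starRingEnd ℂ) (ψ y))
    (by simpa using (Complex.conjLIE.toContinuousLinearEquiv.integrable_comp_iff.2 hψ))]
  rw [← integral_zero ℝ ℂ]; congr 1; ext η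
  rw [fourier_conj, neg_neg]
  by_cases hz : 𝓕 φ η = 0
  · simp [hz]
  · simp [h0 η hz]

/-- convolution -/
noncomputable def cnv (f G : ℝ → ℂ) (x : ℝ) : ℂ := ∫ y, f y * G (x - y)

lemma cnv_eq (f G : ℝ → ℂ) : cnv f G = MeasureTheory.convolution f G (ContinuousLinearMap.mul ℂ ℂ) := rfl

lemma integrable_cnv {f G : ℝ → ℂ} (hf : Integrable f) (hG : Integrable G) :
    Integrable (cnv f G) := by
  rw [cnv_eq]; exact hf.integrable_convolution _ hG

lemma fourier_cnv {f G : ℝ → ℂ} (hf : Integrable f) (hG : Integrable G) (η : ℝ) :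
    𝓕 (cnv f G) η = 𝓕 f η * 𝓕 G η := by
  rw [cnv_eq]; exact Real.fourier_mul_convolution_eq hf hG η

lemma continuous_cnv {f G : ℝ → ℂ} (hf : Integrable f) (hG : Continuous G) {M : ℝ}
    (hM : ∀ x, ‖G x‖ ≤ M) : Continuous (cnv f G) := by
  unfold cnv
  refine continuous_of_dominated (F := fun x y => f y * G (x - y)) (bound := fun y => ‖f y‖ * M)
    (fun x => hf.aestronglyMeasurable.mul (by fun_prop)) (fun x => ae_of_all _ fun y => ?_)
    (hf.norm.mul_const M) (ae_of_all _ fun y => by fun_prop)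
  rw [norm_mul]; gcongr; exact hM _

lemma cnv_multiplier {φ G : ℝ → ℂ} (hc : Continuous φ) (hi : Integrable φ) {a b : ℝ}
    (h : ∀ η, 𝓕 φ η ≠ 0 → η ∈ Icc a b) (hG : Integrable G) (x : ℝ) :
    cnv φ G x = ∫ η, e (η * x) * (𝓕 G η * 𝓕 φ η) := by
  have := parseval hc hi h (hG.comp_sub_left x)
  unfold cnv
  rw [show (fun y => φ y * G (x - y)) = fun y => G (x - y) * φ y by ext; ring, this]
  congr 1; ext η
  rw [fourier_comp_sub, neg_neg]; rw [← mul_assoc]; congr 3; ring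

lemma cnv_eq_self {φ G : ℝ → ℂ} (hc : Continuous φ) (hi : Integrable φ) {a b : ℝ}
    (h : ∀ η, 𝓕 φ η ≠ 0 → η ∈ Icc a b) (hG : Integrable G)
    (h1 : ∀ η, 𝓕 φ η ≠ 0 → 𝓕 G η = 1) (x : ℝ) : cnv φ G x = φ x := by
  rw [cnv_multiplier hc hi h hG]
  have hI : Integrable (𝓕 φ) := integrable_of_bdd_supp (fourier_continuous hi) h
  have inv := hc.fourierInv_fourier_eq hi hI
  conv_rhs => rw [← inv, fourierInv_eq_e]
  congr 1; ext η
  by_cases hz : 𝓕 φ η = 0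
  · simp [hz]
  · simp [h1 η hz]

lemma cnv_eq_zero {φ G : ℝ → ℂ} (hc : Continuous φ) (hi : Integrable φ) {a b : ℝ}
    (h : ∀ η, 𝓕 φ η ≠ 0 → η ∈ Icc a b) (hG : Integrable G)
    (h1 : ∀ η, 𝓕 φ η ≠ 0 → 𝓕 G η = 0) (x : ℝ) : cnv φ G x = 0 := by
  rw [cnv_multiplier hc hi h hG, ← integral_zero ℝ ℂ]
  congr 1; ext η
  by_cases hz : 𝓕 φ η = 0
  · simp [hz]
  · simp [h1 η hz]

/-- wave packets -/
structure IsWP (s : Tile) (φ : ℝ → ℂ) : Prop where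
  cont : Continuous φ
  supp : ∀ η, 𝓕 φ η ≠ 0 → -η ∈ s.w1
  decay : ∀ y, ‖φ y‖ ≤ w (2 ^ s.k) (y - s.c)
  lip : ∀ ν ∈ s.Om, ∀ y z, |y - z| ≤ 2 ^ s.k →
    ‖e (ν * y) * φ y - e (ν * z) * φ z‖ ≤ 2 ^ (-s.k) * |y - z| * w (2 ^ s.k) (y - s.c)

lemma IsWP.integrable {s : Tile} {φ : ℝ → ℂ} (h : IsWP s φ) : Integrable φ :=
  Integrable.mono' (integrable_w_sub (two_zpow_pos s.k) s.c) h.cont.aestronglyMeasurable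
    (ae_of_all _ h.decay)

lemma isWP_zero (s : Tile) : IsWP s 0 where
  cont := continuous_zero
  supp η h := by exfalso; apply h; rw [fourier_eq_e]; simp
  decay y := by simp [w_nonneg (two_zpow_pos s.k)]
  lip ν hν y z h := by
    simp only [Pi.zero_apply, mul_zero, sub_zero, norm_zero]
    have := w_nonneg (two_zpow_pos s.k) (y - s.c); positivity

lemma IsWP.bdd {s : Tile} {φ : ℝ → ℂ} (h : IsWP s φ) :
    ∃ a b, ∀ η, 𝓕 φ η ≠ 0 → η ∈ Icc a b := by
  refine ⟨-(((s.l:ℝ) + 1/2) * 2 ^ (-s.k)), -((s.l:ℝ) * 2 ^ (-s.k)), fun η hη => ?_⟩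
  have := mem_w1.1 (h.supp η hη)
  constructor <;> linarith [this.1, this.2]

lemma IsWP.orth {s s' : Tile} {φ ψ : ℝ → ℂ} (h : IsWP s φ) (h' : IsWP s' ψ)
    (hd : Disjoint s.w1 s'.w1) : ∫ y, (starRingEnd ℂ) (ψ y) * φ y = 0 := by
  obtain ⟨a, b, hab⟩ := h.bdd
  refine parseval_zero h.cont h.integrable hab h'.integrable fun η hη => ?_
  by_contra hc
  exact Set.disjoint_left.1 hd (h.supp η hη) (h'.supp η hc)

lemma IsWP.inner_le {s s' : Tile} {φ ψ : ℝ → ℂ} (h : IsWP s φ) (h' : IsWP s' ψ)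
    (hk : s'.k ≤ s.k) : ‖∫ y, (starRingEnd ℂ) (ψ y) * φ y‖ ≤ 128 * π * w (2 ^ s.k) (s.c - s'.c) := by
  refine le_trans ?_ (integral_w_mul_le (two_zpow_pos s'.k)
    (zpow_le_zpow_right₀ (by norm_num : (1:ℝ) ≤ 2) hk) s.c s'.c)
  refine norm_integral_le_of_norm_le (integrable_w_mul (two_zpow_pos _) (two_zpow_pos _) _ _)
    (ae_of_all _ fun y => ?_)
  rw [norm_mul, RCLike.norm_conj, mul_comm]
  have h1 := h.decay y
  have h2 := h'.decay y
  rw [w_sub_comm] at h1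
  exact mul_le_mul h1 h2 (norm_nonneg _) (w_nonneg (two_zpow_pos _) _)

end CH

namespace CH

lemma sum_w_le (A : Finset Tile) (hd : ∀ s ∈ A, ∀ t ∈ A, s ≠ t → Disjoint s.I t.I) {X : Set ℝ}
    (hX : ∀ s ∈ A, s.I ⊆ X) (hXm : MeasurableSet X) {k : ℤ} (hk : ∀ s ∈ A, s.k ≤ k) (x : ℝ) :
    ∑ s ∈ A, 2 ^ s.k * w (2 ^ k) (x - s.c) ≤ 16 * ∫ y in X, w (2 ^ k) (x - y) := by
  have hi := integrable_w_sub' (two_zpow_pos k) x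
  calc ∑ s ∈ A, 2 ^ s.k * w (2 ^ k) (x - s.c)
      ≤ ∑ s ∈ A, ∫ y in s.I, 16 * w (2 ^ k) (x - y) := by
        refine Finset.sum_le_sum fun s hs => ?_
        have : 2 ^ s.k * w (2 ^ k) (x - s.c) = ∫ y in s.I, w (2 ^ k) (x - s.c) := by
          rw [setIntegral_const, Tile.I, volume_real_dy, smul_eq_mul]
        rw [this]
        refine setIntegral_mono_on ?_ (hi.const_mul _).integrableOn (measurableSet_I s)
          fun y hy => w_close (two_zpow_pos k) ?_
        · exact integrableOn_const (by rw [Tile.I, volume_dy]; simp) (by simp)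
        · rw [sub_sub_sub_cancel_left]
          exact (abs_sub_le_of_mem_dy hy (c_mem s)).trans
            (zpow_le_zpow_right₀ (by norm_num) (hk s hs))
    _ = ∫ y in ⋃ s ∈ A, s.I, 16 * w (2 ^ k) (x - y) := by
        rw [integral_biUnion_finset A (fun s _ => measurableSet_I s)
          (fun s hs t ht hst => hd s hs t ht hst) (fun s _ => (hi.const_mul _).integrableOn)]
    _ ≤ ∫ y in X, 16 * w (2 ^ k) (x - y) := by
        refine setIntegral_mono_set (hi.const_mul _).integrableOn
          (ae_of_all _ fun y => ?_) (HasSubset.Subset.eventuallyLE ?_)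
        · have := w_nonneg (two_zpow_pos k) (x - y); simp; linarith
        · exact iUnion₂_subset hX
    _ = _ := by rw [integral_const_mul]

lemma sum_w_le_pi (A : Finset Tile) (hd : ∀ s ∈ A, ∀ t ∈ A, s ≠ t → Disjoint s.I t.I) {k : ℤ}
    (hk : ∀ s ∈ A, s.k ≤ k) (x : ℝ) :
    ∑ s ∈ A, 2 ^ s.k * w (2 ^ k) (x - s.c) ≤ 16 * π := by
  refine (sum_w_le A hd (X := univ) (fun _ _ => subset_univ _) MeasurableSet.univ hk x).trans ?_
  rw [setIntegral_univ]
  have := integral_w_sub_le' (two_zpow_pos k) x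
  linarith

lemma cauchy_schwarz {f g : ℝ → ℝ} (hf : Integrable (fun x => f x ^ 2))
    (hg : Integrable (fun x => g x ^ 2)) (hfg : Integrable (fun x => f x * g x)) :
    (∫ x, f x * g x) ^ 2 ≤ (∫ x, f x ^ 2) * ∫ x, g x ^ 2 := by
  have h : ∀ t : ℝ, 0 ≤ (∫ x, g x ^ 2) * (t * t) + (-2 * ∫ x, f x * g x) * t + ∫ x, f x ^ 2 := by
    intro t
    have h1 : 0 ≤ ∫ x, (f x - t * g x) ^ 2 := integral_nonneg fun x => sq_nonneg _
    have h2 : ∫ x, (f x - t * g x) ^ 2 =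
        (∫ x, f x ^ 2) - 2 * t * (∫ x, f x * g x) + t * t * ∫ x, g x ^ 2 := by
      have hh : Integrable (fun x => f x ^ 2 - 2 * t * (f x * g x)) := hf.sub (hfg.const_mul _)
      rw [← integral_const_mul, ← integral_const_mul, ← integral_sub hf (hfg.const_mul _),
        ← integral_add hh (hg.const_mul _)]
      congr 1; ext x; ring
    linarith
  have := discrim_le_zero h
  unfold discrim at this
  nlinarith

section bessel
variable (P : Finset Tile) (ψ : Tile → ℝ → ℂ) (b : Tile → ℝ)

/-- size decay data -/
structure Dec (s : Tile) (ψ : ℝ → ℂ) (b : ℝ) : Prop where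
  cont : Continuous ψ
  nonneg : 0 ≤ b
  decay : ∀ y, ‖ψ y‖ ≤ b * (2 ^ s.k * w (2 ^ s.k) (y - s.c))

lemma Dec.le {s : Tile} {ψ : ℝ → ℂ} {b : ℝ} (h : Dec s ψ b) (y : ℝ) : ‖ψ y‖ ≤ b := by
  refine (h.decay y).trans ?_
  have h1 := w_le (two_zpow_pos s.k) (y - s.c)
  have h2 := two_zpow_pos s.k
  have : 2 ^ s.k * w (2 ^ s.k) (y - s.c) ≤ 1 := by
    calc _ ≤ 2 ^ s.k * ((2:ℝ) ^ s.k)⁻¹ := by gcongr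
      _ = 1 := mul_inv_cancel₀ h2.ne'
  exact mul_le_of_le_one_right h.nonneg this

lemma Dec.integrable {s : Tile} {ψ : ℝ → ℂ} {b : ℝ} (h : Dec s ψ b) : Integrable ψ :=
  Integrable.mono' (((integrable_w_sub (two_zpow_pos s.k) s.c).const_mul _).const_mul _)
    h.cont.aestronglyMeasurable (ae_of_all _ h.decay)

lemma Dec.integrable_mul {s s' : Tile} {ψ ψ' : ℝ → ℂ} {b b' : ℝ} (h : Dec s ψ b)
    (h' : Dec s' ψ' b') : Integrable (fun y => (starRingEnd ℂ) (ψ' y) * ψ y) :=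
  h.integrable.bdd_mul (c := b') ((Complex.continuous_conj.comp h'.cont).aestronglyMeasurable)
    (ae_of_all _ fun y => by simpa using h'.le y)

lemma Dec.inner_le {s s' : Tile} {ψ ψ' : ℝ → ℂ} {b b' : ℝ} (h : Dec s ψ b)
    (h' : Dec s' ψ' b') (hk : s'.k ≤ s.k) :
    ‖∫ y, (starRingEnd ℂ) (ψ' y) * ψ y‖ ≤
      128 * π * (b * b' * (2 ^ s.k * (2 ^ s'.k * w (2 ^ s.k) (s.c - s'.c)))) := by
  have h0 := integral_w_mul_le (two_zpow_pos s'.k)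
    (zpow_le_zpow_right₀ (by norm_num : (1:ℝ) ≤ 2) hk) s.c s'.c
  have p1 := two_zpow_pos s.k
  have p2 := two_zpow_pos s'.k
  have n1 := h.nonneg
  have n2 := h'.nonneg
  calc ‖∫ y, (starRingEnd ℂ) (ψ' y) * ψ y‖
      ≤ ∫ y, (b * b' * (2 ^ s.k * 2 ^ s'.k)) * (w (2 ^ s.k) (s.c - y) * w (2 ^ s'.k) (y - s'.c)) := by
        refine norm_integral_le_of_norm_le ((integrable_w_mul p1 p2 _ _).const_mul _)
          (ae_of_all _ fun y => ?_)
        rw [norm_mul, RCLike.norm_conj, mul_comm]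
        have h1 := h.decay y
        have h2 := h'.decay y
        rw [w_sub_comm] at h1
        refine (mul_le_mul h1 h2 (norm_nonneg _) ((norm_nonneg _).trans h1)).trans (le_of_eq ?_)
        ring
    _ ≤ (b * b' * (2 ^ s.k * 2 ^ s'.k)) * (128 * π * w (2 ^ s.k) (s.c - s'.c)) := by
        rw [integral_const_mul]; gcongr
    _ = _ := by ring

lemma norm_sq_sum_le (h : ∀ s ∈ P, Dec s (ψ s) (b s)) :
    Integrable (fun y => ‖∑ s ∈ P, ψ s y‖ ^ 2) ∧
    ∫ y, ‖∑ s ∈ P, ψ s y‖ ^ 2 ≤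
      ∑ s ∈ P, ∑ s' ∈ P, ‖∫ y, (starRingEnd ℂ) (ψ s' y) * ψ s y‖ := by
  have e1 : ∀ y, ((‖∑ s ∈ P, ψ s y‖ ^ 2 : ℝ) : ℂ) =
      ∑ s ∈ P, ∑ s' ∈ P, (starRingEnd ℂ) (ψ s' y) * ψ s y := by
    intro y
    rw [← Complex.normSq_eq_norm_sq, Complex.normSq_eq_conj_mul_self, map_sum, Finset.sum_mul_sum,
      Finset.sum_comm]
  have hI : ∀ s ∈ P, ∀ s' ∈ P, Integrable (fun y => (starRingEnd ℂ) (ψ s' y) * ψ s y) :=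
    fun s hs s' hs' => (h s hs).integrable_mul (h s' hs')
  have hI2 : Integrable (fun y => ((‖∑ s ∈ P, ψ s y‖ ^ 2 : ℝ) : ℂ)) := by
    simp_rw [e1]
    exact integrable_finsetSum _ fun s hs => integrable_finsetSum _ fun s' hs' => hI s hs s' hs'
  refine ⟨by have := hI2.re; simpa only [RCLike.re_to_complex, Complex.ofReal_re] using this, ?_⟩
  have e2 : ((∫ y, ‖∑ s ∈ P, ψ s y‖ ^ 2 : ℝ) : ℂ) =
      ∑ s ∈ P, ∑ s' ∈ P, ∫ y, (starRingEnd ℂ) (ψ s' y) * ψ s y := by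
    rw [← integral_complex_ofReal]
    simp_rw [e1]
    rw [integral_finsetSum _ fun s hs => integrable_finsetSum _ fun s' hs' => hI s hs s' hs']
    refine Finset.sum_congr rfl fun s hs => ?_
    rw [integral_finsetSum _ fun s' hs' => hI s hs s' hs']
  calc ∫ y, ‖∑ s ∈ P, ψ s y‖ ^ 2 ≤ ‖((∫ y, ‖∑ s ∈ P, ψ s y‖ ^ 2 : ℝ) : ℂ)‖ := by
        rw [Complex.norm_real]; exact le_abs_self _
    _ ≤ _ := by
        rw [e2]
        exact (norm_sum_le _ _).trans (Finset.sum_le_sum fun s _ => norm_sum_le _ _)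

lemma inner_symm (s s' : Tile) : ‖∫ y, (starRingEnd ℂ) (ψ s' y) * ψ s y‖ =
    ‖∫ y, (starRingEnd ℂ) (ψ s y) * ψ s' y‖ := by
  rw [← RCLike.norm_conj, ← integral_conj]
  congr 2; ext y; simp [mul_comm]

lemma bessel_gen (h : ∀ s ∈ P, Dec s (ψ s) (b s)) (O : Tile → Finset Tile)
    (hO : ∀ s ∈ P, O s ⊆ P.filter (fun s' => s'.k < s.k))
    (horth : ∀ s ∈ P, ∀ s' ∈ P, s.k = s'.k → s.l ≠ s'.l →
      ∫ y, (starRingEnd ℂ) (ψ s' y) * ψ s y = 0)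
    (horth' : ∀ s ∈ P, ∀ s' ∈ P, s'.k < s.k → s' ∉ O s →
      ∫ y, (starRingEnd ℂ) (ψ s' y) * ψ s y = 0) :
    ∫ y, ‖∑ s ∈ P, ψ s y‖ ^ 2 ≤ 2048 * π ^ 2 * (∑ s ∈ P, b s ^ 2 * 2 ^ s.k) +
      256 * π * ∑ s ∈ P, ∑ s' ∈ O s,
        b s * b s' * (2 ^ s.k * (2 ^ s'.k * w (2 ^ s.k) (s.c - s'.c))) := by
  classical
  set ip : Tile → Tile → ℝ := fun s s' => ‖∫ y, (starRingEnd ℂ) (ψ s' y) * ψ s y‖ with hip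
  have hsym : ∀ s s', ip s s' = ip s' s := fun s s' => inner_symm ψ s s'
  have step1 := (norm_sq_sum_le P ψ b h).2
  have split : ∑ s ∈ P, ∑ s' ∈ P, ip s s' =
      (∑ s ∈ P, ∑ s' ∈ P, if s.k = s'.k then ip s s' else 0) +
      2 * ∑ s ∈ P, ∑ s' ∈ P, if s'.k < s.k then ip s s' else 0 := by
    have : ∑ s ∈ P, ∑ s' ∈ P, (if s'.k < s.k then ip s s' else 0) =
        ∑ s ∈ P, ∑ s' ∈ P, if s.k < s'.k then ip s s' else 0 := by
      rw [Finset.sum_comm]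
      refine Finset.sum_congr rfl fun s _ => Finset.sum_congr rfl fun s' _ => ?_
      rw [hsym]
    rw [two_mul]
    nth_rewrite 2 [this]
    rw [← add_assoc, ← Finset.sum_add_distrib, ← Finset.sum_add_distrib]
    refine Finset.sum_congr rfl fun s _ => ?_
    rw [← Finset.sum_add_distrib, ← Finset.sum_add_distrib]
    refine Finset.sum_congr rfl fun s' _ => ?_
    rcases lt_trichotomy s.k s'.k with h1 | h1 | h1
    · simp [h1, h1.ne, h1.not_gt]
    · simp [h1]
    · simp [h1, h1.ne', h1.not_gt]
  have diag : (∑ s ∈ P, ∑ s' ∈ P, if s.k = s'.k then ip s s' else 0) ≤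
      2048 * π ^ 2 * (∑ s ∈ P, b s ^ 2 * 2 ^ s.k) := by
    set q : Tile → Tile → ℝ := fun s s' => if s.k = s'.k ∧ s.l = s'.l then
      64 * π * (b s ^ 2 * 2 ^ s.k * (2 ^ s'.k * w (2 ^ s.k) (s.c - s'.c))) else 0 with hq
    have b1 : ∀ s ∈ P, ∀ s' ∈ P, (if s.k = s'.k then ip s s' else 0) ≤ q s s' + q s' s := by
      intro s hs s' hs'
      by_cases hk : s.k = s'.k
      · by_cases hl : s.l = s'.l
        · simp only [hq, hk, hl, if_true, and_self]
          refine ((h s hs).inner_le (h s' hs') hk.ge).trans ?_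
          rw [hk, w_sub_comm _ s'.c s.c]
          have h2 := sq_nonneg (b s - b s')
          have h3 : 0 ≤ π * (2 ^ s'.k * (2 ^ s'.k * w (2 ^ s'.k) (s.c - s'.c))) := by
            have := w_nonneg (two_zpow_pos s'.k) (s.c - s'.c); positivity
          nlinarith [mul_nonneg h2 h3]
        · simp only [hq, hk, if_true]
          rw [if_neg (by simp [hl]), if_neg (by simp [Ne.symm hl])]
          simp [hip, horth s hs s' hs' hk hl]
      · simp [hq, hk, Ne.symm hk]
    have b2 : ∀ s ∈ P, ∑ s' ∈ P, q s s' ≤ 1024 * π ^ 2 * (b s ^ 2 * 2 ^ s.k) := by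
      intro s hs
      rw [← Finset.sum_filter, ← Finset.mul_sum, ← Finset.mul_sum]
      have := sum_w_le_pi (P.filter (fun s' => s.k = s'.k ∧ s.l = s'.l)) (by
        intro t ht u hu htu
        simp only [Finset.mem_filter] at ht hu
        have e1 : t.k = u.k := ht.2.1.symm.trans hu.2.1
        have e2 : t.l = u.l := ht.2.2.symm.trans hu.2.2
        rw [Tile.I, Tile.I, e1]
        apply dy_disjoint
        intro hn; exact htu (Tile.ext e1 hn e2)) (k := s.k) (by
          intro t ht; simp only [Finset.mem_filter] at ht; exact ht.2.1.ge) s.c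
      have h3 : 0 ≤ b s ^ 2 * 2 ^ s.k := by positivity
      calc _ ≤ 64 * π * (b s ^ 2 * 2 ^ s.k * (16 * π)) := by gcongr
        _ = _ := by ring
    calc _ ≤ ∑ s ∈ P, ∑ s' ∈ P, (q s s' + q s' s) :=
          Finset.sum_le_sum fun s hs => Finset.sum_le_sum fun s' hs' => b1 s hs s' hs'
      _ = 2 * ∑ s ∈ P, ∑ s' ∈ P, q s s' := by
          simp_rw [Finset.sum_add_distrib]
          rw [Finset.sum_comm (f := fun s s' => q s' s), two_mul]
      _ ≤ 2 * ∑ s ∈ P, 1024 * π ^ 2 * (b s ^ 2 * 2 ^ s.k) := by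
          gcongr with s hs; exact b2 s hs
      _ = _ := by rw [← Finset.mul_sum]; ring
  have off : (∑ s ∈ P, ∑ s' ∈ P, if s'.k < s.k then ip s s' else 0) ≤
      128 * π * ∑ s ∈ P, ∑ s' ∈ O s,
        b s * b s' * (2 ^ s.k * (2 ^ s'.k * w (2 ^ s.k) (s.c - s'.c))) := by
    rw [Finset.mul_sum]
    refine Finset.sum_le_sum fun s hs => ?_
    rw [Finset.mul_sum]
    have hsub : O s ⊆ P := (hO s hs).trans (Finset.filter_subset _ _)
    rw [← Finset.sum_subset hsub (f := fun s' => if s'.k < s.k then ip s s' else 0)]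
    · refine Finset.sum_le_sum fun s' hs' => ?_
      have := (Finset.mem_filter.1 (hO s hs hs')).2
      rw [if_pos this]
      exact (h s hs).inner_le (h s' (hsub hs')) this.le
    · intro s' hs' hn
      split_ifs with hk
      · simp [hip, horth' s hs s' hs' hk hn]
      · rfl
  calc _ ≤ _ := step1
    _ = _ := split
    _ ≤ _ := add_le_add diag (mul_le_mul_of_nonneg_left off (by norm_num))
    _ = _ := by ring

end bessel

/-- duality: abstract TT* -/
lemma tt_star {f : ℝ → ℂ} (hf : Integrable f) (hf2 : Integrable (fun x => ‖f x‖ ^ 2))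
    (P : Finset Tile) (φ : Tile → ℝ → ℂ) (hφ : ∀ s ∈ P, IsWP s (φ s)) :
    (∑ s ∈ P, 2 ^ s.k * ‖∫ y, f y * φ s y‖ ^ 2) ^ 2 ≤ (∫ x, ‖f x‖ ^ 2) *
      ∫ y, ‖∑ s ∈ P, ((2:ℂ) ^ s.k * (starRingEnd ℂ) (∫ y, f y * φ s y)) * φ s y‖ ^ 2 := by
  set a : Tile → ℂ := fun s => ∫ y, f y * φ s y with ha
  set Φ : ℝ → ℂ := fun y => ∑ s ∈ P, ((2:ℂ) ^ s.k * (starRingEnd ℂ) (a s)) * φ s y with hΦ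
  have hdec : ∀ s ∈ P, Dec s (fun y => ((2:ℂ) ^ s.k * (starRingEnd ℂ) (a s)) * φ s y) ‖a s‖ := by
    intro s hs
    refine ⟨continuous_const.mul (hφ s hs).cont, norm_nonneg _, fun y => ?_⟩
    rw [norm_mul, norm_mul, RCLike.norm_conj, norm_zpow, Complex.norm_ofNat]
    have := (hφ s hs).decay y
    calc _ ≤ 2 ^ s.k * ‖a s‖ * w (2 ^ s.k) (y - s.c) := by gcongr
      _ = _ := by ring
  have hΦ2 : Integrable (fun y => ‖Φ y‖ ^ 2) := (norm_sq_sum_le P _ _ hdec).1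
  have hΦc : Continuous Φ := continuous_finsetSum _ fun s hs => (hdec s hs).cont
  have hbd : ∀ y, ‖Φ y‖ ≤ ∑ s ∈ P, ‖a s‖ := fun y =>
    (norm_sum_le _ _).trans (Finset.sum_le_sum fun s hs => (hdec s hs).le y)
  have hfφ : ∀ s ∈ P, Integrable (fun y => f y * φ s y) := by
    intro s hs
    refine hf.mul_bdd (c := ((2:ℝ) ^ s.k)⁻¹) (hφ s hs).cont.aestronglyMeasurable
      (ae_of_all _ fun y => ((hφ s hs).decay y).trans (w_le (two_zpow_pos _) _))
  have e1 : ((∑ s ∈ P, 2 ^ s.k * ‖a s‖ ^ 2 : ℝ) : ℂ) = ∫ y, f y * Φ y := by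
    simp_rw [hΦ, Finset.mul_sum]
    rw [integral_finsetSum]
    · push_cast
      refine Finset.sum_congr rfl fun s hs => ?_
      rw [show (fun y => f y * ((2:ℂ) ^ s.k * (starRingEnd ℂ) (a s) * φ s y)) =
        fun y => ((2:ℂ) ^ s.k * (starRingEnd ℂ) (a s)) * (f y * φ s y) by ext; ring,
        integral_const_mul]
      rw [mul_assoc]; congr 1
      rw [← Complex.ofReal_pow, ← Complex.normSq_eq_norm_sq, Complex.normSq_eq_conj_mul_self]
    · intro s hs
      rw [show (fun y => f y * ((2:ℂ) ^ s.k * (starRingEnd ℂ) (a s) * φ s y)) =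
        fun y => ((2:ℂ) ^ s.k * (starRingEnd ℂ) (a s)) * (f y * φ s y) by ext; ring]
      exact (hfφ s hs).const_mul _
  have hfΦ : Integrable (fun y => ‖f y‖ * ‖Φ y‖) :=
    hf.norm.mul_bdd (c := ∑ s ∈ P, ‖a s‖) hΦc.norm.aestronglyMeasurable
      (ae_of_all _ fun y => by simpa using hbd y)
  have e2 : ∑ s ∈ P, 2 ^ s.k * ‖a s‖ ^ 2 ≤ ∫ y, ‖f y‖ * ‖Φ y‖ := by
    calc _ ≤ ‖((∑ s ∈ P, 2 ^ s.k * ‖a s‖ ^ 2 : ℝ) : ℂ)‖ := by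
          rw [Complex.norm_real]; exact le_abs_self _
      _ ≤ ∫ y, ‖f y * Φ y‖ := by rw [e1]; exact norm_integral_le_integral_norm _
      _ = _ := by simp_rw [norm_mul]
  calc _ ≤ (∫ y, ‖f y‖ * ‖Φ y‖) ^ 2 := by
        gcongr
    _ ≤ _ := cauchy_schwarz hf2 hΦ2 hfΦ

/-- the off-diagonal version used below -/
lemma tt_star_off {f : ℝ → ℂ} (hf : Integrable f) (hf2 : Integrable (fun x => ‖f x‖ ^ 2))
    (P : Finset Tile) (φ : Tile → ℝ → ℂ) (hφ : ∀ s ∈ P, IsWP s (φ s)) (O : Tile → Finset Tile)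
    (hO : ∀ s ∈ P, O s ⊆ P.filter (fun s' => s'.k < s.k))
    (horth' : ∀ s ∈ P, ∀ s' ∈ P, s'.k < s.k → s' ∉ O s → Disjoint s.w1 s'.w1) :
    (∑ s ∈ P, 2 ^ s.k * ‖∫ y, f y * φ s y‖ ^ 2) ^ 2 ≤ (∫ x, ‖f x‖ ^ 2) *
      (2048 * π ^ 2 * (∑ s ∈ P, 2 ^ s.k * ‖∫ y, f y * φ s y‖ ^ 2) +
      256 * π * ∑ s ∈ P, ∑ s' ∈ O s,
        ‖∫ y, f y * φ s y‖ * ‖∫ y, f y * φ s' y‖ *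
          (2 ^ s.k * (2 ^ s'.k * w (2 ^ s.k) (s.c - s'.c)))) := by
  refine (tt_star hf hf2 P φ hφ).trans ?_
  have hz : ∀ s ∈ P, ∀ s' ∈ P, Disjoint s.w1 s'.w1 → ∀ a b : ℂ,
      ∫ y, (starRingEnd ℂ) (b * φ s' y) * (a * φ s y) = 0 := by
    intro s hs s' hs' hd a b
    rw [show (fun y => (starRingEnd ℂ) (b * φ s' y) * (a * φ s y)) =
      fun y => ((starRingEnd ℂ) b * a) * ((starRingEnd ℂ) (φ s' y) * φ s y) by
        ext y; rw [map_mul]; ring, integral_const_mul, (hφ s hs).orth (hφ s' hs') hd, mul_zero]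
  have := bessel_gen P (fun s y => ((2:ℂ) ^ s.k * (starRingEnd ℂ) (∫ y, f y * φ s y)) * φ s y)
    (fun s => ‖∫ y, f y * φ s y‖) (by
      intro s hs
      refine ⟨continuous_const.mul (hφ s hs).cont, norm_nonneg _, fun y => ?_⟩
      rw [norm_mul, norm_mul, RCLike.norm_conj, norm_zpow, Complex.norm_ofNat]
      have := (hφ s hs).decay y
      calc _ ≤ 2 ^ s.k * ‖∫ y, f y * φ s y‖ * w (2 ^ s.k) (y - s.c) := by gcongr
        _ = _ := by ring) O hO (by
      intro s hs s' hs' hk hl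
      apply hz s hs s' hs'
      rw [Tile.w1, Tile.w1, hk]; apply dy_disjoint; omega) (by
      intro s hs s' hs' hk hn
      exact hz s hs s' hs' (horth' s hs s' hs' hk hn) _ _)
  have h0 : 0 ≤ ∫ x, ‖f x‖ ^ 2 := integral_nonneg fun x => by positivity
  refine mul_le_mul_of_nonneg_left (this.trans (le_of_eq ?_)) h0
  congr 2
  exact Finset.sum_congr rfl fun s _ => mul_comm _ _

/-- Bessel inequality for 2-trees -/
lemma bessel_tree {f : ℝ → ℂ} (hf : Integrable f) (hf2 : Integrable (fun x => ‖f x‖ ^ 2))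
    (P : Finset Tile) (φ : Tile → ℝ → ℂ) (hφ : ∀ s ∈ P, IsWP s (φ s)) {ξ : ℝ}
    (hξ : ∀ s ∈ P, ξ ∈ s.w2) :
    ∑ s ∈ P, 2 ^ s.k * ‖∫ y, f y * φ s y‖ ^ 2 ≤ 2048 * π ^ 2 * ∫ x, ‖f x‖ ^ 2 := by
  have := tt_star_off hf hf2 P φ hφ (fun _ => ∅) (fun _ _ => Finset.empty_subset _)
    (fun s hs s' hs' hk _ => w1_disjoint_of_mem_w2 (hξ s hs) (hξ s' hs') hk.ne')
  simp only [Finset.sum_empty, Finset.sum_const_zero, mul_zero, add_zero] at this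
  set A := ∑ s ∈ P, 2 ^ s.k * ‖∫ y, f y * φ s y‖ ^ 2
  have hA : 0 ≤ A := Finset.sum_nonneg fun s _ => by positivity
  rcases hA.eq_or_lt with h | h
  · rw [← h]; have : 0 ≤ ∫ x, ‖f x‖ ^ 2 := integral_nonneg fun x => by positivity
    positivity
  · have h2 : A * A ≤ (2048 * π ^ 2 * ∫ x, ‖f x‖ ^ 2) * A := by nlinarith
    exact le_of_mul_le_mul_right h2 h

end CH

namespace CH

lemma sum_zpow_le (A : Finset ℤ) : ∀ K : ℤ, (∀ k ∈ A, k ≤ K) → ∑ k ∈ A, (2:ℝ) ^ k ≤ 2 * 2 ^ K := by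
  induction A using Finset.induction_on_max with
  | empty => intro K _; simp; positivity
  | insert a A h ih =>
    intro K hK
    rw [Finset.sum_insert (fun ha => lt_irrefl _ (h a ha))]
    have h1 := ih (a - 1) (fun k hk => by have := h k hk; omega)
    rw [zpow_sub_one₀ two_ne_zero] at h1
    have h2 : (2:ℝ) ^ a ≤ 2 ^ K := zpow_le_zpow_right₀ (by norm_num) (hK a (by simp))
    linarith

lemma tree_bdry_gen (T : Finset Tile) {kT : ℤ} {Y : Set ℝ} (hI : ∀ s ∈ T, s.I ⊆ Y)
    (hk : ∀ s ∈ T, s.k ≤ kT)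
    (hY : ∀ k : ℤ, ∫⁻ x in Y, ∫⁻ y in Yᶜ, W (2 ^ k) (x - y) ≤ ENNReal.ofReal (π * 2 ^ k))
    (hl : ∀ s ∈ T, ∀ t ∈ T, s.k = t.k → s.l = t.l) :
    ∑ s ∈ T, 2 ^ s.k * ∫ y in Yᶜ, w (2 ^ s.k) (s.c - y) ≤ 32 * π * 2 ^ kT := by
  classical
  set X := Yᶜ
  set G : ℤ → ℝ → ℝ≥0∞ := fun k x => ∫⁻ y in X, W (2 ^ k) (x - y) with hG
  have hnn : ∀ s : Tile, 0 ≤ 2 ^ s.k * ∫ y in X, w (2 ^ s.k) (s.c - y) := fun s =>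
    mul_nonneg (two_zpow_pos _).le (integral_nonneg fun y => w_nonneg (two_zpow_pos _) _)
  have h1 : ∀ s : Tile, ENNReal.ofReal (2 ^ s.k * ∫ y in X, w (2 ^ s.k) (s.c - y)) ≤
      ∫⁻ x in s.I, 16 * G s.k x := by
    intro s
    rw [ENNReal.ofReal_mul (two_zpow_pos _).le,
      ofReal_integral_eq_lintegral_ofReal (integrable_w_sub' (two_zpow_pos s.k) s.c).integrableOn
        (ae_of_all _ fun y => w_nonneg (two_zpow_pos _) _)]
    have : ENNReal.ofReal (2 ^ s.k) = volume s.I := (volume_dy _ _).symm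
    rw [this, mul_comm, ← setLIntegral_const]
    refine setLIntegral_mono' (measurableSet_I s) fun x hx => ?_
    rw [hG, ← lintegral_const_mul _ (by fun_prop)]
    refine lintegral_mono fun y => W_close (two_zpow_pos _) ?_
    rw [sub_sub_sub_cancel_right]; exact abs_sub_le_of_mem_dy (c_mem s) hx
  have h2 : ∀ k, ∑ s ∈ T.filter (fun s => s.k = k),
      ENNReal.ofReal (2 ^ s.k * ∫ y in X, w (2 ^ s.k) (s.c - y)) ≤ ENNReal.ofReal (16 * π * 2 ^ k) := by
    intro k
    calc _ ≤ ∑ s ∈ T.filter (fun s => s.k = k), ∫⁻ x in s.I, 16 * G k x := by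
          refine Finset.sum_le_sum fun s hs => ?_
          rw [← (Finset.mem_filter.1 hs).2]; exact h1 s
      _ = ∫⁻ x in ⋃ s ∈ T.filter (fun s => s.k = k), s.I, 16 * G k x := by
          rw [lintegral_biUnion_finset _ (fun s _ => measurableSet_I s)]
          intro s hs t ht hst
          simp only [Finset.coe_filter, mem_ofPred_eq] at hs ht
          have e1 : s.k = t.k := hs.2.trans ht.2.symm
          have e2 := hl s hs.1 t ht.1 e1
          simp only [Function.onFun]
          rw [Tile.I, Tile.I, e1]
          exact dy_disjoint fun hn => hst (Tile.ext e1 hn e2)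
      _ ≤ ∫⁻ x in Y, 16 * G k x :=
          lintegral_mono_set (iUnion₂_subset fun s hs => hI s (Finset.mem_filter.1 hs).1)
      _ = 16 * ∫⁻ x in Y, G k x := lintegral_const_mul' _ _ (by norm_num)
      _ ≤ 16 * ENNReal.ofReal (π * 2 ^ k) := by gcongr; exact hY k
      _ = _ := by
          rw [show (16:ℝ≥0∞) = ENNReal.ofReal 16 by norm_num, ← ENNReal.ofReal_mul (by norm_num)]
          congr 1; ring
  have h3 : ∀ k, ∑ s ∈ T.filter (fun s => s.k = k),
      2 ^ s.k * ∫ y in X, w (2 ^ s.k) (s.c - y) ≤ 16 * π * 2 ^ k := by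
    intro k
    have := h2 k
    rw [← ENNReal.ofReal_sum_of_nonneg (fun s _ => hnn s)] at this
    exact (ENNReal.ofReal_le_ofReal_iff (by positivity)).1 this
  rw [← Finset.sum_fiberwise_of_maps_to (t := T.image (fun s => s.k))
    (fun s hs => Finset.mem_image_of_mem _ hs)]
  calc _ ≤ ∑ k ∈ T.image (fun s => s.k), 16 * π * 2 ^ k := Finset.sum_le_sum fun k _ => h3 k
    _ = 16 * π * ∑ k ∈ T.image (fun s => s.k), (2:ℝ) ^ k := by rw [Finset.mul_sum]
    _ ≤ 16 * π * (2 * 2 ^ kT) := by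
        gcongr
        apply sum_zpow_le
        intro k hk'
        obtain ⟨s, hs, rfl⟩ := Finset.mem_image.1 hk'
        exact hk s hs
    _ = _ := by ring

lemma tree_bdry (T : Finset Tile) {kT nT : ℤ} (hI : ∀ s ∈ T, s.I ⊆ dy kT nT)
    (hl : ∀ s ∈ T, ∀ t ∈ T, s.k = t.k → s.l = t.l) :
    ∑ s ∈ T, 2 ^ s.k * ∫ y in (dy kT nT)ᶜ, w (2 ^ s.k) (s.c - y) ≤ 32 * π * 2 ^ kT :=
  tree_bdry_gen T hI (fun s hs => dy_scale_le_of_subset (hI s hs))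
    (fun k => lint_bdry _ _ (two_zpow_pos k)) hl

lemma tree_bdry_out (T : Finset Tile) {kT nT : ℤ} (hI : ∀ s ∈ T, Disjoint s.I (dy kT nT))
    (hk : ∀ s ∈ T, s.k ≤ kT)
    (hl : ∀ s ∈ T, ∀ t ∈ T, s.k = t.k → s.l = t.l) :
    ∑ s ∈ T, 2 ^ s.k * ∫ y in dy kT nT, w (2 ^ s.k) (s.c - y) ≤ 32 * π * 2 ^ kT := by
  have := tree_bdry_gen T (Y := (dy kT nT)ᶜ) (fun s hs => (hI s hs).subset_compl_right) hk ?_ hl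
  · rwa [compl_compl] at this
  · intro k
    rw [compl_compl, lintegral_lintegral_swap (by fun_prop)]
    simp_rw [W_sub_comm _ _ _]
    exact lint_bdry _ _ (two_zpow_pos k)

open Classical in
/-- the size condition -/
def SizeLE (P : Finset Tile) (f : ℝ → ℂ) (σ : ℝ) : Prop :=
  ∀ (kT nT : ℤ) (ξ : ℝ) (φ : Tile → ℝ → ℂ), (∀ s, IsWP s (φ s)) →
    ∑ s ∈ P.filter (fun s => s.I ⊆ dy kT nT ∧ ξ ∈ s.w2), 2 ^ s.k * ‖∫ y, f y * φ s y‖ ^ 2 ≤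
      σ ^ 2 * 2 ^ kT

lemma SizeLE.mono {P Q : Finset Tile} {f : ℝ → ℂ} {σ : ℝ} (h : SizeLE P f σ) (hQ : Q ⊆ P) :
    SizeLE Q f σ := by
  classical
  intro kT nT ξ φ hφ
  refine le_trans (Finset.sum_le_sum_of_subset_of_nonneg ?_ fun s _ _ => by positivity)
    (h kT nT ξ φ hφ)
  exact Finset.filter_subset_filter _ hQ

lemma left_mem_w2 (s : Tile) : ((8 * s.l + 4 : ℤ) : ℝ) * 2 ^ (-s.k - 3) ∈ s.w2 := left_mem_dy _ _

lemma SizeLE.single {P : Finset Tile} {f : ℝ → ℂ} {σ : ℝ} (hσ : 0 ≤ σ) (h : SizeLE P f σ)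
    {s : Tile} (hs : s ∈ P) {φ : ℝ → ℂ} (hφ : IsWP s φ) : ‖∫ y, f y * φ y‖ ≤ σ := by
  classical
  have h1 := h s.k s.n (((8 * s.l + 4 : ℤ) : ℝ) * 2 ^ (-s.k - 3)) (fun t => if t = s then φ else 0) (by
    intro t; split_ifs with h
    · rwa [h]
    · exact isWP_zero t)
  have h2 : 2 ^ s.k * ‖∫ y, f y * φ y‖ ^ 2 ≤ σ ^ 2 * 2 ^ s.k := by
    refine le_trans ?_ h1
    have hm : s ∈ P.filter (fun t => t.I ⊆ dy s.k s.n ∧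
      ((8 * s.l + 4 : ℤ) : ℝ) * 2 ^ (-s.k - 3) ∈ t.w2) :=
      Finset.mem_filter.2 ⟨hs, subset_rfl, left_mem_w2 s⟩
    refine le_trans (le_of_eq ?_) (Finset.single_le_sum (fun t _ => ?_) hm)
    · simp
    · positivity
  have h3 := two_zpow_pos s.k
  have h4 : ‖∫ y, f y * φ y‖ ^ 2 ≤ σ ^ 2 := by
    rw [mul_comm] at h2; exact le_of_mul_le_mul_right h2 h3
  exact abs_le_of_sq_le_sq' h4 hσ |>.2

structure Tr where
  T : Finset Tile
  R : Finset Tile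
  k : ℤ
  n : ℤ
  ξ : ℝ

/-- separation of selected trees -/
def Pr (t t' : Tr) : Prop :=
  ∀ s ∈ t.T, ∀ s' ∈ t'.T, s.Om ⊆ s'.w1 → Disjoint s'.I (dy t.k t.n)

open Classical in
/-- candidate violation -/
def VC (P : Finset Tile) (f : ℝ → ℂ) (σ : ℝ) (ξ : ℝ) : Prop :=
  (∃ s ∈ P, ξ = ((8 * s.l + 4 : ℤ) : ℝ) * 2 ^ (-s.k - 3)) ∧
  ∃ (kT nT : ℤ) (φ : Tile → ℝ → ℂ), (∀ s, IsWP s (φ s)) ∧ σ ^ 2 * 2 ^ kT <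
    ∑ s ∈ P.filter (fun s => s.I ⊆ dy kT nT ∧ ξ ∈ s.w2), 2 ^ s.k * ‖∫ y, f y * φ s y‖ ^ 2

lemma VC.mono {P Q : Finset Tile} {f : ℝ → ℂ} {σ ξ : ℝ} (h : VC Q f σ ξ) (hQ : Q ⊆ P) :
    VC P f σ ξ := by
  classical
  obtain ⟨⟨s, hs, e⟩, kT, nT, φ, hφ, hlt⟩ := h
  refine ⟨⟨s, hQ hs, e⟩, kT, nT, φ, hφ, hlt.trans_le ?_⟩
  exact Finset.sum_le_sum_of_subset_of_nonneg (Finset.filter_subset_filter _ hQ)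
    fun s _ _ => by positivity

lemma exists_VC {P : Finset Tile} {f : ℝ → ℂ} {σ : ℝ} (h : ¬ SizeLE P f σ) :
    ∃ ξ, VC P f σ ξ := by
  classical
  unfold SizeLE at h
  push Not at h
  obtain ⟨kT, nT, ξ, φ, hφ, hlt⟩ := h
  set S := P.filter (fun s => s.I ⊆ dy kT nT ∧ ξ ∈ s.w2) with hS
  have hne : S.Nonempty := by
    rw [Finset.nonempty_iff_ne_empty]; intro h0
    rw [h0, Finset.sum_empty] at hlt
    have := two_zpow_pos kT
    nlinarith [sq_nonneg σ, mul_nonneg (sq_nonneg σ) this.le]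
  obtain ⟨s, hs, hmax⟩ := Finset.exists_max_image S (fun s => s.k) hne
  have hs' := (Finset.mem_filter.1 hs)
  refine ⟨_, ⟨s, hs'.1, rfl⟩, kT, nT, φ, hφ, hlt.trans_le ?_⟩
  refine Finset.sum_le_sum_of_subset_of_nonneg ?_ fun s _ _ => by positivity
  intro t ht
  have ht' := (Finset.mem_filter.1 ht)
  refine Finset.mem_filter.2 ⟨ht'.1, ht'.2.1, ?_⟩
  exact w2_nested hs'.2.2 ht'.2.2 (hmax t ht) (left_mem_w2 s)

lemma exists_min_VC {P : Finset Tile} {f : ℝ → ℂ} {σ : ℝ} (h : ¬ SizeLE P f σ) :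
    ∃ ξ, VC P f σ ξ ∧ ∀ ξ', VC P f σ ξ' → ξ ≤ ξ' := by
  classical
  obtain ⟨ξ₀, h₀⟩ := exists_VC h
  set A := (P.image fun s => ((8 * s.l + 4 : ℤ) : ℝ) * 2 ^ (-s.k - 3)).filter (VC P f σ) with hA
  have hm : ∀ ξ, VC P f σ ξ → ξ ∈ A := by
    intro ξ hξ
    obtain ⟨s, hs, e⟩ := hξ.1
    exact Finset.mem_filter.2 ⟨Finset.mem_image.2 ⟨s, hs, e.symm⟩, hξ⟩
  obtain ⟨ξ, hξ, hmin⟩ := Finset.exists_min_image A id ⟨ξ₀, hm _ h₀⟩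
  exact ⟨ξ, (Finset.mem_filter.1 hξ).2, fun ξ' h' => hmin ξ' (hm _ h')⟩

lemma selection (f : ℝ → ℂ) (σ : ℝ) (N : ℕ) : ∀ P : Finset Tile, P.card ≤ N → TConvex P →
    ∃ (Q : Finset Tile) (L : List Tr) (φ : Tile → ℝ → ℂ), Q ⊆ P ∧ TConvex Q ∧ SizeLE Q f σ ∧
      (∀ s, IsWP s (φ s)) ∧
      (∀ s ∈ P, ∀ u ∈ P, s.Le u → u ∉ Q → s ∉ Q) ∧
      (∀ t ∈ L, t.R ⊆ P ∧ Disjoint t.R Q ∧ TConvex t.R ∧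
        (∀ s ∈ t.R, s.I ⊆ dy t.k t.n ∧ t.ξ ∈ s.Om)) ∧
      (∀ t ∈ L, t.T ⊆ t.R ∧ (∀ s ∈ t.T, t.ξ ∈ s.w2) ∧
        σ ^ 2 * 2 ^ t.k < ∑ s ∈ t.T, 2 ^ s.k * ‖∫ y, f y * φ s y‖ ^ 2 ∧ VC P f σ t.ξ) ∧
      L.Pairwise (fun t t' => Disjoint t.R t'.R ∧ Pr t t' ∧ Pr t' t) ∧
      (∀ F : Tile → ℂ, ∑ s ∈ P, F s = ∑ s ∈ Q, F s + (L.map fun t => ∑ s ∈ t.R, F s).sum) := by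
  classical
  induction N with
  | zero =>
    intro P hP hc
    have : P = ∅ := Finset.card_eq_zero.1 (Nat.le_zero.1 hP)
    subst this
    refine ⟨∅, [], fun _ => 0, subset_rfl, hc, ?_, fun s => isWP_zero s, by simp, by simp, by simp,
      by simp, by simp⟩
    intro kT nT ξ φ _
    simp; positivity
  | succ N ih =>
    intro P hP hc
    by_cases hsz : SizeLE P f σ
    · exact ⟨P, [], fun _ => 0, subset_rfl, hc, hsz, fun s => isWP_zero s, fun s hs u hu _ h => absurd hu h,
        by simp, by simp, by simp, by simp⟩
    obtain ⟨ξ, ⟨hξ1, k, n, φ₀, hφ₀, hlt⟩, hmin⟩ := exists_min_VC hsz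
    set T := P.filter (fun s => s.I ⊆ dy k n ∧ ξ ∈ s.w2) with hT
    set R := P.filter (fun s => s.I ⊆ dy k n ∧ ξ ∈ s.Om) with hR
    have hTR : T ⊆ R := by
      intro s hs
      have := Finset.mem_filter.1 hs
      exact Finset.mem_filter.2 ⟨this.1, this.2.1, w2_subset s this.2.2⟩
    have hTne : T.Nonempty := by
      rw [Finset.nonempty_iff_ne_empty]; intro h0
      rw [h0, Finset.sum_empty] at hlt
      have := two_zpow_pos k
      nlinarith [sq_nonneg σ, mul_nonneg (sq_nonneg σ) this.le]
    have hRP : R ⊆ P := Finset.filter_subset _ _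
    have hdown : ∀ s ∈ P, ∀ u ∈ R, s.Le u → s ∈ R := by
      intro s hs u hu hsu
      have hu' := (Finset.mem_filter.1 hu).2
      exact Finset.mem_filter.2 ⟨hs, hsu.1.trans hu'.1, hsu.2 hu'.2⟩
    have hcR : TConvex R := by
      intro s hs u hu t hst htu
      exact hdown t (hc s (hRP hs) u (hRP hu) t hst htu) u hu htu
    have hcP' : TConvex (P \ R) := by
      intro s hs u hu t hst htu
      rw [Finset.mem_sdiff] at hs hu ⊢
      have ht := hc s hs.1 u hu.1 t hst htu
      exact ⟨ht, fun h => hs.2 (hdown s hs.1 t h hst)⟩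
    have hcard : (P \ R).card ≤ N := by
      have h1 : (P \ R).card < P.card := Finset.card_lt_card
        (Finset.sdiff_ssubset hRP (hTne.mono hTR))
      omega
    obtain ⟨Q, L, φ₁, hQ, hQc, hQs, hφ₁, hup, hL1, hL2, hpw, hsum⟩ := ih _ hcard hcP'
    have hdQ : Disjoint R Q := (Finset.disjoint_sdiff).mono_right hQ
    refine ⟨Q, ⟨T, R, k, n, ξ⟩ :: L, fun s => if s ∈ R then φ₀ s else φ₁ s,
      hQ.trans Finset.sdiff_subset, hQc, hQs, ?_, ?_, ?_, ?_, ?_, ?_⟩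
    · intro s; dsimp only; split_ifs
      · exact hφ₀ s
      · exact hφ₁ s
    · intro s hs u hu hsu huQ hsQ
      have hsR : s ∉ R := (Finset.mem_sdiff.1 (hQ hsQ)).2
      by_cases huR : u ∈ R
      · exact hsR (hdown s hs u huR hsu)
      · exact hup s (Finset.mem_sdiff.2 ⟨hs, hsR⟩) u (Finset.mem_sdiff.2 ⟨hu, huR⟩) hsu huQ hsQ
    · intro t ht
      rcases List.mem_cons.1 ht with rfl | ht
      · exact ⟨hRP, hdQ, hcR, fun s hs => (Finset.mem_filter.1 hs).2⟩
      · have := hL1 t ht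
        exact ⟨this.1.trans Finset.sdiff_subset, this.2⟩
    · intro t ht
      rcases List.mem_cons.1 ht with rfl | ht
      · refine ⟨hTR, fun s hs => (Finset.mem_filter.1 hs).2.2, ?_, hξ1, k, n, φ₀, hφ₀, hlt⟩
        refine hlt.trans_le (le_of_eq (Finset.sum_congr rfl fun s hs => ?_))
        simp only [hTR hs, if_true]
      · obtain ⟨a1, a2, a3, a4⟩ := hL2 t ht
        refine ⟨a1, a2, ?_, a4.mono Finset.sdiff_subset⟩
        refine a3.trans_le (le_of_eq (Finset.sum_congr rfl fun s hs => ?_))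
        have : s ∉ R := (Finset.mem_sdiff.1 ((hL1 t ht).1 (a1 hs))).2
        simp only [this, if_false]
    · refine List.pairwise_cons.2 ⟨fun t' ht' => ⟨?_, ?_, ?_⟩, hpw⟩
      · exact Finset.disjoint_sdiff.mono_right (hL1 t' ht').1
      · intro s hs s' hs' hsub
        simp only at hs ⊢
        have hs'2 := (Finset.mem_sdiff.1 ((hL1 t' ht').1 ((hL2 t' ht').1 hs')))
        have hs2 := (Finset.mem_filter.1 hs).2
        have hsub' : s.Om ⊆ s'.Om := hsub.trans (w1_subset s')
        have hk : s'.k < s.k := by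
          have : -s.k ≤ -s'.k - 1 := dy_scale_le_of_subset hsub
          omega
        have hk2 : s.k ≤ k := dy_scale_le_of_subset hs2.1
        rcases dy_disjoint_or_subset (k := s'.k) (n := s'.n) (k' := k) (n' := n) (by omega) with h | h
        · exact h
        · exact absurd (Finset.mem_filter.2 ⟨hs'2.1, h, hsub' (w2_subset s hs2.2)⟩) hs'2.2
      · intro s hs s' hs' hsub
        exfalso
        simp only at hs'
        have h1 : t'.ξ ∈ s'.w1 := hsub (w2_subset s ((hL2 t' ht').2.1 s hs))
        have h2 : ξ ∈ s'.w2 := (Finset.mem_filter.1 hs').2.2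
        have h3 := w1_lt_w2 h1 h2
        have h4 := hmin t'.ξ ((hL2 t' ht').2.2.2.mono Finset.sdiff_subset)
        linarith
    · intro F
      rw [List.map_cons, List.sum_cons, ← Finset.sum_sdiff hRP, hsum F]
      ring

lemma size_lemma : ∃ C : ℝ, 0 < C ∧ ∀ (P : Finset Tile) (f : ℝ → ℂ) (σ : ℝ), Integrable f →
    Integrable (fun x => ‖f x‖ ^ 2) → 0 < σ → TConvex P → SizeLE P f σ →
    ∃ (Q : Finset Tile) (L : List Tr), Q ⊆ P ∧ TConvex Q ∧
      (∀ s ∈ P, ∀ u ∈ P, s.Le u → u ∉ Q → s ∉ Q) ∧ SizeLE Q f (σ / 2) ∧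
      (∀ t ∈ L, t.R ⊆ P ∧ Disjoint t.R Q ∧ TConvex t.R ∧
        (∀ s ∈ t.R, s.I ⊆ dy t.k t.n ∧ t.ξ ∈ s.Om)) ∧
      (∀ F : Tile → ℂ, ∑ s ∈ P, F s = ∑ s ∈ Q, F s + (L.map fun t => ∑ s ∈ t.R, F s).sum) ∧
      σ ^ 2 * (L.map fun t => (2:ℝ) ^ t.k).sum ≤ C * ∫ x, ‖f x‖ ^ 2 := by
  classical
  refine ⟨4 * (2048 * π ^ 2 + 4 * (256 * π * (512 * π))), by positivity, ?_⟩
  intro P f σ hf hf2 hσ hP hsz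
  obtain ⟨Q, L, φ, hQ, hQc, hQs, hφ, hup, hL1, hL2, hpw, hsum⟩ := selection f (σ / 2) _ P le_rfl hP
  refine ⟨Q, L, hQ, hQc, hup, hQs, hL1, hsum, ?_⟩
  have hne : ∀ t ∈ L, t.R.Nonempty := by
    intro t ht
    obtain ⟨h1, -, h2, -⟩ := hL2 t ht
    refine Finset.Nonempty.mono h1 ?_
    rw [Finset.nonempty_iff_ne_empty]; intro h0
    rw [h0, Finset.sum_empty] at h2
    have : 0 ≤ (σ / 2) ^ 2 * 2 ^ t.k := by positivity
    linarith
  have hnd : L.Nodup := hpw.imp_of_mem fun {a b} ha _ h => by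
    rintro rfl
    exact (hne a ha).ne_empty (Finset.disjoint_self_iff_empty _ |>.1 h.1)
  haveI : Std.Symm (fun t t' : Tr => Disjoint t.R t'.R ∧ Pr t t' ∧ Pr t' t) :=
    ⟨fun a b h => ⟨h.1.symm, h.2.2, h.2.1⟩⟩
  have hpw2 := fun {a b : Tr} => hpw.forall (a := a) (b := b)
  set A := L.toFinset with hA
  have memA : ∀ t, t ∈ A ↔ t ∈ L := fun t => List.mem_toFinset
  have hPr : ∀ t ∈ A, ∀ t' ∈ A, Pr t t' := by
    intro t ht t' ht'
    by_cases h : t = t'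
    · subst h
      intro s hs s' hs' hsub
      have h1 := (hL2 t ((memA t).1 ht)).2.1
      exact absurd (w1_lt_w2 (hsub (w2_subset s (h1 s hs))) (h1 s' hs')) (lt_irrefl _)
    · exact (hpw2 ((memA t).1 ht) ((memA t').1 ht') h).2.1
  rw [← List.sum_toFinset _ hnd, ← hA]
  set U := A.biUnion (fun t => t.T) with hU
  have hUP : U ⊆ P := by
    intro s hs
    obtain ⟨t, ht, hst⟩ := Finset.mem_biUnion.1 hs
    exact (hL1 t ((memA t).1 ht)).1 ((hL2 t ((memA t).1 ht)).1 hst)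
  have hdisj : (A : Set Tr).PairwiseDisjoint (fun t => t.T) := by
    intro t ht t' ht' hne
    have ht := (memA t).1 ht
    have ht' := (memA t').1 ht'
    exact (hpw2 ht ht' hne).1.mono (hL2 t ht).1 (hL2 t' ht').1
  set a : Tile → ℝ := fun s => ‖∫ y, f y * φ s y‖ with ha
  have haσ : ∀ s ∈ U, a s ≤ σ := fun s hs => hsz.single hσ.le (hUP hs) (hφ s)
  set B := ∑ s ∈ U, 2 ^ s.k * a s ^ 2 with hB
  have hB1 : (σ / 2) ^ 2 * ∑ t ∈ A, (2:ℝ) ^ t.k ≤ B := by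
    rw [hB, hU, Finset.sum_biUnion hdisj, Finset.mul_sum]
    exact Finset.sum_le_sum fun t ht => (hL2 t ((memA t).1 ht)).2.2.1.le
  set O : Tile → Finset Tile := fun s => U.filter (fun s' => s'.k < s.k ∧ s.Om ⊆ s'.w1) with hO
  have htt := tt_star_off hf hf2 U φ (fun s _ => hφ s) O
    (fun s _ s' hs' => by
      have := Finset.mem_filter.1 hs'
      exact Finset.mem_filter.2 ⟨this.1, this.2.1⟩)
    (fun s hs s' hs' hk hn => by
      rw [Set.disjoint_left]
      intro x hx hx'
      exact hn (Finset.mem_filter.2 ⟨hs', hk, Om_subset_w1 hk (w1_subset s hx) hx'⟩))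
  have hoff : ∑ s ∈ U, ∑ s' ∈ O s, a s * a s' * (2 ^ s.k * (2 ^ s'.k * w (2 ^ s.k) (s.c - s'.c))) ≤
      512 * π * σ ^ 2 * ∑ t ∈ A, (2:ℝ) ^ t.k := by
    rw [hU, Finset.sum_biUnion hdisj, Finset.mul_sum]
    refine Finset.sum_le_sum fun t ht => ?_
    have htL := (memA t).1 ht
    calc ∑ s ∈ t.T, ∑ s' ∈ O s, a s * a s' * (2 ^ s.k * (2 ^ s'.k * w (2 ^ s.k) (s.c - s'.c)))
        ≤ ∑ s ∈ t.T, σ ^ 2 * (16 * (2 ^ s.k * ∫ y in (dy t.k t.n)ᶜ, w (2 ^ s.k) (s.c - y))) := by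
          refine Finset.sum_le_sum fun s hs => ?_
          have hsU : s ∈ U := Finset.mem_biUnion.2 ⟨t, ht, hs⟩
          have hsm := sum_w_le (O s) (by
            have key : ∀ u ∈ O s, ∀ v ∈ O s, u.k < v.k → Disjoint u.I v.I := by
              intro u hu v hv huv
              obtain ⟨huU, hu1, hu2⟩ := Finset.mem_filter.1 hu
              obtain ⟨hvU, hv1, hv2⟩ := Finset.mem_filter.1 hv
              obtain ⟨t1, ht1, hut⟩ := Finset.mem_biUnion.1 huU
              obtain ⟨t2, ht2, hvt⟩ := Finset.mem_biUnion.1 hvU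
              have hx := left_mem_dy (-s.k) s.l
              have := hPr t2 ht2 t1 ht1 v hvt u hut
                (Om_subset_w1 huv (w1_subset v (hv2 hx)) (hu2 hx))
              have hvL := (memA t2).1 ht2
              exact this.mono_right ((hL1 t2 hvL).2.2.2 v ((hL2 t2 hvL).1 hvt)).1
            intro u hu v hv huv
            rcases lt_trichotomy u.k v.k with h | h | h
            · exact key u hu v hv h
            · obtain ⟨huU, hu1, hu2⟩ := Finset.mem_filter.1 hu
              obtain ⟨hvU, hv1, hv2⟩ := Finset.mem_filter.1 hv
              have hx := left_mem_dy (-s.k) s.l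
              have e1 := hu2 hx
              have e2 := hv2 hx
              rw [Tile.w1, h] at e1
              have e3 := dy_eq_of_mem e1 e2
              rw [Tile.I, Tile.I, h]
              exact dy_disjoint fun hn => huv (Tile.ext h hn (by omega))
            · exact (key v hv u hu h).symm) (X := (dy t.k t.n)ᶜ) (by
              intro u hu
              obtain ⟨huU, hu1, hu2⟩ := Finset.mem_filter.1 hu
              obtain ⟨t1, ht1, hut⟩ := Finset.mem_biUnion.1 huU
              exact Set.subset_compl_iff_disjoint_right.2 (hPr t ht t1 ht1 s hs u hut hu2))
            (measurableSet_dy _ _).compl (k := s.k)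
            (fun u hu => (Finset.mem_filter.1 hu).2.1.le) s.c
          calc ∑ s' ∈ O s, a s * a s' * (2 ^ s.k * (2 ^ s'.k * w (2 ^ s.k) (s.c - s'.c)))
              ≤ ∑ s' ∈ O s, σ * σ * (2 ^ s.k * (2 ^ s'.k * w (2 ^ s.k) (s.c - s'.c))) := by
                refine Finset.sum_le_sum fun s' hs' => ?_
                have p1 := haσ s hsU
                have p2 := haσ s' (Finset.mem_filter.1 hs').1
                have p3 := w_nonneg (two_zpow_pos s.k) (s.c - s'.c)
                have p4 : 0 ≤ a s' := norm_nonneg _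
                gcongr
            _ = σ ^ 2 * (2 ^ s.k * ∑ s' ∈ O s, 2 ^ s'.k * w (2 ^ s.k) (s.c - s'.c)) := by
                rw [← Finset.mul_sum, ← Finset.mul_sum]; ring
            _ ≤ σ ^ 2 * (2 ^ s.k * (16 * ∫ y in (dy t.k t.n)ᶜ, w (2 ^ s.k) (s.c - y))) := by
                gcongr
            _ = _ := by ring
      _ = 16 * σ ^ 2 * ∑ s ∈ t.T, (2 ^ s.k * ∫ y in (dy t.k t.n)ᶜ, w (2 ^ s.k) (s.c - y)) := by
          rw [Finset.mul_sum]; refine Finset.sum_congr rfl fun s _ => by ring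
      _ ≤ 16 * σ ^ 2 * (32 * π * 2 ^ t.k) := by
          gcongr
          refine tree_bdry t.T (fun s hs => ((hL1 t htL).2.2.2 s ((hL2 t htL).1 hs)).1) ?_
          intro s hs u hu hk
          have e1 := w2_subset _ ((hL2 t htL).2.1 s hs)
          have e2 := w2_subset _ ((hL2 t htL).2.1 u hu)
          rw [Tile.Om, hk] at e1
          exact dy_eq_of_mem e1 e2
      _ = _ := by ring
  set S := ∑ t ∈ A, (2:ℝ) ^ t.k with hS
  set F := ∫ x, ‖f x‖ ^ 2 with hF
  have hF0 : 0 ≤ F := integral_nonneg fun x => by positivity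
  have hB0 : 0 ≤ B := Finset.sum_nonneg fun s _ => by positivity
  have h1 : B ^ 2 ≤ F * ((2048 * π ^ 2 + 4 * (256 * π * (512 * π))) * B) := by
    refine htt.trans (mul_le_mul_of_nonneg_left ?_ hF0)
    have h2 : 256 * π * (512 * π * σ ^ 2 * S) ≤ 256 * π * (512 * π) * (4 * B) := by
      have : σ ^ 2 * S ≤ 4 * B := by nlinarith
      calc _ = 256 * π * (512 * π) * (σ ^ 2 * S) := by ring
        _ ≤ _ := by gcongr
    have h3 := mul_le_mul_of_nonneg_left hoff (by positivity : 0 ≤ 256 * π)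
    linarith
  have h2 : B ≤ (2048 * π ^ 2 + 4 * (256 * π * (512 * π))) * F := by
    rcases hB0.eq_or_lt with h | h
    · rw [← h]; positivity
    · refine le_of_mul_le_mul_right ?_ h
      linarith
  linarith

end CH

namespace CH

lemma norm_e_sub_one (t : ℝ) : ‖e t - 1‖ ≤ 2 * π * |t| := by
  unfold e
  rw [mul_comm]
  refine (Real.norm_exp_I_mul_ofReal_sub_one_le).trans (le_of_eq ?_)
  rw [Real.norm_eq_abs, abs_mul, abs_of_pos (by positivity : 0 < 2 * π)]

lemma norm_e_sub (a b : ℝ) : ‖e a - e b‖ ≤ 2 * π * |a - b| := by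
  have : e a - e b = e b * (e (a - b) - 1) := by
    rw [mul_sub, ← e_add]; simp
  rw [this, norm_mul, norm_e, one_mul]; exact norm_e_sub_one _

/-- an admissible kernel -/
structure Krn (G : ℝ → ℂ) (g : ℝ → ℝ) (A : ℝ) : Prop where
  cont : Continuous G
  pos : 0 < A
  four : ∀ u, 𝓕 G u = (g (-u) : ℂ)
  decay : ∀ z, (1 + |z|) * ‖G z‖ ≤ A * v z
  lip : ∀ z z', |z - z'| ≤ 1 → (1 + |z|) * ‖G z - G z'‖ ≤ A * (|z - z'| * v z)
  decay2 : ∀ z, ‖G z‖ ≤ A * v z ^ 2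

lemma one_add_abs_pow_le (z : ℝ) {x a : ℝ} (h : (1 + |z|) ^ 5 * x ≤ a) (ha : 0 ≤ a) :
    (1 + |z|) * x ≤ a * v z := by
  unfold v
  rw [← div_eq_mul_inv, le_div_iff₀ (by positivity)]
  have h1 : 1 + z ^ 2 ≤ (1 + |z|) ^ 2 := by rw [← sq_abs]; nlinarith [abs_nonneg z]
  have h2 : (1 + z ^ 2) ^ 2 ≤ (1 + |z|) ^ 4 := by
    calc _ ≤ ((1 + |z|) ^ 2) ^ 2 := by gcongr
      _ = _ := by ring
  rcases le_or_gt 0 x with hx | hx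
  · calc (1 + |z|) * x * (1 + z ^ 2) ^ 2 ≤ (1 + |z|) * x * (1 + |z|) ^ 4 := by gcongr
      _ = (1 + |z|) ^ 5 * x := by ring
      _ ≤ a := h
  · have : (1 + |z|) * x * (1 + z ^ 2) ^ 2 ≤ 0 := by
      have : 0 ≤ (1 + |z|) * (1 + z ^ 2) ^ 2 := by positivity
      nlinarith
    linarith

lemma exists_krn {g : ℝ → ℝ} (hg : ContDiff ℝ ((⊤ : ℕ∞) : WithTop ℕ∞) g)
    (hc : HasCompactSupport g) : ∃ (G : ℝ → ℂ) (A : ℝ), Krn G g A := by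
  have hc' : HasCompactSupport (fun u : ℝ => ((g (-u) : ℝ) : ℂ)) := by
    have h1 : HasCompactSupport (fun u : ℝ => g (-u)) := hc.comp_homeomorph (Homeomorph.neg ℝ)
    exact h1.comp_left (g := fun x : ℝ => (x : ℂ)) (by simp)
  have hg' : ContDiff ℝ ((⊤ : ℕ∞) : WithTop ℕ∞) (fun u : ℝ => ((g (-u) : ℝ) : ℂ)) :=
    Complex.ofRealCLM.contDiff.comp (hg.comp contDiff_neg)
  set h : SchwartzMap ℝ ℂ := hc'.toSchwartzMap hg' with hh
  set G : SchwartzMap ℝ ℂ := 𝓕⁻ h with hG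
  have b0 := fun z => SchwartzMap.one_add_le_sup_seminorm_apply (𝕜 := ℝ) (m := (5, 1)) (k := 5) (n := 0)
    le_rfl (by norm_num) G z
  have b1 := fun z => SchwartzMap.one_add_le_sup_seminorm_apply (𝕜 := ℝ) (m := (5, 1)) (k := 5) (n := 1)
    le_rfl le_rfl G z
  set M := 2 ^ ((5 : ℕ), (1 : ℕ)).1 * (Finset.Iic ((5 : ℕ), (1 : ℕ))).sup
    (fun m => SchwartzMap.seminorm ℝ m.1 m.2) G with hM
  have hM0 : 0 ≤ M := le_trans (by positivity) (b0 0)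
  have b2 := fun z => SchwartzMap.one_add_le_sup_seminorm_apply (𝕜 := ℝ) (m := (8, 1)) (k := 8) (n := 0)
    le_rfl (by norm_num) G z
  set M2 := 2 ^ ((8 : ℕ), (1 : ℕ)).1 * (Finset.Iic ((8 : ℕ), (1 : ℕ))).sup
    (fun m => SchwartzMap.seminorm ℝ m.1 m.2) G with hM2
  have hM20 : 0 ≤ M2 := le_trans (by positivity) (b2 0)
  refine ⟨G, 32 * M + 1 + M2, G.continuous, by positivity, ?_, ?_, ?_, ?_⟩
  · intro u
    rw [← SchwartzMap.fourier_coe, hG, FourierTransform.fourier_fourierInv_eq]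
    rfl
  · intro z
    apply one_add_abs_pow_le z _ (by positivity)
    have := b0 z
    rw [norm_iteratedFDeriv_zero] at this
    rw [Real.norm_eq_abs] at this
    linarith
  · intro z z' hzz
    rw [← mul_assoc, mul_comm _ (|z - z'|), mul_assoc, mul_comm (|z - z'|)]
    have hd : ∀ t, |z - t| ≤ 1 → (1 + |z|) ^ 5 * ‖deriv G t‖ ≤ 32 * M := by
      intro t ht
      have := b1 t
      rw [norm_iteratedFDeriv_one, ← norm_deriv_eq_norm_fderiv, Real.norm_eq_abs] at this
      have h2 : 1 + |z| ≤ 2 * (1 + |t|) := by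
        have := abs_sub_abs_le_abs_sub z t
        have := abs_nonneg t
        linarith
      calc (1 + |z|) ^ 5 * ‖deriv G t‖ ≤ (2 * (1 + |t|)) ^ 5 * ‖deriv G t‖ := by gcongr
        _ = 32 * ((1 + |t|) ^ 5 * ‖deriv G t‖) := by ring
        _ ≤ _ := by gcongr
    have hmv : ‖G z' - G z‖ ≤ (32 * M / (1 + |z|) ^ 5) * ‖z' - z‖ := by
      apply Convex.norm_image_sub_le_of_norm_deriv_le (s := uIcc z z')
        (fun t _ => G.differentiableAt) _ (convex_uIcc z z') left_mem_uIcc right_mem_uIcc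
      intro t ht
      rw [le_div_iff₀ (by positivity), mul_comm]
      apply hd
      have := abs_sub_left_of_mem_uIcc ht
      rw [abs_sub_comm]; rw [abs_sub_comm z' z] at this; exact this.trans hzz
    rw [norm_sub_rev, Real.norm_eq_abs, abs_sub_comm z' z] at hmv
    have h3 : (1 + |z|) ^ 5 * ‖G z - G z'‖ ≤ 32 * M * |z - z'| := by
      calc _ ≤ (1 + |z|) ^ 5 * ((32 * M / (1 + |z|) ^ 5) * |z - z'|) := by gcongr
        _ = _ := by field_simp
    refine (one_add_abs_pow_le z h3 (by positivity)).trans ?_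
    have := v_pos z
    have := abs_nonneg (z - z')
    have : 0 ≤ v z * |z - z'| := by positivity
    nlinarith
  · intro z
    have := b2 z
    rw [norm_iteratedFDeriv_zero, Real.norm_eq_abs] at this
    unfold v
    rw [inv_pow, ← div_eq_mul_inv, le_div_iff₀ (by positivity)]
    have h1 : 1 + z ^ 2 ≤ (1 + |z|) ^ 2 := by rw [← sq_abs]; nlinarith [abs_nonneg z]
    calc ‖G z‖ * ((1 + z ^ 2) ^ 2) ^ 2 ≤ ‖G z‖ * (((1 + |z|) ^ 2) ^ 2) ^ 2 := by gcongr
      _ = (1 + |z|) ^ 8 * ‖G z‖ := by ring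
      _ ≤ _ := by linarith

/-- scaled modulated kernel -/
noncomputable def kn (G : ℝ → ℂ) (k : ℤ) (N : ℝ) (z : ℝ) : ℂ :=
  (((2:ℝ) ^ (-k) : ℝ) : ℂ) * G (2 ^ (-k) * z) * e (N * z)

lemma norm_kn (G : ℝ → ℂ) (k : ℤ) (N z : ℝ) : ‖kn G k N z‖ = 2 ^ (-k) * ‖G (2 ^ (-k) * z)‖ := by
  unfold kn
  rw [norm_mul, norm_e, mul_one, norm_mul, Complex.norm_real, Real.norm_of_nonneg (two_zpow_pos _).le]

lemma w_zpow (k : ℤ) (z : ℝ) : w (2 ^ k) z = 2 ^ (-k) * v (2 ^ (-k) * z) := by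
  rw [w, zpow_neg]

section
variable {G : ℝ → ℂ} {g : ℝ → ℝ} {A : ℝ}

lemma Krn.bound (h : Krn G g A) (z : ℝ) : ‖G z‖ ≤ A * v z :=
  le_trans (le_mul_of_one_le_left (norm_nonneg _) (by linarith [abs_nonneg z])) (h.decay z)

lemma Krn.kn_cont (h : Krn G g A) (k : ℤ) (N : ℝ) : Continuous (kn G k N) := by
  have := h.cont
  unfold kn; fun_prop

lemma Krn.kn_decay (h : Krn G g A) (k : ℤ) (N z : ℝ) : ‖kn G k N z‖ ≤ A * w (2 ^ k) z := by
  rw [norm_kn, w_zpow]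
  have := h.bound (2 ^ (-k) * z)
  calc _ ≤ 2 ^ (-k) * (A * v (2 ^ (-k) * z)) := by gcongr
    _ = _ := by ring

lemma Krn.kn_bdd (h : Krn G g A) (k : ℤ) (N z : ℝ) : ‖kn G k N z‖ ≤ A * (2 ^ k)⁻¹ :=
  (h.kn_decay k N z).trans (mul_le_mul_of_nonneg_left (w_le (two_zpow_pos k) z) h.pos.le)

lemma Krn.kn_integrable (h : Krn G g A) (k : ℤ) (N : ℝ) : Integrable (kn G k N) :=
  Integrable.mono' ((integrable_w (two_zpow_pos k)).const_mul A) (h.kn_cont k N).aestronglyMeasurable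
    (ae_of_all _ (h.kn_decay k N))

lemma Krn.kn_four (h : Krn G g A) (k : ℤ) (N η : ℝ) : 𝓕 (kn G k N) η = (g (2 ^ k * (N - η)) : ℂ) := by
  have h1 := h.four (2 ^ k * (η - N))
  rw [show -(2 ^ k * (η - N)) = 2 ^ k * (N - η) by ring] at h1
  rw [← h1, fourier_eq_e, fourier_eq_e]
  have hp := two_zpow_pos (-k)
  have h2 := Measure.integral_comp_mul_left (fun y => e (-(y * (2 ^ k * (η - N)))) * G y) ((2:ℝ) ^ (-k))
  rw [abs_of_pos (by positivity), ← zpow_neg, neg_neg] at h2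
  have h3 : ∫ y, e (-(y * (2 ^ k * (η - N)))) * G y = (2:ℝ) ^ (-k) •
      ∫ x, e (-(2 ^ (-k) * x * (2 ^ k * (η - N)))) * G (2 ^ (-k) * x) := by
    rw [h2, smul_smul, zpow_neg, inv_mul_cancel₀ (two_zpow_pos k).ne', one_smul]
  rw [h3, ← integral_smul]
  congr 1; ext y
  unfold kn
  rw [Complex.real_smul]
  have : (2:ℝ) ^ (-k) * y * (2 ^ k * (η - N)) = y * η - N * y := by
    rw [zpow_neg]; field_simp
  rw [this, show -(y * η - N * y) = -(y * η) + N * y by ring, e_add]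
  ring

end

/-- wave packets from profiles -/
lemma isWP_of_profile (s : Tile) (x : ℝ) {Φ : ℝ → ℂ} {N B : ℝ} (hB : 0 < B) (hN : N ∈ s.Om)
    (hc : Continuous Φ) (hd : ∀ z, ‖Φ z‖ ≤ B * v z)
    (hl : ∀ z z', |z - z'| ≤ 1 → ‖Φ z - Φ z'‖ ≤ B * (|z - z'| * v z))
    (hs : ∀ η, 𝓕 (kn Φ s.k N) η ≠ 0 → η ∈ s.w1) :
    IsWP s (fun y => ((v (2 ^ (-s.k) * (x - s.c)) / (32 * B) : ℝ) : ℂ) * kn Φ s.k N (x - y)) := by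
  set a := v (2 ^ (-s.k) * (x - s.c)) / (32 * B) with ha
  have ha0 : 0 < a := by have := v_pos (2 ^ (-s.k) * (x - s.c)); positivity
  have hp := two_zpow_pos (-s.k)
  have hva : ∀ y, a * (8 * B * (2 ^ (-s.k) * v (2 ^ (-s.k) * (x - y)))) ≤ w (2 ^ s.k) (y - s.c) := by
    intro y
    rw [w_zpow]
    have h1 := v_mul_le (2 ^ (-s.k) * (x - s.c)) (-(2 ^ (-s.k) * (x - y)))
    rw [v_neg, show 2 ^ (-s.k) * (x - s.c) + -(2 ^ (-s.k) * (x - y)) = 2 ^ (-s.k) * (y - s.c) by ring]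
      at h1
    have h2 : a * (8 * B * (2 ^ (-s.k) * v (2 ^ (-s.k) * (x - y)))) =
      2 ^ (-s.k) * ((v (2 ^ (-s.k) * (x - s.c)) * v (2 ^ (-s.k) * (x - y))) / 4) := by
      rw [ha]; field_simp; ring
    rw [h2]
    gcongr
    linarith
  have hnk : ∀ z, ‖kn Φ s.k N z‖ ≤ B * (2 ^ (-s.k) * v (2 ^ (-s.k) * z)) := by
    intro z
    rw [norm_kn]
    have := hd (2 ^ (-s.k) * z)
    calc _ ≤ 2 ^ (-s.k) * (B * v (2 ^ (-s.k) * z)) := by gcongr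
      _ = _ := by ring
  refine ⟨?_, ?_, ?_, ?_⟩
  · unfold kn; fun_prop
  · intro η hη
    apply hs
    intro h0
    apply hη
    have := fourier_comp_sub (fun y => (a:ℂ) * kn Φ s.k N y) x η
    rw [this]
    have h2 : 𝓕 (fun y => (a:ℂ) * kn Φ s.k N y) (-η) = (a:ℂ) * 𝓕 (kn Φ s.k N) (-η) := by
      rw [fourier_eq_e, fourier_eq_e, ← integral_const_mul]
      congr 1; ext y; ring
    rw [h2, h0]; simp
  · intro y
    rw [norm_mul, Complex.norm_real, Real.norm_of_nonneg ha0.le]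
    refine le_trans ?_ (hva y)
    gcongr
    refine (hnk _).trans ?_
    have : 0 ≤ 2 ^ (-s.k) * v (2 ^ (-s.k) * (x - y)) := by
      have := v_pos (2 ^ (-s.k) * (x - y)); positivity
    nlinarith
  · intro ν hν y z hyz
    set u := 2 ^ (-s.k) * (x - y) with hu
    set u' := 2 ^ (-s.k) * (x - z) with hu'
    have huu : |u - u'| = 2 ^ (-s.k) * |y - z| := by
      rw [hu, hu', ← mul_sub, abs_mul, abs_of_pos hp, sub_sub_sub_cancel_left, abs_sub_comm]
    have huu1 : |u - u'| ≤ 1 := by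
      rw [huu, zpow_neg, inv_mul_le_iff₀ (two_zpow_pos _), mul_one]; exact hyz
    set α := 2 ^ s.k * (N - ν) with hα
    have hα1 : |α| ≤ 1 := by
      rw [hα, abs_mul, abs_of_pos (two_zpow_pos _)]
      have := abs_sub_le_of_mem_dy hN hν
      rw [zpow_neg] at this
      calc _ ≤ 2 ^ s.k * ((2:ℝ) ^ s.k)⁻¹ := by gcongr
        _ = 1 := mul_inv_cancel₀ (two_zpow_pos _).ne'
    have hrep : ∀ y, e (ν * y) * ((a:ℂ) * kn Φ s.k N (x - y)) =
        ((a * 2 ^ (-s.k) : ℝ) : ℂ) * e (ν * x) * (Φ (2 ^ (-s.k) * (x - y)) *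
          e (α * (2 ^ (-s.k) * (x - y)))) := by
      intro y
      unfold kn
      have : α * (2 ^ (-s.k) * (x - y)) = (N - ν) * (x - y) := by
        rw [hα, zpow_neg]; have := (two_zpow_pos s.k).ne'; field_simp
      rw [this]
      have h3 : e (N * (x - y)) * e (ν * y) = e (ν * x) * e ((N - ν) * (x - y)) := by
        rw [← e_add, ← e_add]; congr 1; ring
      push_cast
      linear_combination ((a:ℂ) * (2:ℂ) ^ (-s.k) * Φ (2 ^ (-s.k) * (x - y))) * h3
    rw [hrep, hrep, ← mul_sub, norm_mul, norm_mul, norm_e, mul_one, Complex.norm_real,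
      Real.norm_of_nonneg (by positivity)]
    have hdiff : ‖Φ u * e (α * u) - Φ u' * e (α * u')‖ ≤ 8 * B * (|u - u'| * v u) := by
      have : Φ u * e (α * u) - Φ u' * e (α * u') = Φ u * (e (α * u) - e (α * u')) +
        (Φ u - Φ u') * e (α * u') := by ring
      rw [this]
      refine (norm_add_le _ _).trans ?_
      rw [norm_mul, norm_mul, norm_e, mul_one]
      have h1 := norm_e_sub (α * u) (α * u')
      rw [← mul_sub, abs_mul] at h1
      have h2 : ‖e (α * u) - e (α * u')‖ ≤ 7 * |u - u'| := by
        refine h1.trans ?_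
        have := Real.pi_lt_d2
        have h3 : |α| * |u - u'| ≤ 1 * |u - u'| := by gcongr
        have := Real.pi_pos
        nlinarith [abs_nonneg (u - u')]
      calc _ ≤ (B * v u) * (7 * |u - u'|) + B * (|u - u'| * v u) :=
            add_le_add (mul_le_mul (hd u) h2 (norm_nonneg _) ((norm_nonneg _).trans (hd u)))
              (hl u u' huu1)
        _ = _ := by ring
    calc _ ≤ a * 2 ^ (-s.k) * (8 * B * (|u - u'| * v u)) := by gcongr
      _ = 2 ^ (-s.k) * |y - z| * (a * (8 * B * (2 ^ (-s.k) * v u))) := by rw [huu]; ring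
      _ ≤ _ := by gcongr; exact hva y

lemma mem_w1_of_mult {s : Tile} {N η : ℝ} (hN : N ∈ s.w2)
    (h1 : 1 / 8 ≤ 2 ^ s.k * (N - η)) (h2 : 2 ^ s.k * (N - η) ≤ 1 / 2) : η ∈ s.w1 := by
  rw [mem_w2] at hN
  rw [mem_w1]
  have hp := two_zpow_pos s.k
  rw [zpow_neg, ← div_eq_mul_inv, ← div_eq_mul_inv] at *
  rw [div_le_iff₀ hp, lt_div_iff₀ hp] at *
  constructor <;> nlinarith

end CH

namespace CH

section
variable {G : ℝ → ℂ} {g : ℝ → ℝ} {A : ℝ}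

lemma Krn.wp_kn (h : Krn G g A) (hg : ∀ t, g t ≠ 0 → 1 / 8 ≤ t ∧ t ≤ 1 / 2) {s : Tile} {N : ℝ} (hN : N ∈ s.w2) (x : ℝ) :
    IsWP s (fun y => ((v (2 ^ (-s.k) * (x - s.c)) / (32 * A) : ℝ) : ℂ) * kn G s.k N (x - y)) := by
  refine isWP_of_profile s x h.pos (w2_subset s hN) h.cont h.bound ?_ ?_
  · intro z z' hz
    exact le_trans (le_mul_of_one_le_left (norm_nonneg _) (by linarith [abs_nonneg z])) (h.lip z z' hz)
  · intro η hη
    rw [h.kn_four] at hη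
    have := hg _ (by exact_mod_cast hη)
    exact mem_w1_of_mult hN this.1 this.2

lemma Krn.wp_diff (h : Krn G g A) (hg : ∀ t, g t ≠ 0 → 1 / 8 ≤ t ∧ t ≤ 1 / 2) {s : Tile} {N ξ : ℝ} (hN : N ∈ s.w2)
    (hξ : ξ ∈ s.w2) (hne : N ≠ ξ) (x : ℝ) :
    IsWP s (fun y => ((v (2 ^ (-s.k) * (x - s.c)) / (32 * (119 * A)) : ℝ) : ℂ) *
      (((2 ^ s.k * (ξ - N) : ℝ) : ℂ)⁻¹ * (kn G s.k N (x - y) - kn G s.k ξ (x - y)))) := by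
  set δ := 2 ^ s.k * (ξ - N) with hδ
  have hδ0 : δ ≠ 0 := mul_ne_zero (two_zpow_pos _).ne' (sub_ne_zero.2 hne.symm)
  have hδa : 0 < |δ| := abs_pos.2 hδ0
  set Φ : ℝ → ℂ := fun u => (δ : ℂ)⁻¹ * (G u * (1 - e (δ * u))) with hΦ
  have hrep : ∀ z, kn Φ s.k N z = (δ : ℂ)⁻¹ * (kn G s.k N z - kn G s.k ξ z) := by
    intro z
    have h1 : e (δ * (2 ^ (-s.k) * z)) * e (N * z) = e (ξ * z) := by
      rw [← e_add]; congr 1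
      rw [hδ, zpow_neg]; have := (two_zpow_pos s.k).ne'; field_simp; ring
    simp only [kn, hΦ]
    linear_combination (-(((2:ℝ) ^ (-s.k) : ℝ) : ℂ) * (δ:ℂ)⁻¹ * G (2 ^ (-s.k) * z)) * h1
  have hexp : ∀ u, ‖1 - e (δ * u)‖ ≤ 7 * (|δ| * |u|) := by
    intro u
    rw [norm_sub_rev]
    refine (norm_e_sub_one _).trans ?_
    rw [abs_mul]
    have := Real.pi_lt_d2
    have : 0 ≤ |δ| * |u| := by positivity
    nlinarith
  have hexp2 : ∀ u u', ‖e (δ * u') - e (δ * u)‖ ≤ 7 * (|δ| * |u - u'|) := by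
    intro u u'
    refine (norm_e_sub _ _).trans ?_
    rw [← mul_sub, abs_mul, abs_sub_comm u' u]
    have := Real.pi_lt_d2
    have : 0 ≤ |δ| * |u - u'| := by positivity
    nlinarith
  have hA := h.pos
  have hcont := h.cont
  have key := isWP_of_profile s x (Φ := Φ) (N := N) (B := 119 * A) (by positivity) (w2_subset s hN)
    (by rw [hΦ]; fun_prop) ?_ ?_ ?_
  · simpa only [hrep] using key
  · intro u
    rw [hΦ]
    simp only [norm_mul, norm_inv, Complex.norm_real, Real.norm_eq_abs]
    rw [inv_mul_le_iff₀ hδa]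
    have h1 := h.decay u
    have h2 : |u| * ‖G u‖ ≤ A * v u :=
      le_trans (mul_le_mul_of_nonneg_right (by linarith) (norm_nonneg _)) h1
    have hv := v_pos u
    calc _ ≤ ‖G u‖ * (7 * (|δ| * |u|)) := by gcongr; exact hexp u
      _ = 7 * |δ| * (|u| * ‖G u‖) := by ring
      _ ≤ 7 * |δ| * (A * v u) := by gcongr
      _ = |δ| * (7 * A * v u) := by ring
      _ ≤ _ := by gcongr; norm_num
  · intro u u' huu
    have : Φ u - Φ u' = (δ : ℂ)⁻¹ * ((G u - G u') * (1 - e (δ * u)) +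
        G u' * (e (δ * u') - e (δ * u))) := by simp only [hΦ]; ring
    rw [this, norm_mul, norm_inv, Complex.norm_real, Real.norm_eq_abs, inv_mul_le_iff₀ hδa]
    have h1 := h.lip u u' huu
    have h2 : |u| * ‖G u - G u'‖ ≤ A * (|u - u'| * v u) :=
      le_trans (mul_le_mul_of_nonneg_right (by linarith) (norm_nonneg _)) h1
    have h3 := h.bound u'
    have h4 : v u' ≤ 16 * v u := v_close (by rwa [abs_sub_comm])
    have hv := v_pos u
    refine (norm_add_le _ _).trans ?_
    rw [norm_mul, norm_mul]
    calc _ ≤ ‖G u - G u'‖ * (7 * (|δ| * |u|)) + (A * (16 * v u)) * (7 * (|δ| * |u - u'|)) := by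
          gcongr
          · exact hexp u
          · exact h3.trans (by gcongr)
          · exact hexp2 u u'
      _ = 7 * |δ| * (|u| * ‖G u - G u'‖) + 112 * |δ| * (A * (|u - u'| * v u)) := by ring
      _ ≤ 7 * |δ| * (A * (|u - u'| * v u)) + 112 * |δ| * (A * (|u - u'| * v u)) := by gcongr
      _ = _ := by ring
  · intro η hη
    by_contra hc
    apply hη
    have h0 : ∀ M ∈ s.w2, 𝓕 (kn G s.k M) η = 0 := by
      intro M hM
      rw [h.kn_four]
      by_contra h2
      have := hg _ (by exact_mod_cast h2)
      exact hc (mem_w1_of_mult hM this.1 this.2)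
    have h1 := h0 N hN
    have h2 := h0 ξ hξ
    rw [fourier_eq_e] at h1 h2 ⊢
    have hi : ∀ M, Integrable (fun y => e (-(y * η)) * kn G s.k M y) := fun M =>
      (h.kn_integrable s.k M).bdd_mul (c := 1) (by fun_prop) (ae_of_all _ fun y => by simp)
    rw [show (fun y => e (-(y * η)) * kn Φ s.k N y) = fun y => (δ : ℂ)⁻¹ *
      (e (-(y * η)) * kn G s.k N y - e (-(y * η)) * kn G s.k ξ y) by ext y; rw [hrep]; ring,
      integral_const_mul, integral_sub (hi N) (hi ξ), h1, h2]
    simp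

lemma Krn.int_cnv (h : Krn G g A) {f : ℝ → ℂ} (hf : Integrable f) (k : ℤ) (N x : ℝ) :
    Integrable (fun y => f y * kn G k N (x - y)) := by
  have := h.kn_cont k N
  exact hf.mul_bdd (c := A * (2 ^ k)⁻¹) (by fun_prop) (ae_of_all _ fun y => h.kn_bdd k N _)

lemma Krn.size_cnv (h : Krn G g A) (hg : ∀ t, g t ≠ 0 → 1 / 8 ≤ t ∧ t ≤ 1 / 2) {P : Finset Tile} {f : ℝ → ℂ} {σ : ℝ}
    (hσ : 0 ≤ σ) (hS : SizeLE P f σ) {s : Tile} (hs : s ∈ P) {N : ℝ} (hN : N ∈ s.w2) (x : ℝ) :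
    ‖cnv f (kn G s.k N) x‖ * v (2 ^ (-s.k) * (x - s.c)) ≤ 32 * A * σ := by
  have h1 := hS.single hσ hs (h.wp_kn hg hN x)
  have h2 : (fun y => f y * (((v (2 ^ (-s.k) * (x - s.c)) / (32 * A) : ℝ) : ℂ) * kn G s.k N (x - y))) =
    fun y => ((v (2 ^ (-s.k) * (x - s.c)) / (32 * A) : ℝ) : ℂ) * (f y * kn G s.k N (x - y)) := by
      ext y; ring
  have hA := h.pos
  have hv := v_pos (2 ^ (-s.k) * (x - s.c))
  rw [h2, integral_const_mul, norm_mul, Complex.norm_real, Real.norm_of_nonneg (by positivity),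
    div_mul_eq_mul_div, div_le_iff₀ (by positivity)] at h1
  unfold cnv
  linarith

lemma Krn.size_diff (h : Krn G g A) (hg : ∀ t, g t ≠ 0 → 1 / 8 ≤ t ∧ t ≤ 1 / 2) {P : Finset Tile} {f : ℝ → ℂ} {σ : ℝ}
    (hf : Integrable f)
    (hσ : 0 ≤ σ) (hS : SizeLE P f σ) {s : Tile} (hs : s ∈ P) {N ξ : ℝ} (hN : N ∈ s.w2)
    (hξ : ξ ∈ s.w2) (x : ℝ) :
    ‖cnv f (kn G s.k N) x - cnv f (kn G s.k ξ) x‖ * v (2 ^ (-s.k) * (x - s.c)) ≤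
      32 * 119 * A * σ * (2 ^ s.k * |N - ξ|) := by
  by_cases hne : N = ξ
  · subst hne; simp
  have h1 := hS.single hσ hs (h.wp_diff hg hN hξ hne x)
  set δ := 2 ^ s.k * (ξ - N) with hδ
  have hδ0 : δ ≠ 0 := mul_ne_zero (two_zpow_pos _).ne' (sub_ne_zero.2 (Ne.symm hne))
  have hδa : 0 < |δ| := abs_pos.2 hδ0
  have h2 : (fun y => f y * (((v (2 ^ (-s.k) * (x - s.c)) / (32 * (119 * A)) : ℝ) : ℂ) *
      ((δ : ℂ)⁻¹ * (kn G s.k N (x - y) - kn G s.k ξ (x - y))))) =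
    fun y => (((v (2 ^ (-s.k) * (x - s.c)) / (32 * (119 * A)) : ℝ) : ℂ) * (δ : ℂ)⁻¹) *
      (f y * kn G s.k N (x - y) - f y * kn G s.k ξ (x - y)) := by
      ext y; ring
  have hA := h.pos
  have hv := v_pos (2 ^ (-s.k) * (x - s.c))
  rw [h2, integral_const_mul, integral_sub (h.int_cnv hf _ _ _) (h.int_cnv hf _ _ _), norm_mul,
    norm_mul, Complex.norm_real, norm_inv, Complex.norm_real, Real.norm_of_nonneg (by positivity),
    Real.norm_eq_abs, ← div_eq_mul_inv, div_mul_eq_mul_div, div_le_iff₀ hδa, div_mul_eq_mul_div,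
    div_le_iff₀ (by positivity)] at h1
  have h3 : |δ| = 2 ^ s.k * |N - ξ| := by
    rw [hδ, abs_mul, abs_of_pos (two_zpow_pos _), abs_sub_comm]
  rw [← h3]
  unfold cnv
  linarith

/-- joint continuity -/
lemma Krn.cont_cnv (h : Krn G g A) {f : ℝ → ℂ} (hf : Integrable f) (k : ℤ) :
    Continuous (fun p : ℝ × ℝ => cnv f (kn G k p.2) p.1) := by
  unfold cnv
  have hc := h.cont
  refine continuous_of_dominated (F := fun (p : ℝ × ℝ) y => f y * kn G k p.2 (p.1 - y))
    (bound := fun y => ‖f y‖ * (A * (2 ^ k)⁻¹))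
    (fun x => (h.int_cnv hf _ _ _).aestronglyMeasurable) (fun x => ae_of_all _ fun y => ?_)
    (hf.norm.mul_const _) (ae_of_all _ fun y => by unfold kn; fun_prop)
  rw [norm_mul]; gcongr; exact h.kn_bdd _ _ _

end

lemma v_ge_quarter {z : ℝ} (h : |z| ≤ 1) : 1 / 4 ≤ v z := by
  unfold v
  rw [one_div]
  apply inv_anti₀ (by positivity)
  have : z ^ 2 ≤ 1 := by rw [← sq_abs]; nlinarith [abs_nonneg z]
  nlinarith [sq_nonneg z]

lemma v_ge_of_mem {s : Tile} {x : ℝ} (hx : x ∈ s.I) : 1 / 4 ≤ v (2 ^ (-s.k) * (x - s.c)) := by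
  apply v_ge_quarter
  rw [abs_mul, abs_of_pos (two_zpow_pos _), zpow_neg, inv_mul_le_iff₀ (two_zpow_pos _), mul_one]
  exact abs_sub_le_of_mem_dy hx (c_mem s)

/-! ### concrete multipliers -/

noncomputable def θ (t : ℝ) : ℝ := Real.smoothTransition (16 * (7 / 16 - t))
noncomputable def χ (t : ℝ) : ℝ := θ t - θ (2 * t)

lemma θ_one {t : ℝ} (h : t ≤ 3 / 8) : θ t = 1 := Real.smoothTransition.one_of_one_le (by linarith)
lemma θ_zero {t : ℝ} (h : 7 / 16 ≤ t) : θ t = 0 := Real.smoothTransition.zero_of_nonpos (by linarith)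

lemma χ_supp {t : ℝ} (h : χ t ≠ 0) : 3 / 16 ≤ t ∧ t ≤ 7 / 16 := by
  by_contra hc
  apply h
  unfold χ
  rw [not_and_or] at hc
  rcases hc with hc | hc
  · rw [θ_one (by linarith), θ_one (by linarith)]; ring
  · rw [θ_zero (by linarith), θ_zero (by linarith)]; ring

lemma χ_contDiff : ContDiff ℝ ((⊤ : ℕ∞) : WithTop ℕ∞) χ := by
  have : ContDiff ℝ ((⊤ : ℕ∞) : WithTop ℕ∞) θ := by
    unfold θ; exact Real.smoothTransition.contDiff.comp (by fun_prop)
  unfold χ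
  exact this.sub (this.comp (by fun_prop))

lemma hcs_of_supp {g : ℝ → ℝ} {a b : ℝ} (h : ∀ t, g t ≠ 0 → a ≤ t ∧ t ≤ b) : HasCompactSupport g := by
  refine HasCompactSupport.intro (isCompact_Icc (a := a) (b := b)) fun x hx => ?_
  by_contra hc; exact hx (h x hc)

lemma exists_kernels : ∃ (κ κ' ϑ : ℝ → ℂ) (χ' h : ℝ → ℝ) (A : ℝ), Krn κ χ A ∧ Krn κ' χ' A ∧ Krn ϑ h A ∧
    (∀ t, 3 / 16 ≤ t → t ≤ 7 / 16 → χ' t = 1) ∧ (∀ t, χ' t ≠ 0 → 1 / 8 ≤ t ∧ t ≤ 1 / 2) ∧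
    (∀ t, |t| ≤ 1 / 4 → h t = 1) ∧ (∀ t, 1 / 2 ≤ |t| → h t = 0) := by
  obtain ⟨κ, A1, h1⟩ := exists_krn χ_contDiff (hcs_of_supp fun t => χ_supp)
  let b2 : ContDiffBump (5 / 16 : ℝ) := ⟨1 / 8, 3 / 16, by norm_num, by norm_num⟩
  let b3 : ContDiffBump (0 : ℝ) := ⟨1 / 4, 1 / 2, by norm_num, by norm_num⟩
  obtain ⟨κ', A2, h2⟩ := exists_krn b2.contDiff b2.hasCompactSupport
  obtain ⟨ϑ, A3, h3⟩ := exists_krn b3.contDiff b3.hasCompactSupport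
  have mono : ∀ {G : ℝ → ℂ} {g : ℝ → ℝ} {A B : ℝ}, Krn G g A → A ≤ B → Krn G g B := by
    intro G g A B h hAB
    refine ⟨h.cont, h.pos.trans_le hAB, h.four, fun z => (h.decay z).trans ?_,
      fun z z' hz => (h.lip z z' hz).trans ?_, fun z => (h.decay2 z).trans ?_⟩
    · have := v_pos z; gcongr
    · have := v_pos z; gcongr
    · have := v_pos z; gcongr
  refine ⟨κ, κ', ϑ, b2, b3, max A1 (max A2 A3), mono h1 (le_max_left _ _),
    mono h2 ((le_max_left _ _).trans (le_max_right _ _)),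
    mono h3 ((le_max_right _ _).trans (le_max_right _ _)), ?_, ?_, ?_, ?_⟩
  · intro t ht1 ht2
    apply b2.one_of_mem_closedBall
    rw [Metric.mem_closedBall, Real.dist_eq]
    show |t - 5 / 16| ≤ 1 / 8
    rw [abs_le]; constructor <;> linarith
  · intro t ht
    have : t ∈ Function.support b2 := ht
    rw [b2.support_eq, Metric.mem_ball, Real.dist_eq] at this
    have : |t - 5 / 16| < 3 / 16 := this
    rw [abs_lt] at this
    constructor <;> linarith
  · intro t ht
    apply b3.one_of_mem_closedBall
    rw [Metric.mem_closedBall, Real.dist_eq, sub_zero]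
    exact ht
  · intro t ht
    apply b3.zero_of_le_dist
    rw [Real.dist_eq, sub_zero]; exact ht

end CH

namespace CH

lemma tile_eq {s t : Tile} (hk : s.k = t.k) {x ξ : ℝ} (hx : x ∈ s.I) (hx' : x ∈ t.I)
    (h : ξ ∈ s.Om) (h' : ξ ∈ t.Om) : s = t := by
  rw [Tile.I, hk] at hx
  rw [Tile.Om, hk] at h
  exact Tile.ext hk (dy_eq_of_mem hx hx') (dy_eq_of_mem h h')

lemma tile_le {s t : Tile} (hk : s.k ≤ t.k) {x ξ : ℝ} (hx : x ∈ s.I) (hx' : x ∈ t.I)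
    (h : ξ ∈ s.Om) (h' : ξ ∈ t.Om) : s.Le t :=
  ⟨I_subset_of_le hk hx hx', Om_subset_of_lt hk h' h⟩

lemma I_cases {s t : Tile} (hk : s.k ≤ t.k) : Disjoint s.I t.I ∨ s.I ⊆ t.I := dy_disjoint_or_subset hk

lemma I_nonempty (s : Tile) : s.I.Nonempty := ⟨_, c_mem s⟩

noncomputable def tl (ξ : ℝ) (k : ℤ) (x : ℝ) : Tile := ⟨k, ⌊x * 2 ^ (-k)⌋, ⌊ξ * 2 ^ (-(-k))⌋⟩

lemma mem_tl_I (ξ : ℝ) (k : ℤ) (x : ℝ) : x ∈ (tl ξ k x).I := mem_dy_self _ _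
lemma mem_tl_Om (ξ : ℝ) (k : ℤ) (x : ℝ) : ξ ∈ (tl ξ k x).Om := mem_dy_self _ _

lemma sum_zpow_disjoint (A : Finset Tile) (hd : ∀ s ∈ A, ∀ t ∈ A, s ≠ t → Disjoint s.I t.I)
    {k n : ℤ} (h : ∀ s ∈ A, s.I ⊆ dy k n) : ∑ s ∈ A, (2:ℝ) ^ s.k ≤ 2 ^ k := by
  have h1 : volume (⋃ s ∈ A, s.I) = ∑ s ∈ A, volume s.I :=
    measure_biUnion_finset (fun s hs t ht hst => hd s hs t ht hst) (fun s _ => measurableSet_I s)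
  have h2 : volume (⋃ s ∈ A, s.I) ≤ volume (dy k n) := measure_mono (iUnion₂_subset h)
  rw [h1, volume_dy] at h2
  have h3 : ∀ s ∈ A, volume s.I = ENNReal.ofReal (2 ^ s.k) := fun s _ => volume_dy _ _
  rw [Finset.sum_congr rfl h3, ← ENNReal.ofReal_sum_of_nonneg (fun s _ => (two_zpow_pos _).le)] at h2
  exact (ENNReal.ofReal_le_ofReal_iff (two_zpow_pos _).le).1 h2

/-- trees -/
structure IsTree (P : Finset Tile) (kT nT : ℤ) (ξ : ℝ) : Prop where
  conv : TConvex P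
  sub : ∀ s ∈ P, s.I ⊆ dy kT nT
  fr : ∀ s ∈ P, ξ ∈ s.Om

def dset (P : Finset Tile) (k : ℤ) : Set ℝ := ⋃ s ∈ P.filter (fun s => s.k = k), s.I

lemma mem_dset {P : Finset Tile} {k : ℤ} {x : ℝ} : x ∈ dset P k ↔ ∃ s ∈ P, s.k = k ∧ x ∈ s.I := by
  simp [dset, and_assoc]

lemma measurableSet_dset (P : Finset Tile) (k : ℤ) : MeasurableSet (dset P k) :=
  Finset.measurableSet_biUnion _ fun s _ => measurableSet_I s

lemma jfinite (P : Finset Tile) (ξ : ℝ) :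
    {J : Tile | J ∉ P ∧ ξ ∈ J.Om ∧ ∃ s ∈ P, s.k = J.k + 1 ∧ J.I ⊆ s.I}.Finite := by
  classical
  refine Set.Finite.subset ((P ×ˢ ({0, 1} : Finset ℤ)).image
    (fun q => (⟨q.1.k - 1, 2 * q.1.n + q.2, ⌊ξ * 2 ^ (-(-(q.1.k - 1)))⌋⟩ : Tile))).finite_toSet ?_
  rintro J ⟨-, hξ, s, hs, hk, hI⟩
  rw [Finset.mem_coe, Finset.mem_image]
  have hc := hI (c_mem J)
  have hl := mem_dy_floor.1 hξ
  rw [Tile.I, mem_dy, Tile.c, hk, zpow_add₀ (by norm_num), zpow_one] at hc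
  have hp := two_zpow_pos J.k
  have h1 : (2 * s.n : ℝ) ≤ J.n := by
    by_contra hh; push Not at hh
    nlinarith [mul_lt_mul_of_pos_right hh hp]
  have h2 : (J.n : ℝ) < 2 * s.n + 2 := by
    by_contra hh; push Not at hh
    nlinarith [mul_le_mul_of_nonneg_right hh hp.le]
  norm_cast at h1 h2
  refine ⟨(s, J.n - 2 * s.n), ?_, ?_⟩
  · rw [Finset.mem_product]
    refine ⟨hs, ?_⟩
    simp only [Finset.mem_insert, Finset.mem_singleton]
    omega
  · have e1 : s.k - 1 = J.k := by omega
    apply Tile.ext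
    · exact e1
    · simp
    · simp only [e1]; exact hl

noncomputable def jset (P : Finset Tile) (ξ : ℝ) : Finset Tile := (jfinite P ξ).toFinset

lemma mem_jset {P : Finset Tile} {ξ : ℝ} {J : Tile} : J ∈ jset P ξ ↔
    J ∉ P ∧ ξ ∈ J.Om ∧ ∃ s ∈ P, s.k = J.k + 1 ∧ J.I ⊆ s.I := by
  unfold jset; rw [Set.Finite.mem_toFinset]; rfl

open Classical in
noncomputable def tops (P : Finset Tile) : Finset Tile := P.filter (fun s => ∀ u ∈ P, s.Le u → u = s)

lemma mem_tops {P : Finset Tile} {s : Tile} : s ∈ tops P ↔ s ∈ P ∧ ∀ u ∈ P, s.Le u → u = s := by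
  classical unfold tops; rw [Finset.mem_filter]

lemma exists_top {P : Finset Tile} {s : Tile} (hs : s ∈ P) : ∃ u ∈ tops P, s.Le u := by
  classical
  obtain ⟨u, hu, hmax⟩ := Finset.exists_max_image (P.filter (fun u => s.Le u)) (fun u => u.k)
    ⟨s, Finset.mem_filter.2 ⟨hs, Tile.Le.refl s⟩⟩
  rw [Finset.mem_filter] at hu
  refine ⟨u, mem_tops.2 ⟨hu.1, fun t ht hut => ?_⟩, hu.2⟩
  have h1 := hmax t (Finset.mem_filter.2 ⟨ht, hu.2.trans hut⟩)
  have h2 := hut.k_le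
  have h3 : t.k = u.k := le_antisymm h1 h2
  refine tile_eq h3 (x := u.c) (ξ := (t.l:ℝ) * 2 ^ (-t.k)) (hut.1 (c_mem u)) (c_mem u)
    (left_mem_dy _ _) (hut.2 (left_mem_dy _ _))

section
variable {P : Finset Tile} {kT nT : ℤ} {ξ : ℝ}

lemma IsTree.same_l (h : IsTree P kT nT ξ) {s t : Tile} (hs : s ∈ P) (ht : t ∈ P) (hk : s.k = t.k) :
    s.l = t.l := by
  have h1 := h.fr s hs
  have h2 := h.fr t ht
  rw [Tile.Om, hk] at h1
  exact dy_eq_of_mem h1 h2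

/-- intermediate tiles belong to the tree -/
lemma IsTree.mid (h : IsTree P kT nT ξ) {s u t : Tile} (hs : s ∈ P) (hu : u ∈ P) {x : ℝ}
    (hx : x ∈ s.I) (hxu : x ∈ u.I) (hxt : x ∈ t.I) (hξ : ξ ∈ t.Om) (h1 : s.k ≤ t.k) (h2 : t.k ≤ u.k) :
    t ∈ P :=
  h.conv s hs u hu t (tile_le h1 hx hxt (h.fr s hs) hξ) (tile_le h2 hxt hxu hξ (h.fr u hu))

lemma IsTree.jdisj (h : IsTree P kT nT ξ) {J J' : Tile} (hJ : J ∈ jset P ξ) (hJ' : J' ∈ jset P ξ)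
    (hne : J ≠ J') : Disjoint J.I J'.I := by
  have key : ∀ J J' : Tile, J ∈ jset P ξ → J' ∈ jset P ξ → J ≠ J' → J.k ≤ J'.k →
      Disjoint J.I J'.I := by
    intro J J' hJ hJ' hne hk
    rcases I_cases hk with h1 | h1
    · exact h1
    exfalso
    obtain ⟨a1, a2, s, hs, hsk, hsI⟩ := mem_jset.1 hJ
    obtain ⟨b1, b2, u, hu, huk, huI⟩ := mem_jset.1 hJ'
    have c1 := c_mem J
    rcases hk.eq_or_lt with h2 | h2
    · exact hne (tile_eq h2 c1 (h1 c1) a2 b2)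
    · exact b1 (h.mid hs hu (hsI c1) (huI (h1 c1)) (h1 c1) b2 (by omega) (by omega))
  rcases le_total J.k J'.k with hk | hk
  · exact key J J' hJ hJ' hne hk
  · exact (key J' J hJ' hJ hne.symm hk).symm

lemma IsTree.jsub (h : IsTree P kT nT ξ) {J : Tile} (hJ : J ∈ jset P ξ) : J.I ⊆ dy kT nT := by
  obtain ⟨a1, a2, s, hs, hsk, hsI⟩ := mem_jset.1 hJ
  exact hsI.trans (h.sub s hs)

lemma IsTree.jcover (_h : IsTree P kT nT ξ) {s : Tile} (hs : s ∈ P) {x : ℝ} (hx : x ∈ s.I) :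
    ∃ J ∈ jset P ξ, x ∈ J.I ∧ J.k < s.k := by
  classical
  obtain ⟨u, hu, hmin⟩ := Finset.exists_min_image (P.filter (fun u => x ∈ u.I)) (fun u => u.k)
    ⟨s, Finset.mem_filter.2 ⟨hs, hx⟩⟩
  rw [Finset.mem_filter] at hu
  refine ⟨tl ξ (u.k - 1) x, mem_jset.2 ⟨fun hm => ?_, mem_tl_Om _ _ _, u, hu.1, ?_, ?_⟩,
    mem_tl_I _ _ _, ?_⟩
  · have := hmin _ (Finset.mem_filter.2 ⟨hm, mem_tl_I _ _ _⟩)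
    simp [tl] at this
  · simp [tl]
  · exact I_subset_of_le (by simp [tl]) (mem_tl_I _ _ _) hu.2
  · have := hmin _ (Finset.mem_filter.2 ⟨hs, hx⟩)
    simp only [tl]; omega

lemma IsTree.tdisj (h : IsTree P kT nT ξ) {s t : Tile} (hs : s ∈ tops P) (ht : t ∈ tops P)
    (hne : s ≠ t) : Disjoint s.I t.I := by
  have key : ∀ s t : Tile, s ∈ tops P → t ∈ tops P → s ≠ t → s.k ≤ t.k → Disjoint s.I t.I := by
    intro s t hs ht hne hk
    rcases I_cases hk with h1 | h1
    · exact h1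
    exfalso
    obtain ⟨a1, a2⟩ := mem_tops.1 hs
    obtain ⟨b1, b2⟩ := mem_tops.1 ht
    exact hne (a2 t b1 (tile_le hk (c_mem s) (h1 (c_mem s)) (h.fr s a1) (h.fr t b1))).symm
  rcases le_total s.k t.k with hk | hk
  · exact key s t hs ht hne hk
  · exact (key t s ht hs hne.symm hk).symm

lemma tops_sub {s : Tile} (hs : s ∈ tops P) : s ∈ P := (mem_tops.1 hs).1

lemma IsTree.sep (h : IsTree P kT nT ξ) {s : Tile} (hs : s ∈ P) {y : ℝ} (hy : y ∉ dset P s.k) :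
    ∃ Q, (Q ∈ jset P ξ ∨ Q ∈ tops P) ∧ s.k ≤ Q.k ∧
      ((s.I ⊆ Q.I ∧ y ∉ Q.I) ∨ (Disjoint s.I Q.I ∧ y ∈ Q.I)) := by
  obtain ⟨u, hu, hsu⟩ := exists_top hs
  by_cases hyu : y ∈ u.I
  · obtain ⟨J, hJ, hyJ, -⟩ := h.jcover (tops_sub hu) hyu
    obtain ⟨a1, a2, t, ht, htk, htI⟩ := mem_jset.1 hJ
    have hk : s.k ≤ J.k := by
      by_contra hlt
      push Not at hlt
      apply hy
      refine mem_dset.2 ⟨tl ξ s.k y, ?_, rfl, mem_tl_I _ _ _⟩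
      exact h.mid ht (tops_sub hu) (htI hyJ) hyu (mem_tl_I _ _ _) (mem_tl_Om _ _ _)
        (by simp only [tl]; omega) (by simp only [tl]; exact hsu.k_le)
    refine ⟨J, Or.inl hJ, hk, Or.inr ⟨?_, hyJ⟩⟩
    rcases I_cases hk with h1 | h1
    · exact h1
    exfalso
    have c1 := c_mem s
    have hJu : J.k ≤ u.k := by
      by_contra hlt
      push Not at hlt
      have hut : u.Le t := tile_le (by omega) hyu (htI hyJ) (h.fr u (tops_sub hu)) (h.fr t ht)
      have := (mem_tops.1 hu).2 t ht hut
      subst this; omega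
    exact a1 (h.mid hs (tops_sub hu) c1 (hsu.1 c1) (h1 c1) a2 hk hJu)
  · exact ⟨u, Or.inr hu, hsu.k_le, Or.inl ⟨hsu.1, hyu⟩⟩

lemma IsTree.bdry1 (h : IsTree P kT nT ξ) :
    ∑ s ∈ P, 2 ^ s.k * ∫ y in (dset P s.k)ᶜ, w (2 ^ s.k) (s.c - y) ≤ 128 * π * 2 ^ kT := by
  classical
  set 𝒬 := jset P ξ ∪ tops P with hQ
  set F : Tile → Set ℝ → ℝ := fun s X => 2 ^ s.k * ∫ y in X, w (2 ^ s.k) (s.c - y) with hF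
  have hIntg : ∀ s : Tile, Integrable (fun y => w (2 ^ s.k) (s.c - y)) := fun s =>
    integrable_w_sub' (two_zpow_pos _) _
  have hnn : ∀ (s : Tile) (y : ℝ), 0 ≤ w (2 ^ s.k) (s.c - y) := fun s y => w_nonneg (two_zpow_pos _) _
  have h1 : ∀ s ∈ P, F s (dset P s.k)ᶜ ≤ ∑ Q ∈ 𝒬, ((if s.I ⊆ Q.I then F s Q.Iᶜ else 0) +
      (if Disjoint s.I Q.I ∧ s.k ≤ Q.k then F s Q.I else 0)) := by
    intro s hs
    simp only [hF]
    rw [← integral_indicator (measurableSet_dset P s.k).compl]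
    have e1 : ∀ Q : Tile, ((if s.I ⊆ Q.I then 2 ^ s.k * ∫ y in Q.Iᶜ, w (2 ^ s.k) (s.c - y) else 0) +
      (if Disjoint s.I Q.I ∧ s.k ≤ Q.k then 2 ^ s.k * ∫ y in Q.I, w (2 ^ s.k) (s.c - y) else 0)) =
      2 ^ s.k * ∫ y, ((if s.I ⊆ Q.I then Q.Iᶜ.indicator (fun y => w (2 ^ s.k) (s.c - y)) y else 0) +
      (if Disjoint s.I Q.I ∧ s.k ≤ Q.k then Q.I.indicator (fun y => w (2 ^ s.k) (s.c - y)) y else 0)) := by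
      intro Q
      rw [← integral_indicator (measurableSet_I Q), ← integral_indicator (measurableSet_I Q).compl]
      split_ifs
      · rw [integral_add ((hIntg s).indicator (measurableSet_I Q).compl)
          ((hIntg s).indicator (measurableSet_I Q)), mul_add]
      all_goals simp
    simp_rw [e1]
    have hi : ∀ Q : Tile, Integrable (fun y =>
      (if s.I ⊆ Q.I then Q.Iᶜ.indicator (fun y => w (2 ^ s.k) (s.c - y)) y else 0) +
      (if Disjoint s.I Q.I ∧ s.k ≤ Q.k then Q.I.indicator (fun y => w (2 ^ s.k) (s.c - y)) y else 0)) := by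
      intro Q
      refine Integrable.add ?_ ?_
      · split_ifs
        · exact (hIntg s).indicator (measurableSet_I Q).compl
        · exact integrable_zero _ _ _
      · split_ifs
        · exact (hIntg s).indicator (measurableSet_I Q)
        · exact integrable_zero _ _ _
    rw [← Finset.mul_sum, ← integral_finsetSum _ (fun Q _ => hi Q)]
    refine mul_le_mul_of_nonneg_left ?_ (two_zpow_pos _).le
    refine integral_mono ((hIntg s).indicator (measurableSet_dset P s.k).compl)
      (integrable_finsetSum _ fun Q _ => hi Q) fun y => ?_
    have hnn2 : ∀ Q ∈ 𝒬, 0 ≤ (if s.I ⊆ Q.I then Q.Iᶜ.indicator (fun y => w (2 ^ s.k) (s.c - y)) y else 0) +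
      (if Disjoint s.I Q.I ∧ s.k ≤ Q.k then Q.I.indicator (fun y => w (2 ^ s.k) (s.c - y)) y else 0) := by
      intro Q _
      refine add_nonneg ?_ ?_
      · split_ifs
        · exact indicator_nonneg (fun y _ => hnn s y) y
        · exact le_rfl
      · split_ifs
        · exact indicator_nonneg (fun y _ => hnn s y) y
        · exact le_rfl
    by_cases hy : y ∈ dset P s.k
    · simp only [mem_compl_iff, hy, not_true_eq_false, not_false_eq_true, indicator_of_notMem]
      exact Finset.sum_nonneg hnn2
    · obtain ⟨Q, hQm, hk, hc⟩ := h.sep hs hy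
      have hQm' : Q ∈ 𝒬 := by simpa [hQ] using hQm
      refine le_trans ?_ (Finset.single_le_sum hnn2 hQm')
      rw [indicator_of_mem (show y ∈ (dset P s.k)ᶜ from hy)]
      rcases hc with ⟨c1, c2⟩ | ⟨c1, c2⟩
      · rw [if_pos c1, indicator_of_mem (show y ∈ Q.Iᶜ from c2)]
        have : 0 ≤ (if Disjoint s.I Q.I ∧ s.k ≤ Q.k then
          Q.I.indicator (fun y => w (2 ^ s.k) (s.c - y)) y else 0) := by
          split_ifs
          · exact indicator_nonneg (fun y _ => hnn s y) y
          · exact le_rfl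
        linarith
      · rw [if_pos (⟨c1, hk⟩ : Disjoint s.I Q.I ∧ s.k ≤ Q.k), indicator_of_mem c2]
        have : 0 ≤ (if s.I ⊆ Q.I then
          Q.Iᶜ.indicator (fun y => w (2 ^ s.k) (s.c - y)) y else 0) := by
          split_ifs
          · exact indicator_nonneg (fun y _ => hnn s y) y
          · exact le_rfl
        linarith
  calc _ ≤ ∑ s ∈ P, ∑ Q ∈ 𝒬, ((if s.I ⊆ Q.I then F s Q.Iᶜ else 0) +
      (if Disjoint s.I Q.I ∧ s.k ≤ Q.k then F s Q.I else 0)) := Finset.sum_le_sum h1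
    _ = ∑ Q ∈ 𝒬, (∑ s ∈ P.filter (fun s => s.I ⊆ Q.I), F s Q.Iᶜ +
          ∑ s ∈ P.filter (fun s => Disjoint s.I Q.I ∧ s.k ≤ Q.k), F s Q.I) := by
        rw [Finset.sum_comm]
        refine Finset.sum_congr rfl fun Q _ => ?_
        rw [Finset.sum_add_distrib, Finset.sum_filter, Finset.sum_filter]
    _ ≤ ∑ Q ∈ 𝒬, (32 * π * 2 ^ Q.k + 32 * π * 2 ^ Q.k) := by
        refine Finset.sum_le_sum fun Q _ => add_le_add ?_ ?_
        · refine tree_bdry _ (fun s hs => (Finset.mem_filter.1 hs).2) ?_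
          intro s hs t ht hk
          exact h.same_l (Finset.mem_filter.1 hs).1 (Finset.mem_filter.1 ht).1 hk
        · refine tree_bdry_out _ (fun s hs => (Finset.mem_filter.1 hs).2.1)
            (fun s hs => (Finset.mem_filter.1 hs).2.2) ?_
          intro s hs t ht hk
          exact h.same_l (Finset.mem_filter.1 hs).1 (Finset.mem_filter.1 ht).1 hk
    _ = 64 * π * ∑ Q ∈ 𝒬, 2 ^ Q.k := by
        rw [Finset.mul_sum]; refine Finset.sum_congr rfl fun Q _ => by ring
    _ ≤ 64 * π * (∑ Q ∈ jset P ξ, 2 ^ Q.k + ∑ Q ∈ tops P, 2 ^ Q.k) := by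
        gcongr
        rw [← Finset.sum_union_inter]
        have : 0 ≤ ∑ Q ∈ jset P ξ ∩ tops P, (2:ℝ) ^ Q.k :=
          Finset.sum_nonneg fun Q _ => (two_zpow_pos _).le
        linarith
    _ ≤ 64 * π * (2 ^ kT + 2 ^ kT) := by
        gcongr
        · exact sum_zpow_disjoint _ (fun s hs t ht => h.jdisj hs ht) fun s hs => h.jsub hs
        · exact sum_zpow_disjoint _ (fun s hs t ht => h.tdisj hs ht)
            fun s hs => h.sub s (tops_sub hs)
    _ = _ := by ring

/-- the boundary error term -/
noncomputable def Berr (P : Finset Tile) (J : Tile) : ℝ :=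
  open Classical in ∑ s ∈ P.filter (fun s => J.I ⊆ s.I),
    ∫ y in (dset P s.k)ᶜ, w (2 ^ s.k) (J.c - y)

lemma IsTree.bdry2 (h : IsTree P kT nT ξ) :
    ∑ J ∈ jset P ξ, 2 ^ J.k * Berr P J ≤ 2048 * π * 2 ^ kT := by
  classical
  set G : Tile → ℝ := fun s => ∫ y in (dset P s.k)ᶜ, w (2 ^ s.k) (s.c - y) with hG
  have hG0 : ∀ s, 0 ≤ G s := fun s => integral_nonneg fun y => w_nonneg (two_zpow_pos _) _
  have h1 : ∀ J ∈ jset P ξ, 2 ^ J.k * Berr P J ≤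
      ∑ s ∈ P, if J.I ⊆ s.I then 2 ^ J.k * (16 * G s) else 0 := by
    intro J hJ
    unfold Berr
    rw [Finset.mul_sum, ← Finset.sum_filter]
    refine Finset.sum_le_sum fun s hs => ?_
    refine mul_le_mul_of_nonneg_left ?_ (two_zpow_pos _).le
    rw [hG, ← integral_const_mul]
    refine integral_mono (integrable_w_sub' (two_zpow_pos _) _).integrableOn
      ((integrable_w_sub' (two_zpow_pos _) _).integrableOn.const_mul _) fun y => ?_
    apply w_close (two_zpow_pos _)
    rw [sub_sub_sub_cancel_right]
    exact abs_sub_le_of_mem_dy ((Finset.mem_filter.1 hs).2 (c_mem J)) (c_mem s)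
  calc _ ≤ ∑ J ∈ jset P ξ, ∑ s ∈ P, if J.I ⊆ s.I then 2 ^ J.k * (16 * G s) else 0 :=
        Finset.sum_le_sum h1
    _ = ∑ s ∈ P, (∑ J ∈ (jset P ξ).filter (fun J => J.I ⊆ s.I), 2 ^ J.k) * (16 * G s) := by
        rw [Finset.sum_comm]
        refine Finset.sum_congr rfl fun s _ => ?_
        rw [← Finset.sum_filter, Finset.sum_mul]
    _ ≤ ∑ s ∈ P, 2 ^ s.k * (16 * G s) := by
        refine Finset.sum_le_sum fun s _ => mul_le_mul_of_nonneg_right ?_ (by linarith [hG0 s])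
        refine sum_zpow_disjoint _ (fun J hJ J' hJ' => h.jdisj (Finset.mem_filter.1 hJ).1
          (Finset.mem_filter.1 hJ').1) fun J hJ => (Finset.mem_filter.1 hJ).2
    _ = 16 * ∑ s ∈ P, 2 ^ s.k * G s := by
        rw [Finset.mul_sum]; exact Finset.sum_congr rfl fun s _ => by ring
    _ ≤ 16 * (128 * π * 2 ^ kT) := by gcongr; exact h.bdry1
    _ = _ := by ring

end
end CH

namespace CH

/-- linearised maximal inequality -/
lemma lin_max (S : Finset Tile) (hd : ∀ s ∈ S, ∀ t ∈ S, s ≠ t → Disjoint s.I t.I) {kT nT : ℤ}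
    (hS : ∀ s ∈ S, s.I ⊆ dy kT nT) (b : Tile → ℤ) (hb : ∀ s ∈ S, s.k ≤ b s)
    {H : ℝ → ℝ} (hH : Continuous H) {M : ℝ} (hM : ∀ y, |H y| ≤ M)
    (hH2 : Integrable (fun y => H y ^ 2)) :
    (∑ s ∈ S, 2 ^ s.k * ∫ y, H y * w (2 ^ b s) (s.c - y)) ^ 2 ≤
      4096 * π ^ 2 * 2 ^ kT * ∫ y, H y ^ 2 := by
  classical
  set Φ : ℝ → ℝ := fun y => ∑ s ∈ S, 2 ^ s.k * w (2 ^ b s) (s.c - y) with hΦ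
  have hi1 : ∀ s : Tile, Integrable (fun y => H y * w (2 ^ b s) (s.c - y)) := fun s =>
    (integrable_w_sub' (two_zpow_pos _) _).bdd_mul (c := M) hH.aestronglyMeasurable
      (ae_of_all _ fun y => hM y)
  have hi2 : ∀ s t : Tile, Integrable (fun y => w (2 ^ b s) (s.c - y) * w (2 ^ b t) (t.c - y)) := by
    intro s t
    have := integrable_w_mul (two_zpow_pos (b s)) (two_zpow_pos (b t)) s.c t.c
    simpa only [w_sub_comm _ t.c] using this
  have hΦ2 : ∀ y, Φ y ^ 2 = ∑ s ∈ S, ∑ t ∈ S, 2 ^ s.k * 2 ^ t.k *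
      (w (2 ^ b s) (s.c - y) * w (2 ^ b t) (t.c - y)) := by
    intro y
    rw [hΦ, sq, Finset.sum_mul_sum]
    exact Finset.sum_congr rfl fun s _ => Finset.sum_congr rfl fun t _ => by ring
  have hi3 : ∀ s t : Tile, Integrable (fun y => (2:ℝ) ^ s.k * 2 ^ t.k *
      (w (2 ^ b s) (s.c - y) * w (2 ^ b t) (t.c - y))) := fun s t => (hi2 s t).const_mul _
  have hiΦ2 : Integrable (fun y => Φ y ^ 2) := by
    simp_rw [hΦ2]
    exact integrable_finsetSum _ fun s _ => integrable_finsetSum _ fun t _ => hi3 s t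
  have e1 : ∑ s ∈ S, 2 ^ s.k * ∫ y, H y * w (2 ^ b s) (s.c - y) = ∫ y, H y * Φ y := by
    rw [hΦ]
    simp_rw [Finset.mul_sum, ← integral_const_mul]
    rw [← integral_finsetSum _ fun s _ => (hi1 s).const_mul _]
    congr 1; ext y; exact Finset.sum_congr rfl fun s _ => by ring
  have hiHΦ : Integrable (fun y => H y * Φ y) := by
    rw [hΦ]; simp_rw [Finset.mul_sum]
    refine integrable_finsetSum _ fun s _ => ?_
    have := (hi1 s).const_mul ((2:ℝ) ^ s.k)
    refine this.congr (ae_of_all _ fun y => by simp only; ring)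
  rw [e1]
  refine (cauchy_schwarz hH2 hiΦ2 hiHΦ).trans ?_
  rw [mul_comm]
  refine mul_le_mul_of_nonneg_right ?_ (integral_nonneg fun y => sq_nonneg _)
  simp_rw [hΦ2]
  rw [integral_finsetSum _ fun s _ => integrable_finsetSum _ fun t _ => hi3 s t]
  simp_rw [integral_finsetSum _ fun t _ => hi3 _ t, integral_const_mul]
  set B : Tile → Tile → ℝ := fun s t => 2 ^ s.k * 2 ^ t.k *
    ∫ y, w (2 ^ b s) (s.c - y) * w (2 ^ b t) (t.c - y) with hB
  have hBs : ∀ s t, B s t = B t s := by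
    intro s t; simp only [hB]
    rw [mul_comm ((2:ℝ) ^ s.k)]; simp_rw [mul_comm (w (2 ^ b s) _)]
  have hB0 : ∀ s t, 0 ≤ B s t := fun s t => mul_nonneg (by positivity)
    (integral_nonneg fun y => mul_nonneg (w_nonneg (two_zpow_pos _) _) (w_nonneg (two_zpow_pos _) _))
  have hBle : ∀ s t, b t ≤ b s → B s t ≤ 128 * π * 2 ^ s.k * (2 ^ t.k * w (2 ^ b s) (s.c - t.c)) := by
    intro s t hst
    have := integral_w_mul_le (two_zpow_pos (b t)) (zpow_le_zpow_right₀ one_le_two hst) s.c t.c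
    simp only [w_sub_comm _ _ t.c] at this ⊢
    simp only [hB]
    calc _ ≤ 2 ^ s.k * 2 ^ t.k * (128 * π * w (2 ^ b s) (t.c - s.c)) := by
          gcongr
      _ = _ := by ring
  have hdiag : ∑ s ∈ S, ∑ t ∈ S, (if b t ≤ b s then B s t else 0) ≤ 2048 * π ^ 2 * 2 ^ kT := by
    calc _ ≤ ∑ s ∈ S, 128 * π * 2 ^ s.k * (16 * π) := by
          refine Finset.sum_le_sum fun s hs => ?_
          rw [← Finset.sum_filter]
          calc _ ≤ ∑ t ∈ S.filter (fun t => b t ≤ b s),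
                128 * π * 2 ^ s.k * (2 ^ t.k * w (2 ^ b s) (s.c - t.c)) :=
                Finset.sum_le_sum fun t ht => hBle s t (Finset.mem_filter.1 ht).2
            _ = 128 * π * 2 ^ s.k * ∑ t ∈ S.filter (fun t => b t ≤ b s),
                (2 ^ t.k * w (2 ^ b s) (s.c - t.c)) := by rw [Finset.mul_sum]
            _ ≤ _ := by
                gcongr
                refine sum_w_le_pi _ (fun t ht u hu => hd t (Finset.mem_filter.1 ht).1 u
                  (Finset.mem_filter.1 hu).1) (fun t ht => ?_) _
                exact (hb t (Finset.mem_filter.1 ht).1).trans (Finset.mem_filter.1 ht).2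
      _ = 2048 * π ^ 2 * ∑ s ∈ S, 2 ^ s.k := by
          rw [Finset.mul_sum]; exact Finset.sum_congr rfl fun s _ => by ring
      _ ≤ _ := by gcongr; exact sum_zpow_disjoint S hd hS
  calc ∑ s ∈ S, ∑ t ∈ S, B s t
      ≤ ∑ s ∈ S, ∑ t ∈ S, ((if b t ≤ b s then B s t else 0) + (if b s ≤ b t then B t s else 0)) := by
        refine Finset.sum_le_sum fun s _ => Finset.sum_le_sum fun t _ => ?_
        rcases le_total (b t) (b s) with h | h
        · rw [if_pos h]; have := hB0 t s; split_ifs <;> linarith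
        · rw [if_pos h, ← hBs s t]; have := hB0 s t; split_ifs <;> linarith
    _ = ∑ s ∈ S, ∑ t ∈ S, (if b t ≤ b s then B s t else 0) +
        ∑ s ∈ S, ∑ t ∈ S, (if b s ≤ b t then B t s else 0) := by
        simp_rw [Finset.sum_add_distrib]
    _ = 2 * ∑ s ∈ S, ∑ t ∈ S, (if b t ≤ b s then B s t else 0) := by
        rw [Finset.sum_comm (f := fun s t => if b s ≤ b t then B t s else 0)]; ring
    _ ≤ _ := by linarith

/-- the package of kernels -/
structure Ker (κ κ' ϑ : ℝ → ℂ) (χ' h : ℝ → ℝ) (A : ℝ) : Prop where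
  k1 : Krn κ χ A
  k2 : Krn κ' χ' A
  k3 : Krn ϑ h A
  one : ∀ t, 3 / 16 ≤ t → t ≤ 7 / 16 → χ' t = 1
  supp : ∀ t, χ' t ≠ 0 → 1 / 8 ≤ t ∧ t ≤ 1 / 2
  h1 : ∀ t, |t| ≤ 1 / 4 → h t = 1
  h0 : ∀ t, 1 / 2 ≤ |t| → h t = 0

lemma χ_supp' (t : ℝ) (h : χ t ≠ 0) : 1 / 8 ≤ t ∧ t ≤ 1 / 2 := by
  have := χ_supp h; constructor <;> linarith [this.1, this.2]

/-- frequency cutoffs -/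
structure Rho (ρ : ℝ → ℝ) : Prop where
  le : ∀ t, |ρ t| ≤ 1
  supp : ∀ t, ρ t ≠ 0 → 1 / 2 ≤ t ∧ t < 5 / 8
  lip : ∀ t t', |ρ t - ρ t'| ≤ 17 * |t - t'|

noncomputable def rs (ρ : ℝ → ℝ) (s : Tile) (N : ℝ) : ℝ := ρ (2 ^ s.k * N - s.l)

lemma Rho.mem_w2 {ρ : ℝ → ℝ} (h : Rho ρ) {s : Tile} {N : ℝ} (hN : rs ρ s N ≠ 0) : N ∈ s.w2 := by
  have h1 := h.supp _ hN
  rw [CH.mem_w2, zpow_neg]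
  have hp := two_zpow_pos s.k
  rw [← div_eq_mul_inv, ← div_eq_mul_inv, div_le_iff₀ hp, lt_div_iff₀ hp]
  constructor <;> linarith [h1.1, h1.2]

end CH

namespace CH

/-- tree setup -/
structure TS (κ κ' ϑ : ℝ → ℂ) (χ' h : ℝ → ℝ) (A : ℝ) (ρ : ℝ → ℝ) (P : Finset Tile) (kT nT : ℤ)
    (ξ : ℝ) (f : ℝ → ℂ) (σ : ℝ) : Prop where
  K : Ker κ κ' ϑ χ' h A
  R : Rho ρ
  T : IsTree P kT nT ξ
  hf : Integrable f
  hσ : 0 ≤ σ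
  hS : SizeLE P f σ

/-- localized piece -/
noncomputable def hs (κ : ℝ → ℂ) (ρ : ℝ → ℝ) (ξ : ℝ) (f : ℝ → ℂ) (s : Tile) : ℝ → ℂ :=
  s.I.indicator (fun y => (rs ρ s ξ : ℂ) * cnv f (kn κ s.k ξ) y)

noncomputable def ps (κ κ' : ℝ → ℂ) (ρ : ℝ → ℝ) (ξ : ℝ) (f : ℝ → ℂ) (s : Tile) : ℝ → ℂ :=
  cnv (hs κ ρ ξ f s) (kn κ' s.k ξ)

section
variable {κ κ' ϑ : ℝ → ℂ} {χ' h : ℝ → ℝ} {A : ℝ} {ρ : ℝ → ℝ} {P : Finset Tile} {kT nT : ℤ}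
  {ξ : ℝ} {f : ℝ → ℂ} {σ : ℝ}

lemma TS.cont (t : TS κ κ' ϑ χ' h A ρ P kT nT ξ f σ) (k : ℤ) (N : ℝ) :
    Continuous (cnv f (kn κ k N)) :=
  continuous_cnv t.hf (t.K.k1.kn_cont k N) (t.K.k1.kn_bdd k N)

lemma TS.integrable (t : TS κ κ' ϑ χ' h A ρ P kT nT ξ f σ) (k : ℤ) (N : ℝ) :
    Integrable (cnv f (kn κ k N)) :=
  integrable_cnv t.hf (t.K.k1.kn_integrable k N)

lemma TS.hs_integrable (t : TS κ κ' ϑ χ' h A ρ P kT nT ξ f σ) (s : Tile) :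
    Integrable (hs κ ρ ξ f s) :=
  ((t.integrable s.k ξ).const_mul _).indicator (measurableSet_I s)

lemma TS.exists_x (t : TS κ κ' ϑ χ' h A ρ P kT nT ξ f σ) (s : Tile) :
    ∃ x, |x - s.c| ≤ 2 ^ s.k ∧ ∀ y ∈ s.I, ‖cnv f (kn κ s.k ξ) y‖ ≤ ‖cnv f (kn κ s.k ξ) x‖ := by
  obtain ⟨x, hx, hmax⟩ := (isCompact_Icc (a := s.c) (b := s.c + 2 ^ s.k)).exists_isMaxOn
    ⟨s.c, by simp [(two_zpow_pos s.k).le]⟩ (t.cont s.k ξ).norm.continuousOn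
  refine ⟨x, ?_, fun y hy => hmax ?_⟩
  · rw [abs_le]; constructor <;> linarith [hx.1, hx.2, two_zpow_pos s.k]
  · rw [Tile.I, mem_dy] at hy
    rw [Tile.c]
    constructor <;> linarith [hy.1, hy.2]

/-- sup of the piece -/
noncomputable def TS.x (t : TS κ κ' ϑ χ' h A ρ P kT nT ξ f σ) (s : Tile) : ℝ :=
  (t.exists_x s).choose

noncomputable def TS.M (t : TS κ κ' ϑ χ' h A ρ P kT nT ξ f σ) (s : Tile) : ℝ :=
  |rs ρ s ξ| * ‖cnv f (kn κ s.k ξ) (t.x s)‖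

lemma TS.M_nonneg (t : TS κ κ' ϑ χ' h A ρ P kT nT ξ f σ) (s : Tile) : 0 ≤ t.M s := by
  unfold TS.M; positivity

lemma TS.hs_le (t : TS κ κ' ϑ χ' h A ρ P kT nT ξ f σ) (s : Tile) (y : ℝ) :
    ‖hs κ ρ ξ f s y‖ ≤ s.I.indicator (fun _ => t.M s) y := by
  unfold hs
  by_cases hy : y ∈ s.I
  · rw [indicator_of_mem hy, indicator_of_mem hy, norm_mul, Complex.norm_real, Real.norm_eq_abs, TS.M]
    gcongr
    exact (t.exists_x s).choose_spec.2 y hy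
  · rw [indicator_of_notMem hy, indicator_of_notMem hy, norm_zero]

lemma TS.v_x (t : TS κ κ' ϑ χ' h A ρ P kT nT ξ f σ) (s : Tile) :
    1 / 4 ≤ v (2 ^ (-s.k) * (t.x s - s.c)) := by
  apply v_ge_quarter
  rw [abs_mul, abs_of_pos (two_zpow_pos _), zpow_neg, inv_mul_le_iff₀ (two_zpow_pos _), mul_one]
  exact (t.exists_x s).choose_spec.1

lemma TS.M_le (t : TS κ κ' ϑ χ' h A ρ P kT nT ξ f σ) {s : Tile} (hsP : s ∈ P) :
    t.M s ≤ 128 * A * σ := by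
  have hA := t.K.k1.pos
  have hσ := t.hσ
  by_cases h0 : rs ρ s ξ = 0
  · unfold TS.M; rw [h0]; simp; positivity
  have h1 := t.K.k1.size_cnv χ_supp' t.hσ t.hS hsP (t.R.mem_w2 h0) (t.x s)
  have h2 := t.v_x s
  have h3 : ‖cnv f (kn κ s.k ξ) (t.x s)‖ * (1 / 4) ≤ 32 * A * σ :=
    le_trans (mul_le_mul_of_nonneg_left h2 (norm_nonneg _)) h1
  unfold TS.M
  have h4 : |rs ρ s ξ| ≤ 1 := t.R.le _
  have := norm_nonneg (cnv f (kn κ s.k ξ) (t.x s))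
  nlinarith

lemma TS.sum_M (t : TS κ κ' ϑ χ' h A ρ P kT nT ξ f σ) :
    ∑ s ∈ P, t.M s ^ 2 * 2 ^ s.k ≤ (128 * A) ^ 2 * (σ ^ 2 * 2 ^ kT) := by
  classical
  have hA := t.K.k1.pos
  set φ : Tile → ℝ → ℂ := fun s => if ξ ∈ s.w2 then
    (fun y => ((v (2 ^ (-s.k) * (t.x s - s.c)) / (32 * A) : ℝ) : ℂ) * kn κ s.k ξ (t.x s - y)) else 0
    with hφ
  have h1 := t.hS kT nT ξ φ (by
    intro s; simp only [hφ]; split_ifs with h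
    · exact t.K.k1.wp_kn χ_supp' h _
    · exact isWP_zero s)
  calc _ ≤ ∑ s ∈ P, if ξ ∈ s.w2 then (128 * A) ^ 2 * (2 ^ s.k * ‖∫ y, f y * φ s y‖ ^ 2) else 0 := by
        refine Finset.sum_le_sum fun s hsP => ?_
        split_ifs with hw
        · have e1 : ∫ y, f y * φ s y = ((v (2 ^ (-s.k) * (t.x s - s.c)) / (32 * A) : ℝ) : ℂ) *
              cnv f (kn κ s.k ξ) (t.x s) := by
            unfold cnv
            rw [← integral_const_mul]; congr 1; ext y; simp only [hφ, if_pos hw]; ring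
          have h2 := t.v_x s
          rw [e1, norm_mul, Complex.norm_real, Real.norm_of_nonneg (by have := v_pos (2 ^ (-s.k) * (t.x s - s.c)); positivity)]
          have h4 : |rs ρ s ξ| ≤ 1 := t.R.le _
          have h5 : t.M s ≤ 128 * A * (v (2 ^ (-s.k) * (t.x s - s.c)) / (32 * A) *
              ‖cnv f (kn κ s.k ξ) (t.x s)‖) := by
            unfold TS.M
            calc _ ≤ 1 * ‖cnv f (kn κ s.k ξ) (t.x s)‖ := by gcongr
              _ ≤ (4 * v (2 ^ (-s.k) * (t.x s - s.c))) * ‖cnv f (kn κ s.k ξ) (t.x s)‖ := by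
                  gcongr; linarith
              _ = _ := by field_simp; ring
          calc _ ≤ (128 * A * (v (2 ^ (-s.k) * (t.x s - s.c)) / (32 * A) *
              ‖cnv f (kn κ s.k ξ) (t.x s)‖)) ^ 2 * 2 ^ s.k := by
                gcongr; exact t.M_nonneg s
            _ = _ := by ring
        · have h0 : rs ρ s ξ = 0 := by by_contra hc; exact hw (t.R.mem_w2 hc)
          unfold TS.M; rw [h0]; simp
    _ = (128 * A) ^ 2 * ∑ s ∈ P.filter (fun s => s.I ⊆ dy kT nT ∧ ξ ∈ s.w2),
          2 ^ s.k * ‖∫ y, f y * φ s y‖ ^ 2 := by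
        rw [← Finset.sum_filter, Finset.mul_sum]
        refine Finset.sum_congr ?_ fun s _ => rfl
        ext s; simp only [Finset.mem_filter]
        constructor
        · rintro ⟨a, b⟩; exact ⟨a, t.T.sub s a, b⟩
        · rintro ⟨a, b, c⟩; exact ⟨a, c⟩
    _ ≤ _ := by gcongr

lemma TS.dec (t : TS κ κ' ϑ χ' h A ρ P kT nT ξ f σ) (s : Tile) :
    Dec s (ps κ κ' ρ ξ f s) (16 * A * t.M s) := by
  have hA := t.K.k2.pos
  have hM := t.M_nonneg s
  refine ⟨continuous_cnv (t.hs_integrable s) (t.K.k2.kn_cont _ _) (t.K.k2.kn_bdd _ _), by positivity,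
    fun x => ?_⟩
  have h1 : ∀ y, ‖hs κ ρ ξ f s y * kn κ' s.k ξ (x - y)‖ ≤
      s.I.indicator (fun _ => t.M s * (A * (16 * w (2 ^ s.k) (x - s.c)))) y := by
    intro y
    rw [norm_mul]
    have h2 := t.hs_le s y
    by_cases hy : y ∈ s.I
    · rw [indicator_of_mem hy] at h2 ⊢
      gcongr
      refine (t.K.k2.kn_decay _ _ _).trans ?_
      gcongr
      apply w_close (two_zpow_pos _)
      rw [sub_sub_sub_cancel_left]
      exact abs_sub_le_of_mem_dy (c_mem s) hy
    · rw [indicator_of_notMem hy] at h2 ⊢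
      have := norm_nonneg (hs κ ρ ξ f s y)
      rw [le_antisymm h2 this, zero_mul]
  unfold ps cnv
  refine (norm_integral_le_of_norm_le ?_ (ae_of_all _ h1)).trans (le_of_eq ?_)
  · refine (integrable_indicator_iff (measurableSet_I s)).2 (integrableOn_const ?_)
    rw [Tile.I, volume_dy]; exact ENNReal.ofReal_ne_top
  · rw [integral_indicator (measurableSet_I s), setIntegral_const, Tile.I, volume_real_dy, smul_eq_mul]
    ring

lemma TS.four (t : TS κ κ' ϑ χ' h A ρ P kT nT ξ f σ) (s : Tile) {η : ℝ}
    (hη : 𝓕 (ps κ κ' ρ ξ f s) η ≠ 0) : rs ρ s ξ ≠ 0 ∧ 1 / 8 ≤ 2 ^ s.k * (ξ - η) ∧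
      2 ^ s.k * (ξ - η) ≤ 1 / 2 := by
  unfold ps at hη
  rw [fourier_cnv (t.hs_integrable s) (t.K.k2.kn_integrable _ _), t.K.k2.kn_four] at hη
  refine ⟨fun h0 => ?_, ?_⟩
  · apply hη
    have : hs κ ρ ξ f s = fun _ => 0 := by
      unfold hs; ext y; simp [h0, indicator]
    rw [this, fourier_eq_e]; simp
  · have := right_ne_zero_of_mul hη
    exact t.K.supp _ (by exact_mod_cast this)

lemma TS.four_bdd (t : TS κ κ' ϑ χ' h A ρ P kT nT ξ f σ) (s : Tile) {η : ℝ}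
    (hη : 𝓕 (ps κ κ' ρ ξ f s) η ≠ 0) : η ∈ Icc (ξ - 2 ^ (-s.k)) ξ := by
  obtain ⟨-, h1, h2⟩ := t.four s hη
  have hp := two_zpow_pos s.k
  have e1 : (2:ℝ) ^ s.k * 2 ^ (-s.k) = 1 := by rw [zpow_neg]; field_simp
  constructor
  · by_contra hc; push Not at hc
    have : 2 ^ s.k * 2 ^ (-s.k) < 2 ^ s.k * (ξ - η) := by gcongr; linarith
    linarith
  · by_contra hc; push Not at hc
    have := mul_pos hp (sub_pos.2 hc)
    linarith

lemma TS.bessel (t : TS κ κ' ϑ χ' h A ρ P kT nT ξ f σ) :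
    Integrable (fun y => ‖∑ s ∈ P, ps κ κ' ρ ξ f s y‖ ^ 2) ∧
    ∫ y, ‖∑ s ∈ P, ps κ κ' ρ ξ f s y‖ ^ 2 ≤
      2048 * π ^ 2 * ((16 * A) ^ 2 * ((128 * A) ^ 2 * (σ ^ 2 * 2 ^ kT))) := by
  refine ⟨(norm_sq_sum_le P (fun s => ps κ κ' ρ ξ f s) _ (fun s _ => t.dec s)).1, ?_⟩
  have := bessel_gen P (fun s => ps κ κ' ρ ξ f s) _ (fun s _ => t.dec s) (fun _ => ∅) (fun s _ => Finset.empty_subset _)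
    (fun s hs s' hs' hk hl => absurd (t.T.same_l hs hs' hk) hl) ?_
  · refine this.trans ?_
    simp only [Finset.sum_empty, Finset.sum_const_zero, mul_zero, add_zero]
    gcongr
    refine le_trans (le_of_eq ?_) (mul_le_mul_of_nonneg_left t.sum_M (sq_nonneg (16 * A)))
    rw [Finset.mul_sum]
    exact Finset.sum_congr rfl fun s _ => by ring
  · intro s hs s' hs' hk _
    refine parseval_zero (t.dec s).cont (t.dec s).integrable (fun η hη => t.four_bdd s hη)
      (t.dec s').integrable ?_
    intro η hη
    by_contra hc
    obtain ⟨a0, a1, a2⟩ := t.four s hη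
    obtain ⟨b0, b1, b2⟩ := t.four s' hc
    have c1 := t.R.mem_w2 a0
    have c2 := t.R.mem_w2 b0
    exact (w1_disjoint_of_mem_w2 c1 c2 hk.ne').le_bot ⟨mem_w1_of_mult c1 a1 a2, mem_w1_of_mult c2 b1 b2⟩

end
end CH

namespace CH
section
variable {κ κ' ϑ : ℝ → ℂ} {χ' h : ℝ → ℝ} {A : ℝ} {ρ : ℝ → ℝ} {P : Finset Tile} {kT nT : ℤ}
  {ξ : ℝ} {f : ℝ → ℂ} {σ : ℝ}

lemma IsTree.kdisj (T : IsTree P kT nT ξ) {s t : Tile} (hs : s ∈ P) (ht : t ∈ P) (hk : s.k = t.k)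
    (hne : s ≠ t) : Disjoint s.I t.I := by
  rw [Set.disjoint_left]
  intro x hx hx'
  exact hne (tile_eq hk hx hx' (T.fr s hs) (T.fr t ht))

/-- the full sum of packets -/
noncomputable def HH (κ κ' : ℝ → ℂ) (ρ : ℝ → ℝ) (ξ : ℝ) (f : ℝ → ℂ) (P : Finset Tile) (y : ℝ) : ℂ :=
  ∑ s ∈ P, ps κ κ' ρ ξ f s y

lemma TS.ps_int (t : TS κ κ' ϑ χ' h A ρ P kT nT ξ f σ) (s : Tile) (a : ℤ) (x : ℝ) :
    Integrable (fun y => ps κ κ' ρ ξ f s y * kn ϑ a ξ (x - y)) :=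
  t.K.k3.int_cnv (t.dec s).integrable _ _ _

lemma TS.edge (t : TS κ κ' ϑ χ' h A ρ P kT nT ξ f σ) {k a : ℤ} (hk : k ≤ a) (x : ℝ) :
    ‖∑ s ∈ P.filter (fun s => s.k = k), cnv (ps κ κ' ρ ξ f s) (kn ϑ a ξ) x‖ ≤
      2 ^ 22 * π ^ 2 * A ^ 3 * σ := by
  have hA := t.K.k1.pos
  have hσ := t.hσ
  have hpa := two_zpow_pos a
  have hle : (2:ℝ) ^ k ≤ 2 ^ a := zpow_le_zpow_right₀ (by norm_num) hk
  calc _ ≤ ∑ s ∈ P.filter (fun s => s.k = k),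
        (2 ^ 18 * π * A ^ 3 * σ) * (2 ^ s.k * w (2 ^ a) (x - s.c)) := by
        refine norm_sum_le_of_le _ fun s hs => ?_
        obtain ⟨hsP, hsk⟩ := Finset.mem_filter.1 hs
        have hM := t.M_le hsP
        have hM0 := t.M_nonneg s
        have hpk := two_zpow_pos s.k
        have h1 : ∀ y, ‖ps κ κ' ρ ξ f s y * kn ϑ a ξ (x - y)‖ ≤
            (16 * A * t.M s * 2 ^ s.k * A) * (w (2 ^ a) (x - y) * w (2 ^ s.k) (y - s.c)) := by
          intro y
          rw [norm_mul]
          refine (mul_le_mul ((t.dec s).decay y) (t.K.k3.kn_decay a ξ (x - y)) (norm_nonneg _)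
            (by have := w_nonneg hpk (y - s.c); positivity)).trans (le_of_eq (by ring))
        unfold cnv
        refine (norm_integral_le_of_norm_le ((integrable_w_mul hpa hpk _ _).const_mul _)
          (ae_of_all _ h1)).trans ?_
        rw [integral_const_mul]
        have hw := w_nonneg hpa (x - s.c)
        calc _ ≤ (16 * A * (128 * A * σ) * 2 ^ s.k * A) * (128 * π * w (2 ^ a) (x - s.c)) := by
              refine mul_le_mul (by gcongr)
                (integral_w_mul_le hpk (by rw [hsk]; exact hle) _ _)
                (integral_nonneg fun y => mul_nonneg (w_nonneg hpa _) (w_nonneg hpk _)) (by positivity)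
          _ = _ := by ring
    _ = (2 ^ 18 * π * A ^ 3 * σ) * ∑ s ∈ P.filter (fun s => s.k = k),
          2 ^ s.k * w (2 ^ a) (x - s.c) := by rw [Finset.mul_sum]
    _ ≤ (2 ^ 18 * π * A ^ 3 * σ) * (16 * π) := by
        gcongr
        refine sum_w_le_pi _ (fun s hs u hu hne => ?_) (fun s hs => ?_) x
        · obtain ⟨a1, a2⟩ := Finset.mem_filter.1 hs
          obtain ⟨b1, b2⟩ := Finset.mem_filter.1 hu
          exact t.T.kdisj a1 b1 (a2.trans b2.symm) hne
        · rw [(Finset.mem_filter.1 hs).2]; exact hk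
    _ = _ := by ring

lemma TS.tele_hi (t : TS κ κ' ϑ χ' h A ρ P kT nT ξ f σ) (s : Tile) {a : ℤ} (hk : a < s.k) (x : ℝ) :
    cnv (ps κ κ' ρ ξ f s) (kn ϑ a ξ) x = ps κ κ' ρ ξ f s x := by
  refine cnv_eq_self (t.dec s).cont (t.dec s).integrable (fun η hη => t.four_bdd s hη)
    (t.K.k3.kn_integrable _ _) (fun η hη => ?_) x
  obtain ⟨-, h1, h2⟩ := t.four s hη
  rw [t.K.k3.kn_four, t.K.h1, Complex.ofReal_one]
  have hle : (2:ℝ) * 2 ^ a ≤ 2 ^ s.k := by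
    rw [← zpow_one_add₀ two_ne_zero]; exact zpow_le_zpow_right₀ (by norm_num) (by omega)
  have hpa := two_zpow_pos a
  have hpk := two_zpow_pos s.k
  have h3 : 0 < ξ - η := by
    by_contra hc; push Not at hc
    have := mul_nonpos_of_nonneg_of_nonpos hpk.le hc; linarith
  rw [abs_of_pos (by positivity)]
  nlinarith

lemma TS.tele_lo (t : TS κ κ' ϑ χ' h A ρ P kT nT ξ f σ) (s : Tile) {a : ℤ} (hk : s.k ≤ a - 2) (x : ℝ) :
    cnv (ps κ κ' ρ ξ f s) (kn ϑ a ξ) x = 0 := by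
  refine cnv_eq_zero (t.dec s).cont (t.dec s).integrable (fun η hη => t.four_bdd s hη)
    (t.K.k3.kn_integrable _ _) (fun η hη => ?_) x
  obtain ⟨-, h1, h2⟩ := t.four s hη
  rw [t.K.k3.kn_four, t.K.h0, Complex.ofReal_zero]
  have hle : (4:ℝ) * 2 ^ s.k ≤ 2 ^ a := by
    rw [show (4:ℝ) = 2 ^ (2:ℤ) by norm_num, ← zpow_add₀ two_ne_zero]
    exact zpow_le_zpow_right₀ (by norm_num) (by omega)
  have hpa := two_zpow_pos a
  have hpk := two_zpow_pos s.k
  have h3 : 0 < ξ - η := by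
    by_contra hc; push Not at hc
    have := mul_nonpos_of_nonneg_of_nonpos hpk.le hc; linarith
  rw [abs_of_pos (by positivity)]
  nlinarith

lemma TS.HH_cont (t : TS κ κ' ϑ χ' h A ρ P kT nT ξ f σ) : Continuous (HH κ κ' ρ ξ f P) := by
  unfold HH; exact continuous_finsetSum _ fun s _ => (t.dec s).cont

lemma TS.HH_bdd (t : TS κ κ' ϑ χ' h A ρ P kT nT ξ f σ) (y : ℝ) :
    ‖HH κ κ' ρ ξ f P y‖ ≤ ∑ s ∈ P, 16 * A * t.M s := by
  unfold HH; exact norm_sum_le_of_le _ fun s _ => (t.dec s).le y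

lemma TS.HHw_int (t : TS κ κ' ϑ χ' h A ρ P kT nT ξ f σ) (a : ℤ) (x : ℝ) :
    Integrable (fun y => ‖HH κ κ' ρ ξ f P y‖ * w (2 ^ a) (x - y)) := by
  refine Integrable.bdd_mul (c := ∑ s ∈ P, 16 * A * t.M s) (integrable_w_sub' (two_zpow_pos a) x)
    t.HH_cont.norm.aestronglyMeasurable (ae_of_all _ fun y => ?_)
  rw [norm_norm]; exact t.HH_bdd y

lemma TS.tele (t : TS κ κ' ϑ χ' h A ρ P kT nT ξ f σ) (a : ℤ) (x : ℝ) :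
    ‖∑ s ∈ P.filter (fun s => a < s.k), ps κ κ' ρ ξ f s x‖ ≤
      A * (∫ y, ‖HH κ κ' ρ ξ f P y‖ * w (2 ^ a) (x - y)) + 2 ^ 23 * π ^ 2 * A ^ 3 * σ := by
  have hA := t.K.k1.pos
  have e1 : cnv (HH κ κ' ρ ξ f P) (kn ϑ a ξ) x = ∑ s ∈ P, cnv (ps κ κ' ρ ξ f s) (kn ϑ a ξ) x := by
    unfold cnv HH
    simp_rw [Finset.sum_mul]
    exact integral_finsetSum _ fun s _ => t.ps_int s a x
  have e2 : ∑ s ∈ P, cnv (ps κ κ' ρ ξ f s) (kn ϑ a ξ) x =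
      ∑ s ∈ P.filter (fun s => a < s.k), ps κ κ' ρ ξ f s x +
      (∑ s ∈ P.filter (fun s => s.k = a), cnv (ps κ κ' ρ ξ f s) (kn ϑ a ξ) x +
       ∑ s ∈ P.filter (fun s => s.k = a - 1), cnv (ps κ κ' ρ ξ f s) (kn ϑ a ξ) x) := by
    simp only [Finset.sum_filter]
    rw [← Finset.sum_add_distrib, ← Finset.sum_add_distrib]
    refine Finset.sum_congr rfl fun s _ => ?_
    rcases lt_trichotomy s.k a with h1 | h1 | h1
    · rw [if_neg (by omega), if_neg (by omega)]
      by_cases h2 : s.k = a - 1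
      · rw [if_pos h2]; ring
      · rw [if_neg h2, t.tele_lo s (by omega)]; ring
    · rw [if_neg (by omega), if_pos h1, if_neg (by omega)]; ring
    · rw [if_pos h1, if_neg (by omega), if_neg (by omega), t.tele_hi s h1]; ring
  have e3 := t.edge (le_refl a) x
  have e4 := t.edge (show a - 1 ≤ a by omega) x
  have e5 : ‖cnv (HH κ κ' ρ ξ f P) (kn ϑ a ξ) x‖ ≤ A * ∫ y, ‖HH κ κ' ρ ξ f P y‖ * w (2 ^ a) (x - y) := by
    rw [← integral_const_mul]
    unfold cnv
    refine norm_integral_le_of_norm_le ((t.HHw_int a x).const_mul A) (ae_of_all _ fun y => ?_)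
    rw [norm_mul]
    have := t.K.k3.kn_decay a ξ (x - y)
    calc _ ≤ ‖HH κ κ' ρ ξ f P y‖ * (A * w (2 ^ a) (x - y)) := by gcongr
      _ = _ := by ring
  rw [e1, e2] at e5
  set X := ∑ s ∈ P.filter (fun s => a < s.k), ps κ κ' ρ ξ f s x
  set Y := ∑ s ∈ P.filter (fun s => s.k = a), cnv (ps κ κ' ρ ξ f s) (kn ϑ a ξ) x
  set Z := ∑ s ∈ P.filter (fun s => s.k = a - 1), cnv (ps κ κ' ρ ξ f s) (kn ϑ a ξ) x
  have e6 : ‖X‖ ≤ ‖X + (Y + Z)‖ + (‖Y‖ + ‖Z‖) := by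
    calc ‖X‖ = ‖(X + (Y + Z)) - (Y + Z)‖ := by congr 1; ring
      _ ≤ _ := (norm_sub_le _ _).trans (by gcongr; exact norm_add_le _ _)
  linarith

end
end CH

namespace CH
section
variable {κ κ' ϑ : ℝ → ℂ} {χ' h : ℝ → ℝ} {A : ℝ} {ρ : ℝ → ℝ} {P : Finset Tile} {kT nT : ℤ}
  {ξ : ℝ} {f : ℝ → ℂ} {σ : ℝ}

lemma TS.cnv_le (t : TS κ κ' ϑ χ' h A ρ P kT nT ξ f σ) {s : Tile} (hs : s ∈ P) {N x : ℝ}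
    (hx : x ∈ s.I) (hN : N ∈ s.w2) : ‖cnv f (kn κ s.k N) x‖ ≤ 128 * A * σ := by
  have h1 := t.K.k1.size_cnv χ_supp' t.hσ t.hS hs hN x
  have h2 := v_ge_of_mem hx
  have := norm_nonneg (cnv f (kn κ s.k N) x)
  nlinarith

lemma TS.rs_lip (t : TS κ κ' ϑ χ' h A ρ P kT nT ξ f σ) (s : Tile) (N N' : ℝ) :
    |rs ρ s N - rs ρ s N'| ≤ 17 * (2 ^ s.k * |N - N'|) := by
  unfold rs
  refine (t.R.lip _ _).trans (le_of_eq ?_)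
  rw [show (2:ℝ) ^ s.k * N - s.l - (2 ^ s.k * N' - s.l) = 2 ^ s.k * (N - N') by ring, abs_mul,
    abs_of_pos (two_zpow_pos _)]

lemma TS.diffN (t : TS κ κ' ϑ χ' h A ρ P kT nT ξ f σ) {s : Tile} (hs : s ∈ P) {N x : ℝ}
    (hx : x ∈ s.I) : ‖(rs ρ s N : ℂ) * cnv f (kn κ s.k N) x - rs ρ s ξ * cnv f (kn κ s.k ξ) x‖ ≤
      17408 * A * σ * (2 ^ s.k * |N - ξ|) := by
  have hA := t.K.k1.pos
  have hσ := t.hσ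
  have hpk := two_zpow_pos s.k
  have hl := t.rs_lip s N ξ
  have hz : 0 ≤ A * σ * (2 ^ s.k * |N - ξ|) := by positivity
  by_cases hN : rs ρ s N = 0
  · by_cases hξ : rs ρ s ξ = 0
    · simp only [hN, hξ, Complex.ofReal_zero, zero_mul, sub_zero, norm_zero]; linarith
    · have hc := t.cnv_le hs hx (t.R.mem_w2 hξ)
      rw [hN, Complex.ofReal_zero, zero_mul, zero_sub, norm_neg, norm_mul, Complex.norm_real,
        Real.norm_eq_abs]
      rw [hN, zero_sub, abs_neg] at hl
      have := mul_le_mul hl hc (norm_nonneg _) (by positivity)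
      nlinarith
  · have hNw := t.R.mem_w2 hN
    by_cases hξ : rs ρ s ξ = 0
    · have hc := t.cnv_le hs hx hNw
      rw [hξ, Complex.ofReal_zero, zero_mul, sub_zero, norm_mul, Complex.norm_real,
        Real.norm_eq_abs]
      rw [hξ, sub_zero] at hl
      have := mul_le_mul hl hc (norm_nonneg _) (by positivity)
      nlinarith
    · have hξw := t.R.mem_w2 hξ
      have hc := t.cnv_le hs hx hξw
      have hd := t.K.k1.size_diff χ_supp' t.hf t.hσ t.hS hs hNw hξw x
      have hv := v_ge_of_mem hx
      have hd' : ‖cnv f (kn κ s.k N) x - cnv f (kn κ s.k ξ) x‖ ≤ 15232 * A * σ * (2 ^ s.k * |N - ξ|) := by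
        have := norm_nonneg (cnv f (kn κ s.k N) x - cnv f (kn κ s.k ξ) x)
        nlinarith
      have e : (rs ρ s N : ℂ) * cnv f (kn κ s.k N) x - rs ρ s ξ * cnv f (kn κ s.k ξ) x =
        rs ρ s N * (cnv f (kn κ s.k N) x - cnv f (kn κ s.k ξ) x) +
          ((rs ρ s N - rs ρ s ξ : ℝ) : ℂ) * cnv f (kn κ s.k ξ) x := by push_cast; ring
      rw [e]
      refine (norm_add_le _ _).trans ?_
      rw [norm_mul, norm_mul, Complex.norm_real, Complex.norm_real, Real.norm_eq_abs, Real.norm_eq_abs]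
      have a1 := mul_le_mul (t.R.le (2 ^ s.k * N - s.l)) hd' (norm_nonneg _) zero_le_one
      have a2 := mul_le_mul hl hc (norm_nonneg _) (by positivity)
      unfold rs at *
      nlinarith

lemma TS.step2 (t : TS κ κ' ϑ χ' h A ρ P kT nT ξ f σ) {s : Tile} (hsP : s ∈ P) {x z : ℝ}
    (hx : x ∈ s.I) (hz : |x - z| ≤ 2 ^ s.k) :
    ‖(rs ρ s ξ : ℂ) * cnv f (kn κ s.k ξ) x - ∑ u ∈ P.filter (fun u => u.k = s.k), ps κ κ' ρ ξ f u x‖ ≤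
      8192 * A ^ 2 * σ * ∫ y in (dset P s.k)ᶜ, w (2 ^ s.k) (z - y) := by
  have hA := t.K.k1.pos
  have hσ := t.hσ
  have hpk := two_zpow_pos s.k
  have hw0 : 0 ≤ ∫ y in (dset P s.k)ᶜ, w (2 ^ s.k) (z - y) :=
    integral_nonneg fun y => w_nonneg hpk _
  have hrs : ∀ u ∈ P.filter (fun u => u.k = s.k), rs ρ u ξ = rs ρ s ξ := by
    intro u hu
    obtain ⟨a1, a2⟩ := Finset.mem_filter.1 hu
    unfold rs; rw [a2, t.T.same_l a1 hsP a2]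
  by_cases h0 : rs ρ s ξ = 0
  · have : ∑ u ∈ P.filter (fun u => u.k = s.k), ps κ κ' ρ ξ f u x = 0 := by
      refine Finset.sum_eq_zero fun u hu => ?_
      have := hrs u hu
      unfold ps cnv hs
      rw [this, h0]; simp
    rw [this, h0]; simp; positivity
  have hw2 := t.R.mem_w2 h0
  set g := cnv f (kn κ s.k ξ) with hg
  -- reproducing
  have e1 : g x = ∫ y, g y * kn κ' s.k ξ (x - y) := by
    refine (cnv_eq_self (t.cont s.k ξ) (t.integrable s.k ξ) (a := ξ - 2 ^ (-s.k)) (b := ξ) ?_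
      (t.K.k2.kn_integrable s.k ξ) ?_ x).symm
    · intro η hη
      rw [fourier_cnv t.hf (t.K.k1.kn_integrable _ _), t.K.k1.kn_four] at hη
      have h2 : χ (2 ^ s.k * (ξ - η)) ≠ 0 := by
        have := right_ne_zero_of_mul hη; exact_mod_cast this
      obtain ⟨h3, h4⟩ := χ_supp h2
      have e1 : (2:ℝ) ^ s.k * 2 ^ (-s.k) = 1 := by rw [zpow_neg]; field_simp
      constructor
      · by_contra hc; push Not at hc
        have : 2 ^ s.k * 2 ^ (-s.k) < 2 ^ s.k * (ξ - η) := by gcongr; linarith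
        linarith
      · by_contra hc; push Not at hc
        have := mul_pos hpk (sub_pos.2 hc)
        linarith
    · intro η hη
      rw [fourier_cnv t.hf (t.K.k1.kn_integrable _ _), t.K.k1.kn_four] at hη
      have h2 : χ (2 ^ s.k * (ξ - η)) ≠ 0 := by
        have := right_ne_zero_of_mul hη; exact_mod_cast this
      obtain ⟨h3, h4⟩ := χ_supp h2
      rw [t.K.k2.kn_four, t.K.one _ h3 h4, Complex.ofReal_one]
  have i1 : Integrable (fun y => g y * kn κ' s.k ξ (x - y)) :=
    t.K.k2.int_cnv (t.integrable s.k ξ) _ _ _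
  have e2 : (rs ρ s ξ : ℂ) * g x - ∑ u ∈ P.filter (fun u => u.k = s.k), ps κ κ' ρ ξ f u x =
      ∫ y, ((rs ρ s ξ : ℂ) * (g y * kn κ' s.k ξ (x - y)) -
        ∑ u ∈ P.filter (fun u => u.k = s.k), hs κ ρ ξ f u y * kn κ' s.k ξ (x - y)) := by
    have i2 : ∀ u, Integrable (fun y => hs κ ρ ξ f u y * kn κ' s.k ξ (x - y)) := fun u =>
      t.K.k2.int_cnv (t.hs_integrable u) _ _ _
    rw [integral_sub (i1.const_mul _) (integrable_finsetSum _ fun u _ => i2 u), integral_const_mul,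
      ← e1, integral_finsetSum _ fun u _ => i2 u]
    congr 1
    refine Finset.sum_congr rfl fun u hu => ?_
    unfold ps cnv; rw [(Finset.mem_filter.1 hu).2]
  rw [e2, ← integral_const_mul, ← integral_indicator (measurableSet_dset P s.k).compl]
  refine norm_integral_le_of_norm_le ?_ (ae_of_all _ fun y => ?_)
  · exact ((integrable_w_sub' hpk z).const_mul _).indicator (measurableSet_dset P s.k).compl
  by_cases hy : y ∈ dset P s.k
  · rw [indicator_of_notMem (by simpa using hy)]
    obtain ⟨u, hu, huk, hyu⟩ := mem_dset.1 hy
    rw [Finset.sum_eq_single_of_mem u (Finset.mem_filter.2 ⟨hu, huk⟩)]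
    · have hu' := hrs u (Finset.mem_filter.2 ⟨hu, huk⟩)
      unfold hs
      rw [indicator_of_mem hyu, hu', huk, ← hg]
      rw [mul_assoc, sub_self, norm_zero]
    · intro u' hu' hne
      obtain ⟨a1, a2⟩ := Finset.mem_filter.1 hu'
      have := t.T.kdisj a1 hu (a2.trans huk.symm) hne
      unfold hs
      rw [indicator_of_notMem (fun hc => (Set.disjoint_left.1 this hc hyu)), zero_mul]
  · rw [indicator_of_mem (by simpa using hy)]
    rw [Finset.sum_eq_zero, sub_zero]
    swap
    · intro u hu
      obtain ⟨a1, a2⟩ := Finset.mem_filter.1 hu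
      unfold hs
      rw [indicator_of_notMem (fun hc => hy (mem_dset.2 ⟨u, a1, a2, hc⟩)), zero_mul]
    rw [norm_mul, Complex.norm_real, Real.norm_eq_abs, norm_mul, norm_kn]
    have b1 := t.K.k1.size_cnv χ_supp' t.hσ t.hS hsP hw2 y
    rw [← hg] at b1
    have b2 := t.K.k2.decay2 (2 ^ (-s.k) * (x - y))
    have b3 : v (2 ^ (-s.k) * (x - y)) ≤ 16 * v (2 ^ (-s.k) * (y - s.c)) := by
      rw [← v_neg (2 ^ (-s.k) * (y - s.c))]
      apply v_close
      rw [show (2:ℝ) ^ (-s.k) * (x - y) - -(2 ^ (-s.k) * (y - s.c)) = 2 ^ (-s.k) * (x - s.c) by ring,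
        abs_mul, abs_of_pos (two_zpow_pos _), zpow_neg, inv_mul_le_iff₀ hpk, mul_one]
      exact abs_sub_le_of_mem_dy hx (c_mem s)
    have b4 : w (2 ^ s.k) (x - y) ≤ 16 * w (2 ^ s.k) (z - y) := by
      apply w_close hpk; rw [sub_sub_sub_cancel_right]; exact hz
    rw [w_zpow] at b4
    set V := v (2 ^ (-s.k) * (x - y)) with hV
    set U := v (2 ^ (-s.k) * (y - s.c)) with hU
    have hV0 : 0 < V := v_pos _
    have hU0 : 0 < U := v_pos _
    have hq := two_zpow_pos (-s.k)
    calc |rs ρ s ξ| * (‖g y‖ * (2 ^ (-s.k) * ‖κ' (2 ^ (-s.k) * (x - y))‖))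
        ≤ 1 * (‖g y‖ * (2 ^ (-s.k) * (A * V ^ 2))) := by
          gcongr; exact t.R.le _
      _ = (‖g y‖ * V) * (A * (2 ^ (-s.k) * V)) := by ring
      _ ≤ (‖g y‖ * (16 * U)) * (A * (16 * w (2 ^ s.k) (z - y))) := by gcongr
      _ = (‖g y‖ * U) * (256 * A * w (2 ^ s.k) (z - y)) := by ring
      _ ≤ (32 * A * σ) * (256 * A * w (2 ^ s.k) (z - y)) := by
          have := w_nonneg hpk (z - y)
          gcongr
      _ = _ := by ring

end
end CH

namespace CH
section
variable {κ κ' ϑ : ℝ → ℂ} {χ' h : ℝ → ℝ} {A : ℝ} {ρ : ℝ → ℝ} {P : Finset Tile} {kT nT : ℤ}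
  {ξ : ℝ} {f : ℝ → ℂ} {σ : ℝ}

/-- averages of the packet sum -/
noncomputable def AvH (κ κ' : ℝ → ℂ) (ρ : ℝ → ℝ) (ξ : ℝ) (f : ℝ → ℂ) (P : Finset Tile) (a : ℤ) (x : ℝ) : ℝ :=
  ∫ y, ‖HH κ κ' ρ ξ f P y‖ * w (2 ^ a) (x - y)

lemma TS.AvH_nonneg (a : ℤ) (x : ℝ) : 0 ≤ AvH κ κ' ρ ξ f P a x :=
  integral_nonneg fun y => mul_nonneg (norm_nonneg _) (w_nonneg (two_zpow_pos _) _)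

lemma TS.AvH_close (t : TS κ κ' ϑ χ' h A ρ P kT nT ξ f σ) {a : ℤ} {x z : ℝ} (hx : |x - z| ≤ 2 ^ a) :
    AvH κ κ' ρ ξ f P a x ≤ 16 * AvH κ κ' ρ ξ f P a z := by
  unfold AvH
  rw [← integral_const_mul]
  refine integral_mono (t.HHw_int a x) ((t.HHw_int a z).const_mul _) fun y => ?_
  have : w (2 ^ a) (x - y) ≤ 16 * w (2 ^ a) (z - y) := by
    apply w_close (two_zpow_pos _); rw [sub_sub_sub_cancel_right]; exact hx
  calc _ ≤ ‖HH κ κ' ρ ξ f P y‖ * (16 * w (2 ^ a) (z - y)) := by gcongr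
    _ = _ := by ring

lemma IsTree.jk (T : IsTree P kT nT ξ) {J s : Tile} (hJ : J ∈ jset P ξ) (hs : s ∈ P) {x : ℝ}
    (hx : x ∈ J.I) (hxs : x ∈ s.I) : J.k < s.k ∧ J.I ⊆ s.I := by
  obtain ⟨a1, a2, u, hu, huk, huI⟩ := mem_jset.1 hJ
  have h1 : J.k < s.k := by
    by_contra hc; push Not at hc
    exact a1 (T.mid hs hu hxs (huI hx) hx a2 hc (by omega))
  exact ⟨h1, I_subset_of_le h1.le hx hxs⟩

lemma TS.pw (t : TS κ κ' ϑ χ' h A ρ P kT nT ξ f σ) {J : Tile} (hJ : J ∈ jset P ξ) {x : ℝ}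
    (hx : x ∈ J.I) (N : ℝ) (S : Finset Tile) (hSm : ∀ s, s ∈ S ↔ s ∈ P ∧ x ∈ s.I ∧ N ∈ s.Om) :
    ∃ b, J.k ≤ b ∧ b ≤ kT ∧ ‖∑ s ∈ S, (rs ρ s N : ℂ) * cnv f (kn κ s.k N) x‖ ≤
      (34816 * A + 2 ^ 24 * π ^ 2 * A ^ 3) * σ + 8192 * A ^ 2 * σ * Berr P J +
        16 * A * (AvH κ κ' ρ ξ f P J.k J.c + AvH κ κ' ρ ξ f P b J.c) := by
  classical
  have hA := t.K.k1.pos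
  have hσ := t.hσ
  have hB0 : 0 ≤ Berr P J := Finset.sum_nonneg fun s _ => integral_nonneg fun y =>
    w_nonneg (two_zpow_pos _) _
  have hxJ : |x - J.c| ≤ 2 ^ J.k := abs_sub_le_of_mem_dy hx (c_mem J)
  rcases S.eq_empty_or_nonempty with hS | hS
  · refine ⟨J.k, le_rfl, dy_scale_le_of_subset (t.T.jsub hJ), ?_⟩
    rw [hS, Finset.sum_empty, norm_zero]
    have := TS.AvH_nonneg (κ := κ) (κ' := κ') (ρ := ρ) (ξ := ξ) (f := f) (P := P) J.k J.c
    positivity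
  obtain ⟨m, hm, hmax⟩ := Finset.exists_max_image S (fun s => s.k) hS
  obtain ⟨hmP, hxm, hNm⟩ := (hSm m).1 hm
  set b := m.k with hb
  have hJb := t.T.jk hJ hmP hx hxm
  refine ⟨b, hJb.1.le, dy_scale_le_of_subset (t.T.sub m hmP), ?_⟩
  have hSm' : ∀ s, s ∈ S ↔ s ∈ P ∧ x ∈ s.I ∧ s.k ≤ b := by
    intro s
    rw [hSm]
    constructor
    · rintro ⟨a1, a2, a3⟩; exact ⟨a1, a2, hmax s ((hSm s).2 ⟨a1, a2, a3⟩)⟩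
    · rintro ⟨a1, a2, a3⟩
      exact ⟨a1, a2, (tile_le a3 a2 hxm (t.T.fr s a1) (t.T.fr m hmP)).2 hNm⟩
  have hNξ : |N - ξ| ≤ 2 ^ (-b) := abs_sub_le_of_mem_dy hNm (t.T.fr m hmP)
  -- first replacement
  have s1 : ‖∑ s ∈ S, ((rs ρ s N : ℂ) * cnv f (kn κ s.k N) x - rs ρ s ξ * cnv f (kn κ s.k ξ) x)‖ ≤
      34816 * A * σ := by
    calc _ ≤ ∑ s ∈ S, 17408 * A * σ * 2 ^ (-b) * 2 ^ s.k := by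
          refine norm_sum_le_of_le _ fun s hs => ?_
          obtain ⟨a1, a2, a3⟩ := (hSm' s).1 hs
          refine (t.diffN a1 a2).trans ?_
          have := two_zpow_pos s.k
          calc _ ≤ 17408 * A * σ * (2 ^ s.k * 2 ^ (-b)) := by gcongr
            _ = _ := by ring
      _ = 17408 * A * σ * 2 ^ (-b) * ∑ k ∈ S.image (fun s => s.k), (2:ℝ) ^ k := by
          rw [← Finset.mul_sum, Finset.sum_image]
          intro s hs u hu hk
          obtain ⟨a1, a2, a3⟩ := (hSm' s).1 hs
          obtain ⟨b1, b2, b3⟩ := (hSm' u).1 hu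
          exact tile_eq hk a2 b2 (t.T.fr s a1) (t.T.fr u b1)
      _ ≤ 17408 * A * σ * 2 ^ (-b) * (2 * 2 ^ b) := by
          gcongr
          apply sum_zpow_le
          intro k hk
          obtain ⟨s, hs, rfl⟩ := Finset.mem_image.1 hk
          exact hmax s hs
      _ = _ := by
          have e1 : (2:ℝ) ^ (-b) * 2 ^ b = 1 := by rw [← zpow_add₀ two_ne_zero]; simp
          linear_combination (34816 * A * σ) * e1
  -- second replacement
  have s2 : ‖∑ s ∈ S, ((rs ρ s ξ : ℂ) * cnv f (kn κ s.k ξ) x -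
      ∑ u ∈ P.filter (fun u => u.k = s.k), ps κ κ' ρ ξ f u x)‖ ≤ 8192 * A ^ 2 * σ * Berr P J := by
    calc _ ≤ ∑ s ∈ S, 8192 * A ^ 2 * σ * ∫ y in (dset P s.k)ᶜ, w (2 ^ s.k) (J.c - y) := by
          refine norm_sum_le_of_le _ fun s hs => ?_
          obtain ⟨a1, a2, a3⟩ := (hSm' s).1 hs
          refine t.step2 a1 a2 (hxJ.trans ?_)
          exact zpow_le_zpow_right₀ (by norm_num) (t.T.jk hJ a1 hx a2).1.le
      _ ≤ _ := by
          rw [← Finset.mul_sum]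
          unfold Berr
          refine mul_le_mul_of_nonneg_left ?_ (by positivity)
          refine Finset.sum_le_sum_of_subset_of_nonneg (fun s hs => ?_) fun s _ _ =>
            integral_nonneg fun y => w_nonneg (two_zpow_pos _) _
          obtain ⟨a1, a2, a3⟩ := (hSm' s).1 hs
          exact Finset.mem_filter.2 ⟨a1, (t.T.jk hJ a1 hx a2).2⟩
  -- telescoping
  have s3 : ∑ s ∈ S, ∑ u ∈ P.filter (fun u => u.k = s.k), ps κ κ' ρ ξ f u x =
      ∑ s ∈ P.filter (fun s => J.k < s.k), ps κ κ' ρ ξ f s x -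
      ∑ s ∈ P.filter (fun s => b < s.k), ps κ κ' ρ ξ f s x := by
    simp only [Finset.sum_filter]
    rw [Finset.sum_comm, ← Finset.sum_sub_distrib]
    refine Finset.sum_congr rfl fun u hu => ?_
    by_cases h1 : J.k < u.k ∧ u.k ≤ b
    · rw [if_pos h1.1, if_neg (by omega), sub_zero]
      obtain ⟨a1, a2, q, hq, hqk, hqI⟩ := mem_jset.1 hJ
      have htl : tl ξ u.k x ∈ P := t.T.mid hq hmP (hqI hx) hxm (mem_tl_I _ _ _) (mem_tl_Om _ _ _)
        (by show q.k ≤ u.k; omega) h1.2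
      rw [Finset.sum_eq_single_of_mem (tl ξ u.k x) ((hSm' _).2 ⟨htl, mem_tl_I _ _ _, h1.2⟩)]
      · exact if_pos rfl
      · intro s hs hne
        obtain ⟨c1, c2, c3⟩ := (hSm' s).1 hs
        rw [if_neg]
        intro hk
        exact hne (tile_eq hk.symm c2 (mem_tl_I _ _ _) (t.T.fr s c1) (mem_tl_Om _ _ _))
    · rw [Finset.sum_eq_zero]
      · by_cases h2 : J.k < u.k
        · rw [if_pos h2, if_pos (by by_contra hc; exact h1 ⟨h2, by omega⟩), sub_self]
        · rw [if_neg h2, if_neg (by have := hJb.1; omega), sub_self]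
      · intro s hs
        obtain ⟨c1, c2, c3⟩ := (hSm' s).1 hs
        rw [if_neg]
        intro hk
        exact h1 ⟨hk ▸ (t.T.jk hJ c1 hx c2).1, hk ▸ c3⟩
  have t1 := t.tele J.k x
  have t2 := t.tele b x
  have t3 := t.AvH_close hxJ
  have t4 := t.AvH_close (hxJ.trans (zpow_le_zpow_right₀ (by norm_num) hJb.1.le) : |x - J.c| ≤ 2 ^ b)
  change _ ≤ A * AvH κ κ' ρ ξ f P J.k x + _ at t1
  change _ ≤ A * AvH κ κ' ρ ξ f P b x + _ at t2
  have t3' := mul_le_mul_of_nonneg_left t3 hA.le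
  have t4' := mul_le_mul_of_nonneg_left t4 hA.le
  have e : ∑ s ∈ S, (rs ρ s N : ℂ) * cnv f (kn κ s.k N) x =
      ∑ s ∈ S, ((rs ρ s N : ℂ) * cnv f (kn κ s.k N) x - rs ρ s ξ * cnv f (kn κ s.k ξ) x) +
      ∑ s ∈ S, ((rs ρ s ξ : ℂ) * cnv f (kn κ s.k ξ) x -
      ∑ u ∈ P.filter (fun u => u.k = s.k), ps κ κ' ρ ξ f u x) +
      ∑ s ∈ S, ∑ u ∈ P.filter (fun u => u.k = s.k), ps κ κ' ρ ξ f u x := by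
    rw [← Finset.sum_add_distrib, ← Finset.sum_add_distrib]
    exact Finset.sum_congr rfl fun s _ => by ring
  rw [e]
  refine (norm_add₃_le).trans ?_
  rw [s3]
  have t5 := norm_sub_le (∑ s ∈ P.filter (fun s => J.k < s.k), ps κ κ' ρ ξ f s x)
    (∑ s ∈ P.filter (fun s => b < s.k), ps κ κ' ρ ξ f s x)
  linarith

end
end CH

namespace CH

/-- the integrand of one tile of the model operator -/
noncomputable def tf (κ : ℝ → ℂ) (ρ : ℝ → ℝ) (f : ℝ → ℂ) (N : ℝ → ℝ) (g : ℝ → ℂ) (s : Tile) : ℝ → ℂ :=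
  s.I.indicator (fun x => g x * ((rs ρ s (N x) : ℂ) * cnv f (kn κ s.k (N x)) x))

lemma Rho.cont {ρ : ℝ → ℝ} (h : Rho ρ) : Continuous ρ := by
  refine (LipschitzWith.of_dist_le_mul (K := 17) fun x y => ?_).continuous
  rw [Real.dist_eq, Real.dist_eq]; exact h.lip x y

lemma Krn.cnv_bdd {G : ℝ → ℂ} {g : ℝ → ℝ} {A : ℝ} (h : Krn G g A) (f : ℝ → ℂ)
    (hf : Integrable f) (k : ℤ) (N x : ℝ) : ‖cnv f (kn G k N) x‖ ≤ (∫ y, ‖f y‖) * (A * (2 ^ k)⁻¹) := by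
  unfold cnv
  rw [← integral_mul_const]
  refine norm_integral_le_of_norm_le (hf.norm.mul_const _) (ae_of_all _ fun y => ?_)
  rw [norm_mul]; gcongr; exact h.kn_bdd _ _ _

section
variable {κ κ' ϑ : ℝ → ℂ} {χ' h : ℝ → ℝ} {A : ℝ} {ρ : ℝ → ℝ} {P : Finset Tile} {kT nT : ℤ}
  {ξ : ℝ} {f : ℝ → ℂ} {σ : ℝ} {E : Set ℝ} {N : ℝ → ℝ} {g : ℝ → ℂ}

lemma tf_integrable (K : Ker κ κ' ϑ χ' h A) (R : Rho ρ) (hf : Integrable f) (hN : Measurable N)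
    (hg : Measurable g) (hg1 : ∀ x, ‖g x‖ ≤ E.indicator (fun _ => 1) x) (s : Tile) :
    Integrable (tf κ ρ f N g s) := by
  unfold tf
  rw [integrable_indicator_iff (measurableSet_I s)]
  have hfin : volume s.I ≠ ∞ := by rw [Tile.I, volume_dy]; exact ENNReal.ofReal_ne_top
  refine Measure.integrableOn_of_bounded (M := 1 * (1 * ((∫ y, ‖f y‖) * (A * (2 ^ s.k)⁻¹)))) hfin ?_
    (ae_of_all _ fun x => ?_)
  · have hm : Measurable (fun x => cnv f (kn κ s.k (N x)) x) := by
      have h0 := (K.k1.cont_cnv hf s.k).measurable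
      have h1 : Measurable (fun x => (x, N x)) := by fun_prop
      have key : ∀ Φ : ℝ × ℝ → ℂ, Measurable Φ → Measurable (fun x => Φ (x, N x)) :=
        fun Φ hΦ => hΦ.comp h1
      exact key _ h0
    have hm2 : Measurable (fun x => (rs ρ s (N x) : ℂ)) := by
      have := R.cont.measurable
      unfold rs
      fun_prop
    exact (hg.mul (hm2.mul hm)).aestronglyMeasurable
  · rw [norm_mul, norm_mul, Complex.norm_real, Real.norm_eq_abs]
    have h1 : ‖g x‖ ≤ 1 := (hg1 x).trans (by by_cases hx : x ∈ E <;> simp [hx])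
    have h2 : |rs ρ s (N x)| ≤ 1 := R.le _
    have h3 := K.k1.cnv_bdd f hf s.k (N x) x
    gcongr

lemma TS.sum_AvH (t : TS κ κ' ϑ χ' h A ρ P kT nT ξ f σ) (b : Tile → ℤ)
    (hb : ∀ J ∈ jset P ξ, J.k ≤ b J) :
    ∑ J ∈ jset P ξ, 2 ^ J.k * AvH κ κ' ρ ξ f P (b J) J.c ≤ 2 ^ 24 * π ^ 2 * A ^ 2 * (σ * 2 ^ kT) := by
  have hA := t.K.k1.pos
  have hσ := t.hσ
  have hb' := t.bessel
  have hp := two_zpow_pos kT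
  have h1 := lin_max (jset P ξ) (fun J hJ J' hJ' => t.T.jdisj hJ hJ') (fun J hJ => t.T.jsub hJ) b hb
    (H := fun y => ‖HH κ κ' ρ ξ f P y‖) t.HH_cont.norm
    (M := ∑ s ∈ P, 16 * A * t.M s) (fun y => by rw [abs_norm]; exact t.HH_bdd y) hb'.1
  refine abs_le_of_sq_le_sq' (h1.trans ?_) (by positivity) |>.2
  calc _ ≤ 4096 * π ^ 2 * 2 ^ kT * (2048 * π ^ 2 * ((16 * A) ^ 2 * ((128 * A) ^ 2 * (σ ^ 2 * 2 ^ kT)))) := by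
        gcongr; exact hb'.2
    _ = 2 ^ 45 * (π ^ 2 * A ^ 2 * (σ * 2 ^ kT)) ^ 2 := by ring
    _ ≤ 2 ^ 48 * (π ^ 2 * A ^ 2 * (σ * 2 ^ kT)) ^ 2 := by gcongr <;> norm_num
    _ = _ := by ring

lemma tree_lemma (K : Ker κ κ' ϑ χ' h A) (R : Rho ρ) : ∃ C > 0, ∀ (P : Finset Tile) (kT nT : ℤ) (ξ : ℝ)
    (f : ℝ → ℂ) (σ : ℝ) (E : Set ℝ) (N : ℝ → ℝ) (g : ℝ → ℂ) (μ : ℝ), IsTree P kT nT ξ → Integrable f →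
    0 ≤ σ → SizeLE P f σ → MeasurableSet E → Measurable N → Measurable g →
    (∀ x, ‖g x‖ ≤ E.indicator (fun _ => 1) x) → 0 ≤ μ →
    (∀ s ∈ P, volume (E ∩ s.I ∩ N ⁻¹' s.Om) ≤ ENNReal.ofReal (μ * 2 ^ s.k)) →
    ‖∑ s ∈ P, ∫ x, tf κ ρ f N g s x‖ ≤ C * μ * σ * 2 ^ kT := by
  classical
  have hA := K.k1.pos
  refine ⟨2 * ((34816 * A + 2 ^ 24 * π ^ 2 * A ^ 3) + 8192 * A ^ 2 * (2048 * π) +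
    32 * A * (2 ^ 24 * π ^ 2 * A ^ 2)), by positivity, ?_⟩
  intro P kT nT ξ f σ E N g μ T hf hσ hS hE hN hg hg1 hμ hdens
  have t : TS κ κ' ϑ χ' h A ρ P kT nT ξ f σ := ⟨K, R, T, hf, hσ, hS⟩
  set a : ℤ → Tile → ℝ := fun b J => AvH κ κ' ρ ξ f P b J.c with ha
  have ha0 : ∀ b J, 0 ≤ a b J := fun b J => TS.AvH_nonneg b J.c
  have hbex : ∀ J : Tile, ∃ b, J ∈ jset P ξ → J.k ≤ b ∧ b ≤ kT ∧ ∀ b', J.k ≤ b' → b' ≤ kT → a b' J ≤ a b J := by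
    intro J
    by_cases hJ : J ∈ jset P ξ
    · obtain ⟨b, hb, hmax⟩ := Finset.exists_max_image (Finset.Icc J.k kT) (fun b => a b J)
        ⟨J.k, Finset.mem_Icc.2 ⟨le_rfl, dy_scale_le_of_subset (T.jsub hJ)⟩⟩
      rw [Finset.mem_Icc] at hb
      exact ⟨b, fun _ => ⟨hb.1, hb.2, fun b' h1 h2 => hmax b' (Finset.mem_Icc.2 ⟨h1, h2⟩)⟩⟩
    · exact ⟨0, fun hc => absurd hc hJ⟩
  choose b hb using hbex
  have hpex : ∀ J : Tile, ∃ q : Tile, J ∈ jset P ξ → q ∈ P ∧ q.k = J.k + 1 ∧ J.I ⊆ q.I := by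
    intro J
    by_cases hJ : J ∈ jset P ξ
    · obtain ⟨a1, a2, q, hq⟩ := mem_jset.1 hJ
      exact ⟨q, fun _ => hq⟩
    · exact ⟨J, fun hc => absurd hc hJ⟩
  choose q hq using hpex
  set X : Tile → ℝ := fun J => (34816 * A + 2 ^ 24 * π ^ 2 * A ^ 3) * σ + 8192 * A ^ 2 * σ * Berr P J +
        16 * A * (a J.k J + a (b J) J) with hX
  have hB0 : ∀ J, 0 ≤ Berr P J := fun J => Finset.sum_nonneg fun s _ => integral_nonneg fun y =>
    w_nonneg (two_zpow_pos _) _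
  have hX0 : ∀ J, 0 ≤ X J := by
    intro J
    have := ha0 J.k J; have := ha0 (b J) J; have := hB0 J
    simp only [hX]; positivity
  set F : Tile → Set ℝ := fun J => E ∩ (q J).I ∩ N ⁻¹' (q J).Om with hF
  have hFm : ∀ J, MeasurableSet (F J) := fun J =>
    (hE.inter (measurableSet_I _)).inter (hN (measurableSet_Om _))
  have hFv : ∀ J ∈ jset P ξ, volume (F J) ≤ ENNReal.ofReal (2 * μ * 2 ^ J.k) := by
    intro J hJ
    obtain ⟨a1, a2, a3⟩ := hq J hJ
    refine (hdens _ a1).trans (le_of_eq ?_)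
    rw [a2, zpow_add_one₀ two_ne_zero]; ring_nf
  have hpt : ∀ x, ‖∑ s ∈ P, tf κ ρ f N g s x‖ ≤ ∑ J ∈ jset P ξ, (F J).indicator (fun _ => X J) x := by
    intro x
    have hR0 : 0 ≤ ∑ J ∈ jset P ξ, (F J).indicator (fun _ => X J) x :=
      Finset.sum_nonneg fun J _ => indicator_nonneg (fun _ _ => hX0 J) x
    set S := P.filter (fun s => x ∈ s.I ∧ N x ∈ s.Om) with hSdef
    have e1 : ∑ s ∈ P, tf κ ρ f N g s x = g x * ∑ s ∈ S, (rs ρ s (N x) : ℂ) * cnv f (kn κ s.k (N x)) x := by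
      rw [hSdef, Finset.sum_filter, Finset.mul_sum]
      refine Finset.sum_congr rfl fun s _ => ?_
      unfold tf
      by_cases hx : x ∈ s.I
      · rw [indicator_of_mem hx]
        by_cases hNx : N x ∈ s.Om
        · rw [if_pos ⟨hx, hNx⟩]
        · have : rs ρ s (N x) = 0 := by
            by_contra hc; exact hNx (w2_subset s (R.mem_w2 hc))
          rw [if_neg (fun hc => hNx hc.2), this]; simp
      · rw [indicator_of_notMem hx, if_neg (fun hc => hx hc.1), mul_zero]
    rcases S.eq_empty_or_nonempty with hSe | ⟨s, hs⟩
    · rw [e1, hSe]; simpa using hR0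
    by_cases hxE : x ∈ E
    swap
    · have := hg1 x
      rw [indicator_of_notMem hxE] at this
      rw [e1, norm_eq_zero.1 (le_antisymm this (norm_nonneg _))]; simpa using hR0
    obtain ⟨hsP, hxs, hNs⟩ := Finset.mem_filter.1 hs
    obtain ⟨J, hJ, hxJ, hJk⟩ := T.jcover hsP hxs
    obtain ⟨q1, q2, q3⟩ := hq J hJ
    have hNq : N x ∈ (q J).Om :=
      (tile_le (by omega) (q3 hxJ) hxs (T.fr _ q1) (T.fr s hsP)).2 hNs
    have hxF : x ∈ F J := ⟨⟨hxE, q3 hxJ⟩, hNq⟩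
    obtain ⟨b', hb1, hb2, hb3⟩ := t.pw hJ hxJ (N x) S (fun s => by simp [hSdef])
    have hbm := (hb J hJ).2.2 b' hb1 hb2
    have h1 : ‖g x‖ ≤ 1 := by have := hg1 x; rwa [indicator_of_mem hxE] at this
    rw [e1, norm_mul]
    calc _ ≤ 1 * X J := by
          gcongr
          refine hb3.trans ?_
          simp only [hX, ha] at hbm ⊢
          gcongr
      _ = (F J).indicator (fun _ => X J) x := by rw [indicator_of_mem hxF, one_mul]
      _ ≤ _ := Finset.single_le_sum (f := fun J => (F J).indicator (fun _ => X J) x)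
          (fun J _ => indicator_nonneg (fun _ _ => hX0 J) x) hJ
  have hFi : ∀ J ∈ jset P ξ, Integrable ((F J).indicator (fun _ => X J)) := fun J hJ =>
    (integrable_indicator_iff (hFm J)).2 (integrableOn_const
      ((hFv J hJ).trans_lt ENNReal.ofReal_lt_top).ne)
  have hFint : ∀ J ∈ jset P ξ, ∫ x, (F J).indicator (fun _ => X J) x ≤ 2 * μ * (2 ^ J.k * X J) := by
    intro J hJ
    rw [integral_indicator (hFm J), setIntegral_const, smul_eq_mul]
    have : volume.real (F J) ≤ 2 * μ * 2 ^ J.k := by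
      have := two_zpow_pos J.k
      exact ENNReal.toReal_le_of_le_ofReal (by positivity) (hFv J hJ)
    calc _ ≤ 2 * μ * 2 ^ J.k * X J := mul_le_mul_of_nonneg_right this (hX0 J)
      _ = _ := by ring
  rw [← integral_finsetSum _ fun s _ => tf_integrable K R hf hN hg hg1 s]
  refine (norm_integral_le_of_norm_le (integrable_finsetSum _ hFi) (ae_of_all _ hpt)).trans ?_
  rw [integral_finsetSum _ hFi]
  refine (Finset.sum_le_sum hFint).trans ?_
  rw [← Finset.mul_sum]
  have c1 := sum_zpow_disjoint (jset P ξ) (fun J hJ J' hJ' => T.jdisj hJ hJ') (fun J hJ => T.jsub hJ)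
  have c2 := T.bdry2
  have c3 := t.sum_AvH (fun J => J.k) (fun J _ => le_rfl)
  have c4 := t.sum_AvH b (fun J hJ => (hb J hJ).1)
  have e : ∑ J ∈ jset P ξ, 2 ^ J.k * X J =
      (34816 * A + 2 ^ 24 * π ^ 2 * A ^ 3) * σ * ∑ J ∈ jset P ξ, (2:ℝ) ^ J.k +
      8192 * A ^ 2 * σ * ∑ J ∈ jset P ξ, 2 ^ J.k * Berr P J +
      16 * A * (∑ J ∈ jset P ξ, 2 ^ J.k * AvH κ κ' ρ ξ f P J.k J.c +
        ∑ J ∈ jset P ξ, 2 ^ J.k * AvH κ κ' ρ ξ f P (b J) J.c) := by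
    rw [← Finset.sum_add_distrib, Finset.mul_sum, Finset.mul_sum, Finset.mul_sum,
      ← Finset.sum_add_distrib, ← Finset.sum_add_distrib]
    refine Finset.sum_congr rfl fun J _ => ?_
    simp only [hX, ha]; ring
  have hp := two_zpow_pos kT
  rw [e]
  calc _ ≤ 2 * μ * ((34816 * A + 2 ^ 24 * π ^ 2 * A ^ 3) * σ * 2 ^ kT +
      8192 * A ^ 2 * σ * (2048 * π * 2 ^ kT) +
      16 * A * (2 ^ 24 * π ^ 2 * A ^ 2 * (σ * 2 ^ kT) + 2 ^ 24 * π ^ 2 * A ^ 2 * (σ * 2 ^ kT))) := by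
        gcongr
    _ = _ := by ring

end
end CH

namespace CH

structure Dat (E : Set ℝ) (N : ℝ → ℝ) (g : ℝ → ℂ) : Prop where
  hE : MeasurableSet E
  fin : volume E ≠ ∞
  hN : Measurable N
  hg : Measurable g
  hg1 : ∀ x, ‖g x‖ ≤ E.indicator (fun _ => 1) x

/-- model form -/
noncomputable def SS (κ : ℝ → ℂ) (ρ : ℝ → ℝ) (f : ℝ → ℂ) (N : ℝ → ℝ) (g : ℝ → ℂ) (P : Finset Tile) : ℂ :=
  ∑ s ∈ P, ∫ x, tf κ ρ f N g s x

/-- density set -/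
def DD (E : Set ℝ) (N : ℝ → ℝ) (s : Tile) : Set ℝ := E ∩ s.I ∩ N ⁻¹' s.Om

section
variable {κ κ' ϑ : ℝ → ℂ} {χ' h : ℝ → ℝ} {A : ℝ} {ρ : ℝ → ℝ}

lemma mass_trees (K : Ker κ κ' ϑ χ' h A) (R : Rho ρ) : ∃ C > 0, ∀ (f : ℝ → ℂ) (σ : ℝ) (E : Set ℝ)
    (N : ℝ → ℝ) (g : ℝ → ℂ) (μ : ℝ), Integrable f → 0 ≤ σ → Dat E N g → 0 ≤ μ → ∀ (M Z : Finset Tile),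
    TConvex Z → SizeLE Z f σ → (∀ s ∈ Z, volume (DD E N s) ≤ ENNReal.ofReal (μ * 2 ^ s.k)) →
    (∀ s ∈ Z, ∃ u ∈ M, s.Le u) → ‖SS κ ρ f N g Z‖ ≤ C * μ * σ * ∑ u ∈ M, (2:ℝ) ^ u.k := by
  classical
  obtain ⟨C, hC, hT⟩ := tree_lemma K R
  refine ⟨C, hC, ?_⟩
  intro f σ E N g μ hf hσ D hμ M
  induction M using Finset.induction_on with
  | empty =>
    intro Z _ _ _ hZ
    have : Z = ∅ := Finset.eq_empty_of_forall_notMem fun s hs => by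
      obtain ⟨u, hu, -⟩ := hZ s hs; simp at hu
    rw [this]; simp [SS]
  | insert u M hu ih =>
    intro Z hZc hZs hZd hZ
    have h1 : SS κ ρ f N g Z = SS κ ρ f N g (Z.filter (fun s => s.Le u)) +
        SS κ ρ f N g (Z.filter (fun s => ¬ s.Le u)) := by
      unfold SS; rw [Finset.sum_filter_add_sum_filter_not]
    have h2 := hT (Z.filter (fun s => s.Le u)) u.k u.n ((u.l : ℝ) * 2 ^ (-u.k)) f σ E N g μ ⟨?_, ?_, ?_⟩ hf hσ
      (hZs.mono (Finset.filter_subset _ _)) D.hE D.hN D.hg D.hg1 hμ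
      (fun s hs => hZd s (Finset.mem_filter.1 hs).1)
    · have h3 := ih (Z.filter (fun s => ¬ s.Le u)) ?_ (hZs.mono (Finset.filter_subset _ _))
        (fun s hs => hZd s (Finset.mem_filter.1 hs).1) ?_
      · rw [h1, Finset.sum_insert hu]
        refine (norm_add_le _ _).trans ?_
        have : ‖SS κ ρ f N g (Z.filter (fun s => s.Le u))‖ ≤ C * μ * σ * 2 ^ u.k := h2
        linarith
      · intro s hs t ht r hsr hrt
        rw [Finset.mem_filter] at hs ht ⊢
        exact ⟨hZc s hs.1 t ht.1 r hsr hrt, fun hc => hs.2 (hsr.trans hc)⟩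
      · intro s hs
        rw [Finset.mem_filter] at hs
        obtain ⟨u', hu', hle⟩ := hZ s hs.1
        rcases Finset.mem_insert.1 hu' with rfl | h4
        · exact absurd hle hs.2
        · exact ⟨u', h4, hle⟩
    · intro s hs t ht r hsr hrt
      rw [Finset.mem_filter] at hs ht ⊢
      exact ⟨hZc s hs.1 t ht.1 r hsr hrt, hrt.trans ht.2⟩
    · intro s hs; exact (Finset.mem_filter.1 hs).2.1
    · intro s hs
      exact (Finset.mem_filter.1 hs).2.2 (left_mem_dy _ _)

lemma one_step (K : Ker κ κ' ϑ χ' h A) (R : Rho ρ) : ∃ C > 0, ∀ (f : ℝ → ℂ) (σ : ℝ) (E : Set ℝ)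
    (N : ℝ → ℝ) (g : ℝ → ℂ) (μ : ℝ), Integrable f → Integrable (fun x => ‖f x‖ ^ 2) → 0 < σ →
    Dat E N g → 0 ≤ μ → ∀ (M Z : Finset Tile),
    TConvex Z → SizeLE Z f σ → (∀ s ∈ Z, volume (DD E N s) ≤ ENNReal.ofReal (μ * 2 ^ s.k)) →
    (∀ s ∈ Z, ∃ u ∈ M, s.Le u) →
    ‖SS κ ρ f N g Z‖ ≤ C * μ * σ * ∑ u ∈ M, (2:ℝ) ^ u.k ∧
    ∃ Q ⊆ Z, TConvex Q ∧ SizeLE Q f (σ / 2) ∧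
      ‖SS κ ρ f N g Z - SS κ ρ f N g Q‖ ≤ C * (μ * σ * ∑ u ∈ M, (2:ℝ) ^ u.k) ∧
      ‖SS κ ρ f N g Z - SS κ ρ f N g Q‖ ≤ C * (μ * (∫ x, ‖f x‖ ^ 2) / σ) := by
  classical
  obtain ⟨C1, hC1, hT⟩ := tree_lemma K R
  obtain ⟨C2, hC2, hM⟩ := mass_trees K R
  obtain ⟨C3, hC3, hL⟩ := size_lemma
  refine ⟨C2 + C1 * C3, by positivity, ?_⟩
  intro f σ E N g μ hf hf2 hσ D hμ M Z hZc hZs hZd hZM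
  have hsum : 0 ≤ ∑ u ∈ M, (2:ℝ) ^ u.k := Finset.sum_nonneg fun u _ => (two_zpow_pos _).le
  have hI : 0 ≤ ∫ x, ‖f x‖ ^ 2 := integral_nonneg fun x => by positivity
  have hall : ∀ Y ⊆ Z, TConvex Y → ‖SS κ ρ f N g Y‖ ≤ (C2 + C1 * C3) * (μ * σ * ∑ u ∈ M, (2:ℝ) ^ u.k) := by
    intro Y hY hYc
    refine (hM f σ E N g μ hf hσ.le D hμ M Y hYc (hZs.mono hY) (fun s hs => hZd s (hY hs))
      (fun s hs => hZM s (hY hs))).trans ?_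
    have : 0 ≤ C1 * C3 * (μ * σ * ∑ u ∈ M, (2:ℝ) ^ u.k) := by positivity
    linarith
  refine ⟨(hall Z subset_rfl hZc).trans (le_of_eq (by ring)), ?_⟩
  obtain ⟨Q, L, hQ, hQc, hQd, hQs, hL1, hL2, hL3⟩ := hL Z f σ hf hf2 hσ hZc hZs
  refine ⟨Q, hQ, hQc, hQs, ?_, ?_⟩
  · have e : SS κ ρ f N g Z - SS κ ρ f N g Q = SS κ ρ f N g (Z \ Q) := by
      unfold SS; rw [← Finset.sum_sdiff hQ]; ring
    rw [e]
    refine hall _ Finset.sdiff_subset ?_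
    intro s hs t ht r hsr hrt
    rw [Finset.mem_sdiff] at hs ht ⊢
    have hr := hZc s hs.1 t ht.1 r hsr hrt
    exact ⟨hr, hQd r hr t ht.1 hrt ht.2⟩
  · have e : SS κ ρ f N g Z - SS κ ρ f N g Q = (L.map fun t => SS κ ρ f N g t.R).sum := by
      have := hL2 (fun s => ∫ x, tf κ ρ f N g s x)
      unfold SS; rw [this]; ring
    rw [e]
    have h1 : ‖(L.map fun t => SS κ ρ f N g t.R).sum‖ ≤ C1 * μ * σ * (L.map fun t => (2:ℝ) ^ t.k).sum := by
      clear e hL3 hL2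
      induction L with
      | nil => simp
      | cons t L ih =>
        simp only [List.map_cons, List.sum_cons]
        refine (norm_add_le _ _).trans ?_
        obtain ⟨a1, -, a3, a4⟩ := hL1 t (by simp)
        have h2 : ‖SS κ ρ f N g t.R‖ ≤ C1 * μ * σ * 2 ^ t.k :=
          hT t.R t.k t.n t.ξ f σ E N g μ ⟨a3, fun s hs => (a4 s hs).1, fun s hs => (a4 s hs).2⟩ hf hσ.le
          (hZs.mono a1) D.hE D.hN D.hg D.hg1 hμ (fun s hs => hZd s (a1 hs))
        have h3 := ih (fun t ht => hL1 t (by simp [ht]))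
        linarith
    refine h1.trans ?_
    have h2 : (L.map fun t => (2:ℝ) ^ t.k).sum ≤ C3 * (∫ x, ‖f x‖ ^ 2) / σ ^ 2 := by
      rw [le_div_iff₀ (by positivity)]; linarith
    calc _ ≤ C1 * μ * σ * (C3 * (∫ x, ‖f x‖ ^ 2) / σ ^ 2) := by gcongr
      _ = C1 * C3 * (μ * (∫ x, ‖f x‖ ^ 2) / σ) := by field_simp
      _ ≤ _ := by
          have : 0 ≤ C2 * (μ * (∫ x, ‖f x‖ ^ 2) / σ) := by positivity
          linarith

lemma geo_le {x a b θ : ℝ} (hx : 0 ≤ x) (ha : x ≤ a) (hb : x ≤ b) (h0 : 0 < θ) (h1 : θ < 1) :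
    x ≤ a ^ θ * b ^ (1 - θ) := by
  rcases hx.eq_or_lt with h | h
  · rw [← h]; have : 0 ≤ a := hx.trans ha; have : 0 ≤ b := hx.trans hb; positivity
  calc x = x ^ θ * x ^ (1 - θ) := by rw [← Real.rpow_add h]; simp
    _ ≤ _ := by
        have : 0 ≤ 1 - θ := by linarith
        have ha0 : 0 ≤ a := hx.trans ha
        have hb0 : 0 ≤ b := hx.trans hb
        have ha1 : 0 ≤ a ^ θ := by positivity
        gcongr

lemma iter_size (K : Ker κ κ' ϑ χ' h A) (R : Rho ρ) (θ : ℝ) (hθ : 1 / 2 < θ) (hθ1 : θ < 1) :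
    ∃ C > 0, ∀ (f : ℝ → ℂ) (σ : ℝ) (E : Set ℝ)
    (N : ℝ → ℝ) (g : ℝ → ℂ) (μ : ℝ), Integrable f → Integrable (fun x => ‖f x‖ ^ 2) → 0 < σ →
    Dat E N g → 0 < μ → ∀ (M Z : Finset Tile),
    TConvex Z → SizeLE Z f σ → (∀ s ∈ Z, volume (DD E N s) ≤ ENNReal.ofReal (μ * 2 ^ s.k)) →
    (∀ s ∈ Z, ∃ u ∈ M, s.Le u) → ∀ B, μ * ∑ u ∈ M, (2:ℝ) ^ u.k ≤ B →
    ‖SS κ ρ f N g Z‖ ≤ C * (B ^ θ * (μ * ∫ x, ‖f x‖ ^ 2) ^ (1 - θ)) * σ ^ (2 * θ - 1) := by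
  obtain ⟨C, hC, hstep⟩ := one_step K R
  set q : ℝ := (1 / 2 : ℝ) ^ (2 * θ - 1) with hq
  have hq1 : q < 1 := Real.rpow_lt_one (by norm_num) (by norm_num) (by linarith)
  have hq0 : 0 < q := by positivity
  refine ⟨C / (1 - q), div_pos hC (by linarith), ?_⟩
  intro f σ E N g μ hf hf2 hσ D hμ M Z hZc hZs hZd hZM B hB
  have hB0 : 0 ≤ B := le_trans (mul_nonneg hμ.le (Finset.sum_nonneg fun u _ => (two_zpow_pos _).le)) hB
  set I := ∫ x, ‖f x‖ ^ 2 with hI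
  have hI0 : 0 ≤ I := integral_nonneg fun x => by positivity
  set X := B ^ θ * (μ * I) ^ (1 - θ) with hX
  have hX0 : 0 ≤ X := by positivity
  have key : ∀ (n : ℕ) (σ : ℝ), 0 < σ → ∀ Z : Finset Tile, TConvex Z → SizeLE Z f σ →
      (∀ s ∈ Z, volume (DD E N s) ≤ ENNReal.ofReal (μ * 2 ^ s.k)) → (∀ s ∈ Z, ∃ u ∈ M, s.Le u) →
      ‖SS κ ρ f N g Z‖ ≤ C / (1 - q) * X * σ ^ (2 * θ - 1) + C * B * σ * (1 / 2) ^ n := by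
    intro n
    induction n with
    | zero =>
      intro σ hσ Z hZc hZs hZd hZM
      obtain ⟨h1, -⟩ := hstep f σ E N g μ hf hf2 hσ D hμ.le M Z hZc hZs hZd hZM
      have h2 : 0 ≤ C / (1 - q) * X * σ ^ (2 * θ - 1) := by
        have : 0 < C / (1 - q) := div_pos hC (by linarith)
        positivity
      have h3 : C * μ * σ * ∑ u ∈ M, (2:ℝ) ^ u.k ≤ C * B * σ := by
        calc _ = C * σ * (μ * ∑ u ∈ M, (2:ℝ) ^ u.k) := by ring
          _ ≤ C * σ * B := by gcongr
          _ = _ := by ring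
      simp only [pow_zero, mul_one]; linarith
    | succ n ih =>
      intro σ hσ Z hZc hZs hZd hZM
      obtain ⟨-, Q, hQ, hQc, hQs, h1, h2⟩ := hstep f σ E N g μ hf hf2 hσ D hμ.le M Z hZc hZs hZd hZM
      have h3 := ih (σ / 2) (by positivity) Q hQc hQs (fun s hs => hZd s (hQ hs)) (fun s hs => hZM s (hQ hs))
      have h4 : ‖SS κ ρ f N g Z - SS κ ρ f N g Q‖ / C ≤ (B * σ) ^ θ * (μ * I / σ) ^ (1 - θ) := by
        refine geo_le (by positivity) ?_ ?_ (by linarith) hθ1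
        · rw [div_le_iff₀ hC]
          refine h1.trans ?_
          calc _ = C * σ * (μ * ∑ u ∈ M, (2:ℝ) ^ u.k) := by ring
            _ ≤ C * σ * B := by gcongr
            _ = _ := by ring
        · rw [div_le_iff₀ hC, mul_comm]; exact h2
      have h5 : (B * σ) ^ θ * (μ * I / σ) ^ (1 - θ) = X * σ ^ (2 * θ - 1) := by
        have e5 : σ ^ (2 * θ - 1) = σ ^ θ / σ ^ (1 - θ) := by
          rw [← Real.rpow_sub hσ]; congr 1; ring
        rw [Real.mul_rpow hB0 hσ.le, Real.div_rpow (by positivity) hσ.le, hX, e5]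
        field_simp
      rw [h5, div_le_iff₀ hC] at h4
      have h6 : (σ / 2) ^ (2 * θ - 1) = q * σ ^ (2 * θ - 1) := by
        rw [hq, ← Real.mul_rpow (by norm_num) hσ.le]; congr 1; ring
      rw [h6] at h3
      have h7 : ‖SS κ ρ f N g Z‖ ≤ ‖SS κ ρ f N g Z - SS κ ρ f N g Q‖ + ‖SS κ ρ f N g Q‖ := by
        have := norm_add_le (SS κ ρ f N g Z - SS κ ρ f N g Q) (SS κ ρ f N g Q)
        rwa [sub_add_cancel] at this
      have h8 : X * σ ^ (2 * θ - 1) * C + C / (1 - q) * X * (q * σ ^ (2 * θ - 1)) =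
          C / (1 - q) * X * σ ^ (2 * θ - 1) := by
        have : 1 - q ≠ 0 := by linarith
        field_simp; ring
      have h9 : C * B * (σ / 2) * (1 / 2) ^ n = C * B * σ * (1 / 2) ^ (n + 1) := by rw [pow_succ]; ring
      linarith
  have hlim : Tendsto (fun n : ℕ => C / (1 - q) * X * σ ^ (2 * θ - 1) + C * B * σ * (1 / 2) ^ n) atTop
      (nhds (C / (1 - q) * X * σ ^ (2 * θ - 1) + C * B * σ * 0)) :=
    ((tendsto_pow_atTop_nhds_zero_of_lt_one (by norm_num) (by norm_num)).const_mul _).const_add _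
  rw [mul_zero, add_zero] at hlim
  exact ge_of_tendsto' hlim fun n => key n σ hσ Z hZc hZs hZd hZM

end
end CH

namespace CH
section
variable {κ κ' ϑ : ℝ → ℂ} {χ' h : ℝ → ℝ} {A : ℝ} {ρ : ℝ → ℝ}

lemma measurableSet_DD {E : Set ℝ} {N : ℝ → ℝ} (hE : MeasurableSet E) (hN : Measurable N) (s : Tile) :
    MeasurableSet (DD E N s) :=
  (hE.inter (measurableSet_I s)).inter (hN (measurableSet_Om s))

lemma vol_DD_le (E : Set ℝ) (N : ℝ → ℝ) (s : Tile) : volume (DD E N s) ≤ ENNReal.ofReal (2 ^ s.k) := by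
  refine (measure_mono (t := s.I) fun x hx => hx.1.2).trans ?_
  rw [Tile.I, volume_dy]

lemma tf_bdd (K : Ker κ κ' ϑ χ' h A) (R : Rho ρ) {f : ℝ → ℂ} {E : Set ℝ} {N : ℝ → ℝ} {g : ℝ → ℂ}
    (hf : Integrable f) (D : Dat E N g) (s : Tile) {μ : ℝ} (hμ : 0 ≤ μ)
    (hd : volume (DD E N s) ≤ ENNReal.ofReal (μ * 2 ^ s.k)) :
    ‖∫ x, tf κ ρ f N g s x‖ ≤ (∫ y, ‖f y‖) * A * μ := by
  have hA := K.k1.pos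
  have h2 := two_zpow_pos s.k
  have hI : 0 ≤ ∫ y, ‖f y‖ := integral_nonneg fun y => norm_nonneg _
  have hz : ∀ x, x ∉ DD E N s → tf κ ρ f N g s x = 0 := by
    intro x hx
    unfold tf
    by_cases hxI : x ∈ s.I
    · rw [indicator_of_mem hxI]
      by_cases hxE : x ∈ E
      · have : rs ρ s (N x) = 0 := by
          by_contra hne
          exact hx ⟨⟨hxE, hxI⟩, w2_subset s (R.mem_w2 hne)⟩
        rw [this]; simp
      · have := D.hg1 x
        rw [indicator_of_notMem hxE] at this
        rw [norm_le_zero_iff.1 this]; simp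
    · rw [indicator_of_notMem hxI]
  rw [← setIntegral_eq_integral_of_forall_compl_eq_zero (s := DD E N s) hz]
  have h3 := norm_setIntegral_le_of_norm_le_const (μ := volume) (s := DD E N s) (f := tf κ ρ f N g s)
    (C := (∫ y, ‖f y‖) * (A * (2 ^ s.k)⁻¹)) (lt_of_le_of_lt hd ENNReal.ofReal_lt_top) ?_
  · refine h3.trans ?_
    have h4 : volume.real (DD E N s) ≤ μ * 2 ^ s.k := ENNReal.toReal_le_of_le_ofReal (by positivity) hd
    calc _ ≤ (∫ y, ‖f y‖) * (A * (2 ^ s.k)⁻¹) * (μ * 2 ^ s.k) := by gcongr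
      _ = _ := by field_simp
  · intro x hx
    unfold tf
    rw [indicator_of_mem hx.1.2, norm_mul, norm_mul]
    have a1 : ‖g x‖ ≤ 1 := (D.hg1 x).trans (indicator_le_self' (fun _ _ => zero_le_one) x)
    have a2 : ‖((rs ρ s (N x) : ℝ) : ℂ)‖ ≤ 1 := by
      rw [Complex.norm_real]; exact R.le _
    have a3 := K.k1.cnv_bdd f hf s.k (N x) x
    calc _ ≤ 1 * (1 * ((∫ y, ‖f y‖) * (A * (2 ^ s.k)⁻¹))) := by gcongr
      _ = _ := by ring

lemma mass_tops {E : Set ℝ} {N : ℝ → ℝ} {g : ℝ → ℂ} (D : Dat E N g) {μ : ℝ} (W : Finset Tile) 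
    (hW : ∀ u ∈ W, ENNReal.ofReal (μ * 2 ^ u.k) < volume (DD E N u)) :
    μ * ∑ u ∈ tops W, (2:ℝ) ^ u.k ≤ volume.real E := by
  have hdis : (↑(tops W) : Set Tile).PairwiseDisjoint (DD E N) := by
    intro u hu u' hu' hne
    rw [Function.onFun, Set.disjoint_left]
    intro x hx hx'
    rw [Finset.mem_coe, mem_tops] at hu hu'
    rcases le_total u.k u'.k with hk | hk
    · exact hne (hu.2 u' hu'.1 (tile_le hk hx.1.2 hx'.1.2 hx.2 hx'.2)).symm
    · exact hne (hu'.2 u hu.1 (tile_le hk hx'.1.2 hx.1.2 hx'.2 hx.2))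
  have h1 : ∑ u ∈ tops W, volume.real (DD E N u) ≤ volume.real E := by
    rw [← measureReal_biUnion_finset hdis (fun u _ => measurableSet_DD D.hE D.hN u) 
      (fun u _ => ne_top_of_le_ne_top D.fin (measure_mono fun x hx => hx.1.1))]
    exact measureReal_mono (iUnion₂_subset fun u _ x hx => hx.1.1) D.fin
  rw [Finset.mul_sum]
  refine le_trans (Finset.sum_le_sum fun u hu => ?_) h1
  have h2 := (hW u (mem_tops.1 hu).1).le
  have h3 : volume (DD E N u) ≠ ∞ := ne_top_of_le_ne_top D.fin (measure_mono fun x hx => hx.1.1)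
  exact (ENNReal.ofReal_le_iff_le_toReal h3).1 h2

lemma combine (K : Ker κ κ' ϑ χ' h A) (R : Rho ρ) (θ : ℝ) (hθ : 1 / 2 < θ) (hθ1 : θ < 1) :
    ∃ C > 0, ∀ (f : ℝ → ℂ) (σ : ℝ) (E : Set ℝ)
    (N : ℝ → ℝ) (g : ℝ → ℂ), Integrable f → Integrable (fun x => ‖f x‖ ^ 2) → 0 < σ →
    Dat E N g → ∀ (U : Finset Tile), TConvex U → SizeLE U f σ → 
    ‖SS κ ρ f N g U‖ ≤ C * (volume.real E ^ θ * (∫ x, ‖f x‖ ^ 2) ^ (1 - θ) * σ ^ (2 * θ - 1)) := by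
  classical
  obtain ⟨C, hC, hit⟩ := iter_size K R θ hθ hθ1
  set q : ℝ := (1 / 2 : ℝ) ^ (1 - θ) with hq
  have hq1 : q < 1 := Real.rpow_lt_one (by norm_num) (by norm_num) (by linarith)
  have hq0 : 0 < q := by positivity
  refine ⟨C / (1 - q) * 2 ^ θ, mul_pos (div_pos hC (by linarith)) (by positivity), ?_⟩
  intro f σ E N g hf hf2 hσ D U hUc hUs
  set I := ∫ x, ‖f x‖ ^ 2 with hI
  have hI0 : 0 ≤ I := integral_nonneg fun x => by positivity
  set Y := (2 * volume.real E) ^ θ * I ^ (1 - θ) * σ ^ (2 * θ - 1) with hY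
  have hY0 : 0 ≤ Y := by positivity
  set D1 : ℝ := U.card * ((∫ y, ‖f y‖) * A) with hD1
  have key : ∀ (n : ℕ) (μ : ℝ), 0 < μ → ∀ V ⊆ U, TConvex V → 
      (∀ s ∈ V, ∀ u ∈ U, s.Le u → volume (DD E N u) ≤ ENNReal.ofReal (μ * 2 ^ u.k)) → 
      ‖SS κ ρ f N g V‖ ≤ C / (1 - q) * Y * μ ^ (1 - θ) + D1 * μ * (1 / 2) ^ n := by
    intro n
    induction n with
    | zero =>
      intro μ hμ V hV hVc hVd
      have hC' : 0 < C / (1 - q) := div_pos hC (by linarith)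
      have h2 : 0 ≤ C / (1 - q) * Y * μ ^ (1 - θ) := by positivity
      have hI1 : 0 ≤ ∫ y, ‖f y‖ := integral_nonneg fun y => norm_nonneg _
      have hA := K.k1.pos
      have h3 : ‖SS κ ρ f N g V‖ ≤ V.card * ((∫ y, ‖f y‖) * A * μ) := by
        unfold SS
        refine (norm_sum_le_of_le _ fun s hs => tf_bdd K R hf D s hμ.le 
          (hVd s hs s (hV hs) (Tile.Le.refl s))).trans ?_
        rw [Finset.sum_const, nsmul_eq_mul]
      have h4 : (V.card : ℝ) ≤ U.card := by exact_mod_cast Finset.card_le_card hV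
      have h5 : (V.card : ℝ) * ((∫ y, ‖f y‖) * A * μ) ≤ U.card * ((∫ y, ‖f y‖) * A * μ) := by gcongr
      simp only [pow_zero, mul_one, hD1]; linarith
    | succ n ih =>
      intro μ hμ V hV hVc hVd
      set W := U.filter (fun u => ENNReal.ofReal (μ / 2 * 2 ^ u.k) < volume (DD E N u)) with hW
      set V1 := V.filter (fun s => ∃ u ∈ W, s.Le u) with hV1
      set V2 := V.filter (fun s => ¬ ∃ u ∈ W, s.Le u) with hV2
      have e1 : SS κ ρ f N g V = SS κ ρ f N g V1 + SS κ ρ f N g V2 := by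
        unfold SS; rw [hV1, hV2, Finset.sum_filter_add_sum_filter_not]
      have h1 := hit f σ E N g μ hf hf2 hσ D hμ (tops W) V1 ?_ (hUs.mono ((Finset.filter_subset _ _).trans hV)) ?_ ?_ 
        (2 * volume.real E) ?_
      · have h2 := ih (μ / 2) (by positivity) V2 ((Finset.filter_subset _ _).trans hV) ?_ ?_
        · have h6 : (μ / 2) ^ (1 - θ) = q * μ ^ (1 - θ) := by
            rw [hq, ← Real.mul_rpow (by norm_num) hμ.le]; congr 1; ring
          have h7 : C * ((2 * volume.real E) ^ θ * (μ * I) ^ (1 - θ)) * σ ^ (2 * θ - 1) = 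
              C * Y * μ ^ (1 - θ) := by
            rw [Real.mul_rpow hμ.le hI0, hY]; ring
          rw [h7] at h1
          rw [h6] at h2
          have h8 : C * Y * μ ^ (1 - θ) + C / (1 - q) * Y * (q * μ ^ (1 - θ)) = 
              C / (1 - q) * Y * μ ^ (1 - θ) := by
            have : 1 - q ≠ 0 := by linarith
            field_simp; ring
          have h9 : D1 * (μ / 2) * (1 / 2) ^ n = D1 * μ * (1 / 2) ^ (n + 1) := by rw [pow_succ]; ring
          have h10 := norm_add_le (SS κ ρ f N g V1) (SS κ ρ f N g V2)
          rw [e1]; linarith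
        · intro s hs t ht r hsr hrt
          rw [hV2, Finset.mem_filter] at hs ht ⊢
          exact ⟨hVc s hs.1 t ht.1 r hsr hrt, fun ⟨u, hu, hru⟩ => hs.2 ⟨u, hu, hsr.trans hru⟩⟩
        · intro s hs u hu hsu
          rw [hV2, Finset.mem_filter] at hs
          by_contra hc
          rw [not_le] at hc
          exact hs.2 ⟨u, Finset.mem_filter.2 ⟨hu, hc⟩, hsu⟩
      · intro s hs t ht r hsr hrt
        rw [hV1, Finset.mem_filter] at hs ht ⊢
        obtain ⟨u, hu, htu⟩ := ht.2
        exact ⟨hVc s hs.1 t ht.1 r hsr hrt, u, hu, hrt.trans htu⟩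
      · intro s hs
        have := (Finset.mem_filter.1 hs).1
        exact hVd s this s (hV this) (Tile.Le.refl s)
      · intro s hs
        obtain ⟨u, hu, hsu⟩ := (Finset.mem_filter.1 hs).2
        obtain ⟨t, ht, hut⟩ := exists_top hu
        exact ⟨t, ht, hsu.trans hut⟩
      · have := mass_tops D (μ := μ / 2) W (fun u hu => (Finset.mem_filter.1 hu).2)
        linarith
  have hlim : Tendsto (fun n : ℕ => C / (1 - q) * Y * 1 ^ (1 - θ) + D1 * 1 * (1 / 2) ^ n) atTop
      (nhds (C / (1 - q) * Y * 1 ^ (1 - θ) + D1 * 1 * 0)) :=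
    ((tendsto_pow_atTop_nhds_zero_of_lt_one (by norm_num) (by norm_num)).const_mul _).const_add _
  rw [mul_zero, add_zero, Real.one_rpow, mul_one] at hlim
  have h1 := ge_of_tendsto' hlim fun n => by
    have := key n 1 one_pos U subset_rfl hUc (fun s _ u _ _ => by rw [one_mul]; exact vol_DD_le E N u)
    rwa [Real.one_rpow, mul_one] at this
  refine h1.trans (le_of_eq ?_)
  rw [hY, Real.mul_rpow (by norm_num) measureReal_nonneg]; ring

end
end CH

namespace CH

/-- tripled dyadic interval -/
def dy3 (k n : ℤ) : Set ℝ := Ico (((n:ℝ) - 1) * 2 ^ k) (((n:ℝ) + 2) * 2 ^ k)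

lemma dy_sub_dy3 (k n : ℤ) : dy k n ⊆ dy3 k n := by
  intro x hx
  have h2 := two_zpow_pos k
  obtain ⟨h1, h3⟩ := mem_dy.1 hx
  constructor
  · nlinarith
  · nlinarith

lemma w_const {j n : ℤ} {s : Tile} (h : s.k < j → Disjoint s.I (dy3 j n)) {y z : ℝ} (hy : y ∈ dy j n)
    (hz : z ∈ dy j n) : w (2 ^ s.k) (y - s.c) ≤ 16 * w (2 ^ s.k) (z - s.c) := by
  have hk := two_zpow_pos s.k
  have hyz := abs_sub_le_of_mem_dy hy hz
  rcases lt_or_ge s.k j with hlt | hge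
  · refine w_ge_half hk ?_
    have h1 : s.c ∉ dy3 j n := fun hc => Set.disjoint_left.1 (h hlt) (c_mem s) hc
    have hj := two_zpow_pos j
    have h2 : (2:ℝ) ^ j ≤ |y - s.c| := by
      obtain ⟨a1, a2⟩ := mem_dy.1 hy
      rw [dy3, mem_Ico, not_and_or, not_le, not_lt] at h1
      rcases h1 with h1 | h1
      · rw [abs_of_nonneg (by nlinarith)]; nlinarith
      · rw [abs_of_nonpos (by nlinarith)]; nlinarith
    calc |z - s.c| = |(y - s.c) - (y - z)| := by congr 1; ring
      _ ≤ |y - s.c| + |y - z| := abs_sub _ _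
      _ ≤ _ := by linarith
  · refine w_close hk ?_
    have : (2:ℝ) ^ j ≤ 2 ^ s.k := zpow_le_zpow_right₀ (by norm_num) hge
    calc _ = |y - z| := by congr 1; ring
      _ ≤ _ := by linarith

section
variable {F : Set ℝ} {f : ℝ → ℂ} {lam : ℝ} {j n : ℤ} {s : Tile} {φ : ℝ → ℂ}

lemma int_f_le (hF : MeasurableSet F) (hl : 0 < lam)
    (hd : volume (F ∩ dy j n) ≤ ENNReal.ofReal (2 * lam * 2 ^ j)) :
    IntegrableOn (F.indicator (fun _ => (1:ℝ))) (dy j n) ∧ 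
    ∫ y in dy j n, F.indicator (fun _ => (1:ℝ)) y ≤ 2 * lam * 2 ^ j := by
  have h2 := two_zpow_pos j
  constructor
  · refine Measure.integrableOn_of_bounded (M := 1) (by rw [volume_dy]; exact ENNReal.ofReal_ne_top) 
      ((measurable_const.indicator hF).aestronglyMeasurable) (ae_of_all _ fun x => ?_)
    rw [norm_indicator_eq_indicator_norm]
    exact indicator_le_self' (fun _ _ => by simp) x |>.trans (by simp)
  · rw [integral_indicator hF, setIntegral_const, smul_eq_mul, mul_one, measureReal_def, Measure.restrict_apply hF]
    exact ENNReal.toReal_le_of_le_ofReal (by positivity) hd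

lemma direct (hF : MeasurableSet F) (hf1 : ∀ x, ‖f x‖ ≤ F.indicator (fun _ => 1) x) (hl : 0 < lam)
    (hd : volume (F ∩ dy j n) ≤ ENNReal.ofReal (2 * lam * 2 ^ j))
    (h : s.k < j → Disjoint s.I (dy3 j n)) (hφ : IsWP s φ) :
    ‖∫ y in dy j n, f y * φ y‖ ≤ 32 * lam * ∫ y in dy j n, w (2 ^ s.k) (s.c - y) := by
  have hj := two_zpow_pos j
  have hk := two_zpow_pos s.k
  set I := ∫ y in dy j n, w (2 ^ s.k) (s.c - y) with hI
  have h1 : ∀ y ∈ dy j n, w (2 ^ s.k) (y - s.c) ≤ 16 * I * (2 ^ j)⁻¹ := by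
    intro y hy
    have : ∫ z in dy j n, w (2 ^ s.k) (y - s.c) ≤ ∫ z in dy j n, 16 * w (2 ^ s.k) (s.c - z) := by
      refine setIntegral_mono_on ?_ ((integrable_w_sub' hk s.c).const_mul 16).integrableOn (measurableSet_dy _ _) 
        fun z hz => ?_
      · exact integrableOn_const (by rw [volume_dy]; exact ENNReal.ofReal_ne_top)
      · rw [w_sub_comm _ s.c z]; exact w_const h hy hz
    rw [setIntegral_const, volume_real_dy, smul_eq_mul, integral_const_mul] at this
    rw [← div_eq_mul_inv, le_div_iff₀ hj]; linarith
  obtain ⟨h2, h3⟩ := int_f_le hF hl hd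
  have hI0 : 0 ≤ I := setIntegral_nonneg (measurableSet_dy _ _) fun y _ => w_nonneg hk _
  calc ‖∫ y in dy j n, f y * φ y‖ ≤ ∫ y in dy j n, F.indicator (fun _ => (1:ℝ)) y * (16 * I * (2 ^ j)⁻¹) := by
        refine norm_integral_le_of_norm_le (h2.mul_const _) ?_
        rw [ae_restrict_iff' (measurableSet_dy _ _)]
        refine ae_of_all _ fun y hy => ?_
        rw [norm_mul]
        have h5 := (hφ.decay y).trans (h1 y hy)
        have h6 := hf1 y
        have h7 : 0 ≤ F.indicator (fun _ => (1:ℝ)) y := indicator_nonneg (fun _ _ => by norm_num) _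
        gcongr
    _ = (∫ y in dy j n, F.indicator (fun _ => (1:ℝ)) y) * (16 * I * (2 ^ j)⁻¹) := integral_mul_const _ _
    _ ≤ 2 * lam * 2 ^ j * (16 * I * (2 ^ j)⁻¹) := by gcongr
    _ = _ := by field_simp; ring

/-- modulated average -/
noncomputable def av (f : ℝ → ℂ) (ν : ℝ) (j n : ℤ) : ℂ := ((2 ^ j)⁻¹ : ℝ) * ∫ y in dy j n, e (-(ν * y)) * f y

lemma norm_av_le (ν : ℝ) (hF : MeasurableSet F) (hf1 : ∀ x, ‖f x‖ ≤ F.indicator (fun _ => 1) x) (hl : 0 < lam)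
    (hd : volume (F ∩ dy j n) ≤ ENNReal.ofReal (2 * lam * 2 ^ j)) : ‖av f ν j n‖ ≤ 2 * lam := by
  have hj := two_zpow_pos j
  obtain ⟨h2, h3⟩ := int_f_le hF hl hd
  have h1 : ‖∫ y in dy j n, e (-(ν * y)) * f y‖ ≤ 2 * lam * 2 ^ j := by
    refine (norm_integral_le_of_norm_le h2 (ae_of_all _ fun y => ?_)).trans h3
    rw [norm_mul, norm_e, one_mul]; exact hf1 y
  unfold av
  rw [norm_mul, Complex.norm_real, norm_of_nonneg (by positivity)]
  calc _ ≤ (2 ^ j)⁻¹ * (2 * lam * 2 ^ j) := by gcongr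
    _ = _ := by field_simp

lemma cancel (ν : ℝ) (hF : MeasurableSet F) (hfm : Measurable f) (hf1 : ∀ x, ‖f x‖ ≤ F.indicator (fun _ => 1) x) (hl : 0 < lam)
    (hd : volume (F ∩ dy j n) ≤ ENNReal.ofReal (2 * lam * 2 ^ j)) (hjk : j ≤ s.k) (hν : ν ∈ s.Om) (hφ : IsWP s φ) :
    ‖∫ y in dy j n, (f y - av f ν j n * e (ν * y)) * φ y‖ ≤ 4 * lam * 2 ^ j * 2 ^ j * 2 ^ (-s.k) * 
      w (2 ^ s.k) (n * 2 ^ j - s.c) := by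
  have hj := two_zpow_pos j
  have hk := two_zpow_pos s.k
  have hk' := two_zpow_pos (-s.k)
  obtain ⟨h2, h3⟩ := int_f_le hF hl hd
  have hfin : volume (dy j n) ≠ ∞ := by rw [volume_dy]; exact ENNReal.ofReal_ne_top
  set a := av f ν j n with ha
  set c : ℝ := n * 2 ^ j with hc
  have hcm : c ∈ dy j n := left_mem_dy _ _
  have ha1 : ‖a‖ ≤ 2 * lam := norm_av_le ν hF hf1 hl hd
  have i1 : IntegrableOn (fun y => e (-(ν * y)) * f y) (dy j n) := by
    refine Integrable.mono' h2 (((continuous_e.comp (by fun_prop)).measurable.mul hfm).aestronglyMeasurable) 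
      (ae_of_all _ fun y => ?_)
    rw [norm_mul, norm_e, one_mul]; exact hf1 y
  have i2 : IntegrableOn (fun _ : ℝ => a) (dy j n) := integrableOn_const hfin
  have z0 : ∫ y in dy j n, (e (-(ν * y)) * f y - a) = 0 := by
    rw [integral_sub i1 i2, setIntegral_const, volume_real_dy, ha]
    unfold av
    rw [Complex.real_smul]; push_cast
    field_simp; simp
  have i3 : IntegrableOn (fun y => (f y - a * e (ν * y)) * φ y) (dy j n) := by
    have hb : ∀ y, ‖φ y‖ ≤ (2 ^ s.k)⁻¹ := fun y => (hφ.decay y).trans (w_le hk _)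
    refine Integrable.mono' ((h2.add (integrableOn_const hfin (C := 2 * lam))).mul_const ((2 ^ s.k)⁻¹)) 
      (((hfm.sub ((continuous_e.comp (by fun_prop)).measurable.const_mul _)).mul hφ.cont.measurable).aestronglyMeasurable) 
      (ae_of_all _ fun y => ?_)
    rw [norm_mul]
    have : ‖f y - a * e (ν * y)‖ ≤ F.indicator (fun _ => 1) y + 2 * lam := by
      refine (norm_sub_le _ _).trans ?_
      rw [norm_mul, norm_e, mul_one]; linarith [hf1 y]
    simp only [Pi.add_apply]
    have h8 := hb y
    gcongr
    exact (norm_nonneg _).trans this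
  have e1 : ∫ y in dy j n, (f y - a * e (ν * y)) * φ y = 
      ∫ y in dy j n, -((e (-(ν * y)) * f y - a) * (e (ν * c) * φ c - e (ν * y) * φ y)) := by
    have : ∫ y in dy j n, (e (-(ν * y)) * f y - a) * (e (ν * c) * φ c) = 0 := by
      rw [integral_mul_const, z0, zero_mul]
    have i4 : IntegrableOn (fun y => (e (-(ν * y)) * f y - a) * (e (ν * c) * φ c)) (dy j n) := (i1.sub i2).mul_const _
    rw [← sub_zero (∫ y in dy j n, (f y - a * e (ν * y)) * φ y), ← this, ← integral_sub i3 i4]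
    refine integral_congr_ae (ae_of_all _ fun y => ?_)
    have h9 : e (-(ν * y)) * e (ν * y) = 1 := by rw [← e_add]; simp [e_zero]
    linear_combination (-(φ y * f y)) * h9
  rw [e1]
  have h4 : IntegrableOn (fun y => F.indicator (fun _ => (1:ℝ)) y + 2 * lam) (dy j n) := 
    h2.add (integrableOn_const hfin)
  calc _ ≤ ∫ y in dy j n, (F.indicator (fun _ => (1:ℝ)) y + 2 * lam) * (2 ^ (-s.k) * 2 ^ j * w (2 ^ s.k) (c - s.c)) := by
        refine norm_integral_le_of_norm_le (h4.mul_const _) ?_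
        rw [ae_restrict_iff' (measurableSet_dy _ _)]
        refine ae_of_all _ fun y hy => ?_
        rw [norm_neg, norm_mul]
        have b1 : ‖e (-(ν * y)) * f y - a‖ ≤ F.indicator (fun _ => 1) y + 2 * lam := by
          refine (norm_sub_le _ _).trans ?_
          rw [norm_mul, norm_e, one_mul]; linarith [hf1 y]
        have b2 : |c - y| ≤ 2 ^ j := abs_sub_le_of_mem_dy hcm hy
        have b4 : (2:ℝ) ^ j ≤ 2 ^ s.k := zpow_le_zpow_right₀ (by norm_num) hjk
        have b3 := hφ.lip ν hν c y (b2.trans b4)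
        have b5 := w_nonneg hk (c - s.c)
        have b6 := (norm_nonneg _).trans b1
        calc _ ≤ (F.indicator (fun _ => 1) y + 2 * lam) * (2 ^ (-s.k) * |c - y| * w (2 ^ s.k) (c - s.c)) := by gcongr
          _ ≤ _ := by gcongr
    _ = (∫ y in dy j n, (F.indicator (fun _ => (1:ℝ)) y + 2 * lam)) * (2 ^ (-s.k) * 2 ^ j * w (2 ^ s.k) (c - s.c)) := 
        integral_mul_const _ _
    _ ≤ (4 * lam * 2 ^ j) * (2 ^ (-s.k) * 2 ^ j * w (2 ^ s.k) (c - s.c)) := by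
        have b5 := w_nonneg hk (c - s.c)
        gcongr
        rw [integral_add h2 (integrableOn_const hfin), setIntegral_const, volume_real_dy, smul_eq_mul]
        linarith
    _ = _ := by ring

end
end CH

namespace CH

/-- CZ family -/
structure CZ (F : Set ℝ) (lam : ℝ) (Js : Finset Tile) : Prop where
  disj : ∀ s ∈ Js, ∀ t ∈ Js, s ≠ t → Disjoint s.I t.I
  cov : ∀ x ∈ F, ∃ J ∈ Js, x ∈ J.I
  dens : ∀ J ∈ Js, volume (F ∩ J.I) ≤ ENNReal.ofReal (2 * lam * 2 ^ J.k)

lemma exists_cz {F : Set ℝ} {lam b : ℝ} (hb : ∀ x ∈ F, |x| ≤ b) (hl : 0 < lam) (K : ℤ) :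
    ∃ Js, CZ F lam Js ∧ ∀ J ∈ Js, K < J.k → ENNReal.ofReal (lam * 2 ^ J.k) < volume (F ∩ J.I) := by
  classical
  have hFfin : volume F < ∞ := lt_of_le_of_lt (measure_mono (t := Icc (-b) b) fun x hx => abs_le.1 (hb x hx)) 
    (by rw [Real.volume_Icc]; exact ENNReal.ofReal_lt_top)
  obtain ⟨m, hm⟩ : ∃ m : ℕ, (volume F).toReal < lam * 2 ^ m := by
    obtain ⟨m, hm⟩ := pow_unbounded_of_one_lt ((volume F).toReal / lam) (one_lt_two)
    exact ⟨m, by rw [div_lt_iff₀ hl] at hm; linarith⟩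
  have hm' : ∀ k : ℤ, ∀ n, ENNReal.ofReal (lam * 2 ^ k) < volume (F ∩ dy k n) → k ≤ m := by
    intro k n hk
    by_contra hc
    have h1 := hk.trans_le (measure_mono (inter_subset_left))
    rw [ENNReal.ofReal_lt_iff_lt_toReal (by positivity) hFfin.ne] at h1
    have h2 : (2:ℝ) ^ (m:ℤ) ≤ 2 ^ k := zpow_le_zpow_right₀ (by norm_num) (by omega)
    rw [zpow_natCast] at h2
    have : lam * 2 ^ m ≤ lam * 2 ^ k := by gcongr
    linarith
  set n0 : ℤ := ⌈|b| * 2 ^ (-K)⌉ + 1 with hn0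
  have hn0' : 0 ≤ n0 := by
    have : 0 ≤ ⌈|b| * 2 ^ (-K)⌉ := Int.ceil_nonneg (by positivity)
    omega
  set cand : Finset Tile := ((Finset.Icc K (max (m:ℤ) K) ×ˢ Finset.Icc (-n0) n0).image (fun p => (⟨p.1, p.2, 0⟩ : Tile))).filter 
    (fun J => J.k = K ∨ ENNReal.ofReal (lam * 2 ^ J.k) < volume (F ∩ J.I)) with hcand
  have mc : ∀ J : Tile, J ∈ cand ↔ ((K ≤ J.k ∧ J.k ≤ max (m:ℤ) K) ∧ (-n0 ≤ J.n ∧ J.n ≤ n0) ∧ J.l = 0) ∧ 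
      (J.k = K ∨ ENNReal.ofReal (lam * 2 ^ J.k) < volume (F ∩ J.I)) := by
    intro J
    rw [hcand, Finset.mem_filter, Finset.mem_image]
    constructor
    · rintro ⟨⟨p, hp, rfl⟩, h⟩
      rw [Finset.mem_product, Finset.mem_Icc, Finset.mem_Icc] at hp
      exact ⟨⟨hp.1, hp.2, rfl⟩, h⟩
    · rintro ⟨⟨h1, h2, h3⟩, h⟩
      refine ⟨⟨(J.k, J.n), ?_, ?_⟩, h⟩
      · rw [Finset.mem_product, Finset.mem_Icc, Finset.mem_Icc]; exact ⟨h1, h2⟩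
      · rw [← h3]
  have hom : ∀ J ∈ cand, (0:ℝ) ∈ J.Om := by
    intro J hJ
    have h3 := ((mc J).1 hJ).1.2.2
    rw [Tile.Om, h3, mem_dy]
    have := two_zpow_pos (-J.k)
    constructor
    · simp
    · simpa using two_zpow_pos J.k
  refine ⟨tops cand, ⟨?_, ?_, ?_⟩, ?_⟩
  · intro s hs t ht hne
    rw [Set.disjoint_left]
    intro x hx hx'
    rw [mem_tops] at hs ht
    rcases le_total s.k t.k with hk | hk
    · exact hne (hs.2 t ht.1 (tile_le hk hx hx' (hom s hs.1) (hom t ht.1))).symm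
    · exact hne (ht.2 s hs.1 (tile_le hk hx' hx (hom t ht.1) (hom s hs.1)))
  · intro x hx
    have hJ : (⟨K, ⌊x * 2 ^ (-K)⌋, 0⟩ : Tile) ∈ cand := by
      rw [mc]
      refine ⟨⟨⟨le_rfl, le_max_right _ _⟩, ?_, rfl⟩, Or.inl rfl⟩
      have h1 : |x * 2 ^ (-K)| ≤ |b| * 2 ^ (-K) := by
        rw [abs_mul, abs_of_pos (two_zpow_pos (-K))]
        have := (hb x hx).trans (le_abs_self b)
        have := two_zpow_pos (-K)
        gcongr
      have h2 := Int.le_ceil (|b| * 2 ^ (-K))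
      have h3 := abs_le.1 h1
      constructor
      · show -n0 ≤ ⌊_⌋
        rw [Int.le_floor, hn0]; push_cast; linarith
      · show ⌊_⌋ ≤ n0
        have := Int.floor_le (x * 2 ^ (-K))
        have h4 : ((⌊x * 2 ^ (-K)⌋ : ℤ) : ℝ) ≤ ((n0 : ℤ) : ℝ) := by rw [hn0]; push_cast; linarith
        exact_mod_cast h4
    obtain ⟨u, hu, hle⟩ := exists_top hJ
    refine ⟨u, hu, hle.1 ?_⟩
    have := two_zpow_pos K
    rw [Tile.I, mem_dy]
    have h1 := Int.floor_le (x * 2 ^ (-K))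
    have h2 := Int.lt_floor_add_one (x * 2 ^ (-K))
    rw [zpow_neg, ← div_eq_mul_inv] at *
    rw [le_div_iff₀ this] at h1
    rw [div_lt_iff₀ this] at h2
    exact ⟨h1, h2⟩
  · intro J hJ
    by_contra hc
    rw [not_le] at hc
    rw [mem_tops] at hJ
    have a := ((mc J).1 hJ.1).1
    set J' : Tile := ⟨J.k + 1, J.n / 2, 0⟩ with hJ'
    have hsub : J.I ⊆ J'.I := by
      refine dy_subset (by rw [hJ']; simp) (left_mem_dy _ _) ?_
      rw [hJ', mem_dy]
      have h2 := two_zpow_pos J.k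
      have e1 : (2:ℝ) ^ (J.k + 1) = 2 * 2 ^ J.k := by rw [zpow_add_one₀ two_ne_zero]; ring
      have b1 : ((J.n / 2 : ℤ) : ℝ) * 2 ≤ J.n := by exact_mod_cast (by omega : J.n / 2 * 2 ≤ J.n)
      have b2 : (J.n : ℝ) + 1 ≤ (((J.n / 2 : ℤ) : ℝ) + 1) * 2 := by exact_mod_cast (by omega : J.n + 1 ≤ (J.n / 2 + 1) * 2)
      simp only
      rw [e1]
      constructor <;> nlinarith
    have hF' : ENNReal.ofReal (lam * 2 ^ (J.k + 1)) < volume (F ∩ J'.I) := by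
      rw [zpow_add_one₀ two_ne_zero, show lam * (2 ^ J.k * 2) = 2 * lam * 2 ^ J.k by ring]
      exact hc.trans_le (measure_mono (inter_subset_inter_right _ hsub))
    have hmem : J' ∈ cand := by
      rw [mc]
      have := hm' (J.k + 1) (J.n / 2) hF'
      refine ⟨⟨⟨by show K ≤ J.k + 1; omega, by show J.k + 1 ≤ _; exact this.trans (le_max_left _ _)⟩, 
        ⟨by show -n0 ≤ J.n / 2; omega, by show J.n / 2 ≤ n0; omega⟩, rfl⟩, Or.inr hF'⟩
    have hle : J.Le J' := tile_le (by rw [hJ']; simp) (c_mem J) (hsub (c_mem J)) (hom J hJ.1) (hom J' hmem)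
    have h5 := congrArg Tile.k (hJ.2 J' hmem hle)
    simp only [hJ'] at h5
    omega
  · intro J hJ hK
    have h1 := ((mc J).1 (mem_tops.1 hJ).1).2
    exact h1.resolve_left hK.ne'

end CH

namespace CH

section
variable {F : Set ℝ} {f : ℝ → ℂ} {lam : ℝ} {Js T : Finset Tile} {φ : Tile → ℝ → ℂ} {ν : ℝ} {kT nT : ℤ}

/-- oscillating part -/
noncomputable def bq (f : ℝ → ℂ) (ν : ℝ) (φ : ℝ → ℂ) (J : Tile) : ℂ :=
  ∫ y in J.I, (f y - av f ν J.k J.n * e (ν * y)) * φ y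

lemma sum_w_high (hν : ∀ s ∈ T, ν ∈ s.w2) (j : ℤ) (x : ℝ) :
    ∑ s ∈ T.filter (fun s => ¬ s.k < j), w (2 ^ s.k) (x - s.c) ≤ 32 * π * 2 ^ (-j) := by
  classical
  set A := T.filter (fun s => ¬ s.k < j) with hA
  calc ∑ s ∈ A, w (2 ^ s.k) (x - s.c) 
      = ∑ k ∈ A.image (fun s => s.k), ∑ s ∈ A.filter (fun s => s.k = k), w (2 ^ s.k) (x - s.c) := by
        rw [Finset.sum_fiberwise_of_maps_to (fun s hs => Finset.mem_image_of_mem _ hs)]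
    _ ≤ ∑ k ∈ A.image (fun s => s.k), 16 * π * 2 ^ (-k) := by
        refine Finset.sum_le_sum fun k _ => ?_
        have h1 := sum_w_le_pi (A.filter (fun s => s.k = k)) ?_ (k := k) (fun s hs => (Finset.mem_filter.1 hs).2.le) x
        · have hk := two_zpow_pos k
          rw [zpow_neg, ← div_eq_mul_inv, le_div_iff₀ hk, Finset.sum_mul]
          refine le_trans (le_of_eq ?_) h1
          refine Finset.sum_congr rfl fun s hs => ?_
          rw [(Finset.mem_filter.1 hs).2]; ring
        · intro s hs t ht hne
          rw [Finset.mem_filter, hA, Finset.mem_filter] at hs ht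
          have e1 : s.k = t.k := hs.2.trans ht.2.symm
          by_contra hc
          obtain ⟨y, hy, hy'⟩ := Set.not_disjoint_iff.1 hc
          have h2 := w2_subset s (hν s hs.1.1)
          have h3 := w2_subset t (hν t ht.1.1)
          exact hne ((tile_le e1.le hy hy' h2 h3).antisymm (tile_le e1.ge hy' hy h3 h2))
    _ = 16 * π * ∑ k ∈ (A.image (fun s => s.k)).image (fun k => -k), (2:ℝ) ^ k := by
        rw [Finset.mul_sum, Finset.sum_image (fun a _ b _ h => neg_injective h)]
    _ ≤ 16 * π * (2 * 2 ^ (-j)) := by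
        have := sum_zpow_le ((A.image (fun s => s.k)).image (fun k => -k)) (-j) (by
          intro k hk
          obtain ⟨k', hk', rfl⟩ := Finset.mem_image.1 hk
          obtain ⟨s, hs, rfl⟩ := Finset.mem_image.1 hk'
          have := (Finset.mem_filter.1 hs).2
          omega)
        gcongr
    _ = _ := by ring

lemma bq_direct (hF : MeasurableSet F) (hfm : Measurable f) (hf1 : ∀ x, ‖f x‖ ≤ F.indicator (fun _ => 1) x) 
    (hl : 0 < lam) {J s : Tile} (hd : volume (F ∩ J.I) ≤ ENNReal.ofReal (2 * lam * 2 ^ J.k)) 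
    (h : s.k < J.k → Disjoint s.I (dy3 J.k J.n)) {φ : ℝ → ℂ} (hφ : IsWP s φ) :
    ‖bq f ν φ J‖ ≤ 34 * lam * ∫ y in J.I, w (2 ^ s.k) (s.c - y) := by
  have hk := two_zpow_pos s.k
  have h1 := direct hF hf1 hl hd h hφ
  have ha := norm_av_le ν hF hf1 hl hd
  have hb : ∀ y, ‖f y‖ ≤ 1 := fun y => (hf1 y).trans (indicator_le_self' (fun _ _ => zero_le_one) y)
  have i1 : IntegrableOn (fun y => f y * φ y) J.I := by
    refine (hφ.integrable.bdd_mul (c := 1) hfm.aestronglyMeasurable (ae_of_all _ hb)).integrableOn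
  have i2 : IntegrableOn (fun y => av f ν J.k J.n * e (ν * y) * φ y) J.I := by
    refine (hφ.integrable.bdd_mul (c := 2 * lam) 
      ((continuous_e.comp (by fun_prop)).measurable.const_mul _).aestronglyMeasurable (ae_of_all _ fun y => ?_)).integrableOn
    show ‖av f ν J.k J.n * e (ν * y)‖ ≤ _
    rw [norm_mul, norm_e, mul_one]; exact ha
  have h2 : ‖∫ y in J.I, av f ν J.k J.n * e (ν * y) * φ y‖ ≤ 2 * lam * ∫ y in J.I, w (2 ^ s.k) (s.c - y) := by
    rw [← integral_const_mul]
    refine norm_integral_le_of_norm_le ((integrable_w_sub' hk s.c).const_mul _).integrableOn (ae_of_all _ fun y => ?_)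
    rw [norm_mul, norm_mul, norm_e, mul_one, w_sub_comm]
    have := hφ.decay y
    gcongr
  unfold bq
  simp only [sub_mul]
  rw [integral_sub i1 i2]
  refine (norm_sub_le _ _).trans ?_
  have h1' : ‖∫ y in J.I, f y * φ y‖ ≤ 32 * lam * ∫ y in J.I, w (2 ^ s.k) (s.c - y) := h1
  linarith

lemma bq_sum (hF : MeasurableSet F) (hfm : Measurable f) (hf1 : ∀ x, ‖f x‖ ≤ F.indicator (fun _ => 1) x) 
    (hl : 0 < lam) {J : Tile} (hd : volume (F ∩ J.I) ≤ ENNReal.ofReal (2 * lam * 2 ^ J.k)) 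
    (h : ∀ s ∈ T, s.k < J.k → Disjoint s.I (dy3 J.k J.n)) (hφ : ∀ s, IsWP s (φ s)) (hν : ∀ s ∈ T, ν ∈ s.w2) :
    ∑ s ∈ T, 2 ^ s.k * ‖bq f ν (φ s) J‖ ≤ 1216 * π * lam * 2 ^ J.k := by
  classical
  have hj := two_zpow_pos J.k
  rw [← Finset.sum_filter_add_sum_filter_not T (fun s => s.k < J.k)]
  have hll : ∀ s ∈ T, ∀ t ∈ T, s.k = t.k → s.l = t.l := by
    intro s hs t ht e1
    have h2 := w2_subset s (hν s hs)
    have h3 := w2_subset t (hν t ht)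
    rw [Tile.Om] at h2 h3
    rw [← e1] at h3
    by_contra hne
    exact Set.disjoint_left.1 (dy_disjoint hne) h2 h3
  have h1 : ∑ s ∈ T.filter (fun s => s.k < J.k), 2 ^ s.k * ‖bq f ν (φ s) J‖ ≤ 34 * lam * (32 * π * 2 ^ J.k) := by
    have := tree_bdry_out (T.filter (fun s => s.k < J.k)) (kT := J.k) (nT := J.n) 
      (fun s hs => ((h s (Finset.mem_filter.1 hs).1 (Finset.mem_filter.1 hs).2).mono_right (dy_sub_dy3 _ _)))
      (fun s hs => (Finset.mem_filter.1 hs).2.le)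
      (fun s hs t ht => hll s (Finset.mem_filter.1 hs).1 t (Finset.mem_filter.1 ht).1)
    refine le_trans ?_ (mul_le_mul_of_nonneg_left this (by positivity))
    rw [Finset.mul_sum]
    refine Finset.sum_le_sum fun s hs => ?_
    have h2 := bq_direct (ν := ν) hF hfm hf1 hl hd (h s (Finset.mem_filter.1 hs).1) (hφ s)
    have hk := two_zpow_pos s.k
    calc _ ≤ 2 ^ s.k * (34 * lam * ∫ y in J.I, w (2 ^ s.k) (s.c - y)) := by gcongr
      _ = _ := by rw [Tile.I]; ring
  have h2 : ∑ s ∈ T.filter (fun s => ¬ s.k < J.k), 2 ^ s.k * ‖bq f ν (φ s) J‖ ≤ 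
      4 * lam * 2 ^ J.k * 2 ^ J.k * (32 * π * 2 ^ (-J.k)) := by
    refine le_trans ?_ (mul_le_mul_of_nonneg_left (sum_w_high hν J.k J.c) (by positivity))
    rw [Finset.mul_sum]
    refine Finset.sum_le_sum fun s hs => ?_
    rw [Finset.mem_filter] at hs
    have h3 := cancel (s := s) (j := J.k) (n := J.n) (φ := φ s) ν hF hfm hf1 hl hd (by omega) 
      (w2_subset s (hν s hs.1)) (hφ s)
    have hk := two_zpow_pos s.k
    calc _ ≤ 2 ^ s.k * (4 * lam * 2 ^ J.k * 2 ^ J.k * 2 ^ (-s.k) * w (2 ^ s.k) (J.n * 2 ^ J.k - s.c)) := by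
          exact mul_le_mul_of_nonneg_left h3 hk.le
      _ = 4 * lam * 2 ^ J.k * 2 ^ J.k * w (2 ^ s.k) (J.c - s.c) := by
          have hJc : J.c = J.n * 2 ^ J.k := rfl
          rw [hJc, zpow_neg]
          generalize w (2 ^ s.k) (J.n * 2 ^ J.k - s.c) = ww
          field_simp
  have h3 : 4 * lam * 2 ^ J.k * 2 ^ J.k * (32 * π * 2 ^ (-J.k)) = 128 * π * lam * 2 ^ J.k := by
    rw [zpow_neg]; field_simp; ring
  linarith

lemma size_bound (hF : MeasurableSet F) (hfm : Measurable f) (hf1 : ∀ x, ‖f x‖ ≤ F.indicator (fun _ => 1) x) 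
    (hl : 0 < lam) (cz : CZ F lam Js) {P : Finset Tile}
    (hP : ∀ s ∈ P, ∀ J ∈ Js, s.k < J.k → Disjoint s.I (dy3 J.k J.n)) : SizeLE P f (500 * π * lam) := by
  classical
  intro kT nT ν φ hφ
  set T := P.filter (fun s => s.I ⊆ dy kT nT ∧ ν ∈ s.w2) with hT
  have hkT := two_zpow_pos kT
  rcases T.eq_empty_or_nonempty with hTe | ⟨s0, hs0⟩
  · rw [hTe, Finset.sum_empty]; positivity
  have hTI : ∀ s ∈ T, s.I ⊆ dy kT nT := fun s hs => (Finset.mem_filter.1 hs).2.1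
  have hTν : ∀ s ∈ T, ν ∈ s.w2 := fun s hs => (Finset.mem_filter.1 hs).2.2
  have hTP : ∀ s ∈ T, s ∈ P := fun s hs => (Finset.mem_filter.1 hs).1
  set Jin := Js.filter (fun J => J.I ⊆ dy kT nT) with hJin
  set Jout := Js.filter (fun J => ¬ J.I ⊆ dy kT nT) with hJout
  have hin : ∀ J ∈ Jin, J ∈ Js := fun s hs => (Finset.mem_filter.1 hs).1
  have hout : ∀ J ∈ Jout, J ∈ Js := fun s hs => (Finset.mem_filter.1 hs).1
  have hod : ∀ J ∈ Jout, J.I ⊆ (dy kT nT)ᶜ := by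
    intro J hJ
    rw [hJout, Finset.mem_filter] at hJ
    refine Disjoint.subset_compl_right ?_
    rcases le_or_gt J.k kT with hk | hk
    · exact (dy_disjoint_or_subset hk).resolve_right hJ.2
    · refine ((dy_disjoint_or_subset hk.le).resolve_right fun hc => ?_).symm
      have h1 := dy_scale_le_of_subset (hTI s0 hs0)
      have h2 := hP s0 (hTP s0 hs0) J hJ.1 (by omega)
      exact Set.disjoint_left.1 h2 (c_mem s0) (dy_sub_dy3 _ _ (hc (hTI s0 hs0 (c_mem s0))))
  have hb : ∀ y, ‖f y‖ ≤ 1 := fun y => (hf1 y).trans (indicator_le_self' (fun _ _ => zero_le_one) y)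
  have hIntg : ∀ s, Integrable (fun y => f y * φ s y) := fun s => 
    (hφ s).integrable.bdd_mul (c := 1) hfm.aestronglyMeasurable (ae_of_all _ hb)
  have hav : ∀ J ∈ Js, ‖av f ν J.k J.n‖ ≤ 2 * lam := fun J hJ => norm_av_le ν hF hf1 hl (cz.dens J hJ)
  -- good function
  set g : ℝ → ℂ := fun y => ∑ J ∈ Jin, J.I.indicator (fun y => av f ν J.k J.n * e (ν * y)) y with hg
  have hgm : Measurable g := by
    refine Finset.measurable_fun_sum _ fun J _ => ?_
    exact ((continuous_e.comp (by fun_prop)).measurable.const_mul _).indicator (measurableSet_I J)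
  have hgb : ∀ y, ‖g y‖ ≤ (dy kT nT).indicator (fun _ => 2 * lam) y := by
    intro y
    rw [hg]; simp only
    by_cases hy : ∃ J ∈ Jin, y ∈ J.I
    · obtain ⟨J, hJ, hyJ⟩ := hy
      rw [Finset.sum_eq_single_of_mem J hJ, indicator_of_mem hyJ, norm_mul, norm_e, mul_one,
        indicator_of_mem ((Finset.mem_filter.1 hJ).2 hyJ)]
      · exact hav J (hin J hJ)
      · intro J' hJ' hne
        exact indicator_of_notMem (fun hc => Set.disjoint_left.1 (cz.disj J' (hin _ hJ') J (hin _ hJ) hne) hc hyJ) _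
    · rw [Finset.sum_eq_zero, norm_zero]
      · exact indicator_nonneg (fun _ _ => by positivity) _
      · intro J hJ
        exact indicator_of_notMem (fun hc => hy ⟨J, hJ, hc⟩) _
  have hmd := measurableSet_dy kT nT
  have hfin : volume (dy kT nT) ≠ ∞ := by rw [volume_dy]; exact ENNReal.ofReal_ne_top
  have hgi : Integrable g := by
    refine Integrable.mono' ((integrable_indicator_iff hmd).2 (integrableOn_const hfin (C := 2 * lam))) 
      hgm.aestronglyMeasurable (ae_of_all _ hgb)
  have hgb2 : ∀ y, ‖g y‖ ^ 2 ≤ (dy kT nT).indicator (fun _ => (2 * lam) ^ 2) y := by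
    intro y
    have := hgb y
    by_cases hy : y ∈ dy kT nT
    · rw [indicator_of_mem hy] at this ⊢; gcongr
    · rw [indicator_of_notMem hy] at this ⊢; rw [norm_le_zero_iff.1 this]; simp
  have hi2 : Integrable ((dy kT nT).indicator (fun _ => (2 * lam) ^ 2)) := 
    (integrable_indicator_iff hmd).2 (integrableOn_const hfin)
  have hgi2 : Integrable (fun y => ‖g y‖ ^ 2) := by
    refine Integrable.mono' hi2 (hgm.norm.pow_const 2).aestronglyMeasurable (ae_of_all _ fun y => ?_)
    rw [norm_of_nonneg (by positivity)]; exact hgb2 y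
  have hg2 : ∫ y, ‖g y‖ ^ 2 ≤ 4 * lam ^ 2 * 2 ^ kT := by
    refine (integral_mono hgi2 hi2 hgb2).trans ?_
    rw [integral_indicator hmd, setIntegral_const, volume_real_dy, smul_eq_mul]
    exact le_of_eq (by ring)
  set X : Tile → ℂ := fun s => ∑ J ∈ Jout, ∫ y in J.I, f y * φ s y with hX
  set Y : Tile → ℂ := fun s => ∑ J ∈ Jin, bq f ν (φ s) J with hY
  set Z : Tile → ℂ := fun s => ∫ y, g y * φ s y with hZ
  have hsplit : ∀ s, ∫ y, f y * φ s y = X s + Y s + Z s := by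
    intro s
    have e1 : ∫ y, f y * φ s y = ∑ J ∈ Js, ∫ y in J.I, f y * φ s y := by
      rw [← integral_biUnion_finset _ (fun J _ => measurableSet_I J) (fun s hs t ht hne => cz.disj s hs t ht hne)
        (fun J _ => (hIntg s).integrableOn)]
      refine (setIntegral_eq_integral_of_forall_compl_eq_zero fun y hy => ?_).symm
      have hyF : y ∉ F := fun hc => hy (by
        obtain ⟨J, hJ, hyJ⟩ := cz.cov y hc
        exact mem_iUnion₂.2 ⟨J, hJ, hyJ⟩)
      have := hf1 y
      rw [indicator_of_notMem hyF] at this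
      rw [norm_le_zero_iff.1 this, zero_mul]
    have i2 : ∀ J : Tile, Integrable (fun y => av f ν J.k J.n * e (ν * y) * φ s y) := by
      intro J
      refine ((hφ s).integrable.bdd_mul (c := ‖av f ν J.k J.n‖) 
        ((continuous_e.comp (by fun_prop)).measurable.const_mul _).aestronglyMeasurable (ae_of_all _ fun y => ?_))
      show ‖av f ν J.k J.n * e (ν * y)‖ ≤ _
      rw [norm_mul, norm_e, mul_one]
    have e2 : Z s = ∑ J ∈ Jin, ∫ y in J.I, av f ν J.k J.n * e (ν * y) * φ s y := by
      have : ∀ y, g y * φ s y = ∑ J ∈ Jin, J.I.indicator (fun y => av f ν J.k J.n * e (ν * y) * φ s y) y := by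
        intro y; rw [hg]; simp only
        rw [Finset.sum_mul]
        refine Finset.sum_congr rfl fun J _ => ?_
        by_cases hy : y ∈ J.I <;> simp [hy]
      rw [hZ]; simp only [this]
      rw [integral_finsetSum _ (fun J _ => (i2 J).indicator (measurableSet_I J))]
      exact Finset.sum_congr rfl fun J _ => integral_indicator (measurableSet_I J)
    have e3 : Y s + Z s = ∑ J ∈ Jin, ∫ y in J.I, f y * φ s y := by
      rw [e2, hY]; simp only
      rw [← Finset.sum_add_distrib]
      refine Finset.sum_congr rfl fun J _ => ?_
      unfold bq
      simp only [sub_mul]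
      rw [integral_sub (hIntg s).integrableOn (i2 J).integrableOn]; ring
    rw [add_assoc, e3, hX, e1]; simp only
    rw [add_comm, hJin, hJout, Finset.sum_filter_add_sum_filter_not]
  have hsumw : ∀ s : Tile, ∀ A ⊆ Js, ∑ J ∈ A, ∫ y in J.I, w (2 ^ s.k) (s.c - y) ≤ ∫ y, w (2 ^ s.k) (s.c - y) := by
    intro s A hA
    have hi := integrable_w_sub' (two_zpow_pos s.k) s.c
    rw [← integral_biUnion_finset _ (fun J _ => measurableSet_I J) (fun s hs t ht hne => cz.disj s (hA hs) t (hA ht) hne)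
        (fun J _ => hi.integrableOn)]
    exact setIntegral_le_integral hi (ae_of_all _ fun y => w_nonneg (two_zpow_pos s.k) _)
  have hpi : ∀ s : Tile, ∫ y, w (2 ^ s.k) (s.c - y) ≤ π := fun s => integral_w_sub_le' (two_zpow_pos s.k) s.c
  -- outer part
  have hX1 : ∀ s ∈ T, ‖X s‖ ≤ 32 * lam * ∑ J ∈ Jout, ∫ y in J.I, w (2 ^ s.k) (s.c - y) := by
    intro s hs
    rw [Finset.mul_sum]
    exact norm_sum_le_of_le _ fun J hJ => direct hF hf1 hl (cz.dens J (hout J hJ)) (hP s (hTP s hs) J (hout J hJ)) (hφ s)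
  have hX2 : ∀ s ∈ T, ‖X s‖ ≤ 32 * lam * ∫ y in (dy kT nT)ᶜ, w (2 ^ s.k) (s.c - y) := by
    intro s hs
    refine (hX1 s hs).trans (mul_le_mul_of_nonneg_left ?_ (by positivity))
    have hi := integrable_w_sub' (two_zpow_pos s.k) s.c
    rw [← integral_biUnion_finset _ (fun J _ => measurableSet_I J) (fun s hs t ht hne => cz.disj s (hout _ hs) t (hout _ ht) hne)
        (fun J _ => hi.integrableOn)]
    exact setIntegral_mono_set hi.integrableOn (ae_of_all _ fun y => w_nonneg (two_zpow_pos s.k) _) 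
      (Eventually.of_forall (iUnion₂_subset hod))
  have hX3 : ∀ s ∈ T, ‖X s‖ ≤ 32 * lam * π := fun s hs => 
    (hX1 s hs).trans (mul_le_mul_of_nonneg_left ((hsumw s Jout (Finset.filter_subset _ _)).trans (hpi s)) (by positivity))
  have hll : ∀ s ∈ T, ∀ t ∈ T, s.k = t.k → s.l = t.l := by
    intro s hs t ht e1
    have h2 := w2_subset s (hTν s hs)
    have h3 := w2_subset t (hTν t ht)
    rw [Tile.Om] at h2 h3
    rw [← e1] at h3
    by_contra hne
    exact Set.disjoint_left.1 (dy_disjoint hne) h2 h3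
  have SX : ∑ s ∈ T, 2 ^ s.k * ‖X s‖ ^ 2 ≤ 32 ^ 3 * π ^ 2 * lam ^ 2 * 2 ^ kT := by
    have h1 := tree_bdry T hTI hll
    calc _ ≤ ∑ s ∈ T, (32 * lam * π) * (32 * lam) * (2 ^ s.k * ∫ y in (dy kT nT)ᶜ, w (2 ^ s.k) (s.c - y)) := by
          refine Finset.sum_le_sum fun s hs => ?_
          have a1 := hX2 s hs
          have a2 := hX3 s hs
          have hk := two_zpow_pos s.k
          calc _ = 2 ^ s.k * (‖X s‖ * ‖X s‖) := by ring
            _ ≤ 2 ^ s.k * ((32 * lam * π) * (32 * lam * ∫ y in (dy kT nT)ᶜ, w (2 ^ s.k) (s.c - y))) := by gcongr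
            _ = _ := by ring
      _ ≤ (32 * lam * π) * (32 * lam) * (32 * π * 2 ^ kT) := by
          rw [← Finset.mul_sum]; gcongr
      _ = _ := by ring
  -- oscillating part
  have hY3 : ∀ s ∈ T, ‖Y s‖ ≤ 34 * lam * π := by
    intro s hs
    calc _ ≤ ∑ J ∈ Jin, 34 * lam * ∫ y in J.I, w (2 ^ s.k) (s.c - y) := norm_sum_le_of_le _ fun J hJ =>
          bq_direct hF hfm hf1 hl (cz.dens J (hin J hJ)) (hP s (hTP s hs) J (hin J hJ)) (hφ s)
      _ ≤ _ := by
          rw [← Finset.mul_sum]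
          exact mul_le_mul_of_nonneg_left ((hsumw s Jin (Finset.filter_subset _ _)).trans (hpi s)) (by positivity)
  have SY : ∑ s ∈ T, 2 ^ s.k * ‖Y s‖ ^ 2 ≤ 41344 * π ^ 2 * lam ^ 2 * 2 ^ kT := by
    calc _ ≤ ∑ s ∈ T, (34 * lam * π) * ∑ J ∈ Jin, 2 ^ s.k * ‖bq f ν (φ s) J‖ := by
          refine Finset.sum_le_sum fun s hs => ?_
          have a1 := hY3 s hs
          have a2 : ‖Y s‖ ≤ ∑ J ∈ Jin, ‖bq f ν (φ s) J‖ := norm_sum_le _ _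
          have hk := two_zpow_pos s.k
          calc _ = 2 ^ s.k * (‖Y s‖ * ‖Y s‖) := by ring
            _ ≤ 2 ^ s.k * ((34 * lam * π) * ∑ J ∈ Jin, ‖bq f ν (φ s) J‖) := by gcongr
            _ = _ := by rw [← Finset.mul_sum]; ring
      _ = (34 * lam * π) * ∑ J ∈ Jin, ∑ s ∈ T, 2 ^ s.k * ‖bq f ν (φ s) J‖ := by
          rw [← Finset.mul_sum, Finset.sum_comm]
      _ ≤ (34 * lam * π) * ∑ J ∈ Jin, 1216 * π * lam * 2 ^ J.k := by
          gcongr with J hJ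
          exact bq_sum hF hfm hf1 hl (cz.dens J (hin J hJ)) (fun s hs => hP s (hTP s hs) J (hin J hJ)) hφ hTν
      _ ≤ (34 * lam * π) * (1216 * π * lam * 2 ^ kT) := by
          rw [← Finset.mul_sum]
          gcongr
          exact sum_zpow_disjoint Jin (fun s hs t ht => cz.disj s (hin s hs) t (hin t ht)) 
            (fun J hJ => (Finset.mem_filter.1 hJ).2)
      _ = _ := by ring
  have SZ : ∑ s ∈ T, 2 ^ s.k * ‖Z s‖ ^ 2 ≤ 8192 * π ^ 2 * lam ^ 2 * 2 ^ kT := by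
    refine (bessel_tree hgi hgi2 T φ (fun s _ => hφ s) hTν).trans ?_
    calc _ ≤ 2048 * π ^ 2 * (4 * lam ^ 2 * 2 ^ kT) := by gcongr
      _ = _ := by ring
  calc _ ≤ ∑ s ∈ T, (3 * (2 ^ s.k * ‖X s‖ ^ 2) + 3 * (2 ^ s.k * ‖Y s‖ ^ 2) + 3 * (2 ^ s.k * ‖Z s‖ ^ 2)) := by
        refine Finset.sum_le_sum fun s hs => ?_
        have hk := two_zpow_pos s.k
        rw [hsplit s]
        have h1 : ‖X s + Y s + Z s‖ ≤ ‖X s‖ + ‖Y s‖ + ‖Z s‖ := norm_add₃_le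
        have h2 : ‖X s + Y s + Z s‖ ^ 2 ≤ 3 * ‖X s‖ ^ 2 + 3 * ‖Y s‖ ^ 2 + 3 * ‖Z s‖ ^ 2 := by
          have := norm_nonneg (X s + Y s + Z s)
          have h3 : ‖X s + Y s + Z s‖ ^ 2 ≤ (‖X s‖ + ‖Y s‖ + ‖Z s‖) ^ 2 := by gcongr
          nlinarith [sq_nonneg (‖X s‖ - ‖Y s‖), sq_nonneg (‖X s‖ - ‖Z s‖), sq_nonneg (‖Y s‖ - ‖Z s‖)]
        calc _ ≤ 2 ^ s.k * (3 * ‖X s‖ ^ 2 + 3 * ‖Y s‖ ^ 2 + 3 * ‖Z s‖ ^ 2) := by gcongr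
          _ = _ := by ring
    _ ≤ _ := by
        rw [Finset.sum_add_distrib, Finset.sum_add_distrib, ← Finset.mul_sum, ← Finset.mul_sum, ← Finset.mul_sum]
        have : 0 ≤ π ^ 2 * lam ^ 2 * 2 ^ kT := by positivity
        nlinarith

end
end CH

namespace CH

/-- model operator -/
noncomputable def T0 (κ : ℝ → ℂ) (ρ : ℝ → ℝ) (K : ℕ) (f : ℝ → ℂ) (N : ℝ → ℝ) (x : ℝ) : ℂ :=
  ∑ k ∈ Finset.Icc (-(K:ℤ)) K, (ρ (Int.fract (2 ^ k * N x)) : ℂ) * cnv f (kn κ k (N x)) x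

noncomputable def box (K : ℕ) (M : ℤ) : Finset Tile :=
  (Finset.Icc (-(K:ℤ)) K ×ˢ (Finset.Icc (-M) M ×ˢ Finset.Icc (-M) M)).map 
    ⟨fun q => ⟨q.1, q.2.1, q.2.2⟩, fun a b h => by
      have h1 := congrArg Tile.k h
      have h2 := congrArg Tile.n h
      have h3 := congrArg Tile.l h
      exact Prod.ext h1 (Prod.ext h2 h3)⟩

lemma mem_box {K : ℕ} {M : ℤ} {s : Tile} : s ∈ box K M ↔ (-(K:ℤ) ≤ s.k ∧ s.k ≤ K) ∧ |s.n| ≤ M ∧ |s.l| ≤ M := by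
  unfold box
  simp only [Finset.mem_map, Finset.mem_product, Finset.mem_Icc, abs_le]
  constructor
  · rintro ⟨q, ⟨h1, h2, h3⟩, rfl⟩; exact ⟨h1, h2, h3⟩
  · rintro ⟨h1, h2, h3⟩; exact ⟨(s.k, s.n, s.l), ⟨h1, h2, h3⟩, rfl⟩

lemma dy_abs_le {k n k' n' : ℤ} (h : dy k n ⊆ dy k' n') : |n'| ≤ |n| := by
  have hk := dy_scale_le_of_subset h
  obtain ⟨d, rfl⟩ := Int.le.dest hk
  have h2 := two_zpow_pos k
  have h1 : (1:ℝ) ≤ 2 ^ d := one_le_pow₀ (by norm_num)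
  have hz : (2:ℝ) ^ (k + (d:ℤ)) = 2 ^ d * 2 ^ k := by rw [zpow_add₀ two_ne_zero, zpow_natCast]; ring
  have hl := (mem_dy.1 (h (left_mem_dy k n)))
  rw [hz] at hl
  have a1 : (n':ℝ) * 2 ^ d ≤ n := by
    have := hl.1; rw [← mul_assoc] at this; exact le_of_mul_le_mul_right this h2
  have a2 : (n:ℝ) < ((n':ℝ) + 1) * 2 ^ d := by
    have := hl.2; rw [← mul_assoc] at this; exact lt_of_mul_lt_mul_right this h2.le
  have b1 : n' * 2 ^ d ≤ n := by exact_mod_cast a1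
  have b2 : n < (n' + 1) * 2 ^ d := by exact_mod_cast a2
  have h1' : (1:ℤ) ≤ 2 ^ d := one_le_pow₀ (by norm_num)
  rcases le_or_gt 0 n' with h0 | h0
  · have : n' ≤ n := by nlinarith
    rw [abs_of_nonneg h0, abs_of_nonneg (by omega)]; exact this
  · have : n ≤ n' := by nlinarith
    rw [abs_of_neg h0, abs_of_neg (by omega)]; omega

lemma box_convex (K : ℕ) (M : ℤ) : TConvex (box K M) := by
  intro s hs u hu t h1 h2
  rw [mem_box] at *
  have a1 := h1.k_le
  have a2 := h2.k_le
  have a3 := dy_abs_le h1.1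
  have a4 := dy_abs_le h2.2
  refine ⟨⟨by omega, by omega⟩, by omega, by omega⟩

lemma dy3_mem {k n : ℤ} {x : ℝ} (h : x ∈ dy3 k n) : ∃ m, x ∈ dy k m ∧ dy k m ⊆ dy3 k n := by
  have h2 := two_zpow_pos k
  refine ⟨_, mem_dy_self k x, ?_⟩
  have h3 := mem_dy_self k x
  set m := ⌊x * 2 ^ (-k)⌋
  rw [mem_dy] at h3
  have a1 : (n:ℝ) - 1 < m + 1 := lt_of_mul_lt_mul_right (h.1.trans_lt h3.2) h2.le
  have a2 : (m:ℝ) < n + 2 := lt_of_mul_lt_mul_right (h3.1.trans_lt h.2) h2.le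
  have b1 : n - 1 ≤ m := by
    have : n - 1 < m + 1 := by exact_mod_cast a1
    omega
  have b2 : m + 1 ≤ n + 2 := by
    have : m < n + 2 := by exact_mod_cast a2
    omega
  have c1 : (n:ℝ) - 1 ≤ m := by exact_mod_cast b1
  have c2 : (m:ℝ) + 1 ≤ n + 2 := by exact_mod_cast b2
  intro y hy
  rw [mem_dy] at hy
  exact ⟨le_trans (by gcongr) hy.1, hy.2.trans_le (by gcongr)⟩

lemma dy3_cases {s : Tile} {k n : ℤ} (h : s.k ≤ k) : Disjoint s.I (dy3 k n) ∨ s.I ⊆ dy3 k n := by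
  by_cases hd : Disjoint s.I (dy3 k n)
  · exact Or.inl hd
  · rw [Set.not_disjoint_iff] at hd
    obtain ⟨x, hx, hx'⟩ := hd
    obtain ⟨m, hm, hsub⟩ := dy3_mem hx'
    exact Or.inr ((dy_subset h hx hm).trans hsub)

lemma rho_zero {ρ : ℝ → ℝ} (R : Rho ρ) {t : ℝ} {l : ℤ} (h : l ≠ ⌊t⌋) : ρ (t - l) = 0 := by
  by_contra hc
  have := R.supp _ hc
  apply h
  symm
  rw [Int.floor_eq_iff]
  constructor <;> linarith [this.1, this.2]

section
variable {κ κ' ϑ : ℝ → ℂ} {χ' h : ℝ → ℝ} {A : ℝ} {ρ : ℝ → ℝ}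

lemma T0_eq (R : Rho ρ) {K : ℕ} {f : ℝ → ℂ} {N : ℝ → ℝ} {g : ℝ → ℂ} {b : ℝ} (hN : ∀ x, |N x| ≤ b) 
    (hg : ∀ x, g x ≠ 0 → |x| ≤ b) {M : ℤ} (hM : b * 2 ^ K + 1 ≤ M) (x : ℝ) :
    g x * T0 κ ρ K f N x = ∑ s ∈ box K M, tf κ ρ f N g s x := by
  classical
  by_cases hgx : g x = 0
  · rw [hgx, zero_mul, Finset.sum_eq_zero]
    intro s _
    unfold tf
    by_cases hx : x ∈ s.I <;> simp [hx, hgx]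
  have hx := hg x hgx
  have hb : 0 ≤ b := (abs_nonneg _).trans hx
  have hfl : ∀ {t u : ℝ}, |t| ≤ b → 0 ≤ u → u ≤ 2 ^ K → |⌊t * u⌋| ≤ M := by
    intro t u ht hu hu'
    have h1 : |t * u| ≤ b * 2 ^ K := by rw [abs_mul, abs_of_nonneg hu]; gcongr
    have h2 := Int.floor_le (t * u)
    have h3 := Int.lt_floor_add_one (t * u)
    have h4 := abs_le.1 h1
    have h5 : |((⌊t * u⌋ : ℤ) : ℝ)| ≤ M := by rw [abs_le]; constructor <;> linarith [h4.1, h4.2]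
    exact_mod_cast h5
  rw [T0, Finset.mul_sum, box, Finset.sum_map, Finset.sum_product]
  refine Finset.sum_congr rfl fun k hk => ?_
  rw [Finset.mem_Icc] at hk
  have hk1 : (2:ℝ) ^ k ≤ 2 ^ K := by
    rw [← zpow_natCast]; exact zpow_le_zpow_right₀ (by norm_num) hk.2
  have hk2 : (2:ℝ) ^ (-k) ≤ 2 ^ K := by
    rw [← zpow_natCast]; exact zpow_le_zpow_right₀ (by norm_num) (by omega)
  have m1 : ⌊x * 2 ^ (-k)⌋ ∈ Finset.Icc (-M) M := by
    rw [Finset.mem_Icc, ← abs_le]; exact hfl hx (two_zpow_pos _).le hk2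
  have m2 : ⌊2 ^ k * N x⌋ ∈ Finset.Icc (-M) M := by
    rw [Finset.mem_Icc, ← abs_le, mul_comm]; exact hfl (hN x) (two_zpow_pos _).le hk1
  rw [Finset.sum_eq_single (⌊x * 2 ^ (-k)⌋, ⌊2 ^ k * N x⌋)]
  · have hin : x ∈ Tile.I ⟨k, ⌊x * 2 ^ (-k)⌋, ⌊2 ^ k * N x⌋⟩ := mem_dy_self k x
    show _ = tf κ ρ f N g ⟨k, ⌊x * 2 ^ (-k)⌋, ⌊2 ^ k * N x⌋⟩ x
    rw [tf, indicator_of_mem hin, rs]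
    rfl
  · rintro ⟨n, l⟩ - hne
    show tf κ ρ f N g ⟨k, n, l⟩ x = 0
    rw [tf]
    by_cases hx' : x ∈ Tile.I ⟨k, n, l⟩
    · have hn : n = ⌊x * 2 ^ (-k)⌋ := dy_eq_of_mem hx' (mem_dy_self k x)
      rw [indicator_of_mem hx', rs]
      simp only
      rw [rho_zero R (fun hl => hne (by rw [hn, hl]))]
      simp
    · rw [indicator_of_notMem hx']
  · intro hc
    exact absurd (Finset.mem_product.2 ⟨m1, m2⟩) hc

lemma T0_integrable (Kr : Ker κ κ' ϑ χ' h A) (R : Rho ρ) {K : ℕ} {f : ℝ → ℂ} (hf : Integrable f) {E : Set ℝ} 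
    {N : ℝ → ℝ} {g : ℝ → ℂ} (D : Dat E N g) {b : ℝ} (hN : ∀ x, |N x| ≤ b) (hE : ∀ x ∈ E, |x| ≤ b) :
    Integrable (fun x => g x * T0 κ ρ K f N x) := by
  obtain ⟨M, hM⟩ := exists_int_gt (b * 2 ^ K + 1)
  have hg : ∀ x, g x ≠ 0 → |x| ≤ b := by
    intro x hx
    refine hE x (by_contra fun hc => hx ?_)
    have := D.hg1 x
    rw [indicator_of_notMem hc] at this
    exact norm_le_zero_iff.1 this
  simp only [T0_eq R hN hg hM.le]
  exact integrable_finsetSum _ fun s _ => tf_integrable Kr R hf D.hN D.hg D.hg1 s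

lemma T0_bdd (Kr : Ker κ κ' ϑ χ' h A) (R : Rho ρ) (K : ℕ) {f : ℝ → ℂ} (hf : Integrable f) :
    ∃ M, 0 ≤ M ∧ ∀ (N : ℝ → ℝ) x, ‖T0 κ ρ K f N x‖ ≤ M := by
  have hA := Kr.k1.pos
  have hI : 0 ≤ ∫ y, ‖f y‖ := integral_nonneg fun y => norm_nonneg _
  refine ⟨∑ k ∈ Finset.Icc (-(K:ℤ)) K, (∫ y, ‖f y‖) * (A * (2 ^ k)⁻¹), by positivity, fun N x => ?_⟩
  refine (norm_sum_le _ _).trans (Finset.sum_le_sum fun k _ => ?_)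
  rw [norm_mul, Complex.norm_real]
  have h1 := R.le (Int.fract (2 ^ k * N x))
  have h2 := Kr.k1.cnv_bdd f hf k (N x) x
  calc _ ≤ 1 * ((∫ y, ‖f y‖) * (A * (2 ^ k)⁻¹)) := by gcongr; exact h1
    _ = _ := one_mul _

/-- the exceptional set -/
lemma exc_set {F : Set ℝ} {lam : ℝ} (hF : MeasurableSet F) (hfin : volume F ≠ ∞) (hl : 0 < lam) {Js : Finset Tile} (cz : CZ F lam Js)
    {K : ℕ} (hJ : ∀ J ∈ Js, -(K:ℤ) < J.k → ENNReal.ofReal (lam * 2 ^ J.k) < volume (F ∩ J.I)) :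
    ∃ G, MeasurableSet G ∧ lam * volume.real G ≤ 3 * volume.real F ∧ volume G ≠ ∞ ∧ (lam = 1 → G = ∅) ∧ 
      ∀ s : Tile, -(K:ℤ) ≤ s.k → ¬ s.I ⊆ G → ∀ J ∈ Js, s.k < J.k → Disjoint s.I (dy3 J.k J.n) := by
  classical
  set D := Js.filter (fun J => ENNReal.ofReal (lam * 2 ^ J.k) < volume (F ∩ J.I)) with hD
  have hvol3 : ∀ J : Tile, volume (dy3 J.k J.n) = ENNReal.ofReal (3 * 2 ^ J.k) := by
    intro J; rw [dy3, Real.volume_Ico]; congr 1; ring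
  have hGle : volume (⋃ J ∈ D, dy3 J.k J.n) ≤ ENNReal.ofReal (∑ J ∈ D, 3 * 2 ^ J.k) := by
    refine (measure_biUnion_finset_le _ _).trans ?_
    rw [ENNReal.ofReal_sum_of_nonneg (fun J _ => by have := two_zpow_pos J.k; positivity)]
    exact (Finset.sum_congr rfl fun J _ => hvol3 J).le
  refine ⟨⋃ J ∈ D, dy3 J.k J.n, Finset.measurableSet_biUnion _ fun J _ => measurableSet_Ico, ?_, ?_, ?_, ?_⟩
  · have h1 : volume.real (⋃ J ∈ D, dy3 J.k J.n) ≤ ∑ J ∈ D, 3 * 2 ^ J.k := by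
      refine ENNReal.toReal_le_of_le_ofReal (Finset.sum_nonneg fun J _ => by have := two_zpow_pos J.k; positivity) hGle
    have h2 : ∑ J ∈ D, volume.real (F ∩ J.I) ≤ volume.real F := by
      have : volume (⋃ J ∈ D, F ∩ J.I) = ∑ J ∈ D, volume (F ∩ J.I) := 
        measure_biUnion_finset (fun s hs t ht hst => (cz.disj s (Finset.mem_filter.1 hs).1 t (Finset.mem_filter.1 ht).1 hst).mono 
          inter_subset_right inter_subset_right) (fun s _ => hF.inter (measurableSet_I s))
      have h3 : volume (⋃ J ∈ D, F ∩ J.I) ≤ volume F := measure_mono (iUnion₂_subset fun _ _ => inter_subset_left)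
      rw [this] at h3
      have := ENNReal.toReal_mono hfin h3
      rwa [ENNReal.toReal_sum (fun J _ => measure_ne_top_of_subset inter_subset_left hfin)] at this
    have h3 : ∀ J ∈ D, lam * 2 ^ J.k ≤ volume.real (F ∩ J.I) := by
      intro J hJ
      have h4 := (Finset.mem_filter.1 hJ).2
      exact (ENNReal.ofReal_le_iff_le_toReal (measure_ne_top_of_subset inter_subset_left hfin)).1 h4.le
    have h4 := Finset.sum_le_sum h3
    rw [← Finset.mul_sum] at h4 h1
    calc _ ≤ lam * (3 * ∑ J ∈ D, 2 ^ J.k) := by gcongr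
      _ ≤ _ := by linarith
  · exact ne_top_of_le_ne_top ENNReal.ofReal_ne_top hGle
  · intro h1
    have : D = ∅ := by
      rw [hD, Finset.filter_eq_empty_iff]
      intro J _ hc
      rw [h1, one_mul, ← volume_dy J.k J.n] at hc
      exact absurd (measure_mono (μ := volume) (inter_subset_right : F ∩ J.I ⊆ J.I)) (not_le.2 hc)
    rw [this]; simp
  · intro s hs hG J hJm hlt
    rcases dy3_cases (s := s) (n := J.n) hlt.le with h1 | h1
    · exact h1
    · exact absurd (h1.trans (subset_biUnion_of_mem (u := fun J : Tile => dy3 J.k J.n) 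
        (Finset.mem_filter.2 ⟨hJm, hJ J hJm (by omega)⟩))) hG

lemma restr (Kr : Ker κ κ' ϑ χ' h A) (R : Rho ρ) (θ : ℝ) (hθ : 1 / 2 < θ) (hθ1 : θ < 1) :
    ∃ C > 0, ∀ (K : ℕ) (f : ℝ → ℂ) (F E : Set ℝ) (N : ℝ → ℝ) (b lam : ℝ), 
      MeasurableSet F → Measurable f → (∀ x, ‖f x‖ ≤ F.indicator (fun _ => 1) x) → (∀ x ∈ F, |x| ≤ b) → 
      (∀ x ∈ E, |x| ≤ b) → (∀ x, |N x| ≤ b) → 0 < lam → 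
      ∃ G, MeasurableSet G ∧ lam * volume.real G ≤ 3 * volume.real F ∧ volume G ≠ ∞ ∧ (lam = 1 → G = ∅) ∧ 
        ∀ g, Dat E N g → (∀ x ∈ G, g x = 0) → ‖∫ x, g x * T0 κ ρ K f N x‖ ≤ 
          C * (volume.real E ^ θ * volume.real F ^ (1 - θ) * lam ^ (2 * θ - 1)) := by
  classical
  obtain ⟨C, hC, hcomb⟩ := combine Kr R θ hθ hθ1
  refine ⟨C * (500 * π) ^ (2 * θ - 1), by positivity, ?_⟩
  intro K f F E N b lam hF hfm hf1 hFb hEb hNb hl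
  have hFfin : volume F ≠ ∞ := ne_top_of_le_ne_top (b := volume (Icc (-b) b)) (by simp)
    (measure_mono fun x hx => abs_le.1 (hFb x hx))
  obtain ⟨Js, cz, hJ⟩ := exists_cz hFb hl (-(K:ℤ))
  obtain ⟨G, hGm, hGv, hGf, hG1, hGd⟩ := exc_set hF hFfin hl cz hJ
  refine ⟨G, hGm, hGv, hGf, hG1, fun g D hg0 => ?_⟩
  have hi1 : Integrable (F.indicator (fun _ => (1:ℝ))) := (integrable_indicator_iff hF).2 (integrableOn_const hFfin)
  have hf : Integrable f := hi1.mono' hfm.aestronglyMeasurable (ae_of_all _ hf1)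
  have hle2 : ∀ x, ‖f x‖ ^ 2 ≤ F.indicator (fun _ => 1) x := by
    intro x
    have := hf1 x
    by_cases hx : x ∈ F
    · rw [indicator_of_mem hx] at *; nlinarith [norm_nonneg (f x)]
    · rw [indicator_of_notMem hx] at *; nlinarith [norm_nonneg (f x)]
  have hf2 : Integrable (fun x => ‖f x‖ ^ 2) := by
    refine hi1.mono' (hfm.norm.pow_const 2).aestronglyMeasurable (ae_of_all _ fun x => ?_)
    rw [Real.norm_of_nonneg (by positivity)]; exact hle2 x
  have hf3 : ∫ x, ‖f x‖ ^ 2 ≤ volume.real F := by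
    have := integral_mono hf2 hi1 hle2
    rwa [integral_indicator_const _ hF, smul_eq_mul, mul_one] at this
  obtain ⟨M, hM⟩ := exists_int_gt (b * 2 ^ K + 1)
  have hg : ∀ x, g x ≠ 0 → |x| ≤ b := by
    intro x hx
    refine hEb x (by_contra fun hc => hx ?_)
    have := D.hg1 x
    rw [indicator_of_notMem hc] at this
    exact norm_le_zero_iff.1 this
  set P := (box K M).filter (fun s => ¬ s.I ⊆ G) with hP
  have hS : ∫ x, g x * T0 κ ρ K f N x = SS κ ρ f N g P := by
    simp only [T0_eq R hNb hg hM.le]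
    rw [integral_finsetSum _ fun s _ => tf_integrable Kr R hf D.hN D.hg D.hg1 s, SS]
    symm
    refine Finset.sum_subset (Finset.filter_subset _ _) fun s hs hs' => ?_
    have hsub : s.I ⊆ G := by
      by_contra hc; exact hs' (Finset.mem_filter.2 ⟨hs, hc⟩)
    have : tf κ ρ f N g s = 0 := by
      ext x
      unfold tf
      by_cases hx : x ∈ s.I
      · simp [hx, hg0 x (hsub hx)]
      · simp [hx]
    rw [this]; simp
  have hconv : TConvex P := by
    intro s hs u hu t h1 h2
    rw [hP, Finset.mem_filter] at *
    exact ⟨box_convex K M s hs.1 u hu.1 t h1 h2, fun hc => hs.2 (h1.1.trans hc)⟩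
  have hsize : SizeLE P f (500 * π * lam) := by
    refine size_bound hF hfm hf1 hl cz fun s hs J hJm hlt => ?_
    rw [hP, Finset.mem_filter, mem_box] at hs
    exact hGd s hs.1.1.1 hs.2 J hJm hlt
  have hmain := hcomb f _ E N g hf hf2 (by positivity) D P hconv hsize
  rw [hS]
  refine hmain.trans ?_
  have hi0 : 0 ≤ ∫ x, ‖f x‖ ^ 2 := integral_nonneg fun x => by positivity
  have hEr : 0 ≤ volume.real E := measureReal_nonneg
  have h1 : (∫ x, ‖f x‖ ^ 2) ^ (1 - θ) ≤ volume.real F ^ (1 - θ) := Real.rpow_le_rpow hi0 hf3 (by linarith)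
  rw [Real.mul_rpow (by positivity) hl.le]
  calc _ ≤ C * (volume.real E ^ θ * volume.real F ^ (1 - θ) * ((500 * π) ^ (2 * θ - 1) * lam ^ (2 * θ - 1))) := by gcongr
    _ = _ := by ring

end
end CH

namespace CH

section
variable {κ κ' ϑ : ℝ → ℂ} {χ' h : ℝ → ℝ} {A : ℝ} {ρ : ℝ → ℝ}

lemma restricted1 (Kr : Ker κ κ' ϑ χ' h A) (R : Rho ρ) (θ : ℝ) (hθ : 1 / 2 < θ) (hθ1 : θ < 1) :
    ∃ C > 0, ∀ (K : ℕ) (f : ℝ → ℂ) (F E : Set ℝ) (N : ℝ → ℝ) (b : ℝ) (g : ℝ → ℂ), 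
      MeasurableSet F → Measurable f → (∀ x, ‖f x‖ ≤ F.indicator (fun _ => 1) x) → (∀ x ∈ F, |x| ≤ b) → 
      (∀ x ∈ E, |x| ≤ b) → (∀ x, |N x| ≤ b) → Dat E N g → 
      ‖∫ x, g x * T0 κ ρ K f N x‖ ≤ C * (volume.real E ^ θ * volume.real F ^ (1 - θ)) := by
  obtain ⟨C, hC, hr⟩ := restr Kr R θ hθ hθ1
  refine ⟨C, hC, ?_⟩
  intro K f F E N b g hF hfm hf1 hFb hEb hNb D
  obtain ⟨G, -, -, -, hG1, hG⟩ := hr K f F E N b 1 hF hfm hf1 hFb hEb hNb one_pos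
  rw [hG1 rfl] at hG
  have := hG g D (by simp)
  simpa using this

lemma half_set {C θ : ℝ} (hC : 0 < C) (hθ : 1 / 2 < θ) (hθ1 : θ < 1) {x y lam : ℝ} (hx : 0 ≤ x) (hy : 0 ≤ y)
    (hl : (lam = 1 ∧ (x ≤ 6 * y ∨ y = 0)) ∨ (lam = 6 * y / x ∧ 0 < x ∧ 0 < y)) : 
    C * (x ^ θ * y ^ (1 - θ) * lam ^ (2 * θ - 1)) ≤ C * 6 * (x ^ (1 - θ) * y ^ θ) := by
  have h6 : (6:ℝ) ^ (2 * θ - 1) ≤ 6 := by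
    calc (6:ℝ) ^ (2 * θ - 1) ≤ 6 ^ (1:ℝ) := Real.rpow_le_rpow_of_exponent_le (by norm_num) (by linarith)
      _ = 6 := Real.rpow_one _
  have key : x ^ θ * y ^ (1 - θ) * lam ^ (2 * θ - 1) ≤ 6 ^ (2 * θ - 1) * (x ^ (1 - θ) * y ^ θ) := by
    rcases hl with ⟨rfl, h1 | h1⟩ | ⟨rfl, h1, h2⟩
    · rw [Real.one_rpow, mul_one]
      rcases hx.eq_or_lt with h0 | h0
      · rw [← h0, Real.zero_rpow (by linarith), Real.zero_rpow (by linarith)]; simp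
      have hy0 : 0 < y := by linarith
      have e1 : x ^ θ = x ^ (2 * θ - 1) * x ^ (1 - θ) := by rw [← Real.rpow_add h0]; congr 1; ring
      have e2 : y ^ θ = y ^ (2 * θ - 1) * y ^ (1 - θ) := by rw [← Real.rpow_add hy0]; congr 1; ring
      have e3 : x ^ (2 * θ - 1) ≤ 6 ^ (2 * θ - 1) * y ^ (2 * θ - 1) := by
        rw [← Real.mul_rpow (by norm_num) hy]; exact Real.rpow_le_rpow hx h1 (by linarith)
      rw [e1, e2]
      calc _ ≤ (6 ^ (2 * θ - 1) * y ^ (2 * θ - 1)) * x ^ (1 - θ) * y ^ (1 - θ) := by gcongr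
        _ = _ := by ring
    · rw [h1, Real.zero_rpow (by linarith : 1 - θ ≠ 0)]; simp; positivity
    · have e1 : x ^ θ = x ^ (2 * θ - 1) * x ^ (1 - θ) := by rw [← Real.rpow_add h1]; congr 1; ring
      have e2 : y ^ θ = y ^ (2 * θ - 1) * y ^ (1 - θ) := by rw [← Real.rpow_add h2]; congr 1; ring
      rw [Real.div_rpow (by positivity) hx, Real.mul_rpow (by norm_num) hy, e1, e2]
      have := Real.rpow_pos_of_pos h1 (2 * θ - 1)
      field_simp
      exact le_rfl
  have h0 : 0 ≤ x ^ (1 - θ) * y ^ θ := by positivity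
  calc _ ≤ C * (6 ^ (2 * θ - 1) * (x ^ (1 - θ) * y ^ θ)) := by gcongr
    _ ≤ C * (6 * (x ^ (1 - θ) * y ^ θ)) := by gcongr
    _ = _ := by ring

lemma restricted2 (Kr : Ker κ κ' ϑ χ' h A) (R : Rho ρ) (θ : ℝ) (hθ : 1 / 2 < θ) (hθ1 : θ < 1) :
    ∃ C > 0, ∀ (K : ℕ) (f : ℝ → ℂ) (F E : Set ℝ) (N : ℝ → ℝ) (b : ℝ) (g : ℝ → ℂ), 
      MeasurableSet F → Measurable f → (∀ x, ‖f x‖ ≤ F.indicator (fun _ => 1) x) → (∀ x ∈ F, |x| ≤ b) → 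
      (∀ x ∈ E, |x| ≤ b) → (∀ x, |N x| ≤ b) → Dat E N g → 
      ‖∫ x, g x * T0 κ ρ K f N x‖ ≤ C * (volume.real E ^ (1 - θ) * volume.real F ^ θ) := by
  classical
  obtain ⟨C, hC, hr⟩ := restr Kr R θ hθ hθ1
  set q : ℝ := (1 / 2 : ℝ) ^ (1 - θ) with hq
  have hq0 : 0 < q := by positivity
  have hq1 : q < 1 := Real.rpow_lt_one (by norm_num) (by norm_num) (by linarith)
  set C2 := C * 6 / (1 - q) with hC2
  have hC2p : 0 < C2 := div_pos (by positivity) (by linarith)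
  have hC2e : C * 6 + C2 * q = C2 := by
    rw [hC2]; have : 1 - q ≠ 0 := by linarith
    field_simp; ring
  refine ⟨C2, hC2p, ?_⟩
  intro K f F E N b g hF hfm hf1 hFb hEb hNb D
  have hFfin : volume F ≠ ∞ := ne_top_of_le_ne_top (b := volume (Icc (-b) b)) (by simp)
    (measure_mono fun x hx => abs_le.1 (hFb x hx))
  have hi1 : Integrable (F.indicator (fun _ => (1:ℝ))) := (integrable_indicator_iff hF).2 (integrableOn_const hFfin)
  have hf : Integrable f := hi1.mono' hfm.aestronglyMeasurable (ae_of_all _ hf1)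
  obtain ⟨M, hM0, hM⟩ := T0_bdd Kr R K hf
  have hFr : 0 ≤ volume.real F := measureReal_nonneg
  have main : ∀ n : ℕ, ∀ (E : Set ℝ) (g : ℝ → ℂ), (∀ x ∈ E, |x| ≤ b) → Dat E N g → 
      ‖∫ x, g x * T0 κ ρ K f N x‖ ≤ C2 * (volume.real E ^ (1 - θ) * volume.real F ^ θ) + M * volume.real E * (1 / 2) ^ n := by
    intro n
    induction n with
    | zero =>
      intro E g hEb D
      have h1 : ‖∫ x, g x * T0 κ ρ K f N x‖ ≤ ∫ x, E.indicator (fun _ => M) x := by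
        refine norm_integral_le_of_norm_le ((integrable_indicator_iff D.hE).2 (integrableOn_const D.fin)) (ae_of_all _ fun x => ?_)
        rw [norm_mul]
        have h1 := D.hg1 x
        have h2 := hM N x
        by_cases hx : x ∈ E
        · rw [indicator_of_mem hx] at *
          calc _ ≤ 1 * M := by gcongr
            _ = M := one_mul _
        · rw [indicator_of_notMem hx] at *
          rw [le_antisymm h1 (norm_nonneg _), zero_mul]
      rw [integral_indicator_const _ D.hE, smul_eq_mul] at h1
      have hEr : 0 ≤ volume.real E := measureReal_nonneg
      have : 0 ≤ C2 * (volume.real E ^ (1 - θ) * volume.real F ^ θ) := by positivity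
      rw [pow_zero, mul_one, mul_comm M]; linarith
    | succ n ih =>
      intro E g hEb D
      have hEr : 0 ≤ volume.real E := measureReal_nonneg
      obtain ⟨lam, hlam, hl⟩ : ∃ lam : ℝ, 0 < lam ∧ ((lam = 1 ∧ (volume.real E ≤ 6 * volume.real F ∨ volume.real F = 0)) ∨ 
          (lam = 6 * volume.real F / volume.real E ∧ 0 < volume.real E ∧ 0 < volume.real F)) := by
        by_cases h1 : volume.real E ≤ 6 * volume.real F ∨ volume.real F = 0
        · exact ⟨1, one_pos, Or.inl ⟨rfl, h1⟩⟩
        · rw [not_or, not_le] at h1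
          have h2 : 0 < volume.real F := lt_of_le_of_ne hFr (Ne.symm h1.2)
          have h3 : 0 < volume.real E := by linarith [h1.1]
          exact ⟨_, by positivity, Or.inr ⟨rfl, h3, h2⟩⟩
      obtain ⟨G, hGm, hGv, hGf, hG1, hG⟩ := hr K f F E N b lam hF hfm hf1 hFb hEb hNb hlam
      have hGE : volume.real G ≤ volume.real E / 2 := by
        rcases hl with ⟨rfl, _⟩ | ⟨h1, h2, h3⟩
        · rw [hG1 rfl]; simp; positivity
        · rw [h1, div_mul_eq_mul_div, div_le_iff₀ h2] at hGv
          nlinarith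
      have hGcE : volume.real (E ∩ G) ≤ volume.real E / 2 := 
        (measureReal_mono inter_subset_right hGf).trans hGE
      have D1 : Dat E N (Gᶜ.indicator g) := by
        refine ⟨D.hE, D.fin, D.hN, D.hg.indicator hGm.compl, fun x => ?_⟩
        exact (norm_indicator_le_norm_self _ _).trans (D.hg1 x)
      have D2 : Dat (E ∩ G) N (G.indicator g) := by
        refine ⟨D.hE.inter hGm, measure_ne_top_of_subset inter_subset_left D.fin, D.hN, D.hg.indicator hGm, fun x => ?_⟩
        have := D.hg1 x
        by_cases hx : x ∈ G <;> by_cases hx' : x ∈ E <;> simp [hx, hx'] at * <;> assumption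
      have b1 := hG _ D1 (fun x hx => by simp [hx])
      have b2 := ih (E ∩ G) _ (fun x hx => hEb x hx.1) D2
      have hsplit : ∫ x, g x * T0 κ ρ K f N x = (∫ x, Gᶜ.indicator g x * T0 κ ρ K f N x) + 
          ∫ x, G.indicator g x * T0 κ ρ K f N x := by
        rw [← integral_add (T0_integrable Kr R hf D1 hNb hEb) (T0_integrable Kr R hf D2 hNb (fun x hx => hEb x hx.1))]
        congr 1; ext x
        by_cases hx : x ∈ G <;> simp [hx]
      have b3 := half_set hC hθ hθ1 hEr hFr hl
      have hGr : 0 ≤ volume.real (E ∩ G) := measureReal_nonneg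
      have b4 : volume.real (E ∩ G) ^ (1 - θ) ≤ q * volume.real E ^ (1 - θ) := by
        rw [hq, ← Real.mul_rpow (by norm_num) hEr]
        exact Real.rpow_le_rpow hGr (by linarith) (by linarith)
      rw [hsplit]
      calc _ ≤ _ := norm_add_le _ _
        _ ≤ C * 6 * (volume.real E ^ (1 - θ) * volume.real F ^ θ) + 
            (C2 * ((q * volume.real E ^ (1 - θ)) * volume.real F ^ θ) + M * (volume.real E / 2) * (1 / 2) ^ n) := by
          refine add_le_add (b1.trans b3) (b2.trans ?_)
          gcongr
        _ = (C * 6 + C2 * q) * (volume.real E ^ (1 - θ) * volume.real F ^ θ) + M * volume.real E * (1 / 2) ^ (n + 1) := by ring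
        _ = _ := by rw [hC2e]
  have hlim : Tendsto (fun n : ℕ => C2 * (volume.real E ^ (1 - θ) * volume.real F ^ θ) + M * volume.real E * (1 / 2) ^ n) 
      atTop (nhds (C2 * (volume.real E ^ (1 - θ) * volume.real F ^ θ) + M * volume.real E * 0)) :=
    tendsto_const_nhds.add ((tendsto_pow_atTop_nhds_zero_of_lt_one (by norm_num) (by norm_num)).const_mul _)
  rw [mul_zero, add_zero] at hlim
  exact ge_of_tendsto' hlim fun n => main n E g hEb D

/-- restricted weak type estimates with all exponents other than one half -/
lemma restricted (Kr : Ker κ κ' ϑ χ' h A) (R : Rho ρ) (a : ℝ) (ha0 : 0 < a) (ha1 : a < 1) (ha : a ≠ 1 / 2) :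
    ∃ C > 0, ∀ (K : ℕ) (f : ℝ → ℂ) (F E : Set ℝ) (N : ℝ → ℝ) (b : ℝ) (g : ℝ → ℂ), 
      MeasurableSet F → Measurable f → (∀ x, ‖f x‖ ≤ F.indicator (fun _ => 1) x) → (∀ x ∈ F, |x| ≤ b) → 
      (∀ x ∈ E, |x| ≤ b) → (∀ x, |N x| ≤ b) → Dat E N g → 
      ‖∫ x, g x * T0 κ ρ K f N x‖ ≤ C * (volume.real F ^ a * volume.real E ^ (1 - a)) := by
  rcases lt_or_gt_of_ne ha with h1 | h1
  · obtain ⟨C, hC, H⟩ := restricted1 Kr R (1 - a) (by linarith) (by linarith)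
    refine ⟨C, hC, fun K f F E N b g h1 h2 h3 h4 h5 h6 h7 => ?_⟩
    have := H K f F E N b g h1 h2 h3 h4 h5 h6 h7
    rwa [sub_sub_cancel, mul_comm (volume.real E ^ _)] at this
  · obtain ⟨C, hC, H⟩ := restricted2 Kr R a (by linarith) (by linarith)
    refine ⟨C, hC, fun K f F E N b g h1 h2 h3 h4 h5 h6 h7 => ?_⟩
    have := H K f F E N b g h1 h2 h3 h4 h5 h6 h7
    rwa [mul_comm (volume.real E ^ _)] at this

end
end CH

namespace CH

lemma sum_r_le {r : ℝ} (hr0 : 0 < r) (hr1 : r < 1) : ∃ c > 0, ∀ (q x : ℝ), 1 ≤ q → ∀ S : Finset ℤ, 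
    ∑ i ∈ S, r ^ |x - q * i| ≤ c := by
  have hs : Summable (fun m : ℤ => r ^ m.natAbs) := by
    refine Summable.of_nat_of_neg ?_ ?_
    · simpa using summable_geometric_of_lt_one hr0.le hr1
    · simpa using summable_geometric_of_lt_one hr0.le hr1
  have h0 : 0 ≤ ∑' m : ℤ, r ^ m.natAbs := tsum_nonneg fun m => by positivity
  refine ⟨r⁻¹ * (∑' m : ℤ, r ^ m.natAbs) + 1, by positivity, fun q x hq S => ?_⟩
  set i0 := ⌊x / q⌋ with hi0
  have hqp : 0 < q := by linarith
  have h1 : ∀ i : ℤ, r ^ |x - q * i| ≤ r⁻¹ * r ^ (i - i0).natAbs := by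
    intro i
    have a1 := Int.floor_le (x / q)
    have a2 := Int.lt_floor_add_one (x / q)
    rw [← hi0] at a1 a2
    rw [le_div_iff₀ hqp] at a1
    rw [div_lt_iff₀ hqp] at a2
    have hc : (((i - i0).natAbs : ℕ) : ℝ) = |(i:ℝ) - i0| := by
      rw [Nat.cast_natAbs]; push_cast; rfl
    have h2 : (((i - i0).natAbs : ℕ) : ℝ) - 1 ≤ |x - q * i| := by
      rw [hc]
      rcases lt_trichotomy i i0 with hlt | heq | hlt
      · have b : (i:ℝ) + 1 ≤ i0 := by exact_mod_cast hlt
        rw [abs_of_neg (by linarith), abs_of_nonneg (by nlinarith)]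
        nlinarith
      · rw [heq, sub_self, abs_zero]; linarith [abs_nonneg (x - q * i0)]
      · have b : (i0:ℝ) + 1 ≤ i := by exact_mod_cast hlt
        rw [abs_of_pos (by linarith), abs_of_nonpos (by nlinarith)]
        nlinarith
    calc r ^ |x - q * i| ≤ r ^ ((((i - i0).natAbs : ℕ) : ℝ) - 1) := Real.rpow_le_rpow_of_exponent_ge hr0 hr1.le h2
      _ = _ := by rw [Real.rpow_sub hr0, Real.rpow_one, Real.rpow_natCast]; field_simp
  have h3 : ∑ i ∈ S, r ^ (i - i0).natAbs ≤ ∑' m : ℤ, r ^ m.natAbs := by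
    have h4 := hs.sum_le_tsum (S.map (Equiv.subRight i0).toEmbedding) (fun i _ => by positivity)
    rw [Finset.sum_map] at h4
    exact h4
  calc _ ≤ ∑ i ∈ S, r⁻¹ * r ^ (i - i0).natAbs := Finset.sum_le_sum fun i _ => h1 i
    _ = r⁻¹ * ∑ i ∈ S, r ^ (i - i0).natAbs := by rw [Finset.mul_sum]
    _ ≤ r⁻¹ * (∑' m : ℤ, r ^ m.natAbs) := by gcongr
    _ ≤ _ := by linarith

lemma young_piece {p q δ C x y Z : ℝ} (hp : 0 < p) (hq : 0 < q) (hpq : 1 / p + 1 / q = 1) (hδ0 : 0 < δ)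
    (hδp : δ < 1 / p) (hδq : δ < 1 / q) (hC : 0 < C) (hx : 0 ≤ x) (hy : 0 ≤ y) 
    (h1 : Z ≤ C * (x ^ (1 / p + δ) * y ^ (1 - (1 / p + δ)))) (h2 : Z ≤ C * (x ^ (1 / p - δ) * y ^ (1 - (1 / p - δ))))
    (i j : ℤ) : 2 ^ i * 2 ^ j * Z ≤ C * ((2 ^ (-δ)) ^ |p * j - q * i| * (2 ^ (p * j) * x + 2 ^ (q * i) * y)) := by
  have key : ∀ ε : ℝ, |ε| ≤ δ → Z ≤ C * (x ^ (1 / p + ε) * y ^ (1 - (1 / p + ε))) → 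
      2 ^ i * 2 ^ j * Z ≤ C * (2 ^ (-ε * (p * j - q * i)) * (2 ^ (p * j) * x + 2 ^ (q * i) * y)) := by
    intro ε hε h
    have hε' := abs_le.1 hε
    set u := 2 ^ (p * j) * x with hu
    set v' := 2 ^ (q * i) * y with hv'
    have hu0 : 0 ≤ u := by positivity
    have hv0 : 0 ≤ v' := by positivity
    have ex : x = 2 ^ (-(p * j)) * u := by
      rw [hu, ← mul_assoc, ← Real.rpow_add two_pos, neg_add_cancel, Real.rpow_zero, one_mul]
    have ey : y = 2 ^ (-(q * i)) * v' := by
      rw [hv', ← mul_assoc, ← Real.rpow_add two_pos, neg_add_cancel, Real.rpow_zero, one_mul]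
    have e1 : x ^ (1 / p + ε) = 2 ^ (-(p * j) * (1 / p + ε)) * u ^ (1 / p + ε) := by
      rw [ex, Real.mul_rpow (by positivity) hu0, ← Real.rpow_mul two_pos.le]
    have e2 : y ^ (1 - (1 / p + ε)) = 2 ^ (-(q * i) * (1 - (1 / p + ε))) * v' ^ (1 - (1 / p + ε)) := by
      rw [ey, Real.mul_rpow (by positivity) hv0, ← Real.rpow_mul two_pos.le]
    have hg := Real.geom_mean_le_arith_mean2_weighted (w₁ := 1 / p + ε) (w₂ := 1 - (1 / p + ε)) 
      (by linarith [hε'.1]) (by linarith [hε'.2]) hu0 hv0 (by ring)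
    have hg2 : u ^ (1 / p + ε) * v' ^ (1 - (1 / p + ε)) ≤ u + v' := by
      refine hg.trans ?_
      have : 0 ≤ 1 / p + ε := by linarith [hε'.1]
      have : 0 ≤ 1 - (1 / p + ε) := by linarith [hε'.2]
      nlinarith
    have e3 : (2:ℝ) ^ i * 2 ^ j * (2 ^ (-(p * j) * (1 / p + ε)) * 2 ^ (-(q * i) * (1 - (1 / p + ε)))) = 2 ^ (-ε * (p * j - q * i)) := by
      rw [← Real.rpow_intCast, ← Real.rpow_intCast, ← Real.rpow_add two_pos, ← Real.rpow_add two_pos, ← Real.rpow_add two_pos]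
      congr 1
      have : 1 - 1 / p = 1 / q := by linarith
      have e : -(q * (i:ℝ)) * (1 - (1 / p + ε)) = -(q * i) * (1 / q - ε) := by rw [← this]; ring
      rw [e]; field_simp; ring
    calc 2 ^ i * 2 ^ j * Z ≤ 2 ^ i * 2 ^ j * (C * (x ^ (1 / p + ε) * y ^ (1 - (1 / p + ε)))) := by gcongr
      _ = C * ((2:ℝ) ^ i * 2 ^ j * (2 ^ (-(p * j) * (1 / p + ε)) * 2 ^ (-(q * i) * (1 - (1 / p + ε)))) * (u ^ (1 / p + ε) * v' ^ (1 - (1 / p + ε)))) := by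
        rw [e1, e2]; ring
      _ ≤ _ := by rw [e3]; gcongr
  rw [← Real.rpow_mul two_pos.le]
  rcases le_total 0 (p * (j:ℝ) - q * i) with h0 | h0
  · rw [abs_of_nonneg h0]
    exact key δ (abs_of_pos hδ0).le h1
  · rw [abs_of_nonpos h0]
    have := key (-δ) (by rw [abs_neg, abs_of_pos hδ0]) (by rw [← sub_eq_add_neg]; exact h2)
    rw [neg_neg] at this
    rwa [neg_mul_neg]

/-- level sets -/
def lv (n : ℕ) (f : ℝ → ℂ) (j : ℤ) : Set ℝ := Icc (-(n:ℝ)) n ∩ {x | (2:ℝ) ^ j < ‖f x‖ ∧ ‖f x‖ ≤ 2 ^ (j + 1)}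

noncomputable def tr (n : ℕ) (f : ℝ → ℂ) (x : ℝ) : ℂ := ∑ j ∈ Finset.Icc (-(n:ℤ)) n, (lv n f j).indicator f x

lemma lv_meas {f : ℝ → ℂ} (hf : Measurable f) (n : ℕ) (j : ℤ) : MeasurableSet (lv n f j) :=
  measurableSet_Icc.inter ((measurableSet_lt measurable_const hf.norm).inter (measurableSet_le hf.norm measurable_const))

lemma lv_unique {f : ℝ → ℂ} {n : ℕ} {i j : ℤ} {x : ℝ} (hi : x ∈ lv n f i) (hj : x ∈ lv n f j) : i = j := by
  have h1 : (2:ℝ) ^ i < 2 ^ (j + 1) := hi.2.1.trans_le hj.2.2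
  have h2 : (2:ℝ) ^ j < 2 ^ (i + 1) := hj.2.1.trans_le hi.2.2
  rw [zpow_lt_zpow_iff_right₀ (by norm_num)] at h1 h2
  omega

lemma lv_sum {f : ℝ → ℂ} (hf : Measurable f) (n : ℕ) {p : ℝ} (hp : 0 < p) (hi : Integrable (fun x => ‖f x‖ ^ p)) (S : Finset ℤ) :
    ∑ j ∈ S, (2:ℝ) ^ (p * j) * volume.real (lv n f j) ≤ ∫ x, ‖f x‖ ^ p := by
  have hfin : ∀ j, volume (lv n f j) ≠ ∞ := fun j => measure_ne_top_of_subset (inter_subset_left) (by simp)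
  have h1 : ∀ j : ℤ, (2:ℝ) ^ (p * j) * volume.real (lv n f j) = ∫ x, (lv n f j).indicator (fun _ => (2:ℝ) ^ (p * j)) x := by
    intro j; rw [integral_indicator_const _ (lv_meas hf n j), smul_eq_mul, mul_comm]
  have hIntg : ∀ j : ℤ, Integrable ((lv n f j).indicator (fun _ => (2:ℝ) ^ (p * j))) := fun j => 
    (integrable_indicator_iff (lv_meas hf n j)).2 (integrableOn_const (hfin j))
  simp only [h1]
  rw [← integral_finsetSum _ fun j _ => hIntg j]
  refine integral_mono (integrable_finsetSum _ fun j _ => hIntg j) hi fun x => ?_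
  simp only
  by_cases hx : ∃ j ∈ S, x ∈ lv n f j
  · obtain ⟨j, hj, hxj⟩ := hx
    rw [Finset.sum_eq_single_of_mem j hj, indicator_of_mem hxj]
    · calc (2:ℝ) ^ (p * j) = (2 ^ j) ^ p := by rw [mul_comm, Real.rpow_mul two_pos.le, Real.rpow_intCast]
        _ ≤ _ := Real.rpow_le_rpow (two_zpow_pos j).le hxj.2.1.le hp.le
    · intro i _ hij
      exact indicator_of_notMem (fun hc => hij (lv_unique hc hxj)) _
  · rw [Finset.sum_eq_zero]
    · positivity
    · intro j hj
      exact indicator_of_notMem (fun hc => hx ⟨j, hj, hc⟩) _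

lemma tr_norm_le (f : ℝ → ℂ) (n : ℕ) (x : ℝ) : tr n f x = f x ∨ tr n f x = 0 := by
  unfold tr
  by_cases hx : ∃ j ∈ Finset.Icc (-(n:ℤ)) n, x ∈ lv n f j
  · obtain ⟨j, hj, hxj⟩ := hx
    left
    rw [Finset.sum_eq_single_of_mem j hj, indicator_of_mem hxj]
    intro i _ hij
    exact indicator_of_notMem (fun hc => hij (lv_unique hc hxj)) _
  · right
    refine Finset.sum_eq_zero fun j hj => indicator_of_notMem (fun hc => hx ⟨j, hj, hc⟩) _

lemma tr_eventually (f : ℝ → ℂ) (x : ℝ) : ∀ᶠ n : ℕ in atTop, tr n f x = f x := by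
  by_cases h0 : f x = 0
  · refine Eventually.of_forall fun n => ?_
    rcases tr_norm_le f n x with h | h
    · exact h
    · rw [h, h0]
  obtain ⟨j, hj⟩ := exists_mem_Ioc_zpow (norm_pos_iff.2 h0) (one_lt_two)
  obtain ⟨m, hm⟩ := exists_nat_gt |x|
  filter_upwards [eventually_ge_atTop m, eventually_ge_atTop j.natAbs] with n hn hn'
  have hxj : x ∈ lv n f j := by
    refine ⟨?_, hj⟩
    have : (m:ℝ) ≤ n := by exact_mod_cast hn
    exact abs_le.1 (by linarith)
  unfold tr
  rw [Finset.sum_eq_single_of_mem j, indicator_of_mem hxj]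
  · rw [Finset.mem_Icc]; omega
  intro i _ hij
  exact indicator_of_notMem (fun hc => hij (lv_unique hc hxj)) _

lemma tr_meas {f : ℝ → ℂ} (hf : Measurable f) (n : ℕ) : Measurable (tr n f) := by
  unfold tr
  exact Finset.measurable_fun_sum _ fun j _ => hf.indicator (lv_meas hf n j)

lemma tr_integrable {f : ℝ → ℂ} (hf : Measurable f) (hi : Integrable f) (n : ℕ) : Integrable (tr n f) := by
  refine hi.norm.mono' (tr_meas hf n).aestronglyMeasurable (ae_of_all _ fun x => ?_)
  rcases tr_norm_le f n x with h | h <;> simp [h]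

lemma tr_tendsto {f : ℝ → ℂ} (hf : Measurable f) (hi : Integrable f) : 
    Tendsto (fun n : ℕ => ∫ x, ‖f x - tr n f x‖) atTop (nhds 0) := by
  have : Tendsto (fun n : ℕ => ∫ x, ‖f x - tr n f x‖) atTop (nhds (∫ _x : ℝ, (0:ℝ))) := by
    refine tendsto_integral_of_dominated_convergence (fun x => ‖f x‖) (fun n => (hf.sub (tr_meas hf n)).norm.aestronglyMeasurable) 
      hi.norm (fun n => ae_of_all _ fun x => ?_) (ae_of_all _ fun x => ?_)
    · rcases tr_norm_le f n x with h | h <;> rw [h] <;> simp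
    · refine tendsto_const_nhds.congr' ?_
      filter_upwards [tr_eventually f x] with n hn
      rw [hn, sub_self, norm_zero]
  simpa using this

end CH

namespace CH

section
variable {κ κ' ϑ : ℝ → ℂ} {χ' h : ℝ → ℝ} {A : ℝ} {ρ : ℝ → ℝ}

lemma T0_meas (Kr : Ker κ κ' ϑ χ' h A) (R : Rho ρ) (K : ℕ) {f : ℝ → ℂ} (hf : Integrable f) {N : ℝ → ℝ} (hN : Measurable N) :
    Measurable (T0 κ ρ K f N) := by
  unfold T0
  refine Finset.measurable_fun_sum _ fun k _ => ?_
  have hm : Measurable (fun x => cnv f (kn κ k (N x)) x) := by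
    have h0 := (Kr.k1.cont_cnv hf k).measurable
    have h1 : Measurable (fun x => (x, N x)) := by fun_prop
    have key : ∀ Φ : ℝ × ℝ → ℂ, Measurable Φ → Measurable (fun x => Φ (x, N x)) :=
      fun Φ hΦ => hΦ.comp h1
    exact key _ h0
  have hm2 : Measurable (fun x => (ρ (Int.fract (2 ^ k * N x)) : ℂ)) := by
    have := R.cont.measurable
    have h2 : Measurable (fun x => Int.fract (2 ^ k * N x)) := measurable_fract.comp (hN.const_mul _)
    exact Complex.measurable_ofReal.comp (this.comp h2)
  exact hm2.mul hm

lemma T0_bdd' (Kr : Ker κ κ' ϑ χ' h A) (R : Rho ρ) (K : ℕ) : ∃ c ≥ 0, ∀ f : ℝ → ℂ, Integrable f → 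
    ∀ (N : ℝ → ℝ) x, ‖T0 κ ρ K f N x‖ ≤ c * ∫ y, ‖f y‖ := by
  have hA := Kr.k1.pos
  refine ⟨∑ k ∈ Finset.Icc (-(K:ℤ)) K, (A * (2 ^ k)⁻¹), by positivity, fun f hf N x => ?_⟩
  rw [Finset.sum_mul]
  refine (norm_sum_le _ _).trans (Finset.sum_le_sum fun k _ => ?_)
  rw [norm_mul, Complex.norm_real]
  have h1 := R.le (Int.fract (2 ^ k * N x))
  have h2 := Kr.k1.cnv_bdd f hf k (N x) x
  calc _ ≤ 1 * ((∫ y, ‖f y‖) * (A * (2 ^ k)⁻¹)) := by gcongr; exact h1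
    _ = _ := by ring

lemma T0_sum (Kr : Ker κ κ' ϑ χ' h A) (K : ℕ) (S : Finset ℤ) (f : ℤ → ℝ → ℂ) (hf : ∀ j ∈ S, Integrable (f j)) 
    (N : ℝ → ℝ) (x : ℝ) : T0 κ ρ K (fun x => ∑ j ∈ S, f j x) N x = ∑ j ∈ S, T0 κ ρ K (f j) N x := by
  unfold T0
  rw [Finset.sum_comm]
  refine Finset.sum_congr rfl fun k _ => ?_
  rw [← Finset.mul_sum]
  congr 1
  unfold cnv
  rw [← integral_finsetSum _ fun j hj => Kr.k1.int_cnv (hf j hj) k (N x) x]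
  simp only [Finset.sum_mul]

lemma T0_sub (Kr : Ker κ κ' ϑ χ' h A) (K : ℕ) {f f' : ℝ → ℂ} (hf : Integrable f) (hf' : Integrable f')
    (N : ℝ → ℝ) (x : ℝ) : T0 κ ρ K (fun x => f x - f' x) N x = T0 κ ρ K f N x - T0 κ ρ K f' N x := by
  unfold T0
  rw [← Finset.sum_sub_distrib]
  refine Finset.sum_congr rfl fun k _ => ?_
  rw [← mul_sub]
  congr 1
  unfold cnv
  rw [← integral_sub (Kr.k1.int_cnv hf k (N x) x) (Kr.k1.int_cnv hf' k (N x) x)]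
  simp only [sub_mul]

lemma T0_smul (K : ℕ) (c : ℂ) (f : ℝ → ℂ) (N : ℝ → ℝ) (x : ℝ) : 
    T0 κ ρ K (fun x => c * f x) N x = c * T0 κ ρ K f N x := by
  unfold T0
  rw [Finset.mul_sum]
  refine Finset.sum_congr rfl fun k _ => ?_
  rw [mul_left_comm]
  congr 1
  unfold cnv
  rw [← integral_const_mul]
  simp only [mul_assoc]

lemma exists_delta {p q : ℝ} (hp : 1 < p) (hpq : 1 / p + 1 / q = 1) (hq : 1 < q) : ∃ δ > 0, δ < 1 / p ∧ δ < 1 / q ∧ 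
    1 / p + δ ≠ 1 / 2 ∧ 1 / p - δ ≠ 1 / 2 := by
  have h1 : 0 < 1 / p := by positivity
  have h2 : 0 < 1 / q := by positivity
  by_cases h : 1 / p = 1 / 2
  · have h3 : 1 / q = 1 / 2 := by linarith
    rw [h, h3]
    exact ⟨1 / 4, by norm_num, by norm_num, by norm_num, by norm_num, by norm_num⟩
  · have h3 : 0 < |1 / p - 1 / 2| := abs_pos.2 (sub_ne_zero.2 h)
    refine ⟨min (min (1 / p) (1 / q)) |1 / p - 1 / 2| / 2, by positivity, ?_, ?_, ?_, ?_⟩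
    · have := (min_le_left (min (1 / p) (1 / q)) |1 / p - 1 / 2|).trans (min_le_left _ _)
      linarith
    · have := (min_le_left (min (1 / p) (1 / q)) |1 / p - 1 / 2|).trans (min_le_right _ _)
      linarith
    · have := (min_le_right (min (1 / p) (1 / q)) |1 / p - 1 / 2|)
      intro hc
      rcases le_total 0 (1 / p - 1 / 2) with h0 | h0
      · have : 0 < min (min (1 / p) (1 / q)) |1 / p - 1 / 2| := by positivity
        linarith
      · rw [abs_of_nonpos h0] at *; linarith
    · have := (min_le_right (min (1 / p) (1 / q)) |1 / p - 1 / 2|)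
      intro hc
      rcases le_total 0 (1 / p - 1 / 2) with h0 | h0
      · rw [abs_of_nonneg h0] at *; linarith
      · have : 0 < min (min (1 / p) (1 / q)) |1 / p - 1 / 2| := by positivity
        linarith

lemma norm_piece (f : ℝ → ℂ) (n : ℕ) (j : ℤ) (x : ℝ) : 
    ‖((2:ℂ) ^ (j + 1))⁻¹ * (lv n f j).indicator f x‖ ≤ (lv n f j).indicator (fun _ => 1) x := by
  have h2 := two_zpow_pos (j + 1)
  rw [norm_mul, norm_inv, norm_zpow, Complex.norm_ofNat]
  by_cases hx : x ∈ lv n f j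
  · rw [indicator_of_mem hx, indicator_of_mem hx, inv_mul_le_iff₀ h2, mul_one]; exact hx.2.2
  · simp [hx]

lemma strong_tr (Kr : Ker κ κ' ϑ χ' h A) (R : Rho ρ) {p q : ℝ} (hp : 1 < p) (hpq : 1 / p + 1 / q = 1) (hq : 1 < q) :
    ∃ C > 0, ∀ (K : ℕ) (f : ℝ → ℂ) (N : ℝ → ℝ) (b : ℝ) (g : ℝ → ℂ) (n : ℕ), 
      Measurable f → Integrable f → Integrable (fun x => ‖f x‖ ^ p) → Measurable N → (∀ x, |N x| ≤ b) →
      Measurable g → Integrable g → Integrable (fun x => ‖g x‖ ^ q) →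
      ‖∫ x, tr n g x * T0 κ ρ K (tr n f) N x‖ ≤ C * ((∫ x, ‖f x‖ ^ p) + ∫ x, ‖g x‖ ^ q) := by
  obtain ⟨δ, hδ, hδp, hδq, hn1, hn2⟩ := exists_delta hp hpq hq
  have hp1 : 1 / p = 1 - 1 / q := by linarith
  have hip : 0 < 1 / p := by positivity
  have hiq : 0 < 1 / q := by positivity
  obtain ⟨C1, hC1, H1⟩ := restricted Kr R (1 / p + δ) (by linarith) (by linarith) hn1
  obtain ⟨C2, hC2, H2⟩ := restricted Kr R (1 / p - δ) (by linarith) (by linarith) hn2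
  have hr1 : (2:ℝ) ^ (-δ) < 1 := by
    rw [Real.rpow_neg two_pos.le]
    exact inv_lt_one_of_one_lt₀ (Real.one_lt_rpow (by norm_num) hδ)
  obtain ⟨c, hc, Hc⟩ := sum_r_le (r := 2 ^ (-δ)) (by positivity) hr1
  set C := C1 + C2 with hC
  refine ⟨4 * C * c, by positivity, ?_⟩
  intro K f N b g n hfm hfi hfp hN hNb hgm hgi hgq
  set S := Finset.Icc (-(n:ℤ)) n
  set fj : ℤ → ℝ → ℂ := fun j => (lv n f j).indicator f with hfj
  set gi : ℤ → ℝ → ℂ := fun i => (lv n g i).indicator g with hgi'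
  have ifj : ∀ j, Integrable (fj j) := fun j => hfi.indicator (lv_meas hfm n j)
  have igi : ∀ i, Integrable (gi i) := fun i => hgi.indicator (lv_meas hgm n i)
  have hpair : ∀ i j : ℤ, ‖∫ x, gi i x * T0 κ ρ K (fj j) N x‖ ≤ 4 * C * ((2 ^ (-δ)) ^ |p * j - q * i| * 
      (2 ^ (p * j) * volume.real (lv n f j) + 2 ^ (q * i) * volume.real (lv n g i))) := by
    intro i j
    have hfin : volume (lv n g i) ≠ ∞ := measure_ne_top_of_subset (inter_subset_left) (by simp)
    set f' : ℝ → ℂ := fun x => ((2:ℂ) ^ (j + 1))⁻¹ * (lv n f j).indicator f x with hf'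
    set g' : ℝ → ℂ := fun x => ((2:ℂ) ^ (i + 1))⁻¹ * (lv n g i).indicator g x with hg'
    have D : Dat (lv n g i) N g' := ⟨lv_meas hgm n i, hfin, hN, (hgm.indicator (lv_meas hgm n i)).const_mul _, 
      norm_piece g n i⟩
    have hf'm : Measurable f' := (hfm.indicator (lv_meas hfm n j)).const_mul _
    have hbf : ∀ x ∈ lv n f j, |x| ≤ max (n:ℝ) b := fun x hx => (abs_le.2 hx.1).trans (le_max_left _ _)
    have hbg : ∀ x ∈ lv n g i, |x| ≤ max (n:ℝ) b := fun x hx => (abs_le.2 hx.1).trans (le_max_left _ _)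
    have hbN : ∀ x, |N x| ≤ max (n:ℝ) b := fun x => (hNb x).trans (le_max_right _ _)
    have b1 := H1 K f' (lv n f j) (lv n g i) N _ g' (lv_meas hfm n j) hf'm (norm_piece f n j) hbf hbg hbN D
    have b2 := H2 K f' (lv n f j) (lv n g i) N _ g' (lv_meas hfm n j) hf'm (norm_piece f n j) hbf hbg hbN D
    have hx0 : 0 ≤ volume.real (lv n f j) := measureReal_nonneg
    have hy0 : 0 ≤ volume.real (lv n g i) := measureReal_nonneg
    have b3 := young_piece (C := C) (by linarith) (by linarith) hpq hδ hδp hδq (by positivity) hx0 hy0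
      (b1.trans (by gcongr; linarith)) (b2.trans (by gcongr; linarith)) i j
    have e1 : ∫ x, g' x * T0 κ ρ K f' N x = ((2:ℂ) ^ (i + 1))⁻¹ * ((2:ℂ) ^ (j + 1))⁻¹ * ∫ x, gi i x * T0 κ ρ K (fj j) N x := by
      rw [← integral_const_mul]
      congr 1; ext x
      rw [hf', T0_smul, hg']; simp only [hfj, hgi']; ring
    rw [e1, norm_mul, norm_mul, norm_inv, norm_inv, norm_zpow, norm_zpow, Complex.norm_ofNat, zpow_add_one₀ two_ne_zero, 
      zpow_add_one₀ two_ne_zero] at b3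
    have p1 := two_zpow_pos i
    have p2 := two_zpow_pos j
    calc ‖∫ x, gi i x * T0 κ ρ K (fj j) N x‖ = 4 * (2 ^ i * 2 ^ j * (((2:ℝ) ^ i * 2)⁻¹ * ((2:ℝ) ^ j * 2)⁻¹ * ‖∫ x, gi i x * T0 κ ρ K (fj j) N x‖)) := by
          field_simp; norm_num
      _ ≤ 4 * (C * ((2 ^ (-δ)) ^ |p * j - q * i| * (2 ^ (p * j) * volume.real (lv n f j) + 2 ^ (q * i) * volume.real (lv n g i)))) := by gcongr
      _ = _ := by ring
  have hT : ∀ x, T0 κ ρ K (tr n f) N x = ∑ j ∈ S, T0 κ ρ K (fj j) N x := fun x => 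
    T0_sum Kr K S fj (fun j _ => ifj j) N x
  have hTm : ∀ j, Measurable (T0 κ ρ K (fj j) N) := fun j => T0_meas Kr R K (ifj j) hN
  obtain ⟨c0, hc0, Hc0⟩ := T0_bdd' Kr R K
  have hIntg : ∀ i j, Integrable (fun x => gi i x * T0 κ ρ K (fj j) N x) := fun i j => 
    (igi i).mul_bdd (c := c0 * ∫ y, ‖fj j y‖) (hTm j).aestronglyMeasurable (ae_of_all _ fun x => Hc0 _ (ifj j) N x)
  have e2 : ∫ x, tr n g x * T0 κ ρ K (tr n f) N x = ∑ i ∈ S, ∑ j ∈ S, ∫ x, gi i x * T0 κ ρ K (fj j) N x := by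
    have : ∀ x, tr n g x * T0 κ ρ K (tr n f) N x = ∑ i ∈ S, ∑ j ∈ S, gi i x * T0 κ ρ K (fj j) N x := by
      intro x; rw [hT, tr, Finset.sum_mul_sum]
    simp only [this]
    rw [integral_finsetSum _ fun i _ => integrable_finsetSum _ fun j _ => hIntg i j]
    refine Finset.sum_congr rfl fun i _ => ?_
    rw [integral_finsetSum _ fun j _ => hIntg i j]
  set u : ℤ → ℝ := fun j => 2 ^ (p * j) * volume.real (lv n f j) with hu
  set v' : ℤ → ℝ := fun i => 2 ^ (q * i) * volume.real (lv n g i) with hv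
  have hu0 : ∀ j, 0 ≤ u j := fun j => by have : 0 ≤ volume.real (lv n f j) := measureReal_nonneg
                                         positivity
  have hv0 : ∀ j, 0 ≤ v' j := fun j => by have : 0 ≤ volume.real (lv n g j) := measureReal_nonneg
                                          positivity
  have s1 : ∑ i ∈ S, ∑ j ∈ S, ((2:ℝ) ^ (-δ)) ^ |p * j - q * i| * u j ≤ c * ∫ x, ‖f x‖ ^ p := by
    rw [Finset.sum_comm]
    calc _ ≤ ∑ j ∈ S, c * u j := Finset.sum_le_sum fun j _ => by
            rw [← Finset.sum_mul]; exact mul_le_mul_of_nonneg_right (Hc q (p * j) hq.le S) (hu0 j)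
      _ = c * ∑ j ∈ S, u j := by rw [Finset.mul_sum]
      _ ≤ _ := by gcongr; exact lv_sum hfm n (by linarith) hfp S
  have s2 : ∑ i ∈ S, ∑ j ∈ S, ((2:ℝ) ^ (-δ)) ^ |p * j - q * i| * v' i ≤ c * ∫ x, ‖g x‖ ^ q := by
    calc _ ≤ ∑ i ∈ S, c * v' i := Finset.sum_le_sum fun i _ => by
            rw [← Finset.sum_mul]
            refine mul_le_mul_of_nonneg_right ?_ (hv0 i)
            refine le_trans (le_of_eq (Finset.sum_congr rfl fun j _ => ?_)) (Hc p (q * i) hp.le S)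
            rw [abs_sub_comm]
      _ = c * ∑ i ∈ S, v' i := by rw [Finset.mul_sum]
      _ ≤ _ := by gcongr; exact lv_sum hgm n (by linarith) hgq S
  rw [e2]
  calc _ ≤ ∑ i ∈ S, ∑ j ∈ S, ‖∫ x, gi i x * T0 κ ρ K (fj j) N x‖ := 
        (norm_sum_le _ _).trans (Finset.sum_le_sum fun i _ => norm_sum_le _ _)
    _ ≤ ∑ i ∈ S, ∑ j ∈ S, 4 * C * ((2 ^ (-δ)) ^ |p * j - q * i| * (u j + v' i)) := 
        Finset.sum_le_sum fun i _ => Finset.sum_le_sum fun j _ => hpair i j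
    _ = 4 * C * ((∑ i ∈ S, ∑ j ∈ S, ((2:ℝ) ^ (-δ)) ^ |p * j - q * i| * u j) + 
          ∑ i ∈ S, ∑ j ∈ S, ((2:ℝ) ^ (-δ)) ^ |p * j - q * i| * v' i) := by
        simp only [mul_add, Finset.sum_add_distrib, Finset.mul_sum]
    _ ≤ 4 * C * (c * (∫ x, ‖f x‖ ^ p) + c * ∫ x, ‖g x‖ ^ q) := by gcongr
    _ = _ := by ring

end
end CH

namespace CH

section
variable {κ κ' ϑ : ℝ → ℂ} {χ' h : ℝ → ℝ} {A : ℝ} {ρ : ℝ → ℝ}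

lemma strong (Kr : Ker κ κ' ϑ χ' h A) (R : Rho ρ) {p q : ℝ} (hp : 1 < p) (hpq : 1 / p + 1 / q = 1) (hq : 1 < q) :
    ∃ C > 0, ∀ (K : ℕ) (f : ℝ → ℂ) (N : ℝ → ℝ) (b : ℝ) (g : ℝ → ℂ), 
      Measurable f → Integrable f → Integrable (fun x => ‖f x‖ ^ p) → Measurable N → (∀ x, |N x| ≤ b) →
      Measurable g → Integrable g → Integrable (fun x => ‖g x‖ ^ q) →
      ‖∫ x, g x * T0 κ ρ K f N x‖ ≤ C * ((∫ x, ‖f x‖ ^ p) + ∫ x, ‖g x‖ ^ q) := by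
  obtain ⟨C, hC, H⟩ := strong_tr Kr R hp hpq hq
  refine ⟨C, hC, ?_⟩
  intro K f N b g hfm hfi hfp hN hNb hgm hgi hgq
  obtain ⟨c0, hc0, Hc0⟩ := T0_bdd' Kr R K
  have hIntg : ∀ {g f : ℝ → ℂ}, Integrable g → Integrable f → Integrable (fun x => g x * T0 κ ρ K f N x) := fun hg hf => 
    hg.mul_bdd (c := c0 * ∫ y, ‖_‖) (T0_meas Kr R K hf hN).aestronglyMeasurable (ae_of_all _ fun x => Hc0 _ hf N x)
  have hfn := fun n => tr_integrable hfm hfi n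
  have hgn := fun n => tr_integrable hgm hgi n
  have hlim : Tendsto (fun n : ℕ => ∫ x, tr n g x * T0 κ ρ K (tr n f) N x) atTop (nhds (∫ x, g x * T0 κ ρ K f N x)) := by
    rw [tendsto_iff_norm_sub_tendsto_zero]
    have hz : Tendsto (fun n : ℕ => (c0 * ∫ y, ‖f y‖) * (∫ x, ‖g x - tr n g x‖) + (c0 * ∫ x, ‖g x‖) * ∫ x, ‖f x - tr n f x‖) 
        atTop (nhds ((c0 * ∫ y, ‖f y‖) * 0 + (c0 * ∫ x, ‖g x‖) * 0)) := 
      ((tr_tendsto hgm hgi).const_mul _).add ((tr_tendsto hfm hfi).const_mul _)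
    rw [mul_zero, mul_zero, add_zero] at hz
    refine squeeze_zero (fun n => norm_nonneg _) (fun n => ?_) hz
    rw [norm_sub_rev, ← integral_sub (hIntg hgi hfi) (hIntg (hgn n) (hfn n))]
    have hE : (c0 * ∫ y, ‖f y‖) * (∫ x, ‖g x - tr n g x‖) + (c0 * ∫ x, ‖g x‖) * (∫ x, ‖f x - tr n f x‖) =
        ∫ x, ((c0 * ∫ y, ‖f y‖) * ‖g x - tr n g x‖ + (c0 * ∫ y, ‖f y - tr n f y‖) * ‖g x‖) := by
      have hgs : Integrable (fun x => ‖g x - tr n g x‖) := (hgi.sub (hgn n)).norm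
      generalize (∫ y, ‖f y‖) = a1
      generalize (∫ y, ‖f y - tr n f y‖) = a2
      rw [integral_add (hgs.const_mul _) (hgi.norm.const_mul _), integral_const_mul, integral_const_mul]
      ring
    rw [hE]
    · refine norm_integral_le_of_norm_le ?_ (ae_of_all _ fun x => ?_)
      · exact ((hgi.sub (hgn n)).norm.const_mul _).add (hgi.norm.const_mul _)
      · have e1 : g x * T0 κ ρ K f N x - tr n g x * T0 κ ρ K (tr n f) N x = 
            (g x - tr n g x) * T0 κ ρ K f N x + tr n g x * (T0 κ ρ K (fun x => f x - tr n f x) N x) := by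
          rw [T0_sub Kr K hfi (hfn n)]; ring
        rw [e1]
        refine (norm_add_le _ _).trans (add_le_add ?_ ?_)
        · rw [norm_mul, mul_comm]; gcongr; exact Hc0 f hfi N x
        · rw [norm_mul, mul_comm]
          gcongr
          · exact Hc0 _ (hfi.sub (hfn n)) N x
          · rcases tr_norm_le g n x with h | h <;> simp [h]
  exact le_of_tendsto' hlim.norm fun n => H K f N b g n hfm hfi hfp hN hNb hgm hgi hgq

lemma lp_R (Kr : Ker κ κ' ϑ χ' h A) (R : Rho ρ) {p : ℝ} (hp : 1 < p) :
    ∃ C > 0, ∀ (K : ℕ) (f : ℝ → ℂ) (N : ℝ → ℝ) (b r : ℝ), 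
      Measurable f → Integrable f → Integrable (fun x => ‖f x‖ ^ p) → Measurable N → (∀ x, |N x| ≤ b) →
      IntegrableOn (fun x => ‖T0 κ ρ K f N x‖ ^ p) (Icc (-r) r) ∧
      ∫ x in Icc (-r) r, ‖T0 κ ρ K f N x‖ ^ p ≤ C * ∫ x, ‖f x‖ ^ p := by
  set q := p / (p - 1) with hqd
  have hp1 : 0 < p - 1 := by linarith
  have hp0 : 0 < p := by linarith
  have hq : 1 < q := by rw [hqd, lt_div_iff₀ hp1]; linarith
  have hpq : 1 / p + 1 / q = 1 := by rw [hqd]; field_simp; ring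
  obtain ⟨C, hC, H⟩ := strong Kr R hp hpq hq
  set α : ℝ := (1 / (2 * C)) ^ (1 / (q - 1)) with hα
  have hα0 : 0 < α := by positivity
  have hq1 : 0 < q - 1 := by linarith
  have hαq : α ^ q = α / (2 * C) := by
    have h1 : α ^ (q - 1) = 1 / (2 * C) := by
      rw [hα, ← Real.rpow_mul (by positivity), one_div_mul_cancel hq1.ne', Real.rpow_one]
    have : q = (q - 1) + 1 := by ring
    rw [this, Real.rpow_add hα0, h1, Real.rpow_one]; ring
  refine ⟨2 * C / α, by positivity, ?_⟩
  intro K f N b r hfm hfi hfp hN hNb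
  obtain ⟨c0, hc0, Hc0⟩ := T0_bdd' Kr R K
  have hTb := fun x => Hc0 f hfi N x
  set M := c0 * ∫ y, ‖f y‖
  set T := T0 κ ρ K f N with hT
  have hTm : Measurable T := T0_meas Kr R K hfi hN
  have hfin : volume (Icc (-r) r) ≠ ∞ := by simp
  set g : ℝ → ℂ := (Icc (-r) r).indicator (fun x => (α : ℂ) * ((starRingEnd ℂ) (T x) * ((‖T x‖ ^ (p - 2) : ℝ) : ℂ))) with hg
  have hin : ∀ x, ‖(α : ℂ) * ((starRingEnd ℂ) (T x) * ((‖T x‖ ^ (p - 2) : ℝ) : ℂ))‖ = α * ‖T x‖ ^ (p - 1) := by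
    intro x
    rw [norm_mul, norm_mul, RCLike.norm_conj, Complex.norm_real, Complex.norm_real, Real.norm_of_nonneg hα0.le, 
      Real.norm_of_nonneg (by positivity)]
    congr 1
    rcases (norm_nonneg (T x)).eq_or_lt with h0 | h0
    · rw [← h0, zero_mul, Real.zero_rpow hp1.ne']
    · rw [← Real.rpow_one_add' h0.le (by linarith)]; congr 1; ring
  have hgm : Measurable g := by
    refine Measurable.indicator ?_ measurableSet_Icc
    have h1 : Measurable (fun x => (starRingEnd ℂ) (T x)) := Complex.continuous_conj.measurable.comp hTm
    have h2 : Measurable (fun x => ((‖T x‖ ^ (p - 2) : ℝ) : ℂ)) := Complex.measurable_ofReal.comp (hTm.norm.pow_const _)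
    exact (h1.mul h2).const_mul _
  have hIp : IntegrableOn (fun x => ‖T x‖ ^ p) (Icc (-r) r) := by
    refine Measure.integrableOn_of_bounded (M := M ^ p) hfin (hTm.norm.pow_const _).aestronglyMeasurable (ae_of_all _ fun x => ?_)
    rw [Real.norm_of_nonneg (by positivity)]
    exact Real.rpow_le_rpow (norm_nonneg _) (hTb x) hp0.le
  refine ⟨hIp, ?_⟩
  have hgi : Integrable g := by
    rw [hg, integrable_indicator_iff measurableSet_Icc]
    refine Measure.integrableOn_of_bounded (M := α * M ^ (p - 1)) hfin ?_ (ae_of_all _ fun x => ?_)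
    · have h1 : Measurable (fun x => (starRingEnd ℂ) (T x)) := Complex.continuous_conj.measurable.comp hTm
      have h2 : Measurable (fun x => ((‖T x‖ ^ (p - 2) : ℝ) : ℂ)) := Complex.measurable_ofReal.comp (hTm.norm.pow_const _)
      exact ((h1.mul h2).const_mul _).aestronglyMeasurable
    · rw [hin x]
      have := Real.rpow_le_rpow (norm_nonneg _) (hTb x) hp1.le
      gcongr
  have hgq : ∀ x, ‖g x‖ ^ q = (Icc (-r) r).indicator (fun x => α / (2 * C) * ‖T x‖ ^ p) x := by
    intro x
    rw [hg]
    by_cases hx : x ∈ Icc (-r) r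
    · rw [indicator_of_mem hx, indicator_of_mem hx, hin, Real.mul_rpow hα0.le (by positivity), hαq, ← Real.rpow_mul (norm_nonneg _)]
      congr 2; rw [hqd]; field_simp
    · rw [indicator_of_notMem hx, indicator_of_notMem hx, norm_zero, Real.zero_rpow (by linarith)]
  have hgqi : Integrable (fun x => ‖g x‖ ^ q) := by
    simp only [hgq]
    rw [integrable_indicator_iff measurableSet_Icc]
    exact hIp.const_mul _
  have hgT : ∀ x, g x * T x = (((Icc (-r) r).indicator (fun x => α * ‖T x‖ ^ p) x : ℝ) : ℂ) := by
    intro x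
    rw [hg]
    by_cases hx : x ∈ Icc (-r) r
    · rw [indicator_of_mem hx, indicator_of_mem hx]
      have : (α : ℂ) * ((starRingEnd ℂ) (T x) * ((‖T x‖ ^ (p - 2) : ℝ) : ℂ)) * T x = 
          α * (((starRingEnd ℂ) (T x) * T x) * ((‖T x‖ ^ (p - 2) : ℝ) : ℂ)) := by ring
      rw [this, mul_comm ((starRingEnd ℂ) (T x)), Complex.mul_conj, Complex.normSq_eq_norm_sq]
      rw [← Complex.ofReal_mul, ← Complex.ofReal_mul]
      congr 2
      rcases (norm_nonneg (T x)).eq_or_lt with h0 | h0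
      · rw [← h0, Real.zero_rpow hp0.ne']; simp
      · rw [← Real.rpow_two, ← Real.rpow_add h0]; congr 1; ring
    · rw [indicator_of_notMem hx, indicator_of_notMem hx]; simp
  have main := H K f N b g hfm hfi hfp hN hNb hgm hgi hgqi
  simp only [← hT, hgT, hgq] at main
  rw [integral_indicator measurableSet_Icc, integral_const_mul, integral_complex_ofReal, integral_indicator measurableSet_Icc, 
    integral_const_mul] at main
  have hX : 0 ≤ ∫ x in Icc (-r) r, ‖T x‖ ^ p := integral_nonneg fun x => by positivity
  rw [Complex.norm_real, Real.norm_of_nonneg (by positivity)] at main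
  have e3 : C * (α / (2 * C) * ∫ x in Icc (-r) r, ‖T x‖ ^ p) = α * (∫ x in Icc (-r) r, ‖T x‖ ^ p) / 2 := by field_simp
  rw [mul_add, e3] at main
  rw [div_mul_eq_mul_div, le_div_iff₀ hα0]
  linarith

lemma lp_T0 (Kr : Ker κ κ' ϑ χ' h A) (R : Rho ρ) {p : ℝ} (hp : 1 < p) :
    ∃ C : ℝ≥0, ∀ (K : ℕ) (f : ℝ → ℂ) (N : ℝ → ℝ) (b : ℝ), 
      Measurable f → Integrable f → Integrable (fun x => ‖f x‖ ^ p) → Measurable N → (∀ x, |N x| ≤ b) →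
      eLpNorm (T0 κ ρ K f N) (ENNReal.ofReal p) volume ≤ C * eLpNorm f (ENNReal.ofReal p) volume := by
  obtain ⟨C, hC, H⟩ := lp_R Kr R hp
  have hp0 : 0 < p := by linarith
  have hpe : ENNReal.ofReal p ≠ 0 := by simpa using hp0
  refine ⟨(C ^ (1 / p)).toNNReal, ?_⟩
  intro K f N b hfm hfi hfp hN hNb
  have hen : ∀ (g : ℝ → ℂ) x, ‖g x‖ₑ ^ p = ENNReal.ofReal (‖g x‖ ^ p) := by
    intro g x
    rw [← ofReal_norm, ENNReal.ofReal_rpow_of_nonneg (norm_nonneg _) hp0.le]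
  have key : ∫⁻ x, ‖T0 κ ρ K f N x‖ₑ ^ p ≤ ENNReal.ofReal C * ∫⁻ x, ‖f x‖ₑ ^ p := by
    have hcov := aecover_Icc (μ := (volume : Measure ℝ)) (a := fun n : ℕ => -(n:ℝ)) (b := fun n : ℕ => (n:ℝ)) 
      (tendsto_neg_atTop_atBot.comp tendsto_natCast_atTop_atTop) tendsto_natCast_atTop_atTop
    have hm : Measurable (fun x => ‖T0 κ ρ K f N x‖ₑ ^ p) := (T0_meas Kr R K hfi hN).enorm.pow_const _
    refine le_of_tendsto' (hcov.lintegral_tendsto_of_countably_generated hm.aemeasurable) fun n => ?_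
    have h1 := H K f N b n hfm hfi hfp hN hNb
    simp only [hen]
    rw [← ofReal_integral_eq_lintegral_ofReal h1.1 (ae_of_all _ fun x => by positivity), 
      ← ofReal_integral_eq_lintegral_ofReal hfp (ae_of_all _ fun x => by positivity), ← ENNReal.ofReal_mul hC.le]
    exact ENNReal.ofReal_le_ofReal h1.2
  rw [eLpNorm_eq_lintegral_rpow_enorm_toReal hpe ENNReal.ofReal_ne_top, eLpNorm_eq_lintegral_rpow_enorm_toReal hpe ENNReal.ofReal_ne_top, 
    ENNReal.toReal_ofReal hp0.le]
  have := ENNReal.rpow_le_rpow key (z := 1 / p) (by positivity)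
  rw [ENNReal.mul_rpow_of_nonneg _ _ (by positivity)] at this
  refine this.trans (le_of_eq ?_)
  congr 1
  rw [ENNReal.ofReal_rpow_of_nonneg hC.le (by positivity)]
  rfl

end
end CH

namespace CH

noncomputable def tent (t : ℝ) : ℝ := max 0 (1 - 17 * |t - 19 / 34|)

lemma tent_rho : Rho tent where
  le t := by
    have := abs_nonneg (t - 19 / 34)
    unfold tent
    rw [abs_of_nonneg (le_max_left _ _)]
    exact max_le (by norm_num) (by linarith)
  supp t h := by
    have h1 : 0 < 1 - 17 * |t - 19 / 34| := by
      by_contra hc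
      exact h (max_eq_left (not_lt.1 hc))
    have h2 : |t - 19 / 34| < 1 / 17 := by linarith
    rw [abs_lt] at h2
    constructor <;> linarith [h2.1, h2.2]
  lip t t' := by
    unfold tent
    rw [max_comm, max_comm 0]
    refine (abs_max_sub_max_le_abs _ _ _).trans ?_
    rw [show 1 - 17 * |t - 19 / 34| - (1 - 17 * |t' - 19 / 34|) = 17 * (|t' - 19 / 34| - |t - 19 / 34|) by ring,
      abs_mul, abs_of_nonneg (by norm_num : (0:ℝ) ≤ 17)]
    refine mul_le_mul_of_nonneg_left ?_ (by norm_num)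
    refine (abs_abs_sub_abs_le_abs_sub (t' - 19 / 34) (t - 19 / 34)).trans ?_
    rw [abs_sub_comm t]
    apply le_of_eq; congr 1; ring

lemma two_ne_17 : (2 : ZMod 17) ≠ 0 := by decide

lemma fract_17 (a : ℤ) {φ : ℝ} (h0 : 0 ≤ φ) (h1 : φ < 1) :
    Int.fract (((a : ℝ) + φ) / 17) = ((((a : ZMod 17).val : ℕ) : ℝ) + φ) / 17 := by
  have hv : (((a : ZMod 17).val : ℕ) : ℤ) = a % 17 := by
    have := ZMod.val_intCast (n := 17) a
    simpa using this
  have hv' : (((a : ZMod 17).val : ℕ) : ℝ) = ((a % 17 : ℤ) : ℝ) := by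
    rw [← hv]; simp
  have hlt : (a : ZMod 17).val ≤ 16 := Nat.lt_succ_iff.1 (ZMod.val_lt _)
  have hlt' : (((a : ZMod 17).val : ℕ) : ℝ) ≤ 16 := by exact_mod_cast hlt
  rw [Int.fract_eq_iff]
  refine ⟨by positivity, by rw [div_lt_one (by norm_num)]; linarith, a / 17, ?_⟩
  rw [hv']
  have := Int.emod_add_mul_ediv a 17
  have h3 : (a : ℝ) = ((a % 17 : ℤ) : ℝ) + 17 * ((a / 17 : ℤ) : ℝ) := by exact_mod_cast this.symm
  rw [h3]
  have h4 : (((((a % 17 : ℤ) : ℤ)) : ℝ)) = ((a % 17 : ℤ) : ℝ) := rfl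
  ring

lemma tent_base {φ : ℝ} (h0 : 0 ≤ φ) (h1 : φ < 1) : ∑ r : ZMod 17, tent (((r.val : ℕ) + φ) / 17) = 1 := by
  have ht : ∀ r : ZMod 17, tent (((r.val : ℕ) + φ) / 17) = max 0 (1 - |(r.val : ℕ) + φ - 19 / 2|) := by
    intro r
    unfold tent
    rw [show ((r.val : ℕ) + φ) / 17 - 19 / 34 = ((r.val : ℕ) + φ - 19 / 2) / 17 by ring, abs_div,
      abs_of_nonneg (by norm_num : (0:ℝ) ≤ 17), mul_div_cancel₀ _ (by norm_num)]
  simp only [ht]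
  have hz : ∀ r : ZMod 17, r ∉ ({8, 9, 10} : Finset (ZMod 17)) → max 0 (1 - |((r.val : ℕ) : ℝ) + φ - 19 / 2|) = 0 := by
    intro r hr
    apply max_eq_left
    have : r.val ≤ 7 ∨ 11 ≤ r.val := by
      by_contra hc
      push Not at hc
      have : r.val = 8 ∨ r.val = 9 ∨ r.val = 10 := by omega
      apply hr
      revert r
      decide
    rcases this with h | h
    · have : ((r.val : ℕ) : ℝ) ≤ 7 := by exact_mod_cast h
      rw [abs_of_nonpos (by linarith)]; linarith
    · have : (11:ℝ) ≤ ((r.val : ℕ) : ℝ) := by exact_mod_cast h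
      rw [abs_of_nonneg (by linarith)]; linarith
  rw [← Finset.sum_subset (Finset.subset_univ ({8, 9, 10} : Finset (ZMod 17))) (fun r _ hr => hz r hr)]
  rw [Finset.sum_insert (by decide), Finset.sum_insert (by decide), Finset.sum_singleton]
  rw [show (8 : ZMod 17).val = 8 from rfl, show (9 : ZMod 17).val = 9 from rfl, show (10 : ZMod 17).val = 10 from rfl]
  push_cast
  rw [abs_of_nonpos (by linarith : 8 + φ - 19 / 2 ≤ 0), abs_of_nonneg (by linarith : 0 ≤ 10 + φ - 19 / 2)]
  rcases le_total φ (1 / 2) with h | h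
  · rw [abs_of_nonpos (by linarith), max_eq_left (by linarith), max_eq_right (by linarith), max_eq_right (by linarith)]; ring
  · rw [abs_of_nonneg (by linarith), max_eq_right (by linarith), max_eq_right (by linarith), max_eq_left (by linarith)]; ring

lemma tent_sum (u : ℝ) (m : ℕ) (hm : ((m : ZMod 17)) ≠ 0) :
    ∑ i : ZMod 17, tent (Int.fract (u - (i.val : ℕ) * m / 17)) = 1 := by
  have : Fact (Nat.Prime 17) := ⟨by norm_num⟩
  set n := ⌊17 * u⌋
  set φ := Int.fract (17 * u)
  have h0 : 0 ≤ φ := Int.fract_nonneg _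
  have h1 : φ < 1 := Int.fract_lt_one _
  have hu : u = ((n : ℝ) + φ) / 17 := by rw [Int.floor_add_fract]; ring
  rw [← tent_base h0 h1]
  refine Fintype.sum_bijective (fun i : ZMod 17 => (n : ZMod 17) - i * m) ?_ _ _ fun i => ?_
  · refine (Finite.injective_iff_bijective).1 fun i j hij => ?_
    exact mul_right_cancel₀ hm (sub_right_injective hij)
  · have : u - (i.val : ℕ) * m / 17 = (((n - (i.val : ℕ) * m : ℤ) : ℝ) + φ) / 17 := by
      rw [hu]; push_cast; ring
    rw [this, fract_17 _ h0 h1]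
    congr 4
    push_cast
    rw [ZMod.natCast_zmod_val]

noncomputable def T1 (κ : ℝ → ℂ) (K : ℕ) (f : ℝ → ℂ) (N : ℝ → ℝ) (x : ℝ) : ℂ :=
  ∑ k ∈ Finset.Icc (-(K:ℤ)) K, cnv f (kn κ k (N x)) x

lemma cnv_shift (κ f : ℝ → ℂ) (k : ℤ) (N τ x : ℝ) :
    cnv f (kn κ k N) x = e (τ * x) * cnv (fun y => e (-(τ * y)) * f y) (kn κ k (N - τ)) x := by
  unfold cnv
  rw [← integral_const_mul]
  congr 1; ext y
  unfold kn
  have : e (N * (x - y)) = e (τ * x) * e (-(τ * y)) * e ((N - τ) * (x - y)) := by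
    rw [← e_add, ← e_add]; congr 1; ring
  rw [this]; ring

noncomputable def sh (K : ℕ) (i : ZMod 17) : ℝ := (i.val : ℕ) * 2 ^ K / 17

lemma T1_eq (κ : ℝ → ℂ) (K : ℕ) (f : ℝ → ℂ) (N : ℝ → ℝ) (x : ℝ) :
    T1 κ K f N x = ∑ i : ZMod 17, e (sh K i * x) * T0 κ tent K (fun y => e (-(sh K i * y)) * f y) (fun x => N x - sh K i) x := by
  have : Fact (Nat.Prime 17) := ⟨by norm_num⟩
  unfold T1 T0
  simp only [Finset.mul_sum]
  rw [Finset.sum_comm]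
  refine Finset.sum_congr rfl fun k hk => ?_
  rw [Finset.mem_Icc] at hk
  have hs : ∑ i : ZMod 17, tent (Int.fract (2 ^ k * (N x - sh K i))) = 1 := by
    obtain ⟨m, hm⟩ : ∃ m : ℕ, (m : ℤ) = k + K := ⟨(k + K).toNat, by omega⟩
    have h2 : (2:ℝ) ^ k * 2 ^ K = 2 ^ m := by
      rw [← zpow_natCast, ← zpow_natCast (2:ℝ) m, hm, zpow_add₀ (by norm_num)]
    rw [← tent_sum (2 ^ k * N x) (2 ^ m) (by push_cast; exact pow_ne_zero _ two_ne_17)]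
    refine Finset.sum_congr rfl fun i _ => ?_
    congr 2
    unfold sh
    push_cast
    rw [← h2]; ring
  have hs' : (1 : ℂ) = ∑ i : ZMod 17, ((tent (Int.fract (2 ^ k * (N x - sh K i))) : ℝ) : ℂ) := by
    rw [← Complex.ofReal_sum, hs]; simp
  rw [← one_mul (cnv f (kn κ k (N x)) x), hs', Finset.sum_mul]
  refine Finset.sum_congr rfl fun i _ => ?_
  rw [cnv_shift κ f k (N x) (sh K i) x]; ring

lemma lp_T1 {κ κ' ϑ : ℝ → ℂ} {χ' h : ℝ → ℝ} {A : ℝ} (Kr : Ker κ κ' ϑ χ' h A) {p : ℝ} (hp : 1 < p) :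
    ∃ C : ℝ≥0, ∀ (K : ℕ) (f : ℝ → ℂ) (N : ℝ → ℝ) (b : ℝ), 
      Measurable f → Integrable f → Integrable (fun x => ‖f x‖ ^ p) → Measurable N → (∀ x, |N x| ≤ b) →
      eLpNorm (T1 κ K f N) (ENNReal.ofReal p) volume ≤ C * eLpNorm f (ENNReal.ofReal p) volume := by
  obtain ⟨C, H⟩ := lp_T0 Kr tent_rho hp
  refine ⟨17 * C, fun K f N b hfm hfi hfp hN hNb => ?_⟩
  have hec := continuous_e
  set F : ZMod 17 → ℝ → ℂ := fun i y => e (-(sh K i * y)) * f y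
  have hFn : ∀ i y, ‖F i y‖ = ‖f y‖ := fun i y => by simp [F]
  have hFm : ∀ i, Measurable (F i) := fun i => by
    have : Continuous fun y => e (-(sh K i * y)) := by fun_prop
    exact this.measurable.mul hfm
  have hFi : ∀ i, Integrable (F i) := fun i => 
    hfi.norm.mono' (hFm i).aestronglyMeasurable (ae_of_all _ fun y => (hFn i y).le)
  have hT : T1 κ K f N = ∑ i : ZMod 17, fun x => e (sh K i * x) * T0 κ tent K (F i) (fun x => N x - sh K i) x := by
    ext x; rw [T1_eq]; simp [F]
  have hm : ∀ i, Measurable (T0 κ tent K (F i) (fun x => N x - sh K i)) := fun i =>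
    T0_meas Kr tent_rho K (hFi i) (hN.sub_const _)
  rw [hT]
  refine (eLpNorm_sum_le (fun i _ => ?_) (by simpa using hp.le)).trans ?_
  · have : Continuous fun y => e (sh K i * y) := by fun_prop
    exact (this.measurable.mul (hm i)).aestronglyMeasurable
  · calc _ ≤ ∑ i : ZMod 17, (C : ℝ≥0∞) * eLpNorm f (ENNReal.ofReal p) volume := by
          refine Finset.sum_le_sum fun i _ => ?_
          rw [eLpNorm_congr_norm_ae (g := T0 κ tent K (F i) (fun x => N x - sh K i)) (ae_of_all _ fun x => by simp)]
          refine (H K (F i) _ (b + |sh K i|) (hFm i) (hFi i) (by simpa only [hFn] using hfp) (hN.sub_const _) 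
            (fun x => ?_)).trans ?_
          · exact (abs_sub _ _).trans (by gcongr; exact hNb x)
          · rw [eLpNorm_congr_norm_ae (f := F i) (g := f) (ae_of_all _ fun x => hFn i x)]
      _ = _ := by
          rw [Finset.sum_const, Finset.card_univ, ZMod.card, nsmul_eq_mul]; push_cast; ring

end CH

namespace CH

lemma strict_of_mono (m : ℝ → ℂ) (u : ℕ → ℝ) (hu : Monotone u) (n : ℕ) : ∃ (L : ℕ) (v : ℕ → ℝ), 
    (∀ i j, i < j → j ≤ L → v i < v j) ∧ v L = u n ∧ 
    ∑ i ∈ Finset.range n, edist (m (u (i + 1))) (m (u i)) = ∑ i ∈ Finset.range L, edist (m (v (i + 1))) (m (v i)) := by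
  induction n with
  | zero => exact ⟨0, fun _ => u 0, fun i j h1 h2 => by omega, rfl, by simp⟩
  | succ n ih =>
    obtain ⟨L, v, h1, h2, h3⟩ := ih
    rcases (hu (Nat.le_succ n)).eq_or_lt with h | h
    · refine ⟨L, v, h1, h2.trans h, ?_⟩
      rw [Finset.sum_range_succ, h3, ← Nat.succ_eq_add_one, ← h]; simp
    · refine ⟨L + 1, fun i => if i ≤ L then v i else u (n + 1), ?_, by simp, ?_⟩
      · intro i j hij hj
        simp only
        rcases Nat.lt_or_ge j (L + 1) with hj' | hj'
        · rw [if_pos (by omega), if_pos (by omega)]; exact h1 i j hij (by omega)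
        · have : j = L + 1 := by omega
          subst this
          rw [if_pos (by omega), if_neg (by omega)]
          refine lt_of_le_of_lt ?_ h
          rw [← h2]
          rcases Nat.lt_or_ge i L with hi | hi
          · exact (h1 i L hi le_rfl).le
          · rw [show i = L by omega]
      · rw [Finset.sum_range_succ, Finset.sum_range_succ, h3]
        congr 1
        · refine Finset.sum_congr rfl fun i hi => ?_
          rw [Finset.mem_range] at hi
          simp only [if_pos (show i + 1 ≤ L by omega), if_pos (show i ≤ L by omega)]
        · simp [h2]

lemma eVar_le (m : ℝ → ℂ) (h : variationNorm 1 m ≤ 1) : eVariationOn m univ ≤ 1 := by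
  refine iSup_le fun ⟨n, u, hu, _⟩ => ?_
  obtain ⟨L, v, h1, h2, h3⟩ := strict_of_mono m u hu n
  simp only
  rw [h3]
  refine le_trans ?_ ((le_add_self).trans h)
  refine le_trans ?_ (le_iSup₂ (f := fun (N : ℕ) (ξ : Fin (N + 1) → ℝ) => ⨆ (_ : StrictMono ξ),
      (∑ i : Fin N, (‖m (ξ i.succ) - m (ξ i.castSucc)‖₊ : ℝ≥0∞) ^ (1:ℝ)) ^ (1 / (1:ℝ))) L (fun i => v i))
  refine le_trans ?_ (le_iSup (fun (_ : StrictMono (fun i : Fin (L + 1) => v i)) => 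
    (∑ i : Fin L, (‖m (v (i.succ : ℕ)) - m (v (i.castSucc : ℕ))‖₊ : ℝ≥0∞) ^ (1:ℝ)) ^ (1 / (1:ℝ))) 
    (fun i j hij => h1 i j hij (by omega)))
  simp only [ENNReal.rpow_one, div_one, Fin.val_succ, Fin.val_castSucc]
  rw [Fin.sum_univ_eq_sum_range (fun i => (‖m (v (i + 1)) - m (v i)‖₊ : ℝ≥0∞)) L]
  refine Finset.sum_le_sum fun i _ => ?_
  rw [edist_eq_enorm_sub]; rfl

lemma norm_le_of_var (m : ℝ → ℂ) (h : variationNorm 1 m ≤ 1) (ξ : ℝ) : ‖m ξ‖ ≤ 1 := by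
  have h1 : (‖m ξ‖₊ : ℝ≥0∞) ≤ 1 := (le_iSup (fun ξ : ℝ => (‖m ξ‖₊ : ℝ≥0∞)) ξ).trans ((le_self_add).trans h)
  exact_mod_cast h1

lemma abel (a s : ℕ → ℂ) (n : ℕ) : ∑ i ∈ Finset.range n, a i * (s (i + 1) - s i) = 
    a n * s n - a 0 * s 0 - ∑ i ∈ Finset.range n, (a (i + 1) - a i) * s (i + 1) := by
  induction n with
  | zero => simp
  | succ n ih => rw [Finset.sum_range_succ, Finset.sum_range_succ, ih]; ring

lemma bv_bound {m G : ℝ → ℂ} (hG : Integrable G) {B : ℝ} (hB : ∀ ξ, ‖G ξ‖ ≤ B) (hm : variationNorm 1 m ≤ 1)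
    {M : ℝ} (hM : ∀ N, ‖∫ ξ in Iio N, G ξ‖ ≤ M) : ‖∫ ξ, m ξ * G ξ‖ ≤ 3 * M := by
  have hm1 := norm_le_of_var m hm
  have hV := eVar_le m hm
  have hM0 : 0 ≤ M := (norm_nonneg _).trans (hM 0)
  have hB0 : 0 ≤ B := (norm_nonneg _).trans (hB 0)
  by_cases hms : AEStronglyMeasurable (fun ξ => m ξ * G ξ) volume
  swap
  · rw [integral_undef (fun h => hms h.1)]; simpa using hM0
  have hIntg : Integrable (fun ξ => m ξ * G ξ) := hG.norm.mono' hms (ae_of_all _ fun ξ => by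
    rw [norm_mul]; exact mul_le_of_le_one_left (norm_nonneg _) (hm1 ξ))
  set s : ℝ → ℂ := fun N => ∫ ξ in Iic N, G ξ with hsd
  have hs1 : ∀ N, ‖s N‖ ≤ M := fun N => by
    rw [hsd]; simp only; rw [integral_Iic_eq_integral_Iio]; exact hM N
  have hsub : ∀ a b, s b - s a = ∫ ξ in a..b, G ξ := fun a b => 
    intervalIntegral.integral_Iic_sub_Iic hG.integrableOn hG.integrableOn
  have hfin : ∀ R : ℝ, 0 ≤ R → ‖∫ ξ in (-R)..R, m ξ * G ξ‖ ≤ 3 * M := by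
    intro R hR
    have key : ∀ n : ℕ, ‖∫ ξ in (-R)..R, m ξ * G ξ‖ ≤ 3 * M + B * (2 * R) * (1 / ((n : ℝ) + 1)) := by
      intro n0
      obtain ⟨n, hn⟩ : ∃ n, n = n0 + 1 := ⟨_, rfl⟩
      have hnr : (n : ℝ) = n0 + 1 := by rw [hn]; push_cast; ring
      have hn0 : (0:ℝ) < n := by rw [hnr]; positivity
      rw [← hnr]
      set E : ℕ → ℝ := fun i => -R + i * (2 * R / n) with hE
      have hd : 0 ≤ 2 * R / n := by positivity
      have hEm : Monotone E := by
        intro i j hij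
        have : (i : ℝ) ≤ j := by exact_mod_cast hij
        simp only [hE]; gcongr
      have hE0 : E 0 = -R := by simp [hE]
      have hEn : E n = R := by simp only [hE]; field_simp; ring
      have hEs : ∀ i, |E (i + 1) - E i| = 2 * R / n := fun i => by
        have : E (i + 1) - E i = 2 * R / n := by simp only [hE]; push_cast; ring
        rw [this, abs_of_nonneg hd]
      have hvs := eVariationOn.sum' m hEm (n := n)
      have hvs1 : ∑ i ∈ Finset.range n, eVariationOn m (Icc (E i) (E (i + 1))) ≤ 1 := by
        rw [hvs]; exact (eVariationOn.mono m (subset_univ _)).trans hV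
      have hvf : ∀ i ∈ Finset.range n, eVariationOn m (Icc (E i) (E (i + 1))) ≠ ⊤ := fun i _ =>
        (((eVariationOn.mono m (subset_univ _)).trans hV).trans_lt ENNReal.one_lt_top).ne
      set V : ℕ → ℝ := fun i => (eVariationOn m (Icc (E i) (E (i + 1)))).toReal with hVd
      have hVs : ∑ i ∈ Finset.range n, V i ≤ 1 := by
        rw [← ENNReal.toReal_sum hvf]
        exact ENNReal.toReal_le_of_le_ofReal (by norm_num) (by simpa using hvs1)
      have hVle : ∀ i ∈ Finset.range n, ∀ ξ ∈ Icc (E i) (E (i + 1)), ‖m ξ - m (E i)‖ ≤ V i := by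
        intro i hi ξ hξ
        have := eVariationOn.edist_le m hξ (left_mem_Icc.2 (hEm (Nat.le_succ i)))
        rw [← dist_eq_norm, dist_edist]
        exact ENNReal.toReal_mono (hvf i hi) this
      rw [← hE0, ← hEn, ← intervalIntegral.sum_integral_adjacent_intervals (fun k _ => hIntg.intervalIntegrable)]
      have hterm : ∀ i, (∫ ξ in (E i)..(E (i + 1)), m ξ * G ξ) = 
          m (E i) * (s (E (i + 1)) - s (E i)) + ∫ ξ in (E i)..(E (i + 1)), (m ξ - m (E i)) * G ξ := by
        intro i
        rw [hsub, ← intervalIntegral.integral_const_mul, ← intervalIntegral.integral_add]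
        · congr 1; ext ξ; ring
        · exact (hG.const_mul _).intervalIntegrable
        · have : (fun ξ => (m ξ - m (E i)) * G ξ) = fun ξ => m ξ * G ξ - m (E i) * G ξ := by ext; ring
          rw [this]; exact (hIntg.sub (hG.const_mul _)).intervalIntegrable
      simp only [hterm]
      rw [Finset.sum_add_distrib]
      refine (norm_add_le _ _).trans (add_le_add ?_ ?_)
      · rw [abel (fun i => m (E i)) (fun i => s (E i))]
        have b1 : ∀ ξ N, ‖m ξ * s N‖ ≤ M := fun ξ N => by
          rw [norm_mul]; exact (mul_le_of_le_one_left (norm_nonneg _) (hm1 ξ)).trans (hs1 N)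
        have b2 : ‖∑ i ∈ Finset.range n, (m (E (i + 1)) - m (E i)) * s (E (i + 1))‖ ≤ M := by
          refine (norm_sum_le _ _).trans ?_
          calc _ ≤ ∑ i ∈ Finset.range n, V i * M := by
                refine Finset.sum_le_sum fun i hi => ?_
                rw [norm_mul]
                exact mul_le_mul (hVle i hi _ (right_mem_Icc.2 (hEm (Nat.le_succ i)))) (hs1 _) (norm_nonneg _) 
                  ENNReal.toReal_nonneg
            _ ≤ M := by rw [← Finset.sum_mul]; exact mul_le_of_le_one_left hM0 hVs
        have := norm_sub_le (m (E n) * s (E n) - m (E 0) * s (E 0)) (∑ i ∈ Finset.range n, (m (E (i + 1)) - m (E i)) * s (E (i + 1)))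
        have := norm_sub_le (m (E n) * s (E n)) (m (E 0) * s (E 0))
        have := b1 (E n) (E n)
        have := b1 (E 0) (E 0)
        linarith
      · refine (norm_sum_le _ _).trans ?_
        calc _ ≤ ∑ i ∈ Finset.range n, V i * (B * (2 * R / n)) := by
              refine Finset.sum_le_sum fun i hi => ?_
              refine (intervalIntegral.norm_integral_le_of_norm_le_const (C := V i * B) fun ξ hξ => ?_).trans ?_
              · rw [uIoc_of_le (hEm (Nat.le_succ i))] at hξ
                rw [norm_mul]
                exact mul_le_mul (hVle i hi _ (Ioc_subset_Icc_self hξ)) (hB _) (norm_nonneg _) ENNReal.toReal_nonneg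
              · rw [hEs, mul_assoc]
          _ ≤ B * (2 * R / n) := by rw [← Finset.sum_mul]; exact mul_le_of_le_one_left (by positivity) hVs
          _ = _ := by rw [hEn]; ring
    have hl : Tendsto (fun n : ℕ => 3 * M + B * (2 * R) * (1 / ((n : ℝ) + 1))) atTop (nhds (3 * M + B * (2 * R) * 0)) :=
      (tendsto_one_div_add_atTop_nhds_zero_nat.const_mul _).const_add _
    rw [mul_zero, add_zero] at hl
    exact ge_of_tendsto' hl key
  have hl := intervalIntegral_tendsto_integral (l := atTop) (a := fun n : ℕ => -(n : ℝ)) (b := fun n : ℕ => (n : ℝ)) hIntg 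
    (tendsto_neg_atTop_atBot.comp tendsto_natCast_atTop_atTop) tendsto_natCast_atTop_atTop
  exact le_of_tendsto' hl.norm fun n => hfin n (by positivity)

end CH

namespace CH

lemma cnv_comm' (f G : ℝ → ℂ) (x : ℝ) : cnv f G x = cnv G f x := by
  unfold cnv
  rw [← integral_sub_left_eq_self _ volume x]
  congr 1; ext y; rw [sub_sub_cancel, mul_comm]

lemma θ_nonneg (t : ℝ) : 0 ≤ θ t := Real.smoothTransition.nonneg _
lemma θ_le_one (t : ℝ) : θ t ≤ 1 := Real.smoothTransition.le_one _
lemma θ_cont : Continuous θ := by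
  unfold θ; exact Real.smoothTransition.continuous.comp (by fun_prop)

lemma tele (K : ℕ) (t : ℝ) : ∑ k ∈ Finset.Icc (-(K:ℤ)) K, χ (2 ^ k * t) = 
    θ (2 ^ (-(K:ℤ)) * t) - θ (2 ^ ((K:ℤ) + 1) * t) := by
  have h2 : ∀ k : ℤ, χ (2 ^ k * t) = θ (2 ^ k * t) - θ (2 ^ (k + 1) * t) := fun k => by
    unfold χ; rw [zpow_add₀ (by norm_num), zpow_one]; congr 2; ring
  have key : ∀ n : ℕ, ∑ k ∈ Finset.Ico (-(K:ℤ)) (-(K:ℤ) + n), χ (2 ^ k * t) = 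
      θ (2 ^ (-(K:ℤ)) * t) - θ (2 ^ (-(K:ℤ) + n) * t) := by
    intro n
    induction n with
    | zero => simp
    | succ n ih =>
      have : Finset.Ico (-(K:ℤ)) (-(K:ℤ) + (n + 1 : ℕ)) = insert (-(K:ℤ) + n) (Finset.Ico (-(K:ℤ)) (-(K:ℤ) + n)) := by
        ext j; simp only [Finset.mem_Ico, Finset.mem_insert]; push_cast; omega
      rw [this, Finset.sum_insert (by simp), ih, h2]
      push_cast
      rw [← add_assoc]; ring
  have h3 : Finset.Icc (-(K:ℤ)) K = Finset.Ico (-(K:ℤ)) (-(K:ℤ) + (2 * K + 1 : ℕ)) := by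
    ext j; simp only [Finset.mem_Ico, Finset.mem_Icc]; push_cast; omega
  rw [h3, key]
  congr 4; push_cast; ring

section
variable {κ κ' ϑ : ℝ → ℂ} {χ' h : ℝ → ℝ} {A : ℝ}

lemma cnv_kn (Kr : Ker κ κ' ϑ χ' h A) {f : ℝ → ℂ} (hf : Integrable f) (k : ℤ) (N x : ℝ) :
    cnv f (kn κ k N) x = ∫ η, e (η * x) * (𝓕 f η * (χ (2 ^ k * (N - η)) : ℂ)) := by
  rw [cnv_comm']
  have hp := two_zpow_pos k
  rw [cnv_multiplier (Kr.k1.kn_cont k N) (Kr.k1.kn_integrable k N) (a := N - 7 / 16 / 2 ^ k) (b := N) ?_ hf]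
  · simp only [Kr.k1.kn_four]
  · intro η hη
    rw [Kr.k1.kn_four] at hη
    have h1 := χ_supp (fun h0 => hη (by rw [h0]; simp))
    have h2 : N - η ≤ 7 / 16 / 2 ^ k := by rw [le_div_iff₀ hp]; linarith [h1.2]
    have h3 : 0 ≤ N - η := by
      by_contra hc
      have := mul_neg_of_pos_of_neg hp (not_le.1 hc)
      linarith [h1.1]
    constructor <;> linarith

lemma θ_lim (t : ℝ) : Tendsto (fun K : ℕ => θ (2 ^ (-(K:ℤ)) * t) - θ (2 ^ ((K:ℤ) + 1) * t)) atTop 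
    (nhds (if 0 < t then 1 else 0)) := by
  have hpw : Tendsto (fun K : ℕ => (2:ℝ) ^ K) atTop atTop := tendsto_pow_atTop_atTop_of_one_lt (by norm_num)
  split_ifs with ht
  · refine tendsto_const_nhds.congr' ?_
    filter_upwards [hpw.eventually_ge_atTop (max (t / (3 / 8)) (1 / t))] with K hK
    have h1 := (le_max_left _ _).trans hK
    have h2 := (le_max_right _ _).trans hK
    rw [div_le_iff₀ (by norm_num)] at h1
    rw [div_le_iff₀ ht] at h2
    have hp : (0:ℝ) < 2 ^ K := by positivity
    rw [θ_one, θ_zero]; · norm_num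
    · rw [zpow_add₀ (by norm_num), zpow_natCast, zpow_one]; linarith
    · rw [zpow_neg, zpow_natCast, inv_mul_le_iff₀ hp]; linarith
  · refine tendsto_const_nhds.congr fun K => ?_
    rw [θ_one, θ_one]; · norm_num
    · have := mul_nonpos_of_nonneg_of_nonpos (two_zpow_pos ((K:ℤ) + 1)).le (not_lt.1 ht); linarith
    · have := mul_nonpos_of_nonneg_of_nonpos (two_zpow_pos (-(K:ℤ))).le (not_lt.1 ht); linarith

lemma T1_lim (Kr : Ker κ κ' ϑ χ' h A) {f : ℝ → ℂ} (hf : Integrable f) (hF : Integrable (𝓕 f)) (N x : ℝ) :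
    Tendsto (fun K : ℕ => T1 κ K f (fun _ => N) x) atTop (nhds (∫ η in Iio N, e (η * x) * 𝓕 f η)) := by
  have hec := continuous_e
  have hχ : Continuous χ := χ_contDiff.continuous
  have hFc := fourier_continuous hf
  have hθ := θ_cont
  have heq : ∀ K : ℕ, T1 κ K f (fun _ => N) x = 
      ∫ η, e (η * x) * 𝓕 f η * ((θ (2 ^ (-(K:ℤ)) * (N - η)) - θ (2 ^ ((K:ℤ) + 1) * (N - η)) : ℝ) : ℂ) := by
    intro K
    unfold T1
    simp only [cnv_kn Kr hf]
    rw [← integral_finsetSum]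
    · congr 1; ext η
      rw [← tele, ← Finset.mul_sum, ← Finset.mul_sum, ← Complex.ofReal_sum]; ring
    · intro k _
      refine (hF.norm.const_mul 1).mono' (by fun_prop) (ae_of_all _ fun η => ?_)
      rw [norm_mul, norm_e, norm_mul, one_mul, one_mul, Complex.norm_real]
      refine mul_le_of_le_one_right (norm_nonneg _) ?_
      rw [Real.norm_eq_abs, abs_le]
      unfold χ
      constructor <;> linarith [θ_nonneg (2 ^ k * (N - η)), θ_nonneg (2 * (2 ^ k * (N - η))), θ_le_one (2 ^ k * (N - η)), θ_le_one (2 * (2 ^ k * (N - η)))]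
  simp only [heq]
  rw [← integral_indicator measurableSet_Iio]
  refine tendsto_integral_of_dominated_convergence (fun η => ‖𝓕 f η‖) (fun K => ?_) hF.norm (fun K => ae_of_all _ fun η => ?_) 
    (ae_of_all _ fun η => ?_)
  · exact Continuous.aestronglyMeasurable (by fun_prop)
  · rw [norm_mul, norm_mul, norm_e, one_mul, Complex.norm_real]
    refine mul_le_of_le_one_right (norm_nonneg _) ?_
    rw [Real.norm_eq_abs, abs_le]
    constructor <;> linarith [θ_nonneg (2 ^ (-(K:ℤ)) * (N - η)), θ_nonneg (2 ^ ((K:ℤ) + 1) * (N - η)), 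
      θ_le_one (2 ^ (-(K:ℤ)) * (N - η)), θ_le_one (2 ^ ((K:ℤ) + 1) * (N - η))]
  · have h1 := ((Complex.continuous_ofReal.tendsto _).comp (θ_lim (N - η))).const_mul (e (η * x) * 𝓕 f η)
    have e1 : (Iio N).indicator (fun η => e (η * x) * 𝓕 f η) η = 
        e (η * x) * 𝓕 f η * (((if 0 < N - η then 1 else 0 : ℝ)) : ℂ) := by
      simp only [indicator, mem_Iio, sub_pos]
      split_ifs <;> simp
    rw [e1]; exact h1

/-- greedy selection of a near-maximal frequency among finitely many -/
noncomputable def sel (Φ : ℝ → ℝ → ℝ) (q : ℕ → ℝ) : ℕ → ℝ → ℝ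
  | 0, _ => q 0
  | n + 1, x => if Φ x (sel Φ q n x) ≤ Φ x (q (n + 1)) then q (n + 1) else sel Φ q n x

lemma sel_meas {Φ : ℝ → ℝ → ℝ} (hΦ : Continuous (fun p : ℝ × ℝ => Φ p.1 p.2)) (q : ℕ → ℝ) (n : ℕ) : Measurable (sel Φ q n) := by
  induction n with
  | zero => exact measurable_const
  | succ n ih =>
    have key : ∀ N : ℝ → ℝ, Measurable N → Measurable (fun x => Φ x (N x)) := fun N hN => 
      hΦ.measurable.comp (measurable_id.prodMk hN)
    exact Measurable.ite (measurableSet_le (key _ ih) (key _ measurable_const)) measurable_const ih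

lemma sel_bdd (Φ : ℝ → ℝ → ℝ) (q : ℕ → ℝ) (n : ℕ) : ∃ b, ∀ x, |sel Φ q n x| ≤ b := by
  induction n with
  | zero => exact ⟨|q 0|, fun x => le_rfl⟩
  | succ n ih =>
    obtain ⟨b, hb⟩ := ih
    refine ⟨max |q (n + 1)| b, fun x => ?_⟩
    rw [sel]
    split_ifs
    · exact le_max_left _ _
    · exact (hb x).trans (le_max_right _ _)

lemma sel_max (Φ : ℝ → ℝ → ℝ) (q : ℕ → ℝ) (n : ℕ) (x : ℝ) : ∀ j ≤ n, Φ x (q j) ≤ Φ x (sel Φ q n x) := by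
  induction n with
  | zero => intro j hj; rw [Nat.le_zero.1 hj]; exact le_rfl
  | succ n ih =>
    intro j hj
    rw [sel]
    rcases Nat.lt_or_ge j (n + 1) with h | h
    · have := ih j (by omega)
      split_ifs with h2
      · exact this.trans h2
      · exact this
    · have : j = n + 1 := by omega
      subst this
      split_ifs with h2
      · exact le_rfl
      · exact (not_le.1 h2).le

lemma carleson (Kr : Ker κ κ' ϑ χ' h A) {p : ℝ} (hp : 1 < p) :
    ∃ C : ℝ≥0, ∀ f : ℝ → ℂ, Measurable f → Integrable f → Integrable (𝓕 f) → Integrable (fun x => ‖f x‖ ^ p) →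
      ∫⁻ x, (⨆ N : ℝ, ‖∫ η in Iio N, e (η * x) * 𝓕 f η‖ₑ) ^ p ≤ (C * eLpNorm f (ENNReal.ofReal p) volume) ^ p := by
  obtain ⟨C, H⟩ := lp_T1 Kr hp
  refine ⟨C, fun f hfm hf hF hfp => ?_⟩
  have hp0 : 0 < p := by linarith
  obtain ⟨q', hq'⟩ := exists_surjective_nat ℚ
  set q : ℕ → ℝ := fun n => (q' n : ℝ)
  set Φ : ℕ → ℝ → ℝ → ℝ := fun K x N => ‖T1 κ K f (fun _ => N) x‖ with hΦd
  have hΦ : ∀ K, Continuous (fun p : ℝ × ℝ => Φ K p.1 p.2) := by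
    intro K
    simp only [hΦd]
    unfold T1
    refine Continuous.norm (continuous_finsetSum _ fun k _ => Kr.k1.cont_cnv hf k)
  set Nn : ℕ → ℝ → ℝ := fun n => sel (Φ n) q n
  have hNm : ∀ n, Measurable (Nn n) := fun n => sel_meas (hΦ n) q n
  set F : ℕ → ℝ → ℝ≥0∞ := fun n x => ‖T1 κ n f (Nn n) x‖ₑ ^ p
  have hFn : ∀ n x, ‖T1 κ n f (Nn n) x‖ = Φ n x (Nn n x) := fun n x => rfl
  have hFm : ∀ n, Measurable (F n) := by
    intro n
    have : Measurable (fun x => ENNReal.ofReal (Φ n x (Nn n x)) ^ p) := 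
      (((hΦ n).measurable.comp (measurable_id.prodMk (hNm n))).ennreal_ofReal).pow_const p
    convert this using 2
    rw [← hFn, ofReal_norm]
  have hFb : ∀ n, ∫⁻ x, F n x ≤ (C * eLpNorm f (ENNReal.ofReal p) volume) ^ p := by
    intro n
    obtain ⟨b, hb⟩ := sel_bdd (Φ n) q n
    have h1 := H n f (Nn n) b hfm hf hfp (hNm n) hb
    rw [eLpNorm_eq_lintegral_rpow_enorm_toReal (by simpa using hp0) ENNReal.ofReal_ne_top, ENNReal.toReal_ofReal hp0.le] at h1
    rw [one_div, ENNReal.rpow_inv_le_iff hp0] at h1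
    exact h1
  have hrat : ∀ x (j : ℕ), ‖∫ η in Iio (q j), e (η * x) * 𝓕 f η‖ₑ ^ p ≤ liminf (fun n => F n x) atTop := by
    intro x j
    have ht : Tendsto (fun K : ℕ => ‖T1 κ K f (fun _ => q j) x‖ₑ ^ p) atTop 
        (nhds (‖∫ η in Iio (q j), e (η * x) * 𝓕 f η‖ₑ ^ p)) := 
      (ENNReal.continuous_rpow_const.tendsto _).comp (T1_lim Kr hf hF (q j) x).enorm
    rw [← ht.liminf_eq]
    refine liminf_le_liminf ?_
    filter_upwards [eventually_ge_atTop j] with n hn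
    refine ENNReal.rpow_le_rpow ?_ hp0.le
    rw [← ofReal_norm, ← ofReal_norm]
    exact ENNReal.ofReal_le_ofReal (sel_max (Φ n) q n x j hn)
  have hreal : ∀ x (N : ℝ), ‖∫ η in Iio N, e (η * x) * 𝓕 f η‖ₑ ^ p ≤ liminf (fun n => F n x) atTop := by
    intro x N
    obtain ⟨u, hu, hun, hut⟩ := Real.exists_seq_rat_strictMono_tendsto N
    have hU : ⋃ n, Iio ((u n : ℚ) : ℝ) = Iio N := by
      ext y
      simp only [mem_iUnion, mem_Iio]
      constructor
      · rintro ⟨n, hn⟩; exact hn.trans (hun n)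
      · intro hy; exact ((tendsto_order.1 hut).1 y hy).exists
    have hec := continuous_e
    have hI : Integrable (fun η => e (η * x) * 𝓕 f η) := 
      hF.norm.mono' (Continuous.aestronglyMeasurable (by have := fourier_continuous hf; fun_prop)) (ae_of_all _ fun η => by simp)
    have h1 := tendsto_setIntegral_of_monotone (μ := volume) (f := fun η => e (η * x) * 𝓕 f η) 
      (s := fun n => Iio ((u n : ℚ) : ℝ)) (fun _ => measurableSet_Iio)
      (fun i j hij => Iio_subset_Iio (by exact_mod_cast hu.monotone hij)) hI.integrableOn
    rw [hU] at h1
    refine le_of_tendsto' ((ENNReal.continuous_rpow_const.tendsto _).comp h1.enorm) fun n => ?_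
    obtain ⟨j, hj⟩ := hq' (u n)
    have := hrat x j
    simp only [q, hj] at this
    exact this
  calc _ ≤ ∫⁻ x, liminf (fun n => F n x) atTop := by
        refine lintegral_mono fun x => ?_
        simp only
        rw [← ENNReal.le_rpow_inv_iff hp0]
        refine iSup_le fun N => ?_
        rw [ENNReal.le_rpow_inv_iff hp0]
        exact hreal x N
    _ ≤ liminf (fun n => ∫⁻ x, F n x) atTop := lintegral_liminf_le hFm
    _ ≤ _ := by
        refine (liminf_le_liminf (v := fun _ => (C * eLpNorm f (ENNReal.ofReal p) volume) ^ p) (Eventually.of_forall hFb)).trans ?_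
        simp
end

end CH

/-- **The case `r = 1` (observed by Lacey).**
For `1 < p < ∞` there is a constant `C = C(p)` such that the maximal operator over
all multipliers of bounded-variation norm at most `1` satisfies
`‖𝓜_1[f]‖_{L^p(ℝ)} ≤ C ‖f‖_{L^p(ℝ)}` for every Schwartz function `f : ℝ → ℂ`. -/
theorem maximalMultiplier_BV_Lp_bound (p : ℝ) (hp1 : 1 < p) :
    ∃ C : ℝ≥0, 0 < C ∧ ∀ f : SchwartzMap ℝ ℂ,
      (∫⁻ x, maximalMultiplier 1 (f : ℝ → ℂ) x ^ p) ^ (1 / p) ≤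
        C * eLpNorm (f : ℝ → ℂ) (ENNReal.ofReal p) volume := by
  obtain ⟨κ, κ', ϑ, χ', h, A, k1, k2, k3, o, s, h1, h0⟩ := CH.exists_kernels
  obtain ⟨C, H⟩ := CH.carleson ⟨k1, k2, k3, o, s, h1, h0⟩ hp1
  have hp0 : 0 < p := by linarith
  refine ⟨3 * C + 1, by positivity, fun f => ?_⟩
  have hec := CH.continuous_e
  have hfi : Integrable (f : ℝ → ℂ) := f.integrable
  have hF : Integrable (𝓕 (f : ℝ → ℂ)) := by
    rw [← SchwartzMap.fourier_coe]; exact (𝓕 f).integrable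
  have hfp : Integrable (fun x => ‖f x‖ ^ p) := by
    have := (f.memLp (ENNReal.ofReal p) volume).integrable_norm_rpow (by simpa using hp0) ENNReal.ofReal_ne_top
    rwa [ENNReal.toReal_ofReal hp0.le] at this
  have hm := H f f.continuous.measurable hfi hF hfp
  have hFc := CH.fourier_continuous hfi
  have hpt : ∀ x, maximalMultiplier 1 (f : ℝ → ℂ) x ≤ 3 * ⨆ N : ℝ, ‖∫ η in Iio N, CH.e (η * x) * 𝓕 (f : ℝ → ℂ) η‖ₑ := by
    intro x
    by_cases ht : (⨆ N : ℝ, ‖∫ η in Iio N, CH.e (η * x) * 𝓕 (f : ℝ → ℂ) η‖ₑ) = ⊤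
    · rw [ht, ENNReal.mul_top (by norm_num)]; exact le_top
    refine iSup₂_le fun m hmv => ?_
    set M := (⨆ N : ℝ, ‖∫ η in Iio N, CH.e (η * x) * 𝓕 (f : ℝ → ℂ) η‖ₑ).toReal with hMd
    have hI : Integrable (fun η => CH.e (η * x) * 𝓕 (f : ℝ → ℂ) η) := 
      hF.norm.mono' (Continuous.aestronglyMeasurable (by fun_prop)) (ae_of_all _ fun η => by simp)
    have hb := CH.bv_bound (m := m) hI (B := ∫ y, ‖f y‖) (fun η => ?_) hmv (M := M) (fun N => ?_)
    · have heq : applyMultiplier m f x = ∫ η, m η * (CH.e (η * x) * 𝓕 (f : ℝ → ℂ) η) := by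
        rw [applyMultiplier, CH.fourierInv_eq_e]
        congr 1; ext η; ring
      have e3 : (3 * ⨆ N : ℝ, ‖∫ η in Iio N, CH.e (η * x) * 𝓕 (f : ℝ → ℂ) η‖ₑ) = ENNReal.ofReal (3 * M) := by
        rw [ENNReal.ofReal_mul (by norm_num), hMd, ENNReal.ofReal_toReal ht]; norm_num
      rw [e3, heq, ← enorm_eq_nnnorm, ← ofReal_norm]
      exact ENNReal.ofReal_le_ofReal hb
    · rw [norm_mul, CH.norm_e, one_mul, CH.fourier_eq_e]
      refine (norm_integral_le_integral_norm _).trans (le_of_eq ?_)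
      congr 1; ext y; simp
    · have := le_iSup (fun N : ℝ => ‖∫ η in Iio N, CH.e (η * x) * 𝓕 (f : ℝ → ℂ) η‖ₑ) N
      rw [hMd, ← toReal_enorm]
      exact ENNReal.toReal_mono ht this
  rw [one_div, ENNReal.rpow_inv_le_iff hp0]
  calc _ ≤ ∫⁻ x, 3 ^ p * (⨆ N : ℝ, ‖∫ η in Iio N, CH.e (η * x) * 𝓕 (f : ℝ → ℂ) η‖ₑ) ^ p := by
        refine lintegral_mono fun x => ?_
        simp only
        rw [← ENNReal.mul_rpow_of_nonneg _ _ hp0.le]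
        exact ENNReal.rpow_le_rpow (hpt x) hp0.le
    _ = 3 ^ p * ∫⁻ x, (⨆ N : ℝ, ‖∫ η in Iio N, CH.e (η * x) * 𝓕 (f : ℝ → ℂ) η‖ₑ) ^ p := 
        lintegral_const_mul' _ _ (ENNReal.rpow_ne_top_of_nonneg hp0.le (by norm_num))
    _ ≤ 3 ^ p * (C * eLpNorm f (ENNReal.ofReal p) volume) ^ p := by gcongr
    _ = (3 * (C * eLpNorm f (ENNReal.ofReal p) volume)) ^ p := (ENNReal.mul_rpow_of_nonneg _ _ hp0.le).symm
    _ ≤ _ := by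
        refine ENNReal.rpow_le_rpow ?_ hp0.le
        rw [← mul_assoc]
        gcongr
        push_cast
        exact le_self_add
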